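/- Fix a prime p. Let K be a p-adic differential field whose field of constants k is p-adically closed, with k ≠ K. Then for every n ≥ 1 and every matrix A ∈ Mat_n(K), there exists a p-adic Picard–Vessiot field for the equation y′ = Ay over K. -/

import Mathlib

/-- A derivation on a field `F`. -/
structure FieldDeriv (F : Type) [Field F] : Type where
  d : F → F
  map_add : ∀ a b : F, d (a + b) = d a + d b
  leibniz : ∀ a b : F, d (a * b) = a * d b + d a * b

/-- A valuation subring `O` of `F` witnesses that `F` is a p-adic field if `pO` is the
maximal ideal of `O` and `O/pO ≅ 𝔽_p`. -/
def PAdicWitness (p : ℕ) {F : Type} [Field F] (O : ValuationSubring F) : Prop :=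
  (Ideal.span {(p : O)}).IsMaximal ∧
    Nonempty ((O ⧸ (Ideal.span {(p : O)} : Ideal O)) ≃+* ZMod p)

/-- A field is p-adic if it admits a valuation subring `O` such that `pO` is the maximal
ideal of `O` and `O/pO ≅ 𝔽_p`. -/
def IsPAdicField (p : ℕ) (F : Type) [Field F] : Prop :=
  ∃ O : ValuationSubring F, PAdicWitness p O

/-- A field is p-adically closed if it is p-adic and no proper algebraic extension of it
is p-adic. -/
def IsPAdicallyClosed (p : ℕ) (F : Type) [Field F] : Prop :=
  IsPAdicField p F ∧
    ∀ (E : Type) [Field E] [Algebra F E], Algebra.IsAlgebraic F E →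
      IsPAdicField p E → Function.Surjective (algebraMap F E)

/-- `L/K`, with derivations `dL` extending `dK`, is a Picard--Vessiot field for `y' = A y`. -/
def IsPicardVessiot {K L : Type} [Field K] [Field L] [Algebra K L]
    (dK : FieldDeriv K) (dL : FieldDeriv L) {n : ℕ}
    (A : Matrix (Fin n) (Fin n) K) : Prop :=
  (∀ a : K, dL.d (algebraMap K L a) = algebraMap K L (dK.d a)) ∧
  ∃ F : Matrix (Fin n) (Fin n) L, IsUnit F.det ∧
    (∀ i j, dL.d (F i j) = (A.map (algebraMap K L) * F) i j) ∧
    IntermediateField.adjoin K (Set.range fun q : Fin n × Fin n => F q.1 q.2) = ⊤ ∧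
    ∀ x : L, dL.d x = 0 → ∃ a : K, dK.d a = 0 ∧ algebraMap K L a = x

/-- The dual numbers over `Λ`, with no algebra structure attached. -/
@[ext]
structure DualExt (Λ : Type) : Type where
  /-- The base component. -/
  fst : Λ
  /-- The infinitesimal component. -/
  snd : Λ

namespace DualExt

/-- The identification with the trivial square-zero extension. -/
def equivTriv (Λ : Type) : DualExt Λ ≃ TrivSqZeroExt Λ Λ where
  toFun x := (x.1, x.2)
  invFun x := ⟨x.1, x.2⟩

noncomputable instance (Λ : Type) [CommRing Λ] : CommRing (DualExt Λ) :=
  (equivTriv Λ).commRing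

variable {R Λ : Type} [CommRing R] [CommRing Λ]

@[simp] theorem fst_add (x y : DualExt Λ) : (x + y).1 = x.1 + y.1 := rfl
@[simp] theorem snd_add (x y : DualExt Λ) : (x + y).2 = x.2 + y.2 := rfl
@[simp] theorem fst_zero : (0 : DualExt Λ).1 = 0 := rfl
@[simp] theorem snd_zero : (0 : DualExt Λ).2 = 0 := rfl
@[simp] theorem fst_one : (1 : DualExt Λ).1 = 1 := rfl
@[simp] theorem snd_one : (1 : DualExt Λ).2 = 0 := rfl
@[simp] theorem fst_mul (x y : DualExt Λ) : (x * y).1 = x.1 * y.1 := rfl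
@[simp] theorem snd_mul (x y : DualExt Λ) : (x * y).2 = x.1 * y.2 + y.1 * x.2 :=
  congrArg (x.1 * y.2 + ·) (mul_comm x.2 y.1)

/-- The projection of the dual numbers to the base. -/
noncomputable def fstHom (Λ : Type) [CommRing Λ] : DualExt Λ →+* Λ where
  toFun x := x.1
  map_one' := rfl
  map_zero' := rfl
  map_add' _ _ := rfl
  map_mul' _ _ := rfl

/-- A derivation with values in an algebra gives a lift to the dual numbers. -/
noncomputable def ofDerivation [Algebra R Λ]
    (D : Derivation ℤ R Λ) : R →+* DualExt Λ where
  toFun r := ⟨algebraMap R Λ r, D r⟩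
  map_one' := by ext <;> simp
  map_zero' := by ext <;> simp
  map_add' a b := by ext <;> simp
  map_mul' a b := by ext <;> simp [Algebra.smul_def]

/-- A lift to the dual numbers gives a derivation. -/
noncomputable def toDerivation [Algebra R Λ] (f : R →+* DualExt Λ)
    (hf : ∀ r, (f r).1 = algebraMap R Λ r) : Derivation ℤ R Λ :=
  Derivation.mk' (AddMonoidHom.toIntLinearMap
    { toFun := fun x => (f x).2
      map_zero' := by simp
      map_add' := by simp }) (by
    intro a b
    simp [hf, Algebra.smul_def])

end DualExt

theorem exists_derivation_extend {R Λ : Type} [CommRing R] [CommRing Λ] [Algebra R Λ]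
    [Algebra.FormallySmooth R Λ] (φ : R →+* DualExt Λ) (hφ : ∀ r, (φ r).1 = algebraMap R Λ r) :
    ∃ E : Derivation ℤ Λ Λ, ∀ r, E (algebraMap R Λ r) = (φ r).2 := by
  let : Algebra R (DualExt Λ) := φ.toAlgebra
  let g : DualExt Λ →ₐ[R] Λ :=
    { DualExt.fstHom Λ with commutes' := fun r => hφ r }
  have hg : Function.Surjective g := fun x => ⟨⟨x, 0⟩, rfl⟩
  have hker : IsNilpotent (RingHom.ker (g : DualExt Λ →+* Λ)) := by
    refine ⟨2, ?_⟩
    rw [pow_two, Submodule.zero_eq_bot, eq_bot_iff, Ideal.mul_le]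
    rintro ⟨a, b⟩ ha ⟨c, e⟩ hc
    have ha' : a = 0 := ha
    have hc' : c = 0 := hc
    subst ha' hc'
    ext <;> simp
  let f : Λ →ₐ[R] DualExt Λ :=
    Algebra.FormallySmooth.liftOfSurjective (AlgHom.id R Λ) g hg hker
  have hf : ∀ x, (f x).1 = x :=
    fun x => Algebra.FormallySmooth.liftOfSurjective_apply (AlgHom.id R Λ) g hg hker x
  refine ⟨DualExt.toDerivation (f : Λ →+* DualExt Λ) hf, fun r => ?_⟩
  change (f (algebraMap R Λ r)).2 = _
  rw [f.commutes]
  rfl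

theorem formallySmooth_of_charZero (K L : Type) [Field K] [CharZero K] [Field L] [Algebra K L] :
    Algebra.FormallySmooth K L := by
  obtain ⟨ι, x, hx⟩ := exists_isTranscendenceBasis' K L
  have := hx.isAlgebraic_field
  have : CharZero (IntermediateField.adjoin K (Set.range x)) := by infer_instance
  exact .of_algebraicIndependent_of_isSeparable hx.1

/-- A derivation extends with prescribed values on an algebraically independent family. -/
theorem exists_derivation_algebraicIndependent {K Λ ι : Type} [Field K] [CharZero K] [Field Λ]
    [Algebra K Λ] (D : Derivation ℤ K Λ) {x : ι → Λ} (hx : AlgebraicIndependent K x)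
    (u : ι → Λ) :
    ∃ E : Derivation ℤ Λ Λ, (∀ a, E (algebraMap K Λ a) = D a) ∧ ∀ i, E (x i) = u i := by
  let : Algebra (MvPolynomial ι K) Λ := (MvPolynomial.aeval x).toAlgebra
  have hinj : Function.Injective (algebraMap (MvPolynomial ι K) Λ) := hx
  have : FaithfulSMul (MvPolynomial ι K) Λ := (faithfulSMul_iff_algebraMap_injective _ _).2 hinj
  let : Algebra (FractionRing (MvPolynomial ι K)) Λ :=
    FractionRing.liftAlgebra (MvPolynomial ι K) Λ
  have : IsScalarTower (MvPolynomial ι K) (FractionRing (MvPolynomial ι K)) Λ :=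
    FractionRing.isScalarTower_liftAlgebra _ _
  have : CharZero (FractionRing (MvPolynomial ι K)) :=
    charZero_of_injective_algebraMap
      (IsFractionRing.injective (MvPolynomial ι K) (FractionRing (MvPolynomial ι K)))
  have h1 : Algebra.FormallySmooth (MvPolynomial ι K) (FractionRing (MvPolynomial ι K)) :=
    .of_isLocalization (nonZeroDivisors _)
  have h2 := formallySmooth_of_charZero (FractionRing (MvPolynomial ι K)) Λ
  have h3 : Algebra.FormallySmooth (MvPolynomial ι K) Λ :=
    .comp _ (FractionRing (MvPolynomial ι K)) _
  let φ : MvPolynomial ι K →+* DualExt Λ :=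
    MvPolynomial.eval₂Hom (DualExt.ofDerivation D) (fun i => ⟨x i, u i⟩)
  have hφ : ∀ r, (φ r).1 = algebraMap (MvPolynomial ι K) Λ r := by
    intro r
    have : (DualExt.fstHom Λ).comp φ = algebraMap (MvPolynomial ι K) Λ := by
      refine MvPolynomial.ringHom_ext (fun a => ?_) fun i => ?_
      · change (φ (MvPolynomial.C a)).1 = MvPolynomial.aeval x (MvPolynomial.C a)
        rw [MvPolynomial.aeval_C, MvPolynomial.eval₂Hom_C]
        rfl
      · change (φ (MvPolynomial.X i)).1 = MvPolynomial.aeval x (MvPolynomial.X i)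
        rw [MvPolynomial.aeval_X, MvPolynomial.eval₂Hom_X']
    exact congrArg (fun f => f r) this
  obtain ⟨E, hE⟩ := exists_derivation_extend φ hφ
  refine ⟨E, fun a => ?_, fun i => ?_⟩
  · have := hE (MvPolynomial.C a)
    rw [MvPolynomial.eval₂Hom_C] at this
    rw [← MvPolynomial.aeval_C (σ := ι) x a]
    exact this
  · have := hE (MvPolynomial.X i)
    rw [MvPolynomial.eval₂Hom_X'] at this
    rw [← MvPolynomial.aeval_X (R := K) x i]
    exact this

theorem exists_derivation_field {K Λ : Type} [Field K] [CharZero K] [Field Λ]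
    [Algebra K Λ] (D : Derivation ℤ K Λ) :
    ∃ E : Derivation ℤ Λ Λ, ∀ a, E (algebraMap K Λ a) = D a := by
  have := formallySmooth_of_charZero K Λ
  exact exists_derivation_extend (DualExt.ofDerivation D) fun _ => rfl

theorem Derivation.map_aeval_of_const {A F Λ : Type} [Field A] [Field F] [Algebra A F] [Field Λ]
    [Algebra F Λ] (D : Derivation ℤ F Λ) (hD : ∀ a, D (algebraMap A F a) = 0)
    (P : Polynomial A) (x : F) :
    D (Polynomial.aeval x P) = (Polynomial.aeval x (Polynomial.derivative P)) • D x := by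
  induction P using Polynomial.induction_on with
  | C a => simp [hD]
  | add p q hp hq => simp [hp, hq, add_smul]
  | monomial n a h =>
    simp only [map_mul, Polynomial.aeval_C, map_pow, Polynomial.aeval_X, D.leibniz, hD, smul_zero,
      add_zero, D.leibniz_pow, Polynomial.derivative_mul, Polynomial.derivative_C, zero_mul,
      Polynomial.derivative_X_pow, zero_add, Nat.add_sub_cancel, nsmul_eq_mul]
    simp only [Algebra.smul_def, map_mul, map_pow]
    push_cast
    ring

/-- A derivation vanishing on a field of characteristic zero vanishes on algebraic elements. -/
theorem Derivation.eq_zero_of_isAlgebraic {A F Λ : Type} [Field A] [CharZero A] [Field F]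
    [Algebra A F] [Field Λ] [Algebra F Λ] (D : Derivation ℤ F Λ)
    (hD : ∀ a, D (algebraMap A F a) = 0) {x : F} (hx : IsAlgebraic A x) : D x = 0 := by
  have h1 := D.map_aeval_of_const hD (minpoly A x) x
  rw [minpoly.aeval, map_zero] at h1
  have h2 : Polynomial.aeval x (Polynomial.derivative (minpoly A x)) ≠ 0 :=
    (minpoly.irreducible hx.isIntegral).separable.aeval_derivative_ne_zero (minpoly.aeval A x)
  exact (smul_eq_zero.1 h1.symm).resolve_left h2

/-- The kernel of a derivation on a field, as a subfield. -/
def Derivation.kerField {F Λ : Type} [Field F] [Field Λ] [Algebra F Λ] (D : Derivation ℤ F Λ) :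
    Subfield F where
  carrier := {x | D x = 0}
  mul_mem' {a b} ha hb := by
    change D (a * b) = 0
    have ha : D a = 0 := ha
    have hb : D b = 0 := hb
    rw [D.leibniz, ha, hb, smul_zero, smul_zero, add_zero]
  one_mem' := D.map_one_eq_zero
  add_mem' {a b} ha hb := by
    change D (a + b) = 0
    have ha : D a = 0 := ha
    have hb : D b = 0 := hb
    rw [map_add, ha, hb, add_zero]
  zero_mem' := map_zero D
  neg_mem' {a} ha := by
    change D (-a) = 0
    have ha : D a = 0 := ha
    rw [map_neg, ha, neg_zero]
  inv_mem' a ha := by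
    change D a⁻¹ = 0
    have ha : D a = 0 := ha
    rw [D.leibniz_inv, ha, smul_zero]

theorem Derivation.mem_kerField {F Λ : Type} [Field F] [Field Λ] [Algebra F Λ]
    (D : Derivation ℤ F Λ) {x : F} : x ∈ D.kerField ↔ D x = 0 := Iff.rfl

theorem Derivation.eq_zero_of_adjoin {A F Λ : Type} [Field A] [Field F]
    [Algebra A F] [Field Λ] [Algebra F Λ] (D : Derivation ℤ F Λ)
    (hD : ∀ a, D (algebraMap A F a) = 0) {s : Set F} (hs : ∀ x ∈ s, D x = 0) {x : F}
    (hx : x ∈ IntermediateField.adjoin A s) : D x = 0 := by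
  let Z : IntermediateField A F := D.kerField.toIntermediateField hD
  have : IntermediateField.adjoin A s ≤ Z := IntermediateField.adjoin_le_iff.2 hs
  exact this hx

theorem Derivation.eq_of_isTranscendenceBasis {A F Λ ι : Type} [Field A] [CharZero A] [Field F]
    [Algebra A F] [Field Λ] [Algebra F Λ] (D E : Derivation ℤ F Λ) {x : ι → F}
    (hx : IsTranscendenceBasis A x) (hA : ∀ a, D (algebraMap A F a) = E (algebraMap A F a))
    (hi : ∀ i, D (x i) = E (x i)) (y : F) : D y = E y := by
  have := hx.isAlgebraic_field
  have h : (D - E) y = 0 := by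
    refine (D - E).eq_zero_of_isAlgebraic (A := IntermediateField.adjoin A (Set.range x)) ?_
      (Algebra.IsAlgebraic.isAlgebraic y)
    rintro ⟨a, ha⟩
    refine (D - E).eq_zero_of_adjoin (A := A) (s := Set.range x) ?_ ?_ ha
    · intro a
      rw [Derivation.sub_apply, hA, sub_self]
    · rintro _ ⟨i, rfl⟩
      rw [Derivation.sub_apply, hi, sub_self]
  rwa [Derivation.sub_apply, sub_eq_zero] at h

theorem Derivation.eq_of_isAlgebraic {A F Λ : Type} [Field A] [CharZero A] [Field F]
    [Algebra A F] [Algebra.IsAlgebraic A F] [Field Λ] [Algebra F Λ] (D E : Derivation ℤ F Λ)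
    (hA : ∀ a, D (algebraMap A F a) = E (algebraMap A F a)) (y : F) : D y = E y := by
  have h : (D - E) y = 0 := by
    refine (D - E).eq_zero_of_isAlgebraic (A := A) ?_ (Algebra.IsAlgebraic.isAlgebraic y)
    intro a
    rw [Derivation.sub_apply, hA, sub_self]
  rwa [Derivation.sub_apply, sub_eq_zero] at h

/-- `dL` extends `dK`. -/
def Extends {K L : Type} [Field K] [Field L] [Algebra K L] (dK : Derivation ℤ K K)
    (dL : Derivation ℤ L L) : Prop :=
  ∀ a, dL (algebraMap K L a) = algebraMap K L (dK a)

/-- Elements linearly independent over the constants stay so over the constants of an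
extension. -/
theorem linearIndependent_const_extension {F Λ : Type} [Field F] [Field Λ] [Algebra F Λ]
    {d : Derivation ℤ F F} {dΛ : Derivation ℤ Λ Λ} (hd : Extends d dΛ) (n : ℕ) (v : Fin n → F)
    (hv : LinearIndependent d.kerField v) :
    LinearIndependent dΛ.kerField (fun i => algebraMap F Λ (v i)) := by
  induction n with
  | zero => exact linearIndependent_empty_type
  | succ n ih =>
    have hv0 : v 0 ≠ 0 := hv.ne_zero 0
    by_contra hdep
    obtain ⟨c, hc, j, hj⟩ := Fintype.not_linearIndependent_iff.1 hdep
    have hv0' : algebraMap F Λ (v 0) ≠ 0 := by simpa using hv0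
    let w : Fin n → F := fun i => d (v i.succ / v 0)
    have hw : LinearIndependent d.kerField w := by
      rw [Fintype.linearIndependent_iff]
      intro g hg
      let z : F := ∑ i, (g i : F) * (v i.succ / v 0)
      have hz : d z = 0 := by
        rw [map_sum, ← hg]
        refine Finset.sum_congr rfl fun i _ => ?_
        have h0 : d (g i : F) = 0 := (g i).2
        rw [d.leibniz, h0, smul_zero, add_zero]
        rfl
      rw [Fintype.linearIndependent_iff] at hv
      have := hv (Fin.cons (-⟨z, hz⟩) g) (by
        rw [Fin.sum_univ_succ]
        simp only [Fin.cons_zero, Fin.cons_succ]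
        change -z * v 0 + ∑ i, (g i : F) * v i.succ = 0
        simp only [z]
        rw [neg_mul, Finset.sum_mul, ← Finset.sum_neg_distrib, ← Finset.sum_add_distrib]
        refine Finset.sum_eq_zero fun i _ => ?_
        field_simp
        ring)
      intro i
      have := this i.succ
      rwa [Fin.cons_succ] at this
    have hw' := ih w hw
    have hsum : ∑ i : Fin n, (c i.succ : Λ) * algebraMap F Λ (w i) = 0 := by
      have h1 : (c 0 : Λ) + ∑ i : Fin n, (c i.succ : Λ) * algebraMap F Λ (v i.succ / v 0) = 0 := by
        rw [Fin.sum_univ_succ] at hc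
        have hc' : (c 0 : Λ) * algebraMap F Λ (v 0) +
          ∑ i : Fin n, (c i.succ : Λ) * algebraMap F Λ (v i.succ) = 0 := hc
        apply mul_right_cancel₀ hv0'
        rw [zero_mul, ← hc', add_mul, Finset.sum_mul]
        congr 1
        refine Finset.sum_congr rfl fun i _ => ?_
        rw [map_div₀]
        field_simp
      have h2 := congrArg dΛ h1
      rw [map_zero, map_add, map_sum] at h2
      have h3 : ∀ i, dΛ (c i : Λ) = 0 := fun i => (c i).2
      rw [h3, zero_add] at h2
      rw [← h2]
      refine Finset.sum_congr rfl fun i _ => ?_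
      rw [dΛ.leibniz, h3, smul_zero, add_zero, hd]
      rfl
    rw [Fintype.linearIndependent_iff] at hw'
    have hcs : ∀ i : Fin n, c i.succ = 0 := hw' (fun i => c i.succ) hsum
    have hc0 : c 0 = 0 := by
      rw [Fin.sum_univ_succ] at hc
      simp only [hcs, zero_smul, Finset.sum_const_zero, add_zero] at hc
      have hc' : (c 0 : Λ) * algebraMap F Λ (v 0) = 0 := hc
      exact Subtype.ext ((mul_eq_zero.1 hc').resolve_right hv0')
    rcases Fin.eq_zero_or_eq_succ j with rfl | ⟨i, rfl⟩
    · exact hj hc0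
    · exact hj (hcs i)

theorem linearIndependent_const_extension' {F Λ ι : Type} [Field F] [Field Λ] [Algebra F Λ]
    {d : Derivation ℤ F F} {dΛ : Derivation ℤ Λ Λ} (hd : Extends d dΛ) (v : ι → F)
    (hv : LinearIndependent d.kerField v) :
    LinearIndependent dΛ.kerField (fun i => algebraMap F Λ (v i)) := by
  rw [linearIndependent_iff_finset_linearIndependent]
  intro s
  have e := s.equivFin
  have h := linearIndependent_const_extension hd s.card (fun i => v (e.symm i))
    (hv.comp _ (Subtype.val_injective.comp e.symm.injective))
  have h2 := h.comp e e.injective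
  convert h2 using 1
  ext i
  simp

/-- Constants of an extension that are linearly independent over the constants stay so over
the ground field. -/
theorem linearIndependent_of_const {F Λ : Type} [Field F] [Field Λ] [Algebra F Λ]
    {d : Derivation ℤ F F} {dΛ : Derivation ℤ Λ Λ} (hd : Extends d dΛ) (n : ℕ) (c : Fin n → Λ)
    (hc : ∀ i, dΛ (c i) = 0)
    (hind : ∀ g : Fin n → F, (∀ i, d (g i) = 0) → ∑ i, algebraMap F Λ (g i) * c i = 0 → g = 0) :
    LinearIndependent F c := by
  induction n with
  | zero => exact linearIndependent_empty_type
  | succ n ih =>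
    rw [Fintype.linearIndependent_iff]
    have ih' : LinearIndependent F (fun i : Fin n => c i.succ) := by
      refine ih _ (fun i => hc _) fun g hg hs => ?_
      have := hind (Fin.cons 0 g) (by
        intro i
        refine Fin.cases ?_ (fun i => ?_) i
        · simp
        · simpa using hg i) (by
        rw [Fin.sum_univ_succ]
        simpa using hs)
      funext i
      simpa using congrFun this i.succ
    rw [Fintype.linearIndependent_iff] at ih'
    intro g hg
    rw [Fin.sum_univ_succ] at hg
    have key : g 0 = 0 := by
      by_contra h0
      have h1 : c 0 + ∑ i : Fin n, (g i.succ / g 0) • c i.succ = 0 := by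
        have := congrArg ((g 0)⁻¹ • ·) hg
        simp only [smul_add, smul_zero, Finset.smul_sum, smul_smul, inv_mul_cancel₀ h0,
          one_smul] at this
        rw [← this]
        simp only [div_eq_inv_mul]
      have h2 := congrArg dΛ h1
      rw [map_add, map_zero, hc, zero_add, map_sum] at h2
      have h3 := ih' (fun i => d (g i.succ / g 0)) (by
        rw [← h2]
        refine Finset.sum_congr rfl fun i _ => ?_
        rw [Algebra.smul_def (g i.succ / g 0), dΛ.leibniz, hc, smul_zero, zero_add, hd,
          Algebra.smul_def, smul_eq_mul, mul_comm])
      have h4 := hind (Fin.cons 1 fun i => g i.succ / g 0) (by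
        intro i
        refine Fin.cases ?_ (fun i => ?_) i
        · simp
        · simpa using h3 i) (by
        rw [Fin.sum_univ_succ]
        simpa [Algebra.smul_def] using h1)
      simpa using congrFun h4 0
    rw [key, zero_smul, zero_add] at hg
    have := ih' (fun i => g i.succ) hg
    intro i
    exact Fin.cases key this i

/-- A derivation of a field, with values in an extension. -/
noncomputable def Derivation.baseTo {K : Type} (Λ : Type) [Field K] [Field Λ] [Algebra K Λ]
    (d : Derivation ℤ K K) : Derivation ℤ K Λ :=
  (Algebra.linearMap K Λ).compDer d

@[simp] theorem Derivation.baseTo_apply {K : Type} (Λ : Type) [Field K] [Field Λ] [Algebra K Λ]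
    (d : Derivation ℤ K K) (a : K) : d.baseTo Λ a = algebraMap K Λ (d a) := rfl

theorem exists_extends {K : Type} (Λ : Type) [Field K] [CharZero K] [Field Λ] [Algebra K Λ]
    (d : Derivation ℤ K K) : ∃ dΛ : Derivation ℤ Λ Λ, Extends d dΛ :=
  exists_derivation_field (d.baseTo Λ)

theorem Derivation.map_matrix_mul {F l m n : Type} [Field F] [Fintype m] (d : Derivation ℤ F F)
    (M : Matrix l m F) (N : Matrix m n F) : (M * N).map d = M.map d * N + M * N.map d := by
  ext i j
  simp only [Matrix.map_apply, Matrix.mul_apply, Matrix.add_apply, map_sum, d.leibniz, smul_eq_mul,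
    Finset.sum_add_distrib]
  rw [add_comm]
  congr 1
  exact Finset.sum_congr rfl fun _ _ => mul_comm _ _

theorem Derivation.comp_mulVec {F m n : Type} [Field F] [Fintype n] (d : Derivation ℤ F F)
    (M : Matrix m n F) (v : n → F) :
    d ∘ (M.mulVec v) = (M.map d).mulVec v + M.mulVec (d ∘ v) := by
  ext i
  simp only [Function.comp_apply, Matrix.mulVec, dotProduct, Matrix.map_apply, Pi.add_apply,
    map_sum, d.leibniz, smul_eq_mul, Finset.sum_add_distrib]
  rw [add_comm]
  congr 1
  exact Finset.sum_congr rfl fun _ _ => mul_comm _ _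

theorem algebraicIndependent_const_extension {F Λ ι : Type} [Field F] [Field Λ] [Algebra F Λ]
    {d : Derivation ℤ F F} {dΛ : Derivation ℤ Λ Λ} (hd : Extends d dΛ) {x : ι → F}
    (hx : AlgebraicIndependent d.kerField x) :
    AlgebraicIndependent dΛ.kerField (fun i => algebraMap F Λ (x i)) := by
  have h1 : LinearIndependent d.kerField
      (fun m => MvPolynomial.aeval x (MvPolynomial.basisMonomials ι d.kerField m)) :=
    (MvPolynomial.basisMonomials ι d.kerField).linearIndependent.map'
      (MvPolynomial.aeval x).toLinearMap (LinearMap.ker_eq_bot.2 hx)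
  have h2 := linearIndependent_const_extension' hd _ h1
  have h3 := (MvPolynomial.basisMonomials ι dΛ.kerField).injective_constr_of_linearIndependent
    (R₂ := dΛ.kerField) h2
  have h4 : (MvPolynomial.basisMonomials ι dΛ.kerField).constr dΛ.kerField
      (fun m => algebraMap F Λ (MvPolynomial.aeval x
        (MvPolynomial.basisMonomials ι d.kerField m))) =
      (MvPolynomial.aeval (R := dΛ.kerField) (fun i => algebraMap F Λ (x i))).toLinearMap := by
    refine (MvPolynomial.basisMonomials ι dΛ.kerField).ext fun m => ?_
    rw [Module.Basis.constr_basis]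
    simp [MvPolynomial.aeval_monomial, Finsupp.prod]
  rw [h4] at h3
  exact h3

/-- A derivation killing the constants extends so as to kill all new constants. -/
theorem exists_derivation_killing_const {F Λ : Type} [Field F] [CharZero F] [Field Λ]
    [Algebra F Λ] {d : Derivation ℤ F F} {dΛ : Derivation ℤ Λ Λ} (hd : Extends d dΛ)
    (D : Derivation ℤ F Λ) (hD : ∀ a, d a = 0 → D a = 0) :
    ∃ E : Derivation ℤ Λ Λ, (∀ a, E (algebraMap F Λ a) = D a) ∧ ∀ c, dΛ c = 0 → E c = 0 := by
  obtain ⟨ι, x, hx⟩ := exists_isTranscendenceBasis' d.kerField F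
  have hx' := algebraicIndependent_const_extension hd hx.1
  have : CharZero Λ := charZero_of_injective_algebraMap (algebraMap F Λ).injective
  have : CharZero d.kerField := inferInstance
  have : CharZero dΛ.kerField := inferInstance
  obtain ⟨E, hE, hE'⟩ := exists_derivation_algebraicIndependent
    (0 : Derivation ℤ dΛ.kerField Λ) hx' (fun i => D (x i))
  have hc : ∀ c, dΛ c = 0 → E c = 0 := fun c hc => hE ⟨c, hc⟩
  refine ⟨E, fun a => ?_, hc⟩
  let E' : Derivation ℤ F Λ := E.compAlgebraMap F
  have hE'a : ∀ a, E' a = E (algebraMap F Λ a) := fun a => rfl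
  rw [← hE'a]
  refine E'.eq_of_isTranscendenceBasis D hx (fun a => ?_) (fun i => hE' i) a
  rw [hE'a, hc, hD]
  · exact a.2
  · rw [hd]
    have : d (algebraMap d.kerField F a) = 0 := a.2
    rw [this, map_zero]

/-- A subspace stable under the coordinatewise derivation is spanned by constant vectors. -/
theorem Derivation.le_span_const {F ι : Type} [Field F] [Fintype ι] (d : Derivation ℤ F F)
    (W : Submodule F (ι → F)) (hW : ∀ w ∈ W, (d ∘ w) ∈ W) :
    W ≤ Submodule.span F {u | u ∈ W ∧ d ∘ u = 0} := by
  classical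
  have key : ∀ (N : ℕ) (w : ι → F), w ∈ W → (Finset.univ.filter (fun i => w i ≠ 0)).card ≤ N →
      w ∈ Submodule.span F {u | u ∈ W ∧ d ∘ u = 0} := by
    intro N
    induction N with
    | zero =>
      intro w _ hN
      have : w = 0 := by
        funext i
        by_contra hi
        have := Finset.card_eq_zero.1 (Nat.le_zero.1 hN)
        have hmem : i ∈ Finset.univ.filter (fun i => w i ≠ 0) := by simpa using hi
        rw [this] at hmem
        simp at hmem
      rw [this]
      exact Submodule.zero_mem _
    | succ N ih =>
      intro w hw hN
      by_cases h0 : w = 0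
      · rw [h0]
        exact Submodule.zero_mem _
      have hex : ∃ n, ∃ u ∈ W, u ≠ 0 ∧ (∀ i, w i = 0 → u i = 0) ∧
          (Finset.univ.filter (fun i => u i ≠ 0)).card = n :=
        ⟨_, w, hw, h0, fun _ h => h, rfl⟩
      obtain ⟨u, huW, hu0, huw, hun⟩ := Nat.find_spec hex
      obtain ⟨i, hi⟩ := Function.ne_iff.1 hu0
      rw [Pi.zero_apply] at hi
      let u' : ι → F := (u i)⁻¹ • u
      have hu'W : u' ∈ W := W.smul_mem _ huW
      have hu'i : u' i = 1 := inv_mul_cancel₀ hi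
      have hu'j : ∀ j, u j = 0 → u' j = 0 := fun j hj => by simp [u', hj]
      have hdu' : d ∘ u' = 0 := by
        by_contra hne
        have hlt : (Finset.univ.filter (fun j => (d ∘ u') j ≠ 0)).card < Nat.find hex := by
          rw [← hun]
          refine Finset.card_lt_card (Finset.ssubset_iff_of_subset ?_ |>.2 ⟨i, ?_, ?_⟩)
          · intro j hj
            simp only [Finset.mem_filter, Finset.mem_univ, true_and, Function.comp_apply] at hj ⊢
            intro h
            apply hj
            rw [hu'j j h, map_zero]
          · simpa using hi
          · simp [hu'i]
        refine Nat.find_min hex hlt ⟨d ∘ u', hW _ hu'W, hne, fun j hj => ?_, rfl⟩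
        rw [Function.comp_apply, hu'j j (huw j hj), map_zero]
      have hsub : w - w i • u' ∈ Submodule.span F {u | u ∈ W ∧ d ∘ u = 0} := by
        refine ih _ (W.sub_mem hw (W.smul_mem _ hu'W)) (Nat.le_of_lt_succ (lt_of_lt_of_le ?_ hN))
        have hwi : w i ≠ 0 := fun h => hi (huw i h)
        refine Finset.card_lt_card (Finset.ssubset_iff_of_subset ?_ |>.2 ⟨i, ?_, ?_⟩)
        · intro j hj
          simp only [Finset.mem_filter, Finset.mem_univ, true_and] at hj ⊢
          intro h
          apply hj
          simp [h, hu'j j (huw j h)]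
        · simpa using hwi
        · simp [hu'i]
      have := Submodule.add_mem _ hsub
        (Submodule.smul_mem _ (w i) (Submodule.subset_span ⟨hu'W, hdu'⟩))
      simpa using this
  exact fun w hw => key _ w hw le_rfl

/-- A subspace stable under `v ↦ v′ - A v` is spanned by solutions, if a fundamental matrix
exists. -/
theorem Derivation.le_span_solutions {F ι : Type} [Field F] [Fintype ι] [DecidableEq ι]
    (d : Derivation ℤ F F) {A X : Matrix ι ι F} (hX : IsUnit X.det) (hA : X.map d = A * X)
    (N : Submodule F (ι → F)) (hN : ∀ w ∈ N, d ∘ w - A.mulVec w ∈ N) :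
    N ≤ Submodule.span F {u | u ∈ N ∧ d ∘ u = A.mulVec u} := by
  have h := d.le_span_const (N.comap X.mulVecLin) (by
    intro w hw
    rw [Submodule.mem_comap, Matrix.mulVecLin_apply] at hw ⊢
    have := hN _ hw
    rwa [d.comp_mulVec, hA, ← Matrix.mulVec_mulVec, add_sub_cancel_left] at this)
  intro w hw
  have h1 : X.mulVec (X⁻¹.mulVec w) = w := by
    rw [Matrix.mulVec_mulVec, Matrix.mul_nonsing_inv _ hX, Matrix.one_mulVec]
  have h2 : X⁻¹.mulVec w ∈ N.comap X.mulVecLin := by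
    rw [Submodule.mem_comap, Matrix.mulVecLin_apply, h1]
    exact hw
  have h3 := Submodule.mem_map_of_mem (f := X.mulVecLin) (h h2)
  rw [Matrix.mulVecLin_apply, h1, Submodule.map_span] at h3
  refine Submodule.span_mono ?_ h3
  rintro _ ⟨u, ⟨hu, hdu⟩, rfl⟩
  refine ⟨hu, ?_⟩
  rw [Matrix.mulVecLin_apply, d.comp_mulVec, hdu, hA, Matrix.mulVec_zero, add_zero,
    Matrix.mulVec_mulVec]

/-- A generic fundamental matrix. -/
theorem exists_generic_fundamental {K : Type} [Field K] [CharZero K] (d : Derivation ℤ K K)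
    {ι : Type} [Fintype ι] [DecidableEq ι] (A : Matrix ι ι K) :
    ∃ (Λ : Type) (_ : Field Λ) (_ : Algebra K Λ) (dΛ : Derivation ℤ Λ Λ)
      (X : Matrix ι ι Λ), Extends d dΛ ∧ IsUnit X.det ∧
        X.map dΛ = A.map (algebraMap K Λ) * X ∧
        AlgebraicIndependent K (fun q : ι × ι => X q.1 q.2) := by
  let R := MvPolynomial (ι × ι) K
  let Λ := FractionRing R
  let X : Matrix ι ι Λ :=
    (Matrix.mvPolynomialX ι ι K).map (algebraMap R Λ)
  have hX : AlgebraicIndependent K (fun q : ι × ι => X q.1 q.2) := by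
    have h1 : AlgebraicIndependent K (MvPolynomial.X : ι × ι → R) :=
      MvPolynomial.algebraicIndependent_X _ _
    have h2 := h1.map' (f := IsScalarTower.toAlgHom K R Λ) (IsFractionRing.injective R Λ)
    exact h2
  have hdet : IsUnit X.det := by
    have h1 : X.det = algebraMap R Λ (Matrix.mvPolynomialX ι ι K).det := by
      rw [RingHom.map_det]
      rfl
    rw [isUnit_iff_ne_zero, h1]
    exact fun h => Matrix.det_mvPolynomialX_ne_zero ι K
      (IsFractionRing.injective R Λ (by rw [h, map_zero]))
  obtain ⟨E, hE, hE'⟩ := exists_derivation_algebraicIndependent (d.baseTo Λ) hX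
    (fun q => (A.map (algebraMap K Λ) * X) q.1 q.2)
  refine ⟨Λ, inferInstance, inferInstance, E, X, hE, hdet, ?_, hX⟩
  ext i j
  exact hE' (i, j)

/-- An elementwise form of `PAdicWitness`. -/
def PAdicSubring (p : ℕ) {F : Type} [Field F] (O : ValuationSubring F) : Prop :=
  (p : F)⁻¹ ∉ O ∧ ∀ x ∈ O, ∃ j : ℤ, (x - j) / p ∈ O

theorem pAdicWitness_iff {p : ℕ} (hp : p.Prime) {F : Type} [Field F] [CharZero F]
    (O : ValuationSubring F) : PAdicWitness p O ↔ PAdicSubring p O := by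
  have hp0 : (p : F) ≠ 0 := Nat.cast_ne_zero.2 hp.ne_zero
  constructor
  · rintro ⟨hmax, ⟨e⟩⟩
    constructor
    · intro h
      refine hmax.ne_top ((Ideal.eq_top_iff_one _).2 (Ideal.mem_span_singleton'.2 ⟨⟨_, h⟩, ?_⟩))
      apply Subtype.ext
      simp [hp0]
    · intro x hx
      let q := Ideal.Quotient.mk (Ideal.span {(p : O)})
      obtain ⟨j, hj⟩ := ZMod.intCast_surjective (e (q ⟨x, hx⟩))
      have h1 : q ⟨x, hx⟩ = q (j : O) := by
        apply e.injective
        rw [← hj]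
        simp
      obtain ⟨a, ha⟩ := Ideal.mem_span_singleton'.1 (Ideal.Quotient.eq.1 h1)
      refine ⟨j, ?_⟩
      have h2 : (x - j) / p = a := by
        have := congrArg (Subtype.val) ha
        simp only [MulMemClass.coe_mul, AddSubgroupClass.coe_sub] at this
        rw [div_eq_iff hp0]
        simpa using this.symm
      rw [h2]
      exact a.2
  · rintro ⟨h1, h2⟩
    let I : Ideal O := Ideal.span {(p : O)}
    have hI : I ≠ ⊤ := by
      intro h
      obtain ⟨a, ha⟩ := Ideal.mem_span_singleton'.1 ((Ideal.eq_top_iff_one _).1 h)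
      apply h1
      have := congrArg (Subtype.val) ha
      simp only [MulMemClass.coe_mul] at this
      have h3 : (a : F) = (p : F)⁻¹ := by
        apply eq_inv_of_mul_eq_one_left
        simpa using this
      rw [← h3]
      exact a.2
    have hnt : Nontrivial (O ⧸ I) := Ideal.Quotient.nontrivial_iff.2 hI
    have hchar : (p : O ⧸ I) = 0 := by
      have := Ideal.Quotient.eq_zero_iff_mem.2 (Ideal.mem_span_singleton_self (p : O))
      simpa using this
    have hcp : CharP (O ⧸ I) p := by
      have := CharP.exists (O ⧸ I)
      obtain ⟨c, hc⟩ := this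
      have hd := (CharP.cast_eq_zero_iff (O ⧸ I) c p).1 hchar
      rcases (Nat.dvd_prime hp).1 hd with h | h
      · subst h
        have := (CharP.cast_eq_zero_iff (O ⧸ I) 1 1).2 dvd_rfl
        rw [Nat.cast_one] at this
        exact absurd this one_ne_zero
      · rwa [h] at hc
    let f : ZMod p →+* O ⧸ I := ZMod.castHom dvd_rfl _
    have : Fact p.Prime := ⟨hp⟩
    have hf : Function.Bijective f := by
      refine ⟨f.injective, fun y => ?_⟩
      obtain ⟨x, rfl⟩ := Ideal.Quotient.mk_surjective y
      obtain ⟨j, hj⟩ := h2 x x.2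
      refine ⟨j, ?_⟩
      rw [map_intCast, ← map_intCast (Ideal.Quotient.mk I)]
      refine (Ideal.Quotient.eq.2 (Ideal.mem_span_singleton'.2 ⟨⟨_, hj⟩, ?_⟩)).symm
      apply Subtype.ext
      simp [hp0]
    let e := RingEquiv.ofBijective f hf
    refine ⟨Ideal.Quotient.maximal_of_isField _ ?_, ⟨e.symm⟩⟩
    exact (e.symm.toMulEquiv.isField (Field.toIsField (ZMod p)))

theorem isPAdicField_iff {p : ℕ} (hp : p.Prime) {F : Type} [Field F] [CharZero F] :
    IsPAdicField p F ↔ ∃ O : ValuationSubring F, PAdicSubring p O :=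
  exists_congr fun O => pAdicWitness_iff hp O

theorem PAdicSubring.comap {p : ℕ} {F E : Type} [Field F] [Field E] (f : F →+* E)
    {O : ValuationSubring E} (hO : PAdicSubring p O) : PAdicSubring p (O.comap f) := by
  refine ⟨fun h => hO.1 ?_, fun x hx => ?_⟩
  · have := ValuationSubring.mem_comap.1 h
    simpa using this
  · obtain ⟨j, hj⟩ := hO.2 _ (ValuationSubring.mem_comap.1 hx)
    refine ⟨j, ValuationSubring.mem_comap.2 ?_⟩
    simpa using hj

theorem IsPAdicField.of_ringHom {p : ℕ} (hp : p.Prime) {F E : Type} [Field F] [CharZero F]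
    [Field E] (f : F →+* E) (hE : IsPAdicField p E) : IsPAdicField p F := by
  have : CharZero E := charZero_of_injective_ringHom f.injective
  obtain ⟨O, hO⟩ := (isPAdicField_iff hp).1 hE
  exact (isPAdicField_iff hp).2 ⟨_, hO.comap f⟩

/-- The residue field of a place being p-adic makes the field p-adic. -/
theorem IsPAdicField.of_place {p : ℕ} (hp : p.Prime) {A L K : Type} [CommRing A] [Field L]
    [CharZero L] [Algebra A L] [Field K] [CharZero K] (φ : A →+* K)
    (hA : ∀ x : L, ∃ a : A, algebraMap A L a = x ∨ (φ a = 0 ∧ (algebraMap A L a)⁻¹ = x))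
    (hu : ∀ a, φ a ≠ 0 → IsUnit a) (hinj : Function.Injective (algebraMap A L))
    (hK : IsPAdicField p K) : IsPAdicField p L := by
  obtain ⟨O, hO⟩ := (isPAdicField_iff hp).1 hK
  have hp0 : (p : L) ≠ 0 := Nat.cast_ne_zero.2 hp.ne_zero
  have hp0' : (p : K) ≠ 0 := Nat.cast_ne_zero.2 hp.ne_zero
  let S : Subring A := O.toSubring.comap φ
  let V : ValuationSubring L :=
    { (S.map (algebraMap A L)) with
      mem_or_inv_mem' := by
        intro x
        obtain ⟨a, rfl | ⟨ha, rfl⟩⟩ := hA x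
        · by_cases h : φ a ∈ O
          · exact Or.inl ⟨a, h, rfl⟩
          · right
            have h0 : φ a ≠ 0 := fun h0 => h (h0 ▸ O.zero_mem)
            obtain ⟨u, rfl⟩ := hu a h0
            refine ⟨(u⁻¹ : Aˣ), ?_, ?_⟩
            · change φ (u⁻¹ : Aˣ) ∈ O
              have h1 : φ (u⁻¹ : Aˣ) = (φ u)⁻¹ := by
                apply eq_inv_of_mul_eq_one_left
                rw [← map_mul]
                simp
              rw [h1]
              exact (O.mem_or_inv_mem _).resolve_left h
            · apply eq_inv_of_mul_eq_one_left
              rw [← map_mul]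
              simp
        · right
          refine ⟨a, ?_, by rw [inv_inv]⟩
          change φ a ∈ O
          rw [ha]
          exact O.zero_mem }
  have hV : ∀ a, algebraMap A L a ∈ V ↔ φ a ∈ O := by
    intro a
    constructor
    · rintro ⟨b, hb, hab⟩
      rw [← hinj hab]
      exact hb
    · intro h
      exact ⟨a, h, rfl⟩
  obtain ⟨u, hu'⟩ := hu (p : A) (by simpa using hp0')
  have hpu : (p : L)⁻¹ = algebraMap A L (u⁻¹ : Aˣ) := by
    symm
    apply eq_inv_of_mul_eq_one_left
    have : (p : L) = algebraMap A L u := by rw [hu']; simp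
    rw [this, ← map_mul]
    simp
  have hpu' : φ (u⁻¹ : Aˣ) = (p : K)⁻¹ := by
    apply eq_inv_of_mul_eq_one_left
    have : (p : K) = φ u := by rw [hu']; simp
    rw [this, ← map_mul]
    simp
  refine (isPAdicField_iff hp).2 ⟨V, ?_, ?_⟩
  · rw [hpu, hV, hpu']
    exact hO.1
  · rintro _ ⟨a, ha, rfl⟩
    obtain ⟨j, hj⟩ := hO.2 _ ha
    refine ⟨j, ?_⟩
    have : (algebraMap A L a - j) / p = algebraMap A L ((a - j) * (u⁻¹ : Aˣ)) := by
      rw [div_eq_mul_inv, hpu]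
      simp
    change (algebraMap A L a - j) / p ∈ V
    rw [this, hV]
    rw [div_eq_mul_inv, ← hpu'] at hj
    simpa using hj

open PowerSeries in
/-- The derivation of `K⟦s⟧` which extends that of `K` and sends `s` to `1`. -/
noncomputable def psDeriv {K : Type} [Field K] (d : Derivation ℤ K K) :
    PowerSeries K →+ PowerSeries K where
  toFun f := PowerSeries.mk fun j => d (coeff j f) + (j + 1) * coeff (j + 1) f
  map_zero' := by ext; simp
  map_add' a b := by ext; simp; ring

open PowerSeries in
theorem coeff_psDeriv {K : Type} [Field K] (d : Derivation ℤ K K) (f : PowerSeries K) (j : ℕ) :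
    coeff j (psDeriv d f) = d (coeff j f) + (j + 1) * coeff (j + 1) f :=
  PowerSeries.coeff_mk j fun j => d (coeff j f) + (j + 1) * coeff (j + 1) f

open PowerSeries in
theorem psDeriv_mul {K : Type} [Field K] (d : Derivation ℤ K K) (a b : PowerSeries K) :
    psDeriv d (a * b) = a * psDeriv d b + b * psDeriv d a := by
  have h : ∀ f : PowerSeries K, psDeriv d f =
      PowerSeries.mk (fun j => d (coeff j f)) + PowerSeries.derivative K f := by
    intro f
    ext j
    simp [coeff_psDeriv, PowerSeries.coeff_derivative, mul_comm]
  have h2 : PowerSeries.mk (fun j => d (coeff j (a * b))) =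
      a * PowerSeries.mk (fun j => d (coeff j b)) +
        b * PowerSeries.mk (fun j => d (coeff j a)) := by
    ext j
    rw [mul_comm b]
    simp only [coeff_mk, coeff_mul, map_sum, d.leibniz, map_add, smul_eq_mul,
      Finset.sum_add_distrib]
    congr 1
    exact Finset.sum_congr rfl fun _ _ => mul_comm _ _
  rw [h, h, h, h2, Derivation.leibniz, smul_eq_mul, smul_eq_mul]
  ring

open PowerSeries in
theorem psDeriv_C {K : Type} [Field K] (d : Derivation ℤ K K) (a : K) :
    psDeriv d (C a) = C (d a) := by
  ext j
  rw [coeff_psDeriv, coeff_C, coeff_C, coeff_C]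
  split_ifs <;> simp_all

open PowerSeries in
/-- Solving first order recursions by power series. -/
theorem exists_powerSeries_recursion {K ι : Type} [Field K] [CharZero K]
    (T : ℕ → (ι → K) → ι → K) (e : ι → K) :
    ∃ y : ι → PowerSeries K, (∀ i, constantCoeff (y i) = e i) ∧
      ∀ (j : ℕ) (i : ι), ((j : K) + 1) * coeff (j + 1) (y i) = T j (fun l => coeff j (y l)) i := by
  let c : ℕ → ι → K := fun j => Nat.rec e (fun j v i => T j v i / ((j : K) + 1)) j
  have hc : ∀ j i, c (j + 1) i = T j (c j) i / ((j : K) + 1) := fun j i => rfl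
  refine ⟨fun i => PowerSeries.mk fun j => c j i, fun i => ?_, fun j i => ?_⟩
  · rw [← coeff_zero_eq_constantCoeff_apply, coeff_mk]
    rfl
  · simp only [coeff_mk]
    rw [hc, mul_div_cancel₀]
    exact_mod_cast Nat.succ_ne_zero j

open PowerSeries in
theorem powerSeries_recursion_eq_zero {K ι : Type} [Field K] [CharZero K]
    (T : ℕ → (ι → K) → ι → K) (hT : ∀ j, T j 0 = 0) (y : ι → PowerSeries K)
    (h0 : ∀ i, constantCoeff (y i) = 0)
    (h : ∀ (j : ℕ) (i : ι), ((j : K) + 1) * coeff (j + 1) (y i) = T j (fun l => coeff j (y l)) i) :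
    y = 0 := by
  have key : ∀ j, (fun i => coeff j (y i)) = 0 := by
    intro j
    induction j with
    | zero =>
      funext i
      rw [coeff_zero_eq_constantCoeff_apply, h0]
      rfl
    | succ j ih =>
      funext i
      have := h j i
      rw [ih, hT] at this
      refine (mul_eq_zero.1 this).resolve_left ?_
      exact_mod_cast Nat.succ_ne_zero j
  funext i
  ext j
  exact congrFun (key j) i

/-- The fraction field of the ring of formal power series. -/
def PSField (K : Type) [Field K] : Type := FractionRing (PowerSeries K)

section PSField

variable {K : Type} [Field K]

noncomputable instance : Field (PSField K) :=
  inferInstanceAs (Field (FractionRing (PowerSeries K)))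

noncomputable instance : Algebra (PowerSeries K) (PSField K) :=
  inferInstanceAs (Algebra (PowerSeries K) (FractionRing (PowerSeries K)))

instance : IsFractionRing (PowerSeries K) (PSField K) :=
  inferInstanceAs (IsFractionRing (PowerSeries K) (FractionRing (PowerSeries K)))

noncomputable instance : Algebra K (PSField K) :=
  ((algebraMap (PowerSeries K) (PSField K)).comp (PowerSeries.C (R := K))).toAlgebra

instance [CharZero K] : CharZero (PSField K) :=
  charZero_of_injective_algebraMap (algebraMap K (PSField K)).injective

theorem psField_algebraMap (a : K) : algebraMap K (PSField K) a =
    algebraMap (PowerSeries K) (PSField K) (PowerSeries.C a) := rfl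

theorem psField_injective : Function.Injective (algebraMap (PowerSeries K) (PSField K)) :=
  IsFractionRing.injective _ _

open PowerSeries in
theorem psField_cases (x : PSField K) : ∃ a : PowerSeries K,
    algebraMap (PowerSeries K) (PSField K) a = x ∨
      (constantCoeff a = 0 ∧ (algebraMap (PowerSeries K) (PSField K) a)⁻¹ = x) := by
  rcases ValuationRing.isInteger_or_isInteger (PowerSeries K) x with ⟨a, ha⟩ | ⟨a, ha⟩
  · exact ⟨a, Or.inl ha⟩
  · by_cases h : constantCoeff a = 0
    · exact ⟨a, Or.inr ⟨h, by rw [ha, inv_inv]⟩⟩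
    · have h1 : a * a⁻¹ = 1 := PowerSeries.mul_inv_cancel a h
      refine ⟨a⁻¹, Or.inl ?_⟩
      have h2 := congrArg (algebraMap (PowerSeries K) (PSField K)) h1
      rw [map_mul, ha, map_one] at h2
      rw [eq_inv_of_mul_eq_one_right h2, inv_inv]

theorem psField_isPAdicField [CharZero K] {p : ℕ} (hp : p.Prime) (hK : IsPAdicField p K) :
    IsPAdicField p (PSField K) := by
  refine IsPAdicField.of_place hp (PowerSeries.constantCoeff (R := K)) psField_cases ?_
    psField_injective hK
  intro a ha
  exact PowerSeries.isUnit_iff_constantCoeff.2 (isUnit_iff_ne_zero.2 ha)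

theorem exists_psField_deriv (d : Derivation ℤ K K) :
    ∃ δ : Derivation ℤ (PSField K) (PSField K), ∀ f,
      δ (algebraMap (PowerSeries K) (PSField K) f) =
        algebraMap (PowerSeries K) (PSField K) (psDeriv d f) := by
  have : Algebra.FormallySmooth (PowerSeries K) (PSField K) :=
    .of_isLocalization (nonZeroDivisors _)
  have h1 : psDeriv d 1 = 0 := by
    rw [← map_one (PowerSeries.C (R := K)), psDeriv_C, d.map_one_eq_zero, map_zero]
  let φ : PowerSeries K →+* DualExt (PSField K) :=
    { toFun := fun f => ⟨algebraMap (PowerSeries K) (PSField K) f,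
        algebraMap (PowerSeries K) (PSField K) (psDeriv d f)⟩
      map_one' := by ext <;> simp [h1]
      map_zero' := by ext <;> simp
      map_add' := fun a b => by ext <;> simp
      map_mul' := fun a b => by ext <;> simp [psDeriv_mul] }
  exact exists_derivation_extend φ fun _ => rfl

/-- The extension of `psDeriv` to the fraction field. -/
noncomputable def psfDeriv (d : Derivation ℤ K K) : Derivation ℤ (PSField K) (PSField K) :=
  (exists_psField_deriv d).choose

theorem psfDeriv_algebraMap (d : Derivation ℤ K K) (f : PowerSeries K) :
    psfDeriv d (algebraMap (PowerSeries K) (PSField K) f) =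
      algebraMap (PowerSeries K) (PSField K) (psDeriv d f) :=
  (exists_psField_deriv d).choose_spec f

theorem extends_psfDeriv (d : Derivation ℤ K K) : Extends d (psfDeriv d) := by
  intro a
  rw [psField_algebraMap, psfDeriv_algebraMap, psDeriv_C, psField_algebraMap]

/-- An element of `K((s))` algebraic over `K` lies in `K`. -/
theorem psField_mem_of_isAlgebraic [CharZero K] {x : PSField K} (hx : IsAlgebraic K x) :
    ∃ a : K, algebraMap K (PSField K) a = x := by
  obtain ⟨δ, hδ⟩ := exists_psField_deriv (0 : Derivation ℤ K K)
  have hK : ∀ a : K, δ (algebraMap K (PSField K) a) = 0 := by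
    intro a
    rw [psField_algebraMap, hδ, psDeriv_C]
    simp
  have hx0 := δ.eq_zero_of_isAlgebraic hK hx
  have key : ∀ f : PowerSeries K, δ (algebraMap (PowerSeries K) (PSField K) f) = 0 →
      f = PowerSeries.C (PowerSeries.constantCoeff f) := by
    intro f hf
    rw [hδ] at hf
    have hf' := psField_injective (hf.trans (map_zero _).symm)
    ext j
    cases j with
    | zero => simp
    | succ j =>
      have := congrArg (PowerSeries.coeff j) hf'
      rw [coeff_psDeriv] at this
      simp only [Derivation.coe_zero, Pi.zero_apply, zero_add, map_zero] at this
      have h1 := (mul_eq_zero.1 this).resolve_left (by exact_mod_cast Nat.succ_ne_zero j)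
      rw [h1, PowerSeries.coeff_C]
      simp
  obtain ⟨a, rfl | ⟨-, rfl⟩⟩ := psField_cases x
  · exact ⟨PowerSeries.constantCoeff a, by rw [psField_algebraMap, ← key a hx0]⟩
  · rw [δ.leibniz_inv, smul_eq_zero] at hx0
    by_cases ha : a = 0
    · exact ⟨0, by simp [ha]⟩
    have ha' : algebraMap (PowerSeries K) (PSField K) a ≠ 0 := fun h =>
      ha (psField_injective (h.trans (map_zero _).symm))
    have h1 := hx0.resolve_left (by simpa using ha')
    exact ⟨(PowerSeries.constantCoeff a)⁻¹, by rw [map_inv₀, psField_algebraMap, ← key a h1]⟩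

end PSField

namespace PadicVal

variable {E Γ₀ : Type} [Field E] [LinearOrderedCommGroupWithZero Γ₀] (v : Valuation E Γ₀)

theorem le_map_sum_of_pairwise_ne {ι : Type} (s : Finset ι) (f : ι → E)
    (h : ∀ i ∈ s, ∀ j ∈ s, i ≠ j → f i ≠ 0 → v (f i) ≠ v (f j)) :
    ∀ i ∈ s, v (f i) ≤ v (∑ i ∈ s, f i) := by
  classical
  intro i hi
  obtain ⟨m, hm, hmax⟩ := s.exists_max_image (fun i => v (f i)) ⟨i, hi⟩
  refine (hmax i hi).trans ?_
  by_cases h0 : f m = 0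
  · rw [h0, map_zero]
    exact zero_le
  rw [← Finset.add_sum_erase s f hm]
  have hlt : v (∑ j ∈ s.erase m, f j) < v (f m) := by
    refine v.map_sum_lt (by simpa using h0) fun j hj => ?_
    rw [Finset.mem_erase] at hj
    exact lt_of_le_of_ne (hmax j hj.2) (h m hm j hj.2 (Ne.symm hj.1) h0).symm
  rw [v.map_add_eq_of_lt_left hlt]

variable {F : Type} [Field F] [Algebra F E]

theorem exists_pow_eq {z : E} (hz : IsAlgebraic F z) (hz0 : z ≠ 0) :
    ∃ N, 0 < N ∧ ∃ c : F, c ≠ 0 ∧ v z ^ N = v (algebraMap F E c) := by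
  obtain ⟨f, hf0, hf⟩ := hz
  rw [Polynomial.aeval_eq_sum_range] at hf
  by_contra hno
  push Not at hno
  have key := le_map_sum_of_pairwise_ne v (Finset.range (f.natDegree + 1))
    (fun i => f.coeff i • z ^ i) (by
      have main : ∀ i j, i < j → f.coeff i • z ^ i ≠ 0 →
          v (f.coeff i • z ^ i) ≠ v (f.coeff j • z ^ j) := by
        intro i j hij h0 heq
        have hci : f.coeff i ≠ 0 := by rintro h; simp [h] at h0
        have hcj : f.coeff j ≠ 0 := by
          rintro h
          rw [h, zero_smul, map_zero, v.zero_iff] at heq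
          exact h0 heq
        refine hno (j - i) (Nat.sub_pos_of_lt hij) (f.coeff i / f.coeff j)
          (div_ne_zero hci hcj) ?_
        have hcj' : v (algebraMap F E (f.coeff j)) ≠ 0 := by simpa using hcj
        have hzi : v z ^ i ≠ 0 := by simpa using fun h => absurd h hz0
        rw [map_div₀, map_div₀, eq_div_iff hcj']
        simp only [Algebra.smul_def, map_mul, map_pow] at heq
        apply mul_right_cancel₀ hzi
        rw [heq, mul_right_comm, ← pow_add, Nat.sub_add_cancel hij.le, mul_comm]
      intro i _ j _ hij h0
      rcases lt_or_gt_of_ne hij with h | h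
      · exact main i j h h0
      · intro heq
        refine main j i h (fun h1 => ?_) heq.symm
        rw [h1, map_zero, v.zero_iff] at heq
        exact h0 heq)
  rw [hf, map_zero] at key
  have h1 := key f.natDegree (by simp)
  rw [le_zero_iff, v.zero_iff] at h1
  rw [Algebra.smul_def, mul_eq_zero] at h1
  rcases h1 with h1 | h1
  · simp [hf0] at h1
  · exact hz0 (eq_zero_of_pow_eq_zero h1)

theorem mul_lt_one_of_le_one_of_lt_one {a b : Γ₀} (ha : a ≤ 1) (hb : b < 1) : a * b < 1 :=
  (mul_le_of_le_one_left' ha).trans_lt hb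

theorem map_intCast_le_one (j : ℤ) : v (j : E) ≤ 1 := by
  obtain ⟨n, rfl | rfl⟩ := j.eq_nat_or_neg
  · induction n with
    | zero => simp
    | succ n ih =>
      push_cast at ih ⊢
      exact v.map_add_le ih (by simp)
  · rw [Int.cast_neg, v.map_neg]
    induction n with
    | zero => simp
    | succ n ih =>
      push_cast at ih ⊢
      exact v.map_add_le ih (by simp)

variable {p : ℕ}

theorem map_intCast_eq_one (hp : p.Prime) (hvp : v (p : E) < 1) {j : ℤ} (hj : ¬ (p : ℤ) ∣ j) :
    v (j : E) = 1 := by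
  refine le_antisymm (map_intCast_le_one v j) (not_lt.1 fun hlt => ?_)
  obtain ⟨a, b, hab⟩ := (Nat.prime_iff_prime_int.1 hp).coprime_iff_not_dvd.2 hj
  have h1 : ((a : E) * p + b * j) = 1 := by exact_mod_cast congrArg (Int.cast : ℤ → E) hab
  have h2 : v ((a : E) * p + b * j) < 1 := by
    refine v.map_add_lt ?_ ?_
    · rw [map_mul]
      exact mul_lt_one_of_le_one_of_lt_one (map_intCast_le_one v a) hvp
    · rw [map_mul]
      exact mul_lt_one_of_le_one_of_lt_one (map_intCast_le_one v b) hlt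
  rw [h1, map_one] at h2
  exact lt_irrefl _ h2

theorem map_intCast_le_of_lt_one (hp : p.Prime) (hvp : v (p : E) < 1) {j : ℤ}
    (hj : v (j : E) < 1) : v (j : E) ≤ v p := by
  by_cases h : (p : ℤ) ∣ j
  · obtain ⟨m, rfl⟩ := h
    push_cast
    rw [map_mul]
    exact mul_le_of_le_one_right' (map_intCast_le_one v m)
  · exact absurd (map_intCast_eq_one v hp hvp h) hj.ne

theorem map_le_of_lt_one (hp : p.Prime) (hvp : v (p : E) < 1)
    (hR : ∀ x : F, v (algebraMap F E x) ≤ 1 → ∃ j : ℤ, v (algebraMap F E x - j) ≤ v (p : E))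
    {c : F} (hc : v (algebraMap F E c) < 1) :
    v (algebraMap F E c) ≤ v (p : E) := by
  obtain ⟨j, hj⟩ := hR c hc.le
  have h1 : v (j : E) < 1 := by
    have : (j : E) = algebraMap F E c - (algebraMap F E c - j) := by ring
    rw [this]
    exact v.map_sub_lt hc (hj.trans_lt hvp)
  have : algebraMap F E c = (algebraMap F E c - j) + j := by ring
  rw [this]
  exact v.map_add_le hj (map_intCast_le_of_lt_one v hp hvp h1)

theorem exists_pow_le (hp : p.Prime) (hvp : v (p : E) < 1)
    (hR : ∀ x : F, v (algebraMap F E x) ≤ 1 → ∃ j : ℤ, v (algebraMap F E x - j) ≤ v (p : E))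
    {z : E} (hz : IsAlgebraic F z) (hz1 : v z < 1) (N : ℕ) :
    ∃ M₀, ∀ M, M₀ ≤ M → v z ^ M ≤ v (p : E) ^ N := by
  by_cases hz0 : z = 0
  · refine ⟨1, fun M hM => ?_⟩
    rw [hz0, map_zero, zero_pow (by omega)]
    exact zero_le
  obtain ⟨m, hm, c, hc0, hc⟩ := exists_pow_eq v hz hz0
  have h1 : v z ^ m ≤ v (p : E) := by
    rw [hc]
    apply map_le_of_lt_one v hp hvp hR
    rw [← hc]
    exact pow_lt_one₀ zero_le hz1 hm.ne'
  refine ⟨m * N, fun M hM => ?_⟩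
  calc v z ^ M ≤ v z ^ (m * N) := pow_le_pow_of_le_one zero_le hz1.le hM
    _ = (v z ^ m) ^ N := pow_mul _ _ _
    _ ≤ _ := pow_le_pow_left₀ zero_le h1 N

theorem exists_pow_sub_one_lt (hp : p.Prime) (hvp : v (p : E) < 1)
    (hR : ∀ x : F, v (algebraMap F E x) ≤ 1 → ∃ j : ℤ, v (algebraMap F E x - j) ≤ v (p : E))
    {z : E} (hz : IsAlgebraic F z) (hz1 : v z = 1) :
    ∃ a, 0 < a ∧ v (z ^ a - 1) < 1 := by
  classical
  have : Fact p.Prime := ⟨hp⟩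
  obtain ⟨f, hf0, hf⟩ := hz
  obtain ⟨m, hm, hmax⟩ := f.support.exists_max_image (fun i => v (algebraMap F E (f.coeff i)))
    (Polynomial.support_nonempty.2 hf0)
  have hm0 : f.coeff m ≠ 0 := Polynomial.mem_support_iff.1 hm
  have hb : ∀ i, v (algebraMap F E (f.coeff i / f.coeff m)) ≤ 1 := by
    intro i
    rw [map_div₀, map_div₀]
    refine div_le_one_of_le₀ ?_ zero_le
    by_cases hi : i ∈ f.support
    · exact hmax i hi
    · rw [Polynomial.notMem_support_iff.1 hi, map_zero, map_zero]
      exact zero_le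
  choose j hj using fun i => hR _ (hb i)
  let g : Polynomial ℤ := ∑ i ∈ Finset.range (f.natDegree + 1), Polynomial.monomial i (j i)
  have hgm : g.coeff m = j m := by
    rw [Polynomial.finsetSum_coeff]
    rw [Finset.sum_eq_single m]
    · simp
    · intro b _ hb
      rw [Polynomial.coeff_monomial, if_neg hb]
    · intro h
      exact absurd (Finset.mem_range.2 (Nat.lt_succ_of_le (Polynomial.le_natDegree_of_mem_supp _ hm))) h
  have hgz : v (Polynomial.aeval z g) < 1 := by
    have h1 : Polynomial.aeval z g = -∑ i ∈ Finset.range (f.natDegree + 1),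
        (algebraMap F E (f.coeff i / f.coeff m) - j i) * z ^ i := by
      rw [Polynomial.aeval_eq_sum_range] at hf
      have h2 : ∑ i ∈ Finset.range (f.natDegree + 1),
          algebraMap F E (f.coeff i / f.coeff m) * z ^ i = 0 := by
        have := congrArg (fun t => t / algebraMap F E (f.coeff m)) hf
        simp only [Finset.sum_div, zero_div] at this
        rw [← this]
        refine Finset.sum_congr rfl fun i _ => ?_
        rw [Algebra.smul_def, map_div₀]
        ring
      simp only [sub_mul, Finset.sum_sub_distrib, h2, zero_sub, neg_neg, g, map_sum,
        Polynomial.aeval_monomial]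
      simp
    rw [h1, v.map_neg]
    refine v.map_sum_lt one_ne_zero fun i _ => ?_
    rw [map_mul, map_pow, hz1, one_pow, mul_one]
    exact (hj i).trans_lt hvp
  have hgp : g.map (Int.castRingHom (ZMod p)) ≠ 0 := by
    intro h
    have h1 := congrArg (fun q => Polynomial.coeff q m) h
    simp only [Polynomial.coeff_map, hgm, Polynomial.coeff_zero] at h1
    have h2 : (p : ℤ) ∣ j m := (ZMod.intCast_zmod_eq_zero_iff_dvd _ _).1 h1
    have h3 : v (j m : E) < 1 := by
      obtain ⟨t, ht⟩ := h2
      rw [ht]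
      push_cast
      rw [map_mul, mul_comm]
      exact mul_lt_one_of_le_one_of_lt_one (map_intCast_le_one v t) hvp
    have h4 : v (algebraMap F E (f.coeff m / f.coeff m)) < 1 := by
      have : algebraMap F E (f.coeff m / f.coeff m) =
        (algebraMap F E (f.coeff m / f.coeff m) - j m) + j m := by ring
      rw [this]
      exact v.map_add_lt ((hj m).trans_lt hvp) h3
    rw [div_self hm0, map_one, map_one] at h4
    exact lt_irrefl _ h4
  have hfin : Finite (AdjoinRoot (g.map (Int.castRingHom (ZMod p)))) := by
    have := (AdjoinRoot.powerBasis hgp).finite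
    exact Module.finite_of_finite (ZMod p)
  obtain ⟨a, b, hab, heq⟩ := Finite.exists_ne_map_eq_of_infinite
    (fun i : ℕ => (AdjoinRoot.root (g.map (Int.castRingHom (ZMod p)))) ^ i)
  have main : ∀ a b : ℕ, a < b → (AdjoinRoot.root (g.map (Int.castRingHom (ZMod p)))) ^ a =
      (AdjoinRoot.root (g.map (Int.castRingHom (ZMod p)))) ^ b →
      ∃ a, 0 < a ∧ v (z ^ a - 1) < 1 := by
    intro a b hab heq
    refine ⟨b - a, Nat.sub_pos_of_lt hab, ?_⟩
    have h1 : AdjoinRoot.mk (g.map (Int.castRingHom (ZMod p)))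
        (Polynomial.X ^ b - Polynomial.X ^ a) = 0 := by
      rw [map_sub, map_pow, map_pow, AdjoinRoot.mk_X, heq, sub_self]
    obtain ⟨q, hq⟩ := AdjoinRoot.mk_eq_zero.1 h1
    obtain ⟨Q, rfl⟩ := Polynomial.map_surjective (Int.castRingHom (ZMod p))
      (ZMod.ringHom_surjective _) q
    have h2 : (Polynomial.X ^ b - Polynomial.X ^ a - g * Q).map (Int.castRingHom (ZMod p)) = 0 := by
      simp [hq]
    have h3 : ∃ r, Polynomial.X ^ b - Polynomial.X ^ a - g * Q = Polynomial.C (p : ℤ) * r := by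
      refine (Polynomial.C_dvd_iff_dvd_coeff _ _).2 fun i => ?_
      have := congrArg (fun q => Polynomial.coeff q i) h2
      simp only [Polynomial.coeff_map, Polynomial.coeff_zero] at this
      exact (ZMod.intCast_zmod_eq_zero_iff_dvd _ _).1 this
    obtain ⟨r, hr⟩ := h3
    have hxint : ∀ q : Polynomial ℤ, v (Polynomial.aeval z q) ≤ 1 := by
      intro q
      rw [Polynomial.aeval_eq_sum_range]
      refine v.map_sum_le fun i _ => ?_
      rw [zsmul_eq_mul, map_mul, map_pow, hz1, one_pow, mul_one]
      exact map_intCast_le_one v _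
    have h4 : z ^ b - z ^ a = Polynomial.aeval z g * Polynomial.aeval z Q +
        p * Polynomial.aeval z r := by
      have := congrArg (Polynomial.aeval z) hr
      simp only [map_sub, map_pow, Polynomial.aeval_X, map_mul, Polynomial.aeval_C] at this
      rw [sub_eq_iff_eq_add] at this
      rw [this]
      simp
      ring
    have h5 : v (z ^ b - z ^ a) < 1 := by
      rw [h4]
      refine v.map_add_lt ?_ ?_
      · rw [map_mul, mul_comm]
        exact mul_lt_one_of_le_one_of_lt_one (hxint _) hgz
      · rw [map_mul, mul_comm]
        exact mul_lt_one_of_le_one_of_lt_one (hxint _) hvp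
    have h6 : z ^ b - z ^ a = z ^ a * (z ^ (b - a) - 1) := by
      rw [mul_sub, ← pow_add, Nat.add_sub_cancel' hab.le, mul_one]
    rw [h6, map_mul, map_pow, hz1, one_pow, one_mul] at h5
    exact h5
  rcases lt_or_gt_of_ne hab with h | h
  · exact main a b h heq
  · exact main b a h heq.symm

end PadicVal

namespace PadicVal

variable {E Γ₀ : Type} [Field E] [LinearOrderedCommGroupWithZero Γ₀] (v : Valuation E Γ₀)
variable {F : Type} [Field F] [Algebra F E] {p : ℕ}

/-- `x` is congruent to an integer modulo `p`. -/
def Approx (v : Valuation E Γ₀) (p : ℕ) (x : E) : Prop := ∃ j : ℤ, v (x - j) ≤ v (p : E)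

theorem Approx.mul {x y : E} (hx : Approx v p x) (hy : Approx v p y) (hvx : v x ≤ 1) :
    Approx v p (x * y) := by
  obtain ⟨i, hi⟩ := hx
  obtain ⟨j, hj⟩ := hy
  refine ⟨i * j, ?_⟩
  have : x * y - ((i * j : ℤ) : E) = x * (y - j) + j * (x - i) := by push_cast; ring
  rw [this]
  refine v.map_add_le ?_ ?_
  · rw [map_mul]
    exact (mul_le_of_le_one_left' hvx).trans hj
  · rw [map_mul]
    exact (mul_le_of_le_one_left' (map_intCast_le_one v j)).trans hi

theorem Approx.of_intCast_mul (hp : p.Prime) {x : E} {m : ℤ}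
    (hm : ¬ (p : ℤ) ∣ m) (hvx : v x ≤ 1) (h : Approx v p (m * x)) : Approx v p x := by
  obtain ⟨a, b, hab⟩ := (Nat.prime_iff_prime_int.1 hp).coprime_iff_not_dvd.2 hm
  obtain ⟨j, hj⟩ := h
  refine ⟨b * j, ?_⟩
  have h1 : ((a : E) * p + b * m) = 1 := by exact_mod_cast congrArg (Int.cast : ℤ → E) hab
  have : x - ((b * j : ℤ) : E) = b * (m * x - j) + a * p * x := by
    push_cast
    linear_combination (-x) * h1
  rw [this]
  refine v.map_add_le ?_ ?_
  · rw [map_mul]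
    exact (mul_le_of_le_one_left' (map_intCast_le_one v b)).trans hj
  · rw [map_mul, map_mul, mul_right_comm]
    exact mul_le_of_le_one_left' (mul_le_one' (map_intCast_le_one v a) hvx)

theorem Approx.of_inv (hp : p.Prime) (hvp : v (p : E) < 1) {x : E} (hvx : v x = 1)
    (h : Approx v p x⁻¹) : Approx v p x := by
  have hx0 : x ≠ 0 := by
    rintro rfl
    rw [map_zero] at hvx
    exact zero_ne_one hvx
  obtain ⟨j, hj⟩ := h
  have hjp : ¬ (p : ℤ) ∣ j := by
    rintro ⟨m, rfl⟩
    have h1 : v (((p * m : ℤ) : E)) < 1 := by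
      push_cast
      rw [map_mul, mul_comm]
      exact mul_lt_one_of_le_one_of_lt_one (map_intCast_le_one v m) hvp
    have h2 : v x⁻¹ < 1 := by
      rw [← sub_add_cancel x⁻¹ (((p * m : ℤ) : E))]
      exact v.map_add_lt (hj.trans_lt hvp) h1
    rw [map_inv₀, hvx, inv_one] at h2
    exact lt_irrefl _ h2
  refine Approx.of_intCast_mul v hp hjp hvx.le ⟨1, ?_⟩
  have : (j : E) * x - ((1 : ℤ) : E) = -(x * (x⁻¹ - j)) := by
    rw [mul_sub, mul_inv_cancel₀ hx0]
    push_cast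
    ring
  rw [this, v.map_neg, map_mul, hvx, one_mul]
  exact hj

theorem pow_dvd_of_map_le (hp : p.Prime) (hvp : v (p : E) < 1) (hvp0 : v (p : E) ≠ 0) (s : ℕ) :
    ∀ {j : ℤ}, v (j : E) ≤ v (p : E) ^ s → (p : ℤ) ^ s ∣ j := by
  induction s with
  | zero => simp
  | succ s ih =>
    intro j hj
    have h1 : v (j : E) < 1 := hj.trans_lt (pow_lt_one₀ zero_le hvp (by omega))
    have h2 : (p : ℤ) ∣ j := by
      by_contra h
      exact h1.ne (map_intCast_eq_one v hp hvp h)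
    obtain ⟨m, rfl⟩ := h2
    push_cast at hj
    rw [map_mul, pow_succ', mul_le_mul_iff_right₀ (zero_lt_iff.2 hvp0)] at hj
    rw [pow_succ']
    exact mul_dvd_mul_left _ (ih hj)

theorem exists_int_map_sub_le (hvp0 : v (p : E) ≠ 0)
    (hR : ∀ x : F, v (algebraMap F E x) ≤ 1 → ∃ j : ℤ, v (algebraMap F E x - j) ≤ v (p : E))
    (N : ℕ) : ∀ x : F, v (algebraMap F E x) ≤ 1 →
      ∃ j : ℤ, v (algebraMap F E x - j) ≤ v (p : E) ^ N := by
  induction N with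
  | zero =>
    intro x hx
    exact ⟨0, by simpa using hx⟩
  | succ N ih =>
    intro x hx
    obtain ⟨j, hj⟩ := ih x hx
    have hp0 : (p : E) ≠ 0 := by simpa using hvp0
    have h1 : v (algebraMap F E ((x - j) / p ^ N)) ≤ 1 := by
      rw [map_div₀, map_sub, map_intCast, map_pow, map_natCast, map_div₀, map_pow]
      exact div_le_one_of_le₀ hj zero_le
    obtain ⟨i, hi⟩ := hR _ h1
    refine ⟨j + p ^ N * i, ?_⟩
    have : algebraMap F E x - ((j + p ^ N * i : ℤ) : E) =
        p ^ N * (algebraMap F E ((x - j) / p ^ N) - i) := by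
      rw [map_div₀, map_sub, map_intCast, map_pow, map_natCast]
      push_cast
      field_simp
      ring
    rw [this, map_mul, map_pow, pow_succ]
    exact mul_le_mul_right hi _

theorem lt_one_iff_of_le_one_iff {γ : E ≃ₐ[F] E} (h : ∀ y, v (γ y) ≤ 1 ↔ v y ≤ 1) (y : E) :
    v (γ y) < 1 ↔ v y < 1 := by
  by_cases hy : y = 0
  · simp [hy]
  have key : ∀ z : E, z ≠ 0 → (v z < 1 ↔ ¬ v z⁻¹ ≤ 1) := by
    intro z hz
    rw [map_inv₀, inv_le_one₀ (zero_lt_iff.2 (v.ne_zero_iff.2 hz)), not_le]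
  rw [key y hy, key (γ y) (by simpa using hy), ← map_inv₀, h]

theorem approx_of_natCast_mul_sub_le (hp : p.Prime) (hvp : v (p : E) < 1)
    (hR : ∀ x : F, v (algebraMap F E x) ≤ 1 → ∃ j : ℤ, v (algebraMap F E x - j) ≤ v (p : E))
    (hvp0 : v (p : E) ≠ 0) {c : ℕ} (hc : c ≠ 0) {x : E} (hx : v x ≤ 1) (t : F)
    (ht : v (algebraMap F E t - c * x) ≤ v (p : E) ^ (c.factorization p + 1)) :
    Approx v p x := by
  set s := c.factorization p with hs
  have hdiv := Nat.ordProj_mul_ordCompl_eq_self c p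
  set m := c / p ^ s with hm
  have hmp : ¬ (p : ℤ) ∣ (m : ℤ) := by
    rw [Int.natCast_dvd_natCast]
    exact Nat.not_dvd_ordCompl hp hc
  have hcE : (c : E) = p ^ s * m := by rw [← hdiv]; push_cast; rfl
  have hps : v (p : E) ^ (s + 1) ≤ v (p : E) ^ s := by
    rw [pow_succ]
    exact mul_le_of_le_one_right' hvp.le
  have hcx : v (c * x) ≤ v (p : E) ^ s := by
    rw [hcE, map_mul, map_mul, map_pow, mul_assoc]
    refine mul_le_of_le_one_right' (mul_le_one' ?_ hx)
    simpa using map_intCast_le_one v (m : ℤ)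
  have ht1 : v (algebraMap F E t) ≤ v (p : E) ^ s := by
    rw [← sub_add_cancel (algebraMap F E t) (c * x)]
    exact v.map_add_le (ht.trans hps) hcx
  obtain ⟨j, hj⟩ := exists_int_map_sub_le v hvp0 hR (s + 1) t
    (ht1.trans (pow_le_one₀ zero_le hvp.le))
  have hj1 : v (j : E) ≤ v (p : E) ^ s := by
    rw [← sub_sub_cancel (algebraMap F E t) (j : E)]
    exact v.map_sub_le ht1 (hj.trans hps)
  obtain ⟨i, rfl⟩ := pow_dvd_of_map_le v hp hvp hvp0 s hj1
  refine Approx.of_intCast_mul v hp hmp hx ⟨i, ?_⟩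
  have h2 : v ((p : E) ^ s * (((m : ℤ) : E) * x - i)) ≤ v (p : E) ^ (s + 1) := by
    have : (p : E) ^ s * (((m : ℤ) : E) * x - i) =
        (algebraMap F E t - (((p : ℤ) ^ s * i : ℤ) : E)) - (algebraMap F E t - c * x) := by
      rw [hcE]
      push_cast
      ring
    rw [this]
    exact v.map_sub_le hj ht
  rw [map_mul, map_pow, pow_succ, mul_le_mul_iff_right₀ (pow_pos (zero_lt_iff.2 hvp0) s)] at h2
  exact h2

variable [FiniteDimensional F E]

theorem le_one_iff_of_le_one_imp (γ : E ≃ₐ[F] E) (h : ∀ y, v y ≤ 1 → v (γ y) ≤ 1) (y : E) :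
    v (γ y) ≤ 1 ↔ v y ≤ 1 := by
  refine ⟨fun hy => ?_, h y⟩
  have h1 : ∀ n : ℕ, v ((γ ^ n) (γ y)) ≤ 1 := by
    intro n
    induction n with
    | zero => simpa using hy
    | succ n ih =>
      rw [pow_succ', AlgEquiv.mul_apply]
      exact h _ ih
  have h2 := h1 (orderOf γ - 1)
  rw [← AlgEquiv.mul_apply, ← pow_succ, Nat.sub_add_cancel (orderOf_pos γ), pow_orderOf_eq_one]
    at h2
  simpa using h2

theorem exists_gt_one_lt_one (γ : E ≃ₐ[F] E) (h : ¬ ∀ y, v (γ y) ≤ 1 ↔ v y ≤ 1) :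
    ∃ u, 1 < v u ∧ v (γ u) < 1 := by
  have h0 : ∃ u, v u ≤ 1 ∧ 1 < v (γ u) := by
    by_contra hno
    push Not at hno
    exact h (le_one_iff_of_le_one_imp v γ hno)
  have h1 : ∃ u, 1 < v u ∧ v (γ u) ≤ 1 := by
    by_contra hno
    push Not at hno
    apply h
    have h2 := le_one_iff_of_le_one_imp v γ⁻¹ (fun y hy => by
      by_contra hlt
      have := hno (γ⁻¹ y) (not_le.1 hlt)
      rw [← AlgEquiv.mul_apply, mul_inv_cancel] at this
      exact absurd hy (not_le.2 (by simpa using this)))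
    intro y
    have := h2 (γ y)
    rw [← AlgEquiv.mul_apply, inv_mul_cancel] at this
    exact this.symm
  obtain ⟨a, ha, ha'⟩ := h0
  obtain ⟨b, hb, hb'⟩ := h1
  refine ⟨b / a, ?_, ?_⟩
  · have ha0 : v a ≠ 0 := by
      rw [v.ne_zero_iff]
      rintro rfl
      simp at ha'
    rw [map_div₀, one_lt_div₀ (zero_lt_iff.2 ha0)]
    exact ha.trans_lt hb
  · rw [map_div₀, map_div₀, div_lt_one₀ (zero_lt_one.trans ha')]
    exact hb'.trans_lt ha'

/-- For each `x` there is a monic quadratic polynomial in a power of `x` which is a unit at all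
conjugate valuations where `x` is integral. -/
theorem exists_denominator (hp : p.Prime) (hvp : v (p : E) < 1)
    (hR : ∀ x : F, v (algebraMap F E x) ≤ 1 → ∃ j : ℤ, v (algebraMap F E x - j) ≤ v (p : E))
    (x : E) : ∃ a : ℕ, 0 < a ∧ ∀ γ : E ≃ₐ[F] E,
    (v (γ x) ≤ 1 → v (γ (1 - x ^ a + x ^ (2 * a))) = 1) ∧
    (1 < v (γ x) → v (γ (1 - x ^ a + x ^ (2 * a))) = v (γ x) ^ (2 * a)) ∧
    (v (γ x) < 1 → v (γ ((1 - x ^ a + x ^ (2 * a)) - 1)) < 1) := by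
  classical
  have h1 : ∀ γ : E ≃ₐ[F] E, ∃ a, 0 < a ∧ (v (γ x) = 1 → v (γ x ^ a - 1) < 1) := by
    intro γ
    by_cases h : v (γ x) = 1
    · obtain ⟨a, ha, h'⟩ := exists_pow_sub_one_lt v hp hvp hR
        (Algebra.IsAlgebraic.isAlgebraic (γ x)) h
      exact ⟨a, ha, fun _ => h'⟩
    · exact ⟨1, one_pos, fun h' => absurd h' h⟩
  choose a ha0 ha using h1
  refine ⟨∏ γ, a γ, Finset.prod_pos fun γ _ => ha0 γ, fun γ => ?_⟩
  set A := ∏ γ, a γ with hA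
  have hA0 : A ≠ 0 := (Finset.prod_pos fun γ _ => ha0 γ).ne'
  have h2 : v (γ x) = 1 → v (γ x ^ A - 1) < 1 := by
    intro h
    obtain ⟨b, hb⟩ : a γ ∣ A := Finset.dvd_prod_of_mem a (Finset.mem_univ γ)
    obtain ⟨c, hc⟩ : γ x ^ a γ - 1 ∣ γ x ^ A - 1 := by
      rw [hb, pow_mul]
      simpa using sub_dvd_pow_sub_pow (γ x ^ a γ) 1 b
    have hcv : c = ∑ i ∈ Finset.range b, (γ x ^ a γ) ^ i ∨ γ x ^ a γ - 1 = 0 := by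
      by_cases h0 : γ x ^ a γ - 1 = 0
      · exact Or.inr h0
      · left
        apply mul_left_cancel₀ h0
        rw [← hc, hb, pow_mul, mul_geom_sum]
    rcases hcv with h3 | h3
    · rw [hc, map_mul, mul_comm]
      refine mul_lt_one_of_le_one_of_lt_one ?_ (ha γ h)
      rw [h3]
      refine v.map_sum_le fun i _ => ?_
      rw [map_pow, map_pow, h, one_pow, one_pow]
    · rw [hc, h3, zero_mul, map_zero]
      exact zero_lt_one
  have hγ : γ (1 - x ^ A + x ^ (2 * A)) = 1 + γ x ^ A * (γ x ^ A - 1) := by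
    rw [map_add, map_sub, map_one, map_pow, map_pow]
    ring
  have hγ' : γ (1 - x ^ A + x ^ (2 * A) - 1) = γ x ^ A * (γ x ^ A - 1) := by
    rw [map_sub, hγ, map_one]
    ring
  have h4 : v (γ x) < 1 → v (γ x ^ A * (γ x ^ A - 1)) < 1 := by
    intro h
    have : v (γ x ^ A) < 1 := by
      rw [map_pow]
      exact pow_lt_one₀ zero_le h hA0
    rw [map_mul, mul_comm]
    exact mul_lt_one_of_le_one_of_lt_one (v.map_sub_le this.le (by simp)) this
  refine ⟨fun h => ?_, fun h => ?_, fun h => by rw [hγ']; exact h4 h⟩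
  · rw [hγ]
    apply v.map_one_add_of_lt
    rcases h.lt_or_eq with h | h
    · exact h4 h
    · rw [map_mul, map_pow, h, one_pow, one_mul]
      exact h2 h
  · have h5 : 1 < v (γ x ^ A) := by
      rw [map_pow]
      exact one_lt_pow₀ h hA0
    have h6 : v (γ x ^ A - 1) = v (γ x ^ A) :=
      v.map_sub_eq_of_lt_left (by simpa using h5)
    have h7 : v (γ x ^ A * (γ x ^ A - 1)) = v (γ x) ^ (2 * A) := by
      rw [map_mul, h6, map_pow, two_mul, pow_add]
    rw [hγ, v.map_add_eq_of_lt_right, h7]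
    rw [h7, map_one]
    exact one_lt_pow₀ h (by omega)

theorem exists_idempotent_approx (hp : p.Prime) (hvp : v (p : E) < 1)
    (hR : ∀ x : F, v (algebraMap F E x) ≤ 1 → ∃ j : ℤ, v (algebraMap F E x - j) ≤ v (p : E))
    (N : ℕ) :
    ∃ y : E, ∀ γ : E ≃ₐ[F] E,
      ((∀ z, v (γ z) ≤ 1 ↔ v z ≤ 1) → v (γ (y - 1)) ≤ v (p : E) ^ N) ∧
      ((¬ ∀ z, v (γ z) ≤ 1 ↔ v z ≤ 1) → v (γ y) ≤ v (p : E) ^ N) := by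
  classical
  have h1 : ∀ γ : E ≃ₐ[F] E, ∃ t : E, v (t - 1) < 1 ∧ (∀ γ' : E ≃ₐ[F] E, v (γ' t) ≤ 1) ∧
      ((¬ ∀ z, v (γ z) ≤ 1 ↔ v z ≤ 1) → v (γ t) < 1) := by
    intro γ
    by_cases h : ∀ z, v (γ z) ≤ 1 ↔ v z ≤ 1
    · exact ⟨1, by simp, by simp, fun h' => absurd h h'⟩
    · obtain ⟨u, hu, hu'⟩ := exists_gt_one_lt_one v γ h
      obtain ⟨a, ha, haγ⟩ := exists_denominator v hp hvp hR u
      set q := 1 - u ^ a + u ^ (2 * a) with hq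
      refine ⟨1 - q⁻¹, ?_, fun γ' => ?_, fun _ => ?_⟩
      · have h2 := (haγ 1).2.1 (by simpa using hu)
        rw [AlgEquiv.one_apply, AlgEquiv.one_apply] at h2
        rw [sub_sub_cancel_left, v.map_neg, map_inv₀, h2]
        exact inv_lt_one_of_one_lt₀ (one_lt_pow₀ hu (by omega))
      · rw [map_sub, map_one, map_inv₀]
        refine v.map_sub_le (by simp) ?_
        rw [map_inv₀]
        apply inv_le_one_of_one_le₀
        rcases le_or_gt (v (γ' u)) 1 with h3 | h3
        · exact ((haγ γ').1 h3).ge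
        · rw [(haγ γ').2.1 h3]
          exact one_le_pow₀ h3.le
      · have h2 := (haγ γ).1 hu'.le
        have h3 := (haγ γ).2.2 hu'
        have hq0 : q ≠ 0 := by
          intro h0
          rw [h0, map_zero, map_zero] at h2
          exact zero_ne_one h2
        have : 1 - q⁻¹ = (q - 1) / q := by field_simp
        rw [this, map_div₀, map_div₀, h2, div_one]
        exact h3
  choose t ht1 ht2 ht3 using h1
  let y0 := ∏ γ, t γ
  have hy1 : v (y0 - 1) < 1 := by
    have : ∀ s : Finset (E ≃ₐ[F] E), v (∏ γ ∈ s, t γ - 1) < 1 := by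
      intro s
      induction s using Finset.induction_on with
      | empty => simp
      | insert γ s hγ ih =>
        rw [Finset.prod_insert hγ]
        have : t γ * ∏ γ ∈ s, t γ - 1 = t γ * (∏ γ ∈ s, t γ - 1) + (t γ - 1) := by ring
        rw [this]
        refine v.map_add_lt ?_ (ht1 γ)
        rw [map_mul]
        exact mul_lt_one_of_le_one_of_lt_one (by simpa using ht2 γ 1) ih
    exact this _
  have hy2 : ∀ γ : E ≃ₐ[F] E, v (γ y0) ≤ 1 := by
    intro γ
    rw [map_prod, map_prod]
    exact Finset.prod_le_one' fun i _ => ht2 i γ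
  have hy3 : ∀ γ : E ≃ₐ[F] E, (¬ ∀ z, v (γ z) ≤ 1 ↔ v z ≤ 1) → v (γ y0) < 1 := by
    intro γ hγ
    have : y0 = (∏ γ' ∈ Finset.univ.erase γ, t γ') * t γ := by
      rw [Finset.prod_erase_mul _ _ (Finset.mem_univ γ)]
    rw [this, map_mul, map_mul]
    refine mul_lt_one_of_le_one_of_lt_one ?_ (ht3 γ hγ)
    rw [map_prod, map_prod]
    exact Finset.prod_le_one' fun i _ => ht2 i γ
  have h4 : ∀ γ : E ≃ₐ[F] E, ∃ M₀, ∀ M, M₀ ≤ M →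
      ((∀ z, v (γ z) ≤ 1 ↔ v z ≤ 1) → v (γ (y0 - 1)) ^ M ≤ v (p : E) ^ N) ∧
      ((¬ ∀ z, v (γ z) ≤ 1 ↔ v z ≤ 1) → v (γ y0) ^ M ≤ v (p : E) ^ N) := by
    intro γ
    by_cases h : ∀ z, v (γ z) ≤ 1 ↔ v z ≤ 1
    · obtain ⟨M₀, hM⟩ := exists_pow_le v hp hvp hR
        (Algebra.IsAlgebraic.isAlgebraic (γ (y0 - 1))) ((lt_one_iff_of_le_one_iff v h _).2 hy1) N
      exact ⟨M₀, fun M h' => ⟨fun _ => hM M h', fun h'' => absurd h h''⟩⟩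
    · obtain ⟨M₀, hM⟩ := exists_pow_le v hp hvp hR
        (Algebra.IsAlgebraic.isAlgebraic (γ y0)) (hy3 γ h) N
      exact ⟨M₀, fun M h' => ⟨fun h'' => absurd h'' h, fun _ => hM M h'⟩⟩
  choose M₀ hM using h4
  set M := ∑ γ, M₀ γ + 1 with hMdef
  have hMγ : ∀ γ, M₀ γ ≤ M := fun γ =>
    (Finset.single_le_sum (fun _ _ => Nat.zero_le _) (Finset.mem_univ γ)).trans (Nat.le_succ _)
  refine ⟨1 - (1 - y0 ^ M) ^ M, fun γ => ⟨fun h => ?_, fun h => ?_⟩⟩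
  · refine le_trans ?_ ((hM γ M (hMγ γ)).1 h)
    rw [sub_sub_cancel_left, map_neg, v.map_neg, map_pow, map_pow]
    refine pow_le_pow_left₀ zero_le ?_ M
    have : 1 - y0 ^ M = -((y0 - 1) * ∑ i ∈ Finset.range M, y0 ^ i) := by
      rw [mul_geom_sum]
      ring
    rw [this, map_neg, v.map_neg, map_mul, map_mul]
    refine mul_le_of_le_one_right' ?_
    rw [map_sum]
    refine v.map_sum_le fun i _ => ?_
    rw [map_pow, map_pow]
    exact pow_le_one₀ zero_le (hy2 γ)
  · refine le_trans ?_ ((hM γ M (hMγ γ)).2 h)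
    have : 1 - (1 - y0 ^ M) ^ M = y0 ^ M * ∑ i ∈ Finset.range M, (1 - y0 ^ M) ^ i := by
      have h5 := mul_neg_geom_sum (1 - y0 ^ M) M
      rw [sub_sub_cancel] at h5
      exact h5.symm
    rw [this, map_mul, map_mul, map_pow, map_pow]
    refine mul_le_of_le_one_right' ?_
    rw [map_sum]
    refine v.map_sum_le fun i _ => ?_
    rw [map_pow, map_pow, map_sub, map_one, map_pow]
    refine pow_le_one₀ zero_le (v.map_sub_le (by simp) ?_)
    rw [map_pow]
    exact pow_le_one₀ zero_le (hy2 γ)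

theorem approx_of_fixed_of_integral (hp : p.Prime) (hvp : v (p : E) < 1)
    (hR : ∀ x : F, v (algebraMap F E x) ≤ 1 → ∃ j : ℤ, v (algebraMap F E x - j) ≤ v (p : E))
    [IsGalois F E] (hvp0 : v (p : E) ≠ 0) {x : E}
    (hx : ∀ γ : E ≃ₐ[F] E, v (γ x) ≤ 1)
    (hfix : ∀ γ : E ≃ₐ[F] E, (∀ z, v (γ z) ≤ 1 ↔ v z ≤ 1) → γ x = x) : Approx v p x := by
  classical
  let H : Finset (E ≃ₐ[F] E) := Finset.univ.filter fun γ => ∀ z, v (γ z) ≤ 1 ↔ v z ≤ 1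
  have hH : H.card ≠ 0 := by
    apply Finset.card_ne_zero_of_mem (a := 1)
    simp [H]
  obtain ⟨y, hy⟩ := exists_idempotent_approx v hp hvp hR (H.card.factorization p + 1)
  obtain ⟨t, ht⟩ : ∃ t : F, algebraMap F E t = ∑ γ : E ≃ₐ[F] E, γ (x * y) := by
    refine (IsGalois.mem_range_algebraMap_iff_fixed _).2 fun σ => ?_
    rw [map_sum]
    exact Fintype.sum_equiv (Equiv.mulLeft σ) _ _ fun γ => rfl
  refine approx_of_natCast_mul_sub_le v hp hvp hR hvp0 hH (by simpa using hx 1) t ?_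
  have hsplit : algebraMap F E t - H.card * x =
      ∑ γ ∈ H, γ x * γ (y - 1) + ∑ γ ∈ Hᶜ, γ x * γ y := by
    rw [ht, ← Finset.sum_add_sum_compl H]
    have : ∑ γ ∈ H, γ (x * y) = ∑ γ ∈ H, γ x * γ (y - 1) + H.card * x := by
      rw [← nsmul_eq_mul, ← Finset.sum_const, ← Finset.sum_add_distrib]
      refine Finset.sum_congr rfl fun γ hγ => ?_
      rw [map_mul, map_sub, map_one, hfix γ (by simpa [H] using hγ)]
      ring
    rw [this]
    simp only [map_mul]
    ring
  rw [hsplit]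
  refine v.map_add_le (v.map_sum_le fun γ hγ => ?_) (v.map_sum_le fun γ hγ => ?_)
  · rw [map_mul]
    exact (mul_le_of_le_one_left' (hx γ)).trans ((hy γ).1 (by simpa [H] using hγ))
  · rw [map_mul]
    refine (mul_le_of_le_one_left' (hx γ)).trans ((hy γ).2 ?_)
    rw [Finset.mem_compl, Finset.mem_filter] at hγ
    exact fun h => hγ ⟨Finset.mem_univ _, h⟩

/-- The decomposition field of a valuation has the same residue field and value of `p`. -/
theorem approx_of_fixed (hp : p.Prime) (hvp : v (p : E) < 1)
    (hR : ∀ x : F, v (algebraMap F E x) ≤ 1 → ∃ j : ℤ, v (algebraMap F E x - j) ≤ v (p : E))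
    [IsGalois F E] (hvp0 : v (p : E) ≠ 0) {x : E} (hx : v x ≤ 1)
    (hfix : ∀ γ : E ≃ₐ[F] E, (∀ z, v (γ z) ≤ 1 ↔ v z ≤ 1) → γ x = x) : Approx v p x := by
  obtain ⟨a, ha, haγ⟩ := exists_denominator v hp hvp hR x
  set q := 1 - x ^ a + x ^ (2 * a) with hq
  have hqfix : ∀ γ : E ≃ₐ[F] E, (∀ z, v (γ z) ≤ 1 ↔ v z ≤ 1) → γ q = q := by
    intro γ hγ
    simp only [hq, map_add, map_sub, map_one, map_pow, hfix γ hγ]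
  have hvq : v q = 1 := by simpa using (haγ 1).1 (by simpa using hx)
  have hq0 : q ≠ 0 := by
    intro h0
    rw [h0, map_zero] at hvq
    exact zero_ne_one hvq
  have h1 : Approx v p q⁻¹ := by
    refine approx_of_fixed_of_integral v hp hvp hR hvp0 (fun γ => ?_) fun γ hγ => ?_
    · rw [map_inv₀, map_inv₀]
      apply inv_le_one_of_one_le₀
      rcases le_or_gt (v (γ x)) 1 with h3 | h3
      · exact ((haγ γ).1 h3).ge
      · rw [(haγ γ).2.1 h3]
        exact one_le_pow₀ h3.le
    · rw [map_inv₀, hqfix γ hγ]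
  have h2 : Approx v p (x / q) := by
    refine approx_of_fixed_of_integral v hp hvp hR hvp0 (fun γ => ?_) fun γ hγ => ?_
    · rw [map_div₀, map_div₀]
      rcases le_or_gt (v (γ x)) 1 with h3 | h3
      · rw [(haγ γ).1 h3, div_one]
        exact h3
      · rw [(haγ γ).2.1 h3]
        refine div_le_one_of_le₀ ?_ zero_le
        exact le_self_pow₀ h3.le (by omega)
    · rw [map_div₀, hqfix γ hγ, hfix γ hγ]
  have h3 := (Approx.of_inv v hp hvp hvq h1).mul v h2 hvq.le
  rwa [mul_div_cancel₀ _ hq0] at h3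

end PadicVal

namespace PadicVal

section

variable {Ω Γ₀ : Type} [Field Ω] [LinearOrderedCommGroupWithZero Γ₀] (v : Valuation Ω Γ₀)
variable {F : Type} [Field F] [Algebra F Ω] {p : ℕ}

/-- `z` and `1` differ by a bounded power of `p`. -/
def Comm1 (v : Valuation Ω Γ₀) (p : ℕ) (z : Ω) : Prop :=
  ∃ N : ℕ, v (p : Ω) ^ N ≤ v z ∧ v z * v (p : Ω) ^ N ≤ 1

theorem comm1_of_le (hvp : v (p : Ω) < 1)
    {z : Ω} (h1 : v (p : Ω) ≤ v z) (h2 : v z ≤ 1) : Comm1 v p z :=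
  ⟨1, by simpa using h1, by simpa using mul_le_one' h2 hvp.le⟩

theorem Comm1.ne_zero (hvp0 : v (p : Ω) ≠ 0) {z : Ω} (h : Comm1 v p z) : z ≠ 0 := by
  rintro rfl
  obtain ⟨N, h, -⟩ := h
  rw [map_zero] at h
  exact pow_ne_zero N hvp0 (le_zero_iff.1 h)

theorem Comm1.mul {x y : Ω} (hx : Comm1 v p x) (hy : Comm1 v p y) : Comm1 v p (x * y) := by
  obtain ⟨N, h1, h2⟩ := hx
  obtain ⟨M, h3, h4⟩ := hy
  refine ⟨N + M, ?_, ?_⟩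
  · rw [pow_add, map_mul]
    exact mul_le_mul' h1 h3
  · rw [pow_add, map_mul, mul_mul_mul_comm]
    exact mul_le_one' h2 h4

theorem Comm1.inv (hvp0 : v (p : Ω) ≠ 0) {x : Ω} (hx : Comm1 v p x) : Comm1 v p x⁻¹ := by
  have hx0 := hx.ne_zero v hvp0
  obtain ⟨N, h1, h2⟩ := hx
  have hv : 0 < v x := zero_lt_iff.2 (v.ne_zero_iff.2 hx0)
  refine ⟨N, ?_, ?_⟩
  · rw [map_inv₀, le_inv_comm₀ (pow_pos (zero_lt_iff.2 hvp0) N) hv]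
    rwa [← one_div, le_div_iff₀ (pow_pos (zero_lt_iff.2 hvp0) N)]
  · rw [map_inv₀, mul_comm, ← div_eq_mul_inv]
    exact div_le_one_of_le₀ h1 zero_le

theorem Comm1.of_pow (hvp : v (p : Ω) < 1)
    {x : Ω} {n : ℕ} (hn : n ≠ 0) (hx : Comm1 v p (x ^ n)) : Comm1 v p x := by
  obtain ⟨N, h1, h2⟩ := hx
  have hpn : v (p : Ω) ^ (N * n) ≤ v (p : Ω) ^ N :=
    pow_le_pow_of_le_one zero_le hvp.le (Nat.le_mul_of_pos_right N (Nat.pos_of_ne_zero hn))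
  refine ⟨N, ?_, ?_⟩
  · rw [← pow_le_pow_iff_left₀ zero_le zero_le hn, ← pow_mul, ← map_pow v x]
    exact hpn.trans h1
  · rw [← pow_le_one_iff_of_nonneg zero_le hn, mul_pow, ← pow_mul, ← map_pow v x]
    exact (mul_le_mul_right hpn _).trans h2

theorem comm1_one : Comm1 v p (1 : Ω) := ⟨0, by simp, by simp⟩

/-- The elements of `Ω` having the same value, up to powers of `p`, as some element of `F`. -/
def commSubgroup (F : Type) [Field F] [Algebra F Ω] (v : Valuation Ω Γ₀) {p : ℕ}
    (hvp0 : v (p : Ω) ≠ 0) : Subgroup Ωˣ where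
  carrier := {z | ∃ c : F, c ≠ 0 ∧ Comm1 v p ((z : Ω) * algebraMap F Ω c)}
  mul_mem' := by
    rintro a b ⟨c, hc0, hc⟩ ⟨d, hd0, hd⟩
    refine ⟨c * d, mul_ne_zero hc0 hd0, ?_⟩
    rw [map_mul, Units.val_mul, mul_mul_mul_comm]
    exact hc.mul v hd
  one_mem' := ⟨1, one_ne_zero, by simpa using comm1_one v⟩
  inv_mem' := by
    rintro a ⟨c, hc0, hc⟩
    refine ⟨c⁻¹, inv_ne_zero hc0, ?_⟩
    rw [map_inv₀, Units.val_inv_eq_inv_val, ← mul_inv]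
    exact hc.inv v hvp0

theorem exists_prime_pow_mem {G : Type*} [Group G] (T : Subgroup G) {x : G} (hx : x ∉ T) {N : ℕ}
    (hN : 0 < N) (hxN : x ^ N ∈ T) : ∃ q : ℕ, q.Prime ∧ ∃ y ∉ T, y ^ q ∈ T := by
  induction N using Nat.strong_induction_on generalizing x with
  | _ N ih =>
    have hN1 : N ≠ 1 := by
      rintro rfl
      exact hx (by simpa using hxN)
    obtain ⟨q, hq, m, rfl⟩ := Nat.exists_prime_and_dvd hN1
    by_cases h : x ^ q ∈ T
    · exact ⟨q, hq, x, hx, h⟩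
    · have hm : 0 < m := Nat.pos_of_mul_pos_left hN
      refine ih m ?_ h hm (by rwa [← pow_mul])
      exact (Nat.lt_mul_iff_one_lt_left hm).2 hq.one_lt

theorem commSubgroup_eq_top (hvp : v (p : Ω) < 1) (hvp0 : v (p : Ω) ≠ 0)
    (hR : ∀ x : F, v (algebraMap F Ω x) ≤ 1 → ∃ j : ℤ, v (algebraMap F Ω x - j) ≤ v (p : Ω))
    (hmax : ∀ x : Ω, (∀ y ∈ IntermediateField.adjoin F {x}, v y ≤ 1 → Approx v p y) →
      x ∈ Set.range (algebraMap F Ω)) [IsAlgClosed Ω] [Algebra.IsAlgebraic F Ω] :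
    commSubgroup F v hvp0 = ⊤ := by
  by_contra hne
  obtain ⟨x, hx⟩ : ∃ x, x ∉ commSubgroup F v hvp0 := by
    by_contra h
    push Not at h
    exact hne ((Subgroup.eq_top_iff' _).2 h)
  obtain ⟨N, hN, c, hc0, hc⟩ := exists_pow_eq v
    (Algebra.IsAlgebraic.isAlgebraic (R := F) (x : Ω)) x.ne_zero
  have hcv : v (algebraMap F Ω c) ≠ 0 := by simpa using hc0
  obtain ⟨q, hq, y, hy, d, hd0, hd⟩ := exists_prime_pow_mem _ hx hN (by
    refine ⟨c⁻¹, inv_ne_zero hc0, 0, ?_, ?_⟩ <;>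
    simp [hc, hcv])
  obtain ⟨r, hr⟩ := IsAlgClosed.exists_pow_nat_eq (algebraMap F Ω d⁻¹) hq.pos
  have hr0 : r ≠ 0 := by
    rintro rfl
    rw [zero_pow hq.ne_zero] at hr
    exact inv_ne_zero hd0 (by simpa using hr.symm)
  have hrT : Units.mk0 r hr0 ∉ commSubgroup F v hvp0 := by
    intro h
    apply hy
    have h1 : Comm1 v p ((y : Ω) * r⁻¹) := by
      apply Comm1.of_pow v hvp hq.ne_zero
      rw [mul_pow, inv_pow, hr, map_inv₀, inv_inv]
      exact hd
    have h2 : y * (Units.mk0 r hr0)⁻¹ ∈ commSubgroup F v hvp0 := ⟨1, one_ne_zero, by simpa using h1⟩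
    simpa using mul_mem h2 h
  have hrq : Units.mk0 r hr0 ^ q ∈ commSubgroup F v hvp0 := by
    refine ⟨d, hd0, ?_⟩
    have hd' : algebraMap F Ω d ≠ 0 := by simpa using hd0
    simp only [Units.val_pow_eq_pow_val, Units.val_mk0, hr, map_inv₀, inv_mul_cancel₀ hd']
    exact comm1_one v
  have hsmall : ∀ m : ℕ, 0 < m → m < q → Units.mk0 r hr0 ^ m ∉ commSubgroup F v hvp0 := by
    intro m hm hmq h
    have hcop : Nat.Coprime m q := Nat.coprime_comm.1 (hq.coprime_iff_not_dvd.2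
      (fun h => absurd (Nat.le_of_dvd hm h) (by omega)))
    apply hrT
    have h1 := Nat.gcd_eq_gcd_ab m q
    rw [hcop] at h1
    have h2 : Units.mk0 r hr0 = (Units.mk0 r hr0 ^ m) ^ (m.gcdA q) *
        (Units.mk0 r hr0 ^ q) ^ (m.gcdB q) := by
      rw [← zpow_natCast, ← zpow_natCast, ← zpow_mul, ← zpow_mul, ← zpow_add, ← h1]
      simp
    rw [h2]
    exact mul_mem (Subgroup.zpow_mem _ h _) (Subgroup.zpow_mem _ hrq _)
  obtain ⟨s, hs⟩ := hmax r (by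
    intro z hz hvz
    have halg : IsAlgebraic F r := Algebra.IsAlgebraic.isAlgebraic r
    rw [← IntermediateField.mem_toSubalgebra,
      IntermediateField.adjoin_simple_toSubalgebra_of_isAlgebraic halg,
      Algebra.adjoin_singleton_eq_range_aeval] at hz
    obtain ⟨f, rfl⟩ := hz
    have hmonic : (Polynomial.X ^ q - Polynomial.C d⁻¹ : Polynomial F).Monic :=
      Polynomial.monic_X_pow_sub_C _ hq.ne_zero
    have hrem : Polynomial.aeval r f =
        Polynomial.aeval r (f %ₘ (Polynomial.X ^ q - Polynomial.C d⁻¹)) := by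
      conv_lhs => rw [← Polynomial.modByMonic_add_div f (Polynomial.X ^ q - Polynomial.C d⁻¹)]
      simp [hr]
    set g := f %ₘ (Polynomial.X ^ q - Polynomial.C d⁻¹) with hg
    have hgdeg : g.natDegree < q := by
      have := Polynomial.natDegree_modByMonic_lt f hmonic (fun h => by
        have := congrArg Polynomial.natDegree h
        rw [Polynomial.natDegree_X_pow_sub_C, Polynomial.natDegree_one] at this
        exact hq.ne_zero this)
      rwa [Polynomial.natDegree_X_pow_sub_C] at this
    change Approx v p (Polynomial.aeval r f)
    change v (Polynomial.aeval r f) ≤ 1 at hvz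
    rw [hrem, Polynomial.aeval_eq_sum_range' hgdeg] at hvz ⊢
    have hdist : ∀ i j, i < j → j < q → g.coeff i • r ^ i ≠ 0 → 
        v (g.coeff i • r ^ i) ≠ v (g.coeff j • r ^ j) := by
      intro i j hij hjq h0 heq
      have hci : g.coeff i ≠ 0 := by rintro h; simp [h] at h0
      have hcj : g.coeff j ≠ 0 := by
        rintro h
        rw [h, zero_smul, map_zero, v.zero_iff] at heq
        exact h0 heq
      refine hsmall (j - i) (by omega) (by omega) ⟨g.coeff j / g.coeff i,
        div_ne_zero hcj hci, 0, ?_⟩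
      have hone : v (((Units.mk0 r hr0 ^ (j - i) : Ωˣ) : Ω) *
          algebraMap F Ω (g.coeff j / g.coeff i)) = 1 := by
        have hvi : v (algebraMap F Ω (g.coeff i)) * v r ^ i ≠ 0 :=
          mul_ne_zero (by simpa using hci) (pow_ne_zero _ (by simpa using hr0))
        apply mul_left_cancel₀ hvi
        simp only [Algebra.smul_def, map_mul, map_pow] at heq
        rw [mul_one, Units.val_pow_eq_pow_val, Units.val_mk0, map_mul, map_pow, map_div₀,
          map_div₀]
        refine Eq.trans ?_ heq.symm
        have hvi' : v (algebraMap F Ω (g.coeff i)) ≠ 0 := by simpa using hci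
        obtain ⟨m, rfl⟩ := Nat.exists_eq_add_of_lt hij
        rw [show i + m + 1 - i = m + 1 by omega]
        field_simp
        rw [← pow_add, add_assoc, add_comm i, mul_comm]
      rw [hone]
      simp
    have hle := le_map_sum_of_pairwise_ne v (Finset.range q) (fun i => g.coeff i • r ^ i) (by
      intro i hi j hj hij h0
      rw [Finset.mem_range] at hi hj
      rcases lt_or_gt_of_ne hij with h | h
      · exact hdist i j h hj h0
      · intro heq
        refine hdist j i h hi (fun h1 => ?_) heq.symm
        rw [h1, map_zero, v.zero_iff] at heq
        exact h0 heq)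
    have hle1 : ∀ i ∈ Finset.range q, v (g.coeff i • r ^ i) ≤ 1 := fun i hi => (hle i hi).trans hvz
    obtain ⟨j, hj⟩ := hR (g.coeff 0) (by simpa [Algebra.smul_def] using hle1 0 (by simpa using hq.pos))
    refine ⟨j, ?_⟩
    rw [Finset.range_eq_Ico, Finset.sum_eq_sum_Ico_succ_bot hq.pos]
    have : g.coeff 0 • r ^ 0 + ∑ k ∈ Finset.Ico (0 + 1) q, g.coeff k • r ^ k - (j : Ω) =
        (algebraMap F Ω (g.coeff 0) - j) + ∑ k ∈ Finset.Ico (0 + 1) q, g.coeff k • r ^ k := by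
      rw [pow_zero, Algebra.smul_def, mul_one]
      ring
    rw [this]
    refine v.map_add_le hj (v.map_sum_le fun i hi => ?_)
    rw [Finset.mem_Ico] at hi
    by_contra hlt
    have hi1 := hle1 i (Finset.mem_range.2 hi.2)
    refine hsmall i (by omega) hi.2 ⟨g.coeff i, ?_, ?_⟩
    · intro h0
      simp [h0] at hlt
    · apply comm1_of_le v hvp
      · rw [Units.val_pow_eq_pow_val, Units.val_mk0, mul_comm, ← Algebra.smul_def]
        exact (not_le.1 hlt).le
      · rw [Units.val_pow_eq_pow_val, Units.val_mk0, mul_comm, ← Algebra.smul_def]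
        exact hi1)
  have hs0 : s ≠ 0 := by
    rintro rfl
    rw [map_zero] at hs
    exact hr0 hs.symm
  apply hrT
  refine ⟨s⁻¹, inv_ne_zero hs0, ?_⟩
  rw [Units.val_mk0, map_inv₀, hs, mul_inv_cancel₀ hr0]
  exact comm1_one v

theorem map_algEquiv_le_one_iff (hp : p.Prime) (hvp : v (p : Ω) < 1) (hvp0 : v (p : Ω) ≠ 0)
    (hR : ∀ x : F, v (algebraMap F Ω x) ≤ 1 → ∃ j : ℤ, v (algebraMap F Ω x - j) ≤ v (p : Ω))
    (hmax : ∀ x : Ω, (∀ y ∈ IntermediateField.adjoin F {x}, v y ≤ 1 → Approx v p y) →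
      x ∈ Set.range (algebraMap F Ω)) [IsAlgClosed Ω] [CharZero F] [Algebra.IsAlgebraic F Ω]
    (σ : Ω ≃ₐ[F] Ω) (x : Ω) : v (σ x) ≤ 1 ↔ v x ≤ 1 := by
  have : IsAlgClosure F Ω := ⟨inferInstance, inferInstance⟩
  have : Normal F Ω := IsAlgClosure.normal F Ω
  have hx : IsIntegral F x := Algebra.IsIntegral.isIntegral x
  have := IntermediateField.adjoin.finiteDimensional hx
  let E := IntermediateField.normalClosure F (IntermediateField.adjoin F {x}) Ω
  have : Normal F E := inferInstance
  have : FiniteDimensional F E := inferInstance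
  have : IsGalois F E := ⟨⟩
  let w : Valuation E Γ₀ := v.comap (algebraMap E Ω)
  have hw : ∀ y : E, w y = v y := fun y => rfl
  let H : Subgroup (E ≃ₐ[F] E) :=
    { carrier := {γ | ∀ z, w (γ z) ≤ 1 ↔ w z ≤ 1}
      mul_mem' := by
        intro a b ha hb z
        rw [AlgEquiv.mul_apply, ha, hb]
      one_mem' := by intro z; rfl
      inv_mem' := by
        intro a ha z
        have := ha (a⁻¹ z)
        rw [← AlgEquiv.mul_apply, mul_inv_cancel] at this
        exact this.symm }
  have hfix : IntermediateField.fixedField H = ⊥ := by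
    rw [eq_bot_iff]
    intro y hy
    obtain ⟨c, hc⟩ := hmax (y : Ω) (by
      intro z hz hvz
      have h1 : IntermediateField.adjoin F {(y : Ω)} ≤
          IntermediateField.lift (IntermediateField.fixedField H) := by
        rw [IntermediateField.adjoin_le_iff, Set.singleton_subset_iff]
        exact (IntermediateField.mem_lift y).2 hy
      have hzE : z ∈ E := IntermediateField.lift_le _ (h1 hz)
      have hz1 := (IntermediateField.mem_lift (⟨z, hzE⟩ : E)).1 (h1 hz)
      rw [IntermediateField.mem_fixedField_iff] at hz1
      have hwp : w (p : E) = v (p : Ω) := by rw [hw]; simp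
      obtain ⟨j, hj⟩ := approx_of_fixed (F := F) w hp (by rwa [hwp]) (by
        intro a ha
        obtain ⟨j, hj⟩ := hR a ha
        refine ⟨j, ?_⟩
        rw [hwp, hw]
        simpa using hj) (by rwa [hwp]) (x := ⟨z, hzE⟩) hvz (fun γ hγ => hz1 γ hγ)
      refine ⟨j, ?_⟩
      rw [hwp, hw] at hj
      simpa using hj)
    rw [IntermediateField.mem_bot]
    exact ⟨c, Subtype.ext hc⟩
  have htop : H = ⊤ := by
    rw [← IntermediateField.fixingSubgroup_fixedField H, hfix, IntermediateField.fixingSubgroup_bot]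
  have hxE : x ∈ E := by
    have h1 : IntermediateField.adjoin F {x} ≤ E := IntermediateField.le_normalClosure _
    exact h1 (IntermediateField.mem_adjoin_simple_self F x)
  have hσ : (σ.restrictNormal E) ∈ H := by rw [htop]; trivial
  have h1 := hσ ⟨x, hxE⟩
  have h2 := AlgEquiv.restrictNormal_commutes σ E ⟨x, hxE⟩
  rw [hw, hw] at h1
  change ((σ.restrictNormal E ⟨x, hxE⟩ : E) : Ω) = σ x at h2
  rwa [h2] at h1

end

end PadicVal

namespace PadicVal

variable {Ω Γ₀ : Type} [Field Ω] [LinearOrderedCommGroupWithZero Γ₀] (v : Valuation Ω Γ₀)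
variable {F : Type} [Field F] [Algebra F Ω] {p : ℕ}

section

theorem map_algEquiv_le_iff (hσv : ∀ (σ : Ω ≃ₐ[F] Ω) (x : Ω), v (σ x) ≤ 1 ↔ v x ≤ 1)
    (σ : Ω ≃ₐ[F] Ω) (x : Ω) (c : F) :
    v (σ x) ≤ v (algebraMap F Ω c) ↔ v x ≤ v (algebraMap F Ω c) := by
  by_cases hc : c = 0
  · simp [hc]
  have hcv : 0 < v (algebraMap F Ω c) := zero_lt_iff.2 (by simpa using hc)
  have h := hσv σ (x / algebraMap F Ω c)
  rwa [map_div₀, AlgEquiv.commutes, map_div₀, map_div₀, div_le_one₀ hcv, div_le_one₀ hcv] at h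

theorem map_coeff_minpoly_le_one (hσv : ∀ (σ : Ω ≃ₐ[F] Ω) (x : Ω), v (σ x) ≤ 1 ↔ v x ≤ 1)
    [IsAlgClosed Ω] [Normal F Ω] {x : Ω} (hx : v x ≤ 1)
    (i : ℕ) : v (algebraMap F Ω ((minpoly F x).coeff i)) ≤ 1 := by
  have hxint : IsIntegral F x := Algebra.IsIntegral.isIntegral x
  have hm : ((minpoly F x).map (algebraMap F Ω)).Monic := (minpoly.monic hxint).map _
  have h := (IsAlgClosed.splits ((minpoly F x).map (algebraMap F Ω))).eq_prod_roots
  rw [hm.leadingCoeff, Polynomial.C_1, one_mul] at h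
  rw [← Polynomial.coeff_map, h]
  have hroots : ∀ b ∈ ((minpoly F x).map (algebraMap F Ω)).roots, v b ≤ 1 := by
    intro b hb
    rw [Polynomial.mem_roots hm.ne_zero, Polynomial.IsRoot, Polynomial.eval_map_algebraMap] at hb
    obtain ⟨σ, hσ⟩ := minpoly.exists_algEquiv_of_root (Algebra.IsAlgebraic.isAlgebraic x) hb
    rw [← hσv σ, hσ]
    exact hx
  generalize ((minpoly F x).map (algebraMap F Ω)).roots = s at hroots
  induction s using Multiset.induction_on generalizing i with
  | empty =>
    rw [Multiset.map_zero, Multiset.prod_zero, Polynomial.coeff_one]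
    split_ifs <;> simp
  | cons b s ih =>
    rw [Multiset.map_cons, Multiset.prod_cons, sub_mul, Polynomial.coeff_sub,
      Polynomial.coeff_C_mul]
    have hb : v b ≤ 1 := hroots b (by simp)
    have hs : ∀ j, v ((s.map fun x => Polynomial.X - Polynomial.C x).prod.coeff j) ≤ 1 :=
      fun j => ih j fun c hc => hroots c (by simp [hc])
    refine v.map_sub_le ?_ ?_
    · cases i with
      | zero => simp
      | succ i => simpa using hs i
    · rw [map_mul]
      exact mul_le_one' hb (hs i)

/-- Elements of the inertia group over the algebraic numbers act trivially modulo all powers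
of `p`. -/
theorem map_algEquiv_sub_le (hσv : ∀ (σ : Ω ≃ₐ[F] Ω) (x : Ω), v (σ x) ≤ 1 ↔ v x ≤ 1)
    (hvp0 : v (p : Ω) ≠ 0)
    (hR : ∀ x : F, v (algebraMap F Ω x) ≤ 1 → ∃ j : ℤ, v (algebraMap F Ω x - j) ≤ v (p : Ω))
    [IsAlgClosed Ω] [CharZero Ω] [Normal F Ω] (σ : Ω ≃ₐ[F] Ω)
    (hσ : ∀ z, IsAlgebraic ℚ z → σ z = z) {x : Ω} (hx : v x ≤ 1) (N : ℕ) :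
    v (σ x - x) ≤ v (p : Ω) ^ N := by
  have hxint : IsIntegral F x := Algebra.IsIntegral.isIntegral x
  set m := (minpoly F x).natDegree with hm
  have hm0 : 0 < m := minpoly.natDegree_pos hxint
  choose j hj using fun i => exists_int_map_sub_le v hvp0 hR (m * N) _
    (map_coeff_minpoly_le_one v hσv hx i)
  let g : Polynomial ℚ := Polynomial.X ^ m + ∑ i ∈ Finset.range m, Polynomial.C (j i : ℚ) *
    Polynomial.X ^ i
  have hgm : g.Monic := by
    apply Polynomial.monic_X_pow_add
    refine lt_of_le_of_lt (Polynomial.degree_sum_le _ _) ?_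
    rw [Finset.sup_lt_iff (by exact WithBot.bot_lt_coe m)]
    intro i hi
    refine lt_of_le_of_lt (Polynomial.degree_C_mul_X_pow_le _ _) ?_
    exact_mod_cast Finset.mem_range.1 hi
  have hgdeg : g.natDegree = m := by
    apply Polynomial.natDegree_eq_of_degree_eq_some
    change (Polynomial.X ^ m + _ : Polynomial ℚ).degree = _
    rw [Polynomial.degree_add_eq_left_of_degree_lt, Polynomial.degree_X_pow]
    rw [Polynomial.degree_X_pow]
    refine lt_of_le_of_lt (Polynomial.degree_sum_le _ _) ?_
    rw [Finset.sup_lt_iff (by exact WithBot.bot_lt_coe m)]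
    intro i hi
    refine lt_of_le_of_lt (Polynomial.degree_C_mul_X_pow_le _ _) ?_
    exact_mod_cast Finset.mem_range.1 hi
  have hgx : v (Polynomial.aeval x g) ≤ v (p : Ω) ^ (m * N) := by
    have h1 : Polynomial.aeval x g = -∑ i ∈ Finset.range m,
        (algebraMap F Ω ((minpoly F x).coeff i) - j i) * x ^ i := by
      have h2 := minpoly.aeval F x
      rw [Polynomial.aeval_eq_sum_range, Finset.sum_range_succ, ← hm,
        (minpoly.monic hxint).coeff_natDegree, one_smul] at h2
      simp only [Algebra.smul_def] at h2
      simp only [g, map_add, map_pow, Polynomial.aeval_X, map_sum, map_mul, sub_mul,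
        Finset.sum_sub_distrib, map_intCast]
      linear_combination h2
    rw [h1, v.map_neg]
    refine v.map_sum_le fun i _ => ?_
    rw [map_mul, map_pow]
    exact (mul_le_of_le_one_right' (pow_le_one₀ zero_le hx)).trans (hj i)
  have hroot := (IsAlgClosed.splits (g.map (algebraMap ℚ Ω))).eq_prod_roots
  have hcard := (IsAlgClosed.splits (g.map (algebraMap ℚ Ω))).natDegree_eq_card_roots
  rw [Polynomial.natDegree_map, hgdeg] at hcard
  rw [(hgm.map _).leadingCoeff, Polynomial.C_1, one_mul] at hroot
  have hex : ∃ b ∈ (g.map (algebraMap ℚ Ω)).roots, v (x - b) ≤ v (p : Ω) ^ N := by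
    by_contra hno
    push Not at hno
    have h1 : Polynomial.aeval x g =
        (((g.map (algebraMap ℚ Ω)).roots).map fun b => x - b).prod := by
      rw [← Polynomial.eval_map_algebraMap]
      conv_lhs => rw [hroot]
      rw [Polynomial.eval_multiset_prod, Multiset.map_map]
      simp
    have h2 : ∀ s : Multiset Ω, s ≠ 0 → (∀ b ∈ s, v (p : Ω) ^ N < v (x - b)) →
        v (p : Ω) ^ (s.card * N) < v ((s.map fun b => x - b).prod) := by
      intro s
      induction s using Multiset.induction_on with
      | empty => simp
      | cons b s ih =>
        intro _ hb
        rw [Multiset.map_cons, Multiset.prod_cons, Multiset.card_cons, add_mul, one_mul, map_mul,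
          pow_add, mul_comm]
        have hb1 := hb b (by simp)
        by_cases hs : s = 0
        · subst hs
          simpa using hb1
        · exact mul_lt_mul'' hb1 (ih hs fun c hc => hb c (by simp [hc])) zero_le zero_le
    have h3 := h2 _ (by
      rw [← Multiset.card_pos, ← hcard]
      exact hm0) hno
    rw [← h1, ← hcard] at h3
    exact absurd hgx (not_le.2 h3)
  obtain ⟨b, hb, hxb⟩ := hex
  have hbalg : IsAlgebraic ℚ b := by
    refine ⟨g, hgm.ne_zero, ?_⟩
    rw [Polynomial.mem_roots (hgm.map _).ne_zero, Polynomial.IsRoot,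
      Polynomial.eval_map_algebraMap] at hb
    exact hb
  have h1 : v (σ (x - b)) ≤ v (p : Ω) ^ N := by
    have := (map_algEquiv_le_iff v hσv σ (x - b) ((p : F) ^ N)).2 (by simpa using hxb)
    simpa using this
  have h2 : σ x - x = σ (x - b) - (x - b) := by
    rw [map_sub, hσ b hbalg]
    ring
  rw [h2]
  exact v.map_sub_le h1 hxb

theorem mem_adjoin_of_comm (hσv : ∀ (σ : Ω ≃ₐ[F] Ω) (x : Ω), v (σ x) ≤ 1 ↔ v x ≤ 1)
    (hvp : v (p : Ω) < 1) (hvp0 : v (p : Ω) ≠ 0)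
    (hR : ∀ x : F, v (algebraMap F Ω x) ≤ 1 → ∃ j : ℤ, v (algebraMap F Ω x - j) ≤ v (p : Ω))
    [IsAlgClosed Ω] [CharZero Ω] [CharZero F] [Normal F Ω]
    (hp : p.Prime)
    (hcomm : ∀ x : Ω, x ≠ 0 → ∃ c : F, c ≠ 0 ∧ Comm1 v p (x * algebraMap F Ω c)) (x : Ω) :
    x ∈ IntermediateField.adjoin F {z : Ω | IsAlgebraic ℚ z} := by
  by_contra hx
  set M := IntermediateField.adjoin F {z : Ω | IsAlgebraic ℚ z} with hM
  have : Normal M Ω := Normal.tower_top_of_normal F M Ω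
  have hxint : IsIntegral M x := Algebra.IsIntegral.isIntegral x
  set f := (minpoly M x).map (algebraMap M Ω) with hf
  have hfm : f.Monic := (minpoly.monic hxint).map _
  set s := f.roots with hs
  have hcard : s.card = (minpoly M x).natDegree := by
    rw [← (IsAlgClosed.splits f).natDegree_eq_card_roots, Polynomial.natDegree_map]
  have hm0 : s.card ≠ 0 := by
    rw [hcard]
    exact (minpoly.natDegree_pos hxint).ne'
  have hsum : s.sum ∈ M := by
    have h1 := (IsAlgClosed.splits f).nextCoeff_eq_neg_sum_roots_of_monic hfm
    rw [← hs, hf, Polynomial.nextCoeff_map (algebraMap M Ω).injective] at h1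
    rw [← neg_neg s.sum, ← h1]
    exact neg_mem (SetLike.coe_mem _)
  have hconj : ∀ b ∈ s, ∃ σ : Ω ≃ₐ[M] Ω, σ x = b := by
    intro b hb
    rw [hs, Polynomial.mem_roots hfm.ne_zero, Polynomial.IsRoot, hf,
      Polynomial.eval_map_algebraMap] at hb
    exact minpoly.exists_algEquiv_of_root' (Algebra.IsAlgebraic.isAlgebraic x) hb
  have hmΩ : (s.card : Ω) ≠ 0 := Nat.cast_ne_zero.2 hm0
  set y := s.card * x - s.sum with hy
  have hy0 : y ≠ 0 := by
    intro h0
    apply hx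
    have : x = s.sum * (s.card : Ω)⁻¹ := by
      rw [eq_mul_inv_iff_mul_eq₀ hmΩ, mul_comm]
      exact sub_eq_zero.1 h0
    rw [this]
    exact mul_mem hsum (inv_mem (natCast_mem M _))
  obtain ⟨c, hc0, N, hc1, hc2⟩ := hcomm y hy0
  have hcΩ : algebraMap F Ω c ≠ 0 := by simpa using hc0
  have hvp' : ∀ n, 0 < v (p : Ω) ^ n := fun n => pow_pos (zero_lt_iff.2 hvp0) n
  have hy1 : v (y * algebraMap F Ω c * p ^ N) ≤ 1 := by rwa [map_mul, map_pow]
  have hbd : ∀ N' (b : Ω), b ∈ s →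
      v (s.card * (x - b) * algebraMap F Ω c * p ^ N) ≤ v (p : Ω) ^ N' := by
    intro N' b hb
    obtain ⟨σ, rfl⟩ := hconj b hb
    have h1 := map_algEquiv_sub_le v hσv hvp0 hR (σ.restrictScalars F) (fun z hz => by
      have : z ∈ M := IntermediateField.subset_adjoin F _ hz
      exact σ.commutes ⟨z, this⟩) hy1 N'
    have h2 : σ (algebraMap F Ω c) = algebraMap F Ω c := by
      rw [IsScalarTower.algebraMap_apply F M Ω, σ.commutes]
    have h3 : σ s.sum = s.sum := σ.commutes ⟨s.sum, hsum⟩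
    have h4 : s.card * (x - σ x) * algebraMap F Ω c * p ^ N =
        -((σ.restrictScalars F) (y * algebraMap F Ω c * p ^ N) - y * algebraMap F Ω c * p ^ N) := by
      simp only [AlgEquiv.restrictScalars_apply, hy, map_mul, map_sub, h2, h3, map_natCast, map_pow]
      ring
    rw [h4, v.map_neg]
    exact h1
  have hsumeq : y = (s.map fun b => x - b).sum := by
    rw [Multiset.sum_map_sub, Multiset.map_const', Multiset.sum_replicate, nsmul_eq_mul,
      Multiset.map_id']
  have hbd2 : ∀ N', v (s.card * y * algebraMap F Ω c * p ^ N) ≤ v (p : Ω) ^ N' := by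
    intro N'
    have h1 : ∀ t : Multiset Ω, (∀ b ∈ t, b ∈ s) →
        v (s.card * (t.map fun b => x - b).sum * algebraMap F Ω c * p ^ N) ≤ v (p : Ω) ^ N' := by
      intro t
      induction t using Multiset.induction_on with
      | empty => simp
      | cons b t ih =>
        intro hb
        rw [Multiset.map_cons, Multiset.sum_cons, mul_add, add_mul, add_mul]
        exact v.map_add_le (hbd N' b (hb b (by simp))) (ih fun c hc => hb c (by simp [hc]))
    rw [hsumeq]
    exact h1 s fun b hb => hb
  have h5 := hbd2 (s.card.factorization p + 1 + (N + N))
  have h6 : v (s.card * y * algebraMap F Ω c * p ^ N) =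
      v ((s.card : ℤ) : Ω) * (v (y * algebraMap F Ω c)) * v (p : Ω) ^ N := by
    simp only [map_mul, map_pow, Int.cast_natCast, mul_assoc]
  rw [h6] at h5
  have h7 : v ((s.card : ℤ) : Ω) ≤ v (p : Ω) ^ (s.card.factorization p + 1) := by
    have h8 : v ((s.card : ℤ) : Ω) * (v (p : Ω) ^ (N + N)) ≤
        v (p : Ω) ^ (s.card.factorization p + 1) * v (p : Ω) ^ (N + N) := by
      rw [← pow_add]
      refine le_trans ?_ h5
      rw [pow_add, ← mul_assoc]
      exact mul_le_mul_left (mul_le_mul_right hc1 _) _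
    exact (mul_le_mul_iff_left₀ (hvp' _)).1 h8
  have h9 := pow_dvd_of_map_le v hp hvp hvp0 _ h7
  have h10 : p ^ (s.card.factorization p + 1) ∣ s.card := by exact_mod_cast h9
  exact Nat.pow_succ_factorization_not_dvd hm0 hp h10

end

/-- Every `p`-adic field has an algebraic extension `F` which is `p`-adic and whose algebraic
closure is generated by algebraic numbers. -/
theorem exists_padic_closure (hp : p.Prime) (L Ω : Type) [Field L] [Field Ω] [CharZero L]
    [CharZero Ω] [Algebra L Ω] [IsAlgClosed Ω] [Algebra.IsAlgebraic L Ω] (hL : IsPAdicField p L) :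
    ∃ F : IntermediateField L Ω, IsPAdicField p F ∧
      ∀ z : Ω, z ∈ Submodule.span F {z : Ω | IsAlgebraic ℚ z} := by
  obtain ⟨O, hO⟩ := (isPAdicField_iff hp).1 hL
  obtain ⟨V, hV⟩ := LocalSubring.exists_le_valuationSubring
    (LocalSubring.map (algebraMap L Ω) O.toLocalSubring)
  set v := V.valuation with hv
  have hOV : ∀ x ∈ O, v (algebraMap L Ω x) ≤ 1 := by
    intro x hx
    rw [hv, ValuationSubring.valuation_le_one_iff]
    exact hV.1 ⟨x, hx, rfl⟩
  have hunit : ∀ x ∈ O, v (algebraMap L Ω x) = 1 → x⁻¹ ∈ O := by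
    intro x hx h1
    have hx0 : x ≠ 0 := by
      rintro rfl
      rw [map_zero, map_zero] at h1
      exact zero_ne_one h1
    have hmem : algebraMap L Ω x ∈ (LocalSubring.map (algebraMap L Ω) O.toLocalSubring).toSubring :=
      ⟨x, hx, rfl⟩
    have hu : IsUnit (Subring.inclusion hV.1 ⟨_, hmem⟩) := by
      have hinv : (algebraMap L Ω x)⁻¹ ∈ V := by
        rw [← ValuationSubring.valuation_le_one_iff, map_inv₀, ← hv, h1, inv_one]
      refine IsUnit.of_mul_eq_one ⟨_, hinv⟩ (Subtype.ext ?_)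
      exact mul_inv_cancel₀ (by simpa using hx0)
    obtain ⟨⟨b, hb⟩, hab, -⟩ := (@isUnit_iff_exists _ _ _).1 (hV.2.map_nonunit _ hu)
    obtain ⟨y, hy, rfl⟩ := hb
    have h2 := congrArg Subtype.val hab
    have h3 : algebraMap L Ω (x * y) = algebraMap L Ω 1 := by
      rw [map_mul, map_one]
      exact h2
    rw [inv_eq_of_mul_eq_one_right ((algebraMap L Ω).injective h3)]
    exact hy
  have hp0 : (p : L) ≠ 0 := Nat.cast_ne_zero.2 hp.ne_zero
  have hpO : (p : L) ∈ O := natCast_mem O p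
  have hvp : v (p : Ω) < 1 := by
    have h1 := hOV _ hpO
    rw [map_natCast] at h1
    refine lt_of_le_of_ne h1 fun h2 => hO.1 (hunit _ hpO ?_)
    rwa [map_natCast]
  have hvp0 : v (p : Ω) ≠ 0 := by
    rw [v.ne_zero_iff]
    exact Nat.cast_ne_zero.2 hp.ne_zero
  have hRL : ∀ x : L, v (algebraMap L Ω x) ≤ 1 → Approx v p (algebraMap L Ω x) := by
    intro x hx
    have hxO : x ∈ O := by
      rcases O.mem_or_inv_mem x with h | h
      · exact h
      · by_cases hx0 : x = 0
        · rw [hx0]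
          exact zero_mem O
        have h1 : v (algebraMap L Ω x⁻¹) = 1 := by
          refine le_antisymm (hOV _ h) ?_
          rw [map_inv₀, map_inv₀]
          exact (one_le_inv₀ (zero_lt_iff.2 (by simpa using hx0))).2 hx
        simpa using hunit _ h h1
    obtain ⟨j, hj⟩ := hO.2 x hxO
    refine ⟨j, ?_⟩
    have h1 := hOV _ hj
    rw [map_div₀, map_div₀, map_natCast, map_sub, map_intCast,
      div_le_one₀ (zero_lt_iff.2 hvp0)] at h1
    exact h1
  obtain ⟨T, hLT, hT⟩ := zorn_le_nonempty₀
    {T : Subfield Ω | (algebraMap L Ω).fieldRange ≤ T ∧ ∀ x ∈ T, v x ≤ 1 → Approx v p x} (by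
      intro c hc hchain y hy
      refine ⟨sSup c, ⟨(hc hy).1.trans (le_sSup hy), fun x hx hvx => ?_⟩, fun z hz => le_sSup hz⟩
      obtain ⟨s, hs, hxs⟩ := (Subfield.mem_sSup_of_directedOn ⟨y, hy⟩ hchain.directedOn).1 hx
      exact (hc hs).2 x hxs hvx) (algebraMap L Ω).fieldRange ⟨le_rfl, by
        rintro _ ⟨x, rfl⟩ hx
        exact hRL x hx⟩
  let F : IntermediateField L Ω := T.toIntermediateField fun x => hLT ⟨x, rfl⟩
  have hFT : ∀ x, x ∈ F ↔ x ∈ T := fun x => Iff.rfl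
  have hR : ∀ x : F, v (algebraMap F Ω x) ≤ 1 → ∃ j : ℤ, v (algebraMap F Ω x - j) ≤ v (p : Ω) :=
    fun x hx => hT.prop.2 x x.2 hx
  have hmax : ∀ x : Ω, (∀ y ∈ IntermediateField.adjoin F {x}, v y ≤ 1 → Approx v p y) →
      x ∈ Set.range (algebraMap F Ω) := by
    intro x hx
    have h1 : T ≤ (IntermediateField.adjoin F {x}).toSubfield := by
      intro y hy
      exact (IntermediateField.adjoin F {x}).algebraMap_mem ⟨y, hy⟩
    have h2 := hT.2 ⟨hT.prop.1.trans h1, hx⟩ h1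
    exact ⟨⟨x, h2 (IntermediateField.mem_adjoin_simple_self F x)⟩, rfl⟩
  have : Algebra.IsAlgebraic F Ω := Algebra.IsAlgebraic.tower_top (K := L) F
  have : IsAlgClosure F Ω := ⟨inferInstance, inferInstance⟩
  have : Normal F Ω := IsAlgClosure.normal F Ω
  have hσv := map_algEquiv_le_one_iff v hp hvp hvp0 hR hmax
  have htop := commSubgroup_eq_top v hvp hvp0 hR hmax
  refine ⟨F, (isPAdicField_iff hp).2 ⟨V.comap (algebraMap F Ω), fun h => ?_, fun x hx => ?_⟩,
    fun z => ?_⟩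
  · rw [ValuationSubring.mem_comap, ← ValuationSubring.valuation_le_one_iff, map_inv₀, map_inv₀,
      map_natCast, inv_le_one₀ (zero_lt_iff.2 hvp0)] at h
    exact absurd h (not_le.2 hvp)
  · rw [ValuationSubring.mem_comap, ← ValuationSubring.valuation_le_one_iff] at hx
    obtain ⟨j, hj⟩ := hR x hx
    refine ⟨j, ?_⟩
    rw [ValuationSubring.mem_comap, ← ValuationSubring.valuation_le_one_iff, map_div₀, map_div₀,
      map_sub, map_natCast, map_intCast]
    exact div_le_one_of_le₀ hj zero_le
  · have hz := mem_adjoin_of_comm v hσv hvp hvp0 hR hp (fun x hx => by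
      have h1 : Units.mk0 x hx ∈ commSubgroup F v hvp0 := by
        rw [htop]
        trivial
      exact h1) z
    rw [← IntermediateField.mem_toSubalgebra, IntermediateField.adjoin_toSubalgebra_of_isAlgebraic
      (fun x _ => Algebra.IsAlgebraic.isAlgebraic x), ← Subalgebra.mem_toSubmodule,
      Algebra.adjoin_eq_span] at hz
    have hclosed : ((Submonoid.closure {z : Ω | IsAlgebraic ℚ z} : Submonoid Ω) : Set Ω) =
        {z : Ω | IsAlgebraic ℚ z} := by
      refine Set.Subset.antisymm ?_ Submonoid.subset_closure
      exact fun x hx => mem_algebraicClosure_iff.1 ((Submonoid.closure_le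
        (S := (algebraicClosure ℚ Ω).toSubalgebra.toSubmonoid)).2
          (fun z hz => mem_algebraicClosure_iff.2 hz) hx)
    rwa [hclosed] at hz

end PadicVal

open MvPolynomial in
/-- The derivation `X ↦ v X` of the polynomial ring in the entries of a generic matrix. -/
noncomputable def linD {K ι : Type} [Field K] [Fintype ι] (v : Matrix ι ι K) :
    Derivation K (MvPolynomial (ι × ι) K) (MvPolynomial (ι × ι) K) :=
  mkDerivation K fun q => ∑ l, C (v q.1 l) * X (l, q.2)

open MvPolynomial in
/-- The operator induced on the polynomial ring by `X ↦ A X` and by `d` on the coefficients. -/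
noncomputable def polyD {K ι : Type} [Field K] [Fintype ι] (d : Derivation ℤ K K)
    (A : Matrix ι ι K) (P : MvPolynomial (ι × ι) K) : MvPolynomial (ι × ι) K :=
  (∑ m ∈ P.support, monomial m (d (coeff m P))) + linD A P

/-- The matrices `v` such that the derivation `X ↦ v X` kills all constants of `K(X)`. -/
def InG {K ι : Type} [Field K] [Fintype ι] (d : Derivation ℤ K K) (A v : Matrix ι ι K) : Prop :=
  ∀ P Q : MvPolynomial (ι × ι) K, Q ≠ 0 → polyD d A P * Q = P * polyD d A Q →
    linD v P * Q = P * linD v Q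

section
open MvPolynomial

theorem derivation_aeval_sum {K Λ ι α : Type} [Field K] [Field Λ] [Algebra K Λ] [Fintype ι]
    [Fintype α] (E : Derivation ℤ Λ Λ) (hE : ∀ a, E (algebraMap K Λ a) = 0) (X : Matrix ι ι Λ)
    (e : α → Λ) (v : α → Matrix ι ι K)
    (hX : X.map E = ∑ a, e a • ((v a).map (algebraMap K Λ) * X)) (P : MvPolynomial (ι × ι) K) :
    E (aeval (fun q : ι × ι => X q.1 q.2) P) =
      ∑ a, e a * aeval (fun q : ι × ι => X q.1 q.2) (linD (v a) P) := by
  induction P using MvPolynomial.induction_on with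
  | C a => simp [hE]
  | add p q hp hq => simp [hp, hq, mul_add, Finset.sum_add_distrib]
  | mul_X p i hp =>
    have h1 : E (X i.1 i.2) = ∑ a, e a * ∑ l, algebraMap K Λ (v a i.1 l) * X l i.2 := by
      have := congrFun (congrFun hX i.1) i.2
      rw [Matrix.map_apply] at this
      rw [this, Matrix.sum_apply]
      rfl
    rw [map_mul, E.leibniz, hp]
    simp only [aeval_X, h1, Derivation.leibniz, smul_eq_mul, map_add, map_mul, linD,
      mkDerivation_X, map_sum, MvPolynomial.aeval_C, Finset.mul_sum, mul_add,
      Finset.sum_add_distrib]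
    congr 1
    · refine Finset.sum_congr rfl fun a _ => Finset.sum_congr rfl fun l _ => ?_
      ring
    · refine Finset.sum_congr rfl fun a _ => ?_
      ring

theorem derivation_aeval_linD {K Λ ι : Type} [Field K] [Field Λ] [Algebra K Λ] [Fintype ι]
    (E : Derivation ℤ Λ Λ) (hE : ∀ a, E (algebraMap K Λ a) = 0) (X : Matrix ι ι Λ)
    (v : Matrix ι ι K) (hX : X.map E = v.map (algebraMap K Λ) * X)
    (P : MvPolynomial (ι × ι) K) :
    E (aeval (fun q : ι × ι => X q.1 q.2) P) =
      aeval (fun q : ι × ι => X q.1 q.2) (linD v P) := by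
  have := derivation_aeval_sum (α := Unit) E hE X (fun _ => 1) (fun _ => v) (by simpa using hX) P
  simpa using this

theorem derivation_aeval_polyD {K Λ ι : Type} [Field K] [Field Λ] [Algebra K Λ] [Fintype ι]
    {d : Derivation ℤ K K} {dΛ : Derivation ℤ Λ Λ} (hd : Extends d dΛ) (X : Matrix ι ι Λ)
    (A : Matrix ι ι K) (hX : X.map dΛ = A.map (algebraMap K Λ) * X)
    (P : MvPolynomial (ι × ι) K) :
    dΛ (aeval (fun q : ι × ι => X q.1 q.2) P) =
      aeval (fun q : ι × ι => X q.1 q.2) (polyD d A P) := by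
  have hmon : ∀ (m : ι × ι →₀ ℕ),
      dΛ (aeval (fun q : ι × ι => X q.1 q.2) (monomial m (1 : K))) =
        aeval (fun q : ι × ι => X q.1 q.2) (linD A (monomial m (1 : K))) := by
    intro m
    induction m using Finsupp.induction_linear with
    | zero =>
      have h1 : (monomial (0 : ι × ι →₀ ℕ) (1 : K)) = 1 := rfl
      rw [h1, map_one, Derivation.map_one_eq_zero, Derivation.map_one_eq_zero, map_zero]
    | add f g hf hg =>
      rw [show monomial (f + g) (1 : K) = monomial f 1 * monomial g 1 by
        rw [monomial_mul, one_mul]]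
      rw [map_mul, dΛ.leibniz, hf, hg, Derivation.leibniz]
      simp only [smul_eq_mul, map_add, map_mul]
    | single i k =>
      rw [show monomial (Finsupp.single i k) (1 : K) = (MvPolynomial.X i) ^ k by
        rw [X_pow_eq_monomial]]
      rw [map_pow, dΛ.leibniz_pow, Derivation.leibniz_pow]
      have h1 : dΛ (X i.1 i.2) = aeval (fun q : ι × ι => X q.1 q.2)
          (linD A (MvPolynomial.X i)) := by
        have := congrFun (congrFun hX i.1) i.2
        rw [Matrix.map_apply] at this
        rw [this]
        simp [linD, mkDerivation_X, Matrix.mul_apply]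
      simp only [aeval_X, h1, map_nsmul, smul_eq_mul, map_mul, map_pow]
  have hP : P = ∑ m ∈ P.support, C (coeff m P) * monomial m 1 := by
    conv_lhs => rw [P.as_sum]
    refine Finset.sum_congr rfl fun m _ => ?_
    rw [C_mul_monomial, mul_one]
  have h2 : linD A P = ∑ m ∈ P.support, C (coeff m P) * linD A (monomial m 1) := by
    conv_lhs => rw [hP]
    rw [map_sum]
    refine Finset.sum_congr rfl fun m _ => ?_
    rw [← smul_eq_C_mul, Derivation.map_smul, smul_eq_C_mul]
  rw [polyD, h2, map_add]
  conv_lhs => rw [hP]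
  simp only [map_sum]
  rw [← Finset.sum_add_distrib]
  refine Finset.sum_congr rfl fun m _ => ?_
  rw [map_mul, dΛ.leibniz, hmon, MvPolynomial.aeval_C, hd, map_mul, MvPolynomial.aeval_C, add_comm,
    show monomial m (d (coeff m P)) = C (d (coeff m P)) * monomial m 1 by
      rw [C_mul_monomial, mul_one], map_mul, MvPolynomial.aeval_C]
  simp only [smul_eq_mul]
  ring

theorem eq_zero_of_sum_mul_aeval_eq_zero {K L Λ τ α : Type} [Field K] [Field L] [Field Λ]
    [Algebra K L] [Algebra K Λ] [Algebra L Λ] [IsScalarTower K L Λ] [Fintype α] {x : τ → Λ}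
    (hx : AlgebraicIndependent L x) {e : α → L} (he : LinearIndependent K e)
    (p : α → MvPolynomial τ K) (h : ∑ a, algebraMap L Λ (e a) * aeval x (p a) = 0) (a : α) :
    p a = 0 := by
  have h1 : ∑ a, C (e a) * map (algebraMap K L) (p a) = 0 := by
    apply hx
    simp only [map_sum, map_mul, MvPolynomial.aeval_C, map_zero, aeval_map_algebraMap]
    exact h
  ext m
  rw [Fintype.linearIndependent_iff] at he
  refine he (fun a => coeff m (p a)) ?_ a
  have := congrArg (coeff m) h1
  simp only [coeff_sum, coeff_C_mul, coeff_map, coeff_zero] at this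
  rw [← this]
  refine Finset.sum_congr rfl fun a _ => ?_
  rw [Algebra.smul_def, mul_comm]

theorem inG_of_exists_sum {K L Λ ι α : Type} [Field K] [Field L] [Field Λ]
    [Algebra K L] [Algebra K Λ] [Algebra L Λ] [IsScalarTower K L Λ] [Fintype α] [Fintype ι]
    {d : Derivation ℤ K K} {dΛ : Derivation ℤ Λ Λ} (hd : Extends d dΛ) (X : Matrix ι ι Λ)
    {A : Matrix ι ι K} (hX : X.map dΛ = A.map (algebraMap K Λ) * X)
    (hXL : AlgebraicIndependent L fun q : ι × ι => X q.1 q.2)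
    (E : Derivation ℤ Λ Λ) (hE : ∀ a, E (algebraMap K Λ a) = 0) (hEc : ∀ c, dΛ c = 0 → E c = 0)
    {e : α → L} (he : LinearIndependent K e) (v : α → Matrix ι ι K)
    (hEX : X.map E = ∑ a, algebraMap L Λ (e a) • ((v a).map (algebraMap K Λ) * X)) (a : α) :
    InG d A (v a) := by
  intro P Q hQ hPQ
  have hXK : AlgebraicIndependent K fun q : ι × ι => X q.1 q.2 := hXL.restrictScalars
    (algebraMap K L).injective
  set x := fun q : ι × ι => X q.1 q.2 with hxdef
  have hQ0 : aeval x Q ≠ 0 := fun h => hQ (hXK (by rw [h, map_zero]))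
  have h1 : dΛ (aeval x P / aeval x Q) = 0 := by
    rw [Derivation.leibniz_div, derivation_aeval_polyD hd X A hX, derivation_aeval_polyD hd X A hX]
    simp only [smul_eq_mul, ← hxdef]
    have := congrArg (aeval x) hPQ
    rw [map_mul, map_mul] at this
    rw [mul_comm (aeval x Q), this, sub_self, mul_zero]
  have h2 := hEc _ h1
  rw [Derivation.leibniz_div, derivation_aeval_sum E hE X _ v hEX,
    derivation_aeval_sum E hE X _ v hEX] at h2
  simp only [smul_eq_mul, ← hxdef] at h2
  have h3 := (mul_eq_zero.1 h2).resolve_left (by simpa using hQ0)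
  have h4 := eq_zero_of_sum_mul_aeval_eq_zero hXL he (fun a => linD (v a) P * Q - P * linD (v a) Q)
    (by
      rw [← h3, Finset.mul_sum, Finset.mul_sum, ← Finset.sum_sub_distrib]
      refine Finset.sum_congr rfl fun a _ => ?_
      rw [map_sub, map_mul, map_mul]
      ring) a
  exact sub_eq_zero.1 h4

theorem inG_of_exists {K Λ ι : Type} [Field K] [Field Λ]
    [Algebra K Λ] [Fintype ι]
    {d : Derivation ℤ K K} {dΛ : Derivation ℤ Λ Λ} (hd : Extends d dΛ) (X : Matrix ι ι Λ)
    {A : Matrix ι ι K} (hX : X.map dΛ = A.map (algebraMap K Λ) * X)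
    (hXL : AlgebraicIndependent K fun q : ι × ι => X q.1 q.2)
    (E : Derivation ℤ Λ Λ) (hE : ∀ a, E (algebraMap K Λ a) = 0) (hEc : ∀ c, dΛ c = 0 → E c = 0)
    (v : Matrix ι ι K) (hEX : X.map E = v.map (algebraMap K Λ) * X) :
    InG d A v :=
  inG_of_exists_sum (α := Unit) hd X hX hXL E hE hEc (e := fun _ => (1 : K))
    (linearIndependent_unique_iff.2 one_ne_zero) (fun _ => v) (by simpa using hEX) ()

/-- For `v` in the Lie algebra there is a derivation `X ↦ v X` of any generic solution field,
killing the ground field and the constants. -/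
theorem InG.exists_derivation {K Λ ι : Type} [Field K] [CharZero K] [Field Λ]
    [Algebra K Λ] [Fintype ι]
    {d : Derivation ℤ K K} {dΛ : Derivation ℤ Λ Λ} (hd : Extends d dΛ) (X : Matrix ι ι Λ)
    {A v : Matrix ι ι K} (hv : InG d A v) (hX : X.map dΛ = A.map (algebraMap K Λ) * X)
    (hXL : AlgebraicIndependent K fun q : ι × ι => X q.1 q.2) :
    ∃ E : Derivation ℤ Λ Λ, (∀ a, E (algebraMap K Λ a) = 0) ∧ (∀ c, dΛ c = 0 → E c = 0) ∧
      X.map E = v.map (algebraMap K Λ) * X := by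
  set x := fun q : ι × ι => X q.1 q.2 with hxdef
  obtain ⟨E0, hE0, hE0X⟩ := exists_derivation_algebraicIndependent (0 : Derivation ℤ K Λ) hXL
    (fun q => (v.map (algebraMap K Λ) * X) q.1 q.2)
  have hE0K : ∀ a, E0 (algebraMap K Λ a) = 0 := fun a => by rw [hE0]; rfl
  have hE0X' : X.map E0 = v.map (algebraMap K Λ) * X := by
    ext i j
    exact hE0X (i, j)
  let F : Subfield Λ := (IntermediateField.adjoin K (Set.range x)).toSubfield
  have hmem : ∀ y, y ∈ F ↔ ∃ P Q : MvPolynomial (ι × ι) K, y = aeval x P / aeval x Q :=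
    fun y => IntermediateField.mem_adjoin_range_iff K x y
  have hpoly : ∀ P, aeval x P ∈ F := fun P => (hmem _).2 ⟨P, 1, by simp⟩
  have hdF : ∀ y : F, dΛ y ∈ F := by
    rintro ⟨y, hy⟩
    obtain ⟨P, Q, rfl⟩ := (hmem y).1 hy
    change dΛ (aeval x P / aeval x Q) ∈ F
    rw [Derivation.leibniz_div, derivation_aeval_polyD hd X A hX, derivation_aeval_polyD hd X A hX]
    exact F.mul_mem (F.pow_mem (F.inv_mem (hpoly _)) 2)
      (F.sub_mem (F.mul_mem (hpoly _) (hpoly _)) (F.mul_mem (hpoly _) (hpoly _)))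
  obtain ⟨dF, hdFe⟩ : ∃ dF : Derivation ℤ F F, ∀ a : F, (dF a : Λ) = dΛ a :=
    ⟨Derivation.mk' ⟨⟨fun a => ⟨dΛ a, hdF a⟩, fun a b => Subtype.ext (map_add dΛ _ _)⟩,
      fun z a => Subtype.ext (by simp)⟩
      (fun a b => Subtype.ext (by simp)), fun _ => rfl⟩
  have hext : Extends dF dΛ := fun a => (hdFe a).symm
  have : CharZero Λ := charZero_of_injective_algebraMap (algebraMap K Λ).injective
  obtain ⟨E, hE, hEc⟩ := exists_derivation_killing_const hext (E0.compAlgebraMap F) (by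
    rintro ⟨y, hy⟩ hy0
    obtain ⟨P, Q, rfl⟩ := (hmem y).1 hy
    change E0 (aeval x P / aeval x Q) = 0
    have h1 := congrArg (fun z : F => (z : Λ)) hy0
    rw [hdFe] at h1
    change dΛ (aeval x P / aeval x Q) = 0 at h1
    by_cases hQ : Q = 0
    · rw [hQ, map_zero, div_zero, map_zero]
    have hQ0 : aeval x Q ≠ 0 := fun h => hQ (hXL (by rw [h, map_zero]))
    rw [Derivation.leibniz_div, derivation_aeval_polyD hd X A hX,
      derivation_aeval_polyD hd X A hX] at h1
    have h2 := (smul_eq_zero.1 h1).resolve_left (by simpa using hQ0)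
    simp only [smul_eq_mul, ← hxdef, ← map_mul, ← map_sub] at h2
    have h3 := hv P Q hQ (by
      have := hXL (h2.trans (map_zero _).symm)
      rw [sub_eq_zero] at this
      rw [mul_comm, this])
    have h4 := congrArg (aeval x) h3
    rw [map_mul, map_mul] at h4
    rw [Derivation.leibniz_div, derivation_aeval_linD E0 hE0K X v hE0X',
      derivation_aeval_linD E0 hE0K X v hE0X']
    simp only [smul_eq_mul, ← hxdef]
    rw [mul_comm (aeval x Q), h4, sub_self, mul_zero])
  have hEF : ∀ y ∈ F, E y = E0 y := fun y hy => hE ⟨y, hy⟩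
  refine ⟨E, fun a => ?_, hEc, ?_⟩
  · rw [hEF, hE0K]
    have := hpoly (C a)
    rwa [MvPolynomial.aeval_C] at this
  · rw [← hE0X']
    ext i j
    refine hEF _ ?_
    have := hpoly (MvPolynomial.X (i, j))
    rwa [aeval_X] at this

end

section
variable {K ι : Type} [Field K] [CharZero K] [Fintype ι] [DecidableEq ι]

theorem InG.lin {d : Derivation ℤ K K} {A v w : Matrix ι ι K} (hv : InG d A v) (hw : InG d A w)
    (a b : K) : InG d A (a • v + b • w) := by
  obtain ⟨Λ, _, _, dΛ, X, hd, hdet, hX, hXi⟩ := exists_generic_fundamental d A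
  obtain ⟨E, h1, h2, h3⟩ := hv.exists_derivation hd X hX hXi
  obtain ⟨E', h1', h2', h3'⟩ := hw.exists_derivation hd X hX hXi
  refine inG_of_exists hd X hX hXi (algebraMap K Λ a • E + algebraMap K Λ b • E') ?_ ?_ _ ?_
  · intro c
    simp [h1, h1']
  · intro c hc
    simp [h2 c hc, h2' c hc]
  · have : X.map (algebraMap K Λ a • E + algebraMap K Λ b • E') =
        algebraMap K Λ a • X.map E + algebraMap K Λ b • X.map E' := by
      ext i j
      simp
    rw [this, h3, h3', ← Matrix.smul_mul, ← Matrix.smul_mul, ← Matrix.add_mul]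
    congr 1
    ext i j
    simp only [Matrix.add_apply, Matrix.smul_apply, Matrix.map_apply, smul_eq_mul, map_add, map_mul]

theorem InG.zero (d : Derivation ℤ K K) (A : Matrix ι ι K) : InG d A 0 := by
  obtain ⟨Λ, _, _, dΛ, X, hd, hdet, hX, hXi⟩ := exists_generic_fundamental d A
  refine inG_of_exists hd X hX hXi 0 (fun _ => rfl) (fun _ _ => rfl) _ ?_
  ext i j
  simp

/-- The Lie algebra of `y′ = A y`, as a subspace of the space of matrices. -/
def inGSubmodule (d : Derivation ℤ K K) (A : Matrix ι ι K) : Submodule K (Matrix ι ι K) where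
  carrier := {v | InG d A v}
  add_mem' {v w} hv hw := by simpa using InG.lin hv hw 1 1
  zero_mem' := InG.zero d A
  smul_mem' a v hv := by simpa using InG.lin hv hv a 0

theorem InG.lie {d : Derivation ℤ K K} {A v w : Matrix ι ι K} (hv : InG d A v) (hw : InG d A w) :
    InG d A (v * w - w * v) := by
  obtain ⟨Λ, _, _, dΛ, X, hd, hdet, hX, hXi⟩ := exists_generic_fundamental d A
  obtain ⟨E, h1, h2, h3⟩ := hv.exists_derivation hd X hX hXi
  obtain ⟨E', h1', h2', h3'⟩ := hw.exists_derivation hd X hX hXi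
  refine inG_of_exists hd X hX hXi ⁅E', E⁆ ?_ ?_ _ ?_
  · intro c
    simp [Derivation.commutator_apply, h1, h1']
  · intro c hc
    simp [Derivation.commutator_apply, h2 c hc, h2' c hc]
  · have : X.map (⁅E', E⁆ : Derivation ℤ Λ Λ) = (X.map E).map E' - (X.map E').map E := by
      ext i j
      simp [Derivation.commutator_apply]
    have h0 : ∀ (D : Derivation ℤ Λ Λ), (∀ a, D (algebraMap K Λ a) = 0) → ∀ u : Matrix ι ι K,
        (u.map (algebraMap K Λ)).map D = 0 := by
      intro D hD u
      ext i j
      simp [hD]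
    rw [this, h3, h3', Derivation.map_matrix_mul, Derivation.map_matrix_mul, h0 _ h1, h0 _ h1',
      h3, h3', Matrix.zero_mul, zero_add, zero_add, ← Matrix.mul_assoc,
      ← Matrix.mul_assoc, ← Matrix.sub_mul]
    congr 1
    rw [← Matrix.map_mul, ← Matrix.map_mul]
    ext i j
    simp only [Matrix.sub_apply, Matrix.map_apply, map_sub]

theorem InG.nabla {d : Derivation ℤ K K} {A v : Matrix ι ι K} (hv : InG d A v) :
    InG d A (v.map d - (A * v - v * A)) := by
  obtain ⟨Λ, _, _, dΛ, X, hd, hdet, hX, hXi⟩ := exists_generic_fundamental d A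
  obtain ⟨E, h1, h2, h3⟩ := hv.exists_derivation hd X hX hXi
  refine inG_of_exists hd X hX hXi ⁅dΛ, E⁆ ?_ ?_ _ ?_
  · intro c
    simp [Derivation.commutator_apply, h1, hd c]
  · intro c hc
    simp [Derivation.commutator_apply, h2 c hc, hc]
  · have : X.map (⁅dΛ, E⁆ : Derivation ℤ Λ Λ) = (X.map E).map dΛ - (X.map dΛ).map E := by
      ext i j
      simp [Derivation.commutator_apply]
    have h0 : (A.map (algebraMap K Λ)).map E = 0 := by
      ext i j
      simp [h1]
    have h0' : (v.map (algebraMap K Λ)).map dΛ = (v.map d).map (algebraMap K Λ) := by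
      ext i j
      simp [hd _]
    rw [this, h3, hX, Derivation.map_matrix_mul, Derivation.map_matrix_mul, h0, h0', hX, h3,
      Matrix.zero_mul, zero_add, ← Matrix.mul_assoc, ← Matrix.mul_assoc, ← Matrix.add_mul,
      ← Matrix.sub_mul]
    congr 1
    rw [← Matrix.map_mul, ← Matrix.map_mul]
    ext i j
    simp only [Matrix.sub_apply, Matrix.add_apply, Matrix.map_apply, map_sub]
    ring

end

theorem exists_finite_expansion {K L τ : Type} [Field K] [AddCommGroup L] [Module K L] [Finite τ]
    (f : τ → L) : ∃ (r : ℕ) (e : Fin r → L) (c : Fin r → τ → K), LinearIndependent K e ∧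
      ∀ t, f t = ∑ a, c a t • e a := by
  let W := Submodule.span K (Set.range f)
  have : FiniteDimensional K W := FiniteDimensional.span_of_finite K (Set.finite_range f)
  let b := Module.finBasis K W
  refine ⟨_, fun a => (b a : L), fun a t => b.repr ⟨f t, Submodule.subset_span ⟨t, rfl⟩⟩ a,
    b.linearIndependent.map' W.subtype (Submodule.ker_subtype _), fun t => ?_⟩
  have := congrArg W.subtype (b.sum_repr ⟨f t, Submodule.subset_span ⟨t, rfl⟩⟩)
  rw [map_sum] at this
  exact this.symm

theorem exists_matrix_expansion {K L ι : Type} [Field K] [Field L] [Algebra K L] [Finite ι]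
    (M : Matrix ι ι L) : ∃ (r : ℕ) (e : Fin r → L) (v : Fin r → Matrix ι ι K),
      LinearIndependent K e ∧ M = ∑ a, e a • (v a).map (algebraMap K L) := by
  obtain ⟨r, e, c, he, h⟩ := exists_finite_expansion (K := K) fun q : ι × ι => M q.1 q.2
  refine ⟨r, e, fun a => Matrix.of fun i j => c a (i, j), he, ?_⟩
  ext i j
  rw [h (i, j), Matrix.sum_apply]
  refine Finset.sum_congr rfl fun a _ => ?_
  rw [Algebra.smul_def, mul_comm]
  rfl

/-- A derivation of a field containing a fundamental matrix, killing the ground field and the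
constants, comes from the Lie algebra. -/
theorem exists_inG_of_derivation {K L ι : Type} [Field K] [CharZero K] [Field L] [Algebra K L]
    [Fintype ι] [DecidableEq ι] {d : Derivation ℤ K K} {dL : Derivation ℤ L L} (hd : Extends d dL)
    {A : Matrix ι ι K} (F : Matrix ι ι L) (hF : IsUnit F.det)
    (hFA : F.map dL = A.map (algebraMap K L) * F) (D : Derivation ℤ L L)
    (hDK : ∀ a, D (algebraMap K L a) = 0) (hDc : ∀ c, dL c = 0 → D c = 0) :
    ∃ (r : ℕ) (e : Fin r → L) (v : Fin r → Matrix ι ι K), (∀ a, InG d A (v a)) ∧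
      F.map D = (∑ a, e a • (v a).map (algebraMap K L)) * F := by
  have : CharZero L := charZero_of_injective_algebraMap (algebraMap K L).injective
  obtain ⟨r, e, v, he, h⟩ := exists_matrix_expansion (K := K) (F.map D * F⁻¹)
  have hDF : F.map D = (∑ a, e a • (v a).map (algebraMap K L)) * F := by
    rw [← h, Matrix.mul_assoc, Matrix.nonsing_inv_mul _ hF, Matrix.mul_one]
  refine ⟨r, e, v, ?_, hDF⟩
  obtain ⟨Λ, _, _, dΛ, X, hΛ, hdet, hX, hXi⟩ :=
    exists_generic_fundamental dL (A.map (algebraMap K L))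
  let _ : Algebra K Λ := ((algebraMap L Λ).comp (algebraMap K L)).toAlgebra
  have : IsScalarTower K L Λ := IsScalarTower.of_algebraMap_eq fun _ => rfl
  obtain ⟨E, hE, hEc⟩ := exists_derivation_killing_const hΛ (D.baseTo Λ) (by
    intro a ha
    rw [Derivation.baseTo_apply, hDc a ha, map_zero])
  have hAX : X.map dΛ = A.map (algebraMap K Λ) * X := by
    rw [hX, Matrix.map_map]
    rfl
  let F' := F.map (algebraMap L Λ)
  have hF' : IsUnit F'.det := by
    have : F'.det = algebraMap L Λ F.det := (RingHom.map_det _ _).symm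
    rw [this]
    exact hF.map _
  let h' := F'⁻¹ * X
  have hX' : X = F' * h' := by
    rw [← Matrix.mul_assoc, Matrix.mul_nonsing_inv _ hF', Matrix.one_mul]
  have hF'd : F'.map dΛ = A.map (algebraMap K Λ) * F' := by
    have h1 : F'.map dΛ = (F.map dL).map (algebraMap L Λ) := by
      ext i j
      simp [F', hΛ (F i j)]
    rw [h1, hFA, Matrix.map_mul, Matrix.map_map]
    rfl
  have hconst : h'.map dΛ = 0 := by
    have h2 := hAX
    rw [hX', Derivation.map_matrix_mul, hF'd, Matrix.mul_assoc] at h2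
    have h3 := add_eq_left.1 h2
    have := congrArg (F'⁻¹ * ·) h3
    simpa [← Matrix.mul_assoc, Matrix.nonsing_inv_mul _ hF'] using this
  have hE0 : h'.map E = 0 := by
    ext i j
    exact hEc _ (congrFun (congrFun hconst i) j)
  have hEF : F'.map E = (F.map D).map (algebraMap L Λ) := by
    ext i j
    exact hE (F i j)
  refine fun a => inG_of_exists_sum (L := L) (fun a => ?_) X hAX hXi E (fun a => ?_) hEc he v ?_ a
  · change dΛ (algebraMap L Λ (algebraMap K L a)) = algebraMap L Λ (algebraMap K L (d a))
    rw [hΛ, hd]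
  · change E (algebraMap L Λ (algebraMap K L a)) = 0
    rw [hE, Derivation.baseTo_apply, hDK, map_zero]
  · conv_lhs => rw [hX']
    rw [Derivation.map_matrix_mul, hE0, Matrix.mul_zero, add_zero, hEF, hDF, Matrix.map_mul,
      Matrix.mul_assoc, ← hX']
    have : (∑ a, e a • (v a).map (algebraMap K L)).map (algebraMap L Λ) =
        ∑ a, algebraMap L Λ (e a) • (v a).map (algebraMap K Λ) := by
      ext i j
      simp only [Matrix.map_apply, Matrix.sum_apply, Matrix.smul_apply, smul_eq_mul, map_sum,
        map_mul]
      rfl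
    rw [this, Finset.sum_mul]
    refine Finset.sum_congr rfl fun a _ => ?_
    rw [Matrix.smul_mul]

/-- Extension of scalars of a subspace of a coordinate space. -/
def Submodule.extendScalarsPi {F ι : Type} (Λ : Type) [Field F] [Field Λ] [Algebra F Λ]
    (N : Submodule F (ι → F)) : Submodule Λ (ι → Λ) :=
  Submodule.span Λ ((fun w i => algebraMap F Λ (w i)) '' (N : Set (ι → F)))

section
variable {F Λ ι : Type} [Field F] [Field Λ] [Algebra F Λ]

theorem Submodule.mem_extendScalarsPi {N : Submodule F (ι → F)} {w : ι → F} (hw : w ∈ N) :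
    (fun i => algebraMap F Λ (w i)) ∈ N.extendScalarsPi Λ :=
  Submodule.subset_span ⟨w, hw, rfl⟩

theorem Submodule.of_mem_extendScalarsPi [Fintype ι] {N : Submodule F (ι → F)} {w : ι → F}
    (hw : (fun i => algebraMap F Λ (w i)) ∈ N.extendScalarsPi Λ) : w ∈ N := by
  classical
  by_contra h
  obtain ⟨f, hf, hN⟩ := Submodule.exists_le_ker_of_notMem h
  have hfe : ∀ x, f x = ∑ i, x i * f (Pi.single i 1) := fun x => by
    conv_lhs => rw [← Finset.univ_sum_single x]
    rw [map_sum]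
    refine Finset.sum_congr rfl fun i _ => ?_
    have : (Pi.single i (x i) : ι → F) = x i • Pi.single i 1 := by
      rw [← Pi.single_smul', smul_eq_mul, mul_one]
    rw [this, map_smul, smul_eq_mul]
  have h1 : ∀ y ∈ N.extendScalarsPi Λ, ∑ i, y i * algebraMap F Λ (f (Pi.single i 1)) = 0 := by
    intro y hy
    induction hy using Submodule.span_induction with
    | mem y hy =>
      obtain ⟨x, hx, rfl⟩ := hy
      have : f x = 0 := hN hx
      rw [hfe] at this
      have := congrArg (algebraMap F Λ) this
      simpa using this
    | zero => simp
    | add a b _ _ ha hb => simp [add_mul, Finset.sum_add_distrib, ha, hb]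
    | smul c a _ ha => simp [mul_assoc, ← Finset.mul_sum, ha]
  have h2 := h1 _ hw
  refine hf ((algebraMap F Λ).injective ?_)
  rw [hfe, map_zero, ← h2, map_sum]
  simp

theorem Submodule.nabla_mem_extendScalarsPi [Fintype ι] {d : Derivation ℤ F F}
    {dΛ : Derivation ℤ Λ Λ} (hd : Extends d dΛ) {A : Matrix ι ι F} {N : Submodule F (ι → F)}
    (hN : ∀ w ∈ N, d ∘ w - A.mulVec w ∈ N) {w : ι → Λ} (hw : w ∈ N.extendScalarsPi Λ) :
    dΛ ∘ w - (A.map (algebraMap F Λ)).mulVec w ∈ N.extendScalarsPi Λ := by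
  induction hw using Submodule.span_induction with
  | mem y hy =>
    obtain ⟨x, hx, rfl⟩ := hy
    convert Submodule.mem_extendScalarsPi (Λ := Λ) (hN x hx) using 1
    ext i
    simp [Matrix.mulVec, dotProduct, hd (x i)]
  | zero =>
    convert Submodule.zero_mem _ using 1
    ext i
    simp
  | add a b _ _ ha hb =>
    convert Submodule.add_mem _ ha hb using 1
    rw [Matrix.mulVec_add]
    ext i
    simp
    ring
  | smul c a ha' ha =>
    convert Submodule.add_mem _ (Submodule.smul_mem _ c ha) (Submodule.smul_mem _ (dΛ c) ha') using 1
    rw [Matrix.mulVec_smul]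
    ext i
    simp
    ring

theorem Submodule.comp_mem_extendScalarsPi {E : Derivation ℤ Λ Λ}
    (hE : ∀ a, E (algebraMap F Λ a) = 0) {N : Submodule F (ι → F)}
    {w : ι → Λ} (hw : w ∈ N.extendScalarsPi Λ) : E ∘ w ∈ N.extendScalarsPi Λ := by
  induction hw using Submodule.span_induction with
  | mem y hy =>
    obtain ⟨x, hx, rfl⟩ := hy
    convert Submodule.zero_mem _ using 1
    ext i
    simp [hE]
  | zero =>
    convert Submodule.zero_mem _ using 1
    ext i
    simp
  | add a b _ _ ha hb =>
    convert Submodule.add_mem _ ha hb using 1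
    ext i
    simp
  | smul c a ha' ha =>
    convert Submodule.add_mem _ (Submodule.smul_mem _ c ha) (Submodule.smul_mem _ (E c) ha') using 1
    ext i
    simp
    ring

end

/-- A derivation killing the constants acts on solutions as it acts on a fundamental matrix. -/
theorem derivation_comp_solution {Λ ι : Type} [Field Λ] [Fintype ι] [DecidableEq ι]
    {d E : Derivation ℤ Λ Λ} (hE : ∀ c, d c = 0 → E c = 0) {A V X : Matrix ι ι Λ}
    (hX : IsUnit X.det) (hd : X.map d = A * X) (hV : X.map E = V * X) {t : ι → Λ}
    (ht : d ∘ t = A.mulVec t) : E ∘ t = V.mulVec t := by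
  have h1 : t = X.mulVec (X⁻¹.mulVec t) := by
    rw [Matrix.mulVec_mulVec, Matrix.mul_nonsing_inv _ hX, Matrix.one_mulVec]
  have h2 : d ∘ (X⁻¹.mulVec t) = 0 := by
    have h3 := ht
    rw [h1, d.comp_mulVec, hd, ← Matrix.mulVec_mulVec, add_eq_left] at h3
    have := congrArg X⁻¹.mulVec h3
    rwa [Matrix.mulVec_mulVec, Matrix.nonsing_inv_mul _ hX, Matrix.one_mulVec,
      Matrix.mulVec_zero] at this
  have h4 : E ∘ (X⁻¹.mulVec t) = 0 := by
    ext i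
    exact hE _ (congrFun h2 i)
  conv_lhs => rw [h1]
  rw [E.comp_mulVec, h4, Matrix.mulVec_zero, add_zero, hV, ← Matrix.mulVec_mulVec, ← h1]

/-- Stable subspaces are stable under the Lie algebra. -/
theorem InG.mulVec_mem {K Ω ι : Type} [Field K] [CharZero K] [Field Ω] [Algebra K Ω]
    [Algebra.IsAlgebraic K Ω] [Fintype ι] [DecidableEq ι] {d : Derivation ℤ K K}
    {dΩ : Derivation ℤ Ω Ω} (hd : Extends d dΩ) {A v : Matrix ι ι K} (hv : InG d A v)
    {N : Submodule Ω (ι → Ω)} (hN : ∀ w ∈ N, dΩ ∘ w - (A.map (algebraMap K Ω)).mulVec w ∈ N)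
    {w : ι → Ω} (hw : w ∈ N) : (v.map (algebraMap K Ω)).mulVec w ∈ N := by
  have : CharZero Ω := charZero_of_injective_algebraMap (algebraMap K Ω).injective
  obtain ⟨Λ, _, _, dΛ, X, hΛ, hdet, hX, hXi⟩ :=
    exists_generic_fundamental dΩ (A.map (algebraMap K Ω))
  let _ : Algebra K Λ := ((algebraMap Ω Λ).comp (algebraMap K Ω)).toAlgebra
  have : IsScalarTower K Ω Λ := IsScalarTower.of_algebraMap_eq fun _ => rfl
  have hmap : ∀ M : Matrix ι ι K, M.map (algebraMap K Λ) =
      (M.map (algebraMap K Ω)).map (algebraMap Ω Λ) := fun M => rfl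
  obtain ⟨E, hEK, hEc, hEX⟩ := hv.exists_derivation (dΛ := dΛ) (fun a => by
    change dΛ (algebraMap Ω Λ (algebraMap K Ω a)) = algebraMap Ω Λ (algebraMap K Ω (d a))
    rw [hΛ, hd]) X (by rw [hX]; rfl) (hXi.restrictScalars (algebraMap K Ω).injective)
  have hEΩ : ∀ a, E (algebraMap Ω Λ a) = 0 := fun a =>
    (E.compAlgebraMap Ω).eq_zero_of_isAlgebraic (A := K) hEK (Algebra.IsAlgebraic.isAlgebraic a)
  have key : ∀ u ∈ N.extendScalarsPi Λ, (v.map (algebraMap K Λ)).mulVec u ∈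
      N.extendScalarsPi Λ := by
    intro u hu
    have h1 := dΛ.le_span_solutions hdet hX (N.extendScalarsPi Λ)
      (fun w hw => Submodule.nabla_mem_extendScalarsPi hΛ hN hw) hu
    have h2 : Submodule.span Λ {u | u ∈ N.extendScalarsPi Λ ∧ dΛ ∘ u =
        ((A.map (algebraMap K Ω)).map (algebraMap Ω Λ)).mulVec u} ≤
        (N.extendScalarsPi Λ).comap (v.map (algebraMap K Λ)).mulVecLin := by
      refine Submodule.span_le.2 fun y hy => ?_
      rw [SetLike.mem_coe, Submodule.mem_comap, Matrix.mulVecLin_apply,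
        ← derivation_comp_solution hEc hdet hX hEX hy.2]
      exact Submodule.comp_mem_extendScalarsPi hEΩ hy.1
    exact h2 h1
  refine Submodule.of_mem_extendScalarsPi (Λ := Λ) ?_
  convert key _ (Submodule.mem_extendScalarsPi hw) using 1
  rw [hmap]
  ext i
  simp [Matrix.mulVec, dotProduct]

/-- The joint eigenspace. -/
def jointEigen {Ω V β : Type} [Field Ω] [AddCommGroup V] [Module Ω V]
    (D : β → Module.End Ω V) (χ : β → Ω) : Submodule Ω V := ⨅ b, (D b).eigenspace (χ b)

section
variable {Ω V β : Type} [Field Ω] [AddCommGroup V] [Module Ω V]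
  {D : β → Module.End Ω V}

theorem mem_jointEigen {χ : β → Ω} {P : V} :
    P ∈ jointEigen D χ ↔ ∀ b, D b P = χ b • P := by
  simp [jointEigen, Submodule.mem_iInf]

theorem iSupIndep_jointEigen (hD : ∀ b b', Commute (D b) (D b')) : iSupIndep (jointEigen D) := by
  refine (Module.End.independent_iInf_maxGenEigenspace_of_forall_mapsTo D fun i j φ =>
    Module.End.mapsTo_maxGenEigenspace_of_comm (hD j i) φ).mono fun χ => ?_
  exact iInf_mono fun b => (D b).genEigenspace (χ b) |>.mono le_top

variable [Fintype β] {Dn : Module.End Ω V} (κ : β → Ω)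

theorem jointEigen_apply_sub (hc : ∀ b, Commute (D b) Dn) {χ : β → Ω} {P : V}
    (hP : P ∈ jointEigen D χ) :
    (∑ b, κ b • D b + Dn) P = (∑ b, κ b * χ b) • P + Dn P ∧ Dn P ∈ jointEigen D χ := by
  rw [mem_jointEigen] at *
  constructor
  · simp [LinearMap.add_apply, LinearMap.sum_apply, hP, Finset.sum_smul, smul_smul]
  · intro b
    have : D b (Dn P) = Dn (D b P) := LinearMap.congr_fun (hc b) P
    rw [this, hP, map_smul]

theorem exists_aeval_apply_eq_zero (hc : ∀ b, Commute (D b) Dn)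
    (htop : ⨆ χ, jointEigen D χ = ⊤) (hn : ∀ P, ∃ N, (Dn ^ N) P = 0) (P : V) :
    ∃ f : Polynomial Ω, f ≠ 0 ∧ Polynomial.aeval (∑ b, κ b • D b + Dn) f P = 0 := by
  have hP : P ∈ ⨆ χ, jointEigen D χ := htop ▸ Submodule.mem_top
  induction hP using Submodule.iSup_induction' with
  | mem χ P hP =>
    obtain ⟨N, hN⟩ := hn P
    refine ⟨(Polynomial.X - Polynomial.C (∑ b, κ b * χ b)) ^ N,
      pow_ne_zero _ (Polynomial.X_sub_C_ne_zero _), ?_⟩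
    rw [map_pow, map_sub, Polynomial.aeval_X, Polynomial.aeval_C]
    have : ∀ M : ℕ, ∀ R ∈ jointEigen D χ,
        ((∑ b, κ b • D b + Dn - algebraMap Ω _ (∑ b, κ b * χ b)) ^ M) R = (Dn ^ M) R := by
      intro M
      induction M with
      | zero => intro R _; rfl
      | succ M ih =>
        intro R hR
        obtain ⟨h1, h2⟩ := jointEigen_apply_sub κ hc hR
        rw [pow_succ, pow_succ, Module.End.mul_apply, Module.End.mul_apply, LinearMap.sub_apply,
          h1, Module.algebraMap_end_apply, add_sub_cancel_left, ih _ h2]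
    rw [this N P hP, hN]
  | zero => exact ⟨1, one_ne_zero, by simp⟩
  | add x y _ _ hx hy =>
    obtain ⟨f, hf, hfx⟩ := hx
    obtain ⟨g, hg, hgy⟩ := hy
    refine ⟨f * g, mul_ne_zero hf hg, ?_⟩
    rw [map_add, map_mul, Module.End.mul_apply, Module.End.mul_apply, hgy, map_zero, add_zero,
      ← Module.End.mul_apply, ← map_mul, mul_comm f g, map_mul, Module.End.mul_apply, hfx, map_zero]

/-- An eigenvector of `∑ κ D + Dn` is a joint eigenvector of the `D`. -/
theorem exists_jointEigen_of_eigen (hD : ∀ b b', Commute (D b) (D b'))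
    (hc : ∀ b, Commute (D b) Dn) (C : Set (β → Ω))
    (hC : ∀ χ ∈ C, ∀ χ' ∈ C, ∑ b, κ b * χ b = ∑ b, κ b * χ' b → χ = χ')
    (htop : ⨆ χ : C, jointEigen D χ.1 = ⊤) (hn : ∀ P, ∃ N, (Dn ^ N) P = 0) (a : Ω) :
    ∃ χ : β → Ω, ∀ P, (∑ b, κ b • D b + Dn) P = a • P → P ∈ jointEigen D χ := by
  have key : ∀ P, (∑ b, κ b • D b + Dn) P = a • P → ∃ f : C →₀ V,
      (∀ χ, f χ ∈ jointEigen D χ.1) ∧ f.sum (fun _ x => x) = P ∧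
        ∀ χ : C, f χ ≠ 0 → ∑ b, κ b * χ.1 b = a := by
    intro P hP
    have hPt : P ∈ ⨆ χ : C, jointEigen D χ.1 := htop ▸ Submodule.mem_top
    obtain ⟨f, hf, hfP⟩ := (Submodule.mem_iSup_iff_exists_finsupp _ _).1 hPt
    refine ⟨f, hf, hfP, fun χ hχ => ?_⟩
    have hind := (iSupIndep_jointEigen hD).comp (f := fun χ : C => χ.1) Subtype.val_injective
    rw [iSupIndep_iff_finsetSum_eq_zero_imp_eq_zero] at hind
    have h0 := hind f.support (fun χ => (∑ b, κ b * χ.1 b - a) • f χ + Dn (f χ)) (fun χ _ =>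
      Submodule.add_mem _ (Submodule.smul_mem _ _ (hf χ)) (jointEigen_apply_sub κ hc (hf χ)).2) (by
        have h1 : (∑ b, κ b • D b + Dn) P - a • P = 0 := sub_eq_zero.2 hP
        rw [← hfP, Finsupp.sum, map_sum, Finset.smul_sum, ← Finset.sum_sub_distrib] at h1
        rw [← h1]
        refine Finset.sum_congr rfl fun χ _ => ?_
        rw [(jointEigen_apply_sub κ hc (hf χ)).1, sub_smul]
        abel)
    have h1 := h0 χ (Finsupp.mem_support_iff.2 hχ)
    by_contra hne
    have hne' : ∑ b, κ b * χ.1 b - a ≠ 0 := sub_ne_zero.2 hne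
    have h2 : Dn (f χ) = (-(∑ b, κ b * χ.1 b - a)) • f χ := by
      rw [neg_smul]
      exact eq_neg_of_add_eq_zero_right h1
    have h3 : ∀ M : ℕ, (Dn ^ M) (f χ) = (-(∑ b, κ b * χ.1 b - a)) ^ M • f χ := by
      intro M
      induction M with
      | zero => simp
      | succ M ih => rw [pow_succ', Module.End.mul_apply, ih, map_smul, h2, smul_smul, pow_succ]
    obtain ⟨N, hN⟩ := hn (f χ)
    rw [h3] at hN
    exact (smul_ne_zero (pow_ne_zero _ (neg_ne_zero.2 hne')) hχ) hN
  by_cases hex : ∃ χ ∈ C, ∑ b, κ b * χ b = a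
  · obtain ⟨χ, hχ, hχa⟩ := hex
    refine ⟨χ, fun P hP => ?_⟩
    obtain ⟨f, hf, hfP, hfa⟩ := key P hP
    rw [← hfP]
    refine Submodule.sum_mem _ fun χ' h' => ?_
    have h1 := hfa χ' (Finsupp.mem_support_iff.1 h')
    have h2 : χ'.1 = χ := hC _ χ'.2 _ hχ (h1.trans hχa.symm)
    rw [← h2]
    exact hf χ'
  · refine ⟨0, fun P hP => ?_⟩
    obtain ⟨f, hf, hfP, hfa⟩ := key P hP
    have : P = 0 := by
      rw [← hfP]
      refine Finset.sum_eq_zero fun χ' h' => ?_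
      exact absurd ⟨χ'.1, χ'.2, hfa χ' (Finsupp.mem_support_iff.1 h')⟩ hex
    rw [this]
    exact Submodule.zero_mem _

end

open Polynomial in
theorem exists_separable_of_finite {Ω τ : Type} [Field Ω] [CharZero Ω] [Finite τ] (x : τ → Ω)
    (hx : ∀ t, IsAlgebraic ℚ (x t)) :
    ∃ m : ℚ[X], m.Separable ∧ ∀ t, aeval (x t) m = 0 := by
  classical
  cases nonempty_fintype τ
  let f : ℚ[X] := ∏ t, minpoly ℚ (x t)
  have hf : f ≠ 0 := Finset.prod_ne_zero_iff.2 fun t _ => minpoly.ne_zero (hx t).isIntegral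
  refine ⟨UniqueFactorizationMonoid.radical f, PerfectField.separable_iff_squarefree.2
    UniqueFactorizationMonoid.squarefree_radical, fun t => ?_⟩
  obtain ⟨n, hn⟩ := UniqueFactorizationMonoid.exists_dvd_radical_self_pow hf
  have h1 : aeval (x t) f = 0 := by
    rw [map_prod]
    exact Finset.prod_eq_zero (Finset.mem_univ t) (minpoly.aeval _ _)
  have h2 : aeval (x t) (UniqueFactorizationMonoid.radical f) ^ n = 0 := by
    rw [← map_pow]
    exact aeval_eq_zero_of_dvd_aeval_eq_zero hn h1
  exact pow_eq_zero_iff (fun h => by simp [h] at h2) |>.1 h2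

/-- A finite set of elements of `K C`, with `C` a subfield, is expanded over `C` by a finite
`C`-independent family of elements of `K`. -/
theorem exists_basis_expansion {K Ω τ : Type} [Field K] [Field Ω] [Algebra K Ω] [Finite τ]
    (C : Subfield Ω) (x : τ → Ω) (hx : ∀ t, x t ∈ Submodule.span K (C : Set Ω)) :
    ∃ (β : Type) (_ : Fintype β) (κ : β → K) (ε : τ → β → C),
      LinearIndependent C (fun b => algebraMap K Ω (κ b)) ∧
      ∀ t, x t = ∑ b, algebraMap K Ω (κ b) * ε t b := by
  classical
  cases nonempty_fintype τ
  have h1 : ∀ y ∈ Submodule.span K (C : Set Ω), y ∈ Submodule.span C (Set.range (algebraMap K Ω)) := by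
    intro y hy
    induction hy using Submodule.span_induction with
    | mem y hy =>
      have : y = (⟨y, hy⟩ : C) • (algebraMap K Ω 1) := by simp [Subfield.smul_def]
      rw [this]
      exact Submodule.smul_mem _ _ (Submodule.subset_span ⟨1, rfl⟩)
    | zero => exact Submodule.zero_mem _
    | add _ _ _ _ h h' => exact Submodule.add_mem _ h h'
    | smul a y h0 h =>
      clear h0
      induction h using Submodule.span_induction with
      | mem y hy =>
        obtain ⟨b, rfl⟩ := hy
        rw [Algebra.smul_def, ← map_mul]
        exact Submodule.subset_span ⟨_, rfl⟩
      | zero => simp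
      | add _ _ _ _ h h' =>
        rw [smul_add]
        exact Submodule.add_mem _ h h'
      | smul c y _ h =>
        rw [smul_comm]
        exact Submodule.smul_mem _ _ h
  have h2 : ∀ t, ∃ T : Finset Ω, (T : Set Ω) ⊆ Set.range (algebraMap K Ω) ∧
      x t ∈ Submodule.span C (T : Set Ω) := fun t =>
    Submodule.mem_span_finite_of_mem_span (h1 _ (hx t))
  choose T hT hxT using h2
  obtain ⟨b, hb, hbs, hbi⟩ := exists_linearIndependent C ((Finset.univ.biUnion T : Finset Ω) : Set Ω)
  have hfin : b.Finite := (Finset.finite_toSet _).subset hb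
  have := hfin.fintype
  have hbr : ∀ y : b, ∃ a : K, algebraMap K Ω a = y := fun y => by
    have h := hb y.2
    simp only [Finset.coe_biUnion, Set.mem_iUnion] at h
    obtain ⟨t, -, ht⟩ := h
    exact hT t ht
  choose κ hκ using hbr
  have hx' : ∀ t, ∃ c : b → C, ∑ i, c i • (i : Ω) = x t := fun t => by
    have h : x t ∈ Submodule.span C b := by
      rw [hbs]
      refine Submodule.span_mono ?_ (hxT t)
      exact Finset.coe_subset.2 (Finset.subset_biUnion_of_mem T (Finset.mem_univ t))
    rw [← Subtype.range_coe (s := b)] at h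
    exact (Submodule.mem_span_range_iff_exists_fun C).1 h
  choose ε hε using hx'
  refine ⟨b, inferInstance, κ, ε, ?_, fun t => ?_⟩
  · simp_rw [hκ]
    exact hbi
  · rw [← hε]
    refine Finset.sum_congr rfl fun i _ => ?_
    rw [hκ, Subfield.smul_def, smul_eq_mul, mul_comm]

section
open Polynomial

variable {K Ω ι : Type} [Field K] [Field Ω] [Algebra K Ω] [Fintype ι] [DecidableEq ι]

theorem vecMul_aeval_of_eigen {s : Matrix ι ι K} {u : ι → Ω} {l : Ω}
    (hu : Matrix.vecMul u (s.map (algebraMap K Ω)) = l • u) (q : K[X]) :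
    Matrix.vecMul u ((aeval s q).map (algebraMap K Ω)) = aeval l q • u := by
  have hadd : ∀ M N : Matrix ι ι K, (M + N).map (algebraMap K Ω) =
      M.map (algebraMap K Ω) + N.map (algebraMap K Ω) := fun M N => by ext; simp
  induction q using Polynomial.induction_on' with
  | add p q hp hq => rw [map_add, hadd, Matrix.vecMul_add, hp, hq, map_add, add_smul]
  | monomial n a =>
    have hpow : ∀ n : ℕ, Matrix.vecMul u ((s ^ n).map (algebraMap K Ω)) = l ^ n • u := by
      intro n
      induction n with
      | zero => simp
      | succ n ih =>
        rw [pow_succ, Matrix.map_mul, ← Matrix.vecMul_vecMul, ih, Matrix.smul_vecMul, hu, smul_smul,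
          pow_succ]
    rw [aeval_monomial, aeval_monomial, ← Algebra.smul_def,
      Matrix.map_smul' _ _ _ (map_mul (algebraMap K Ω)), Matrix.vecMul_smul, hpow, smul_smul]

theorem aeval_vecMulLinear_apply (M : Matrix ι ι Ω) (q : Polynomial Ω) (u : ι → Ω) :
    aeval (Matrix.vecMulLinear M : Module.End Ω (ι → Ω)) q u = Matrix.vecMul u (aeval M q) := by
  induction q using Polynomial.induction_on' with
  | add p q hp hq => simp [map_add, hp, hq, Matrix.vecMul_add]
  | monomial n a =>
    have hpow : ∀ n : ℕ, ((Matrix.vecMulLinear M : Module.End Ω (ι → Ω)) ^ n) u =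
        Matrix.vecMul u (M ^ n) := by
      intro n
      induction n with
      | zero => simp
      | succ n ih =>
        rw [pow_succ', Module.End.mul_apply, ih, pow_succ, ← Matrix.vecMul_vecMul]
        rfl
    rw [aeval_monomial, aeval_monomial, ← Algebra.smul_def, ← Algebra.smul_def,
      LinearMap.smul_apply, hpow, Matrix.vecMul_smul]

/-- A matrix annihilated by a separable polynomial is diagonalizable. -/
theorem span_left_eigenvectors [IsAlgClosed Ω] {s : Matrix ι ι K} {μ : K[X]} (hμ : μ.Separable)
    (hs : aeval s μ = 0) :
    Submodule.span Ω {u : ι → Ω | ∃ l : Ω, aeval l μ = 0 ∧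
      Matrix.vecMul u (s.map (algebraMap K Ω)) = l • u} = ⊤ := by
  classical
  set T : Module.End Ω (ι → Ω) := Matrix.vecMulLinear (s.map (algebraMap K Ω)) with hT
  have h1 : aeval T (μ.map (algebraMap K Ω)) = 0 := by
    ext1 u
    have h2 : aeval (s.map (algebraMap K Ω)) (μ.map (algebraMap K Ω)) = 0 := by
      have := congrArg (Algebra.ofId K Ω).mapMatrix hs
      rw [map_zero, ← aeval_algHom_apply] at this
      rw [aeval_map_algebraMap]
      exact this
    ext j
    simp only [LinearMap.comp_apply, hT]
    rw [aeval_vecMulLinear_apply, h2]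
    simp
  have h2 : T.IsSemisimple :=
    Module.End.isSemisimple_of_squarefree_aeval_eq_zero hμ.map.squarefree h1
  have h3 := h2.iSup_eigenspace_eq_top
  rw [eq_top_iff, ← h3, iSup_le_iff]
  intro l u hu
  by_cases hu0 : u = 0
  · simp [hu0]
  have hul : Matrix.vecMul u (s.map (algebraMap K Ω)) = l • u :=
    Module.End.mem_eigenspace_iff.1 hu
  refine Submodule.subset_span ⟨l, ?_, hul⟩
  have h4 := vecMul_aeval_of_eigen hul μ
  rw [hs] at h4
  have h5 : aeval l μ • u = 0 := by
    rw [← h4]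
    ext; simp
  exact (smul_eq_zero.1 h5).resolve_right hu0

theorem matrix_eq_of_vecMul_eq {S : Set (ι → Ω)} (hS : Submodule.span Ω S = ⊤) {M N : Matrix ι ι K}
    (h : ∀ u ∈ S, Matrix.vecMul u (M.map (algebraMap K Ω)) =
      Matrix.vecMul u (N.map (algebraMap K Ω))) : M = N := by
  have h1 : Matrix.vecMulLinear (M.map (algebraMap K Ω)) =
      Matrix.vecMulLinear (N.map (algebraMap K Ω)) := LinearMap.ext_on hS h
  ext i j
  have h2 := congrFun (LinearMap.congr_fun h1 (Pi.single i 1)) j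
  simpa using h2

end

section
open Polynomial

variable {K Ω ι : Type} [Field K] [Field Ω] [Algebra K Ω] [Fintype ι] [DecidableEq ι]

theorem Matrix.exists_isNilpotent_separable [CharZero K] (v : Matrix ι ι K) :
    ∃ (q : K[X]) (μ : K[X]), μ.Separable ∧ aeval (aeval v q) μ = 0 ∧
      IsNilpotent (v - aeval v q) := by
  obtain ⟨n, hn, s, hs, hnil, hss, hv⟩ :=
    Module.End.exists_isNilpotent_isSemisimple (K := K) (f := Matrix.toLin' v)
  obtain ⟨q, hq⟩ : ∃ q : K[X], aeval (Matrix.toLin' v) q = s := by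
    rw [Algebra.adjoin_singleton_eq_range_aeval] at hs
    exact hs
  have hφ : ∀ (w : Matrix ι ι K) (f : K[X]),
      Matrix.toLinAlgEquiv' (aeval w f) = aeval (Matrix.toLin' w) f := fun w f =>
    (aeval_algHom_apply (Matrix.toLinAlgEquiv' : Matrix ι ι K ≃ₐ[K] _).toAlgHom w f).symm
  have hq' : Matrix.toLin' (aeval v q) = s := (hφ v q).trans hq
  refine ⟨q, minpoly K s, PerfectField.separable_iff_squarefree.2 hss.minpoly_squarefree, ?_, ?_⟩
  · apply (Matrix.toLinAlgEquiv' : Matrix ι ι K ≃ₐ[K] _).injective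
    rw [hφ, hq', minpoly.aeval, map_zero]
  · obtain ⟨N, hN⟩ := hnil
    refine ⟨N, ?_⟩
    apply (Matrix.toLinAlgEquiv' : Matrix ι ι K ≃ₐ[K] _).injective
    have h1 : (Matrix.toLinAlgEquiv' : Matrix ι ι K ≃ₐ[K] _) (v - aeval v q) = n := by
      rw [map_sub, hφ, hq]
      exact sub_eq_of_eq_add hv
    rw [map_pow, h1, hN, map_zero]

/-- Interpolation of a Galois-equivariant function by a polynomial over the base field. -/
theorem exists_interpolate_of_equivariant [CharZero K] [IsAlgClosed Ω] [Algebra.IsAlgebraic K Ω]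
    (S : Finset Ω) (ε : Ω → Ω) (hS : ∀ σ : Ω ≃ₐ[K] Ω, ∀ l ∈ S, σ l ∈ S)
    (hε : ∀ σ : Ω ≃ₐ[K] Ω, ∀ l ∈ S, σ (ε l) = ε (σ l)) :
    ∃ q : K[X], ∀ l ∈ S, aeval l q = ε l := by
  classical
  have : IsGalois K Ω := by
    have : IsAlgClosure K Ω := ⟨inferInstance, inferInstance⟩
    infer_instance
  obtain ⟨P, hP⟩ : ∃ P, P = Lagrange.interpolate S id ε := ⟨_, rfl⟩
  have hinj : Set.InjOn (id : Ω → Ω) S := Function.injective_id.injOn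
  have hval : ∀ l ∈ S, eval l P = ε l := fun l hl => by
    rw [hP]
    exact Lagrange.eval_interpolate_at_node (v := id) ε hinj hl
  have hdeg : P.degree < S.card := hP ▸ Lagrange.degree_interpolate_lt ε hinj
  have hfix : ∀ σ : Ω ≃ₐ[K] Ω, P.map (σ : Ω →+* Ω) = P := by
    intro σ
    refine (Lagrange.eq_interpolate_of_eval_eq ε hinj ?_ fun l hl => ?_).trans hP.symm
    · exact degree_map_le.trans_lt hdeg
    · have h1 := hS σ.symm l hl
      have h2 : l = σ (σ.symm l) := (σ.apply_symm_apply l).symm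
      have h3 : eval (σ.symm l) P = ε (σ.symm l) := hval _ h1
      have h4 : eval (σ (σ.symm l)) (P.map (σ : Ω →+* Ω)) = σ (eval (σ.symm l) P) :=
        Polynomial.eval_map_apply (σ : Ω →+* Ω) (σ.symm l)
      rw [id, h2, h4, h3, hε σ _ h1]
  have hl : P ∈ Polynomial.lifts (algebraMap K Ω) := by
    rw [Polynomial.lifts_iff_coeff_lifts]
    intro n
    rw [InfiniteGalois.mem_range_algebraMap_iff_fixed]
    intro σ
    have := congrArg (fun R => coeff R n) (hfix σ)
    simpa using this
  obtain ⟨q, hq⟩ := (Polynomial.mem_lifts _).1 hl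
  refine ⟨q, fun l hl => ?_⟩
  rw [← eval_map_algebraMap, hq]
  exact hval l hl

/-- The semisimple part of a matrix is a combination of commuting matrices annihilated by separable
polynomials over `ℚ`. -/
theorem Matrix.exists_rational_parts [CharZero K] [CharZero Ω] [IsAlgClosed Ω]
    [Algebra.IsAlgebraic K Ω]
    (hCl : ∀ z : Ω, z ∈ Submodule.span K {z : Ω | IsAlgebraic ℚ z}) (v : Matrix ι ι K) :
    ∃ (β : Type) (_ : Fintype β) (κ : β → K) (e : β → Matrix ι ι K) (n : Matrix ι ι K),
      v = ∑ b, κ b • e b + n ∧ IsNilpotent n ∧ (∀ b, Commute (e b) n) ∧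
      (∀ b b', Commute (e b) (e b')) ∧ (∀ b, ∃ m : ℚ[X], m.Separable ∧ aeval (e b) m = 0) ∧
      (∀ χ χ' : β → Ω, (∀ b, IsAlgebraic ℚ (χ b)) → (∀ b, IsAlgebraic ℚ (χ' b)) →
        ∑ b, algebraMap K Ω (κ b) * χ b = ∑ b, algebraMap K Ω (κ b) * χ' b → χ = χ') ∧
      Submodule.span Ω {u : ι → Ω | ∃ χ : β → Ω, (∀ b, IsAlgebraic ℚ (χ b)) ∧
        ∀ b, Matrix.vecMul u ((e b).map (algebraMap K Ω)) = χ b • u} = ⊤ := by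
  classical
  obtain ⟨q, μ, hμ, hμ0, hnil⟩ := v.exists_isNilpotent_separable
  set s := aeval v q with hs
  let C : Subfield Ω := (algebraicClosure ℚ Ω).toSubfield
  have hCmem : ∀ z : Ω, z ∈ C ↔ IsAlgebraic ℚ z := fun z => mem_algebraicClosure_iff
  let S : Finset Ω := (μ.aroots Ω).toFinset
  have hSmem : ∀ l : Ω, l ∈ S ↔ aeval l μ = 0 := fun l => by
    simp [S, hμ.ne_zero]
  obtain ⟨β, _, κ, ε, hκ, hε⟩ := exists_basis_expansion (K := K) C (fun l : S => (l : Ω)) (fun l => by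
    refine Submodule.span_mono (fun z hz => ?_) (hCl l)
    exact (hCmem z).2 hz)
  have huniq : ∀ χ χ' : β → Ω, (∀ b, IsAlgebraic ℚ (χ b)) → (∀ b, IsAlgebraic ℚ (χ' b)) →
        ∑ b, algebraMap K Ω (κ b) * χ b = ∑ b, algebraMap K Ω (κ b) * χ' b → χ = χ' := by
    intro χ χ' h h' heq
    have h1 := Fintype.linearIndependent_iff.1 hκ
      (fun b => (⟨χ b, (hCmem _).2 (h b)⟩ - ⟨χ' b, (hCmem _).2 (h' b)⟩ : C)) (by
        simp only [Subfield.smul_def, smul_eq_mul]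
        simp only [AddSubgroupClass.coe_sub, sub_mul, Finset.sum_sub_distrib]
        rw [sub_eq_zero]
        simpa [mul_comm] using heq)
    funext b
    have := congrArg (Subtype.val) (h1 b)
    simpa [sub_eq_zero] using this
  have hSσ : ∀ σ : Ω ≃ₐ[K] Ω, ∀ l ∈ S, σ l ∈ S := fun σ l hl => by
    rw [hSmem] at *
    have := aeval_algHom_apply (σ : Ω →ₐ[K] Ω) l μ
    rw [hl, map_zero] at this
    exact this
  have hεalg : ∀ l b, IsAlgebraic ℚ (ε l b : Ω) := fun l b => (hCmem _).1 (ε l b).2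
  have hq : ∀ b, ∃ q : K[X], ∀ l (hl : l ∈ S), aeval l q = ε ⟨l, hl⟩ b := by
    intro b
    obtain ⟨q, hq⟩ := exists_interpolate_of_equivariant (K := K) S
      (fun l => if hl : l ∈ S then (ε ⟨l, hl⟩ b : Ω) else 0) hSσ (by
        intro σ l hl
        simp only [hl, hSσ σ l hl, dif_pos]
        refine congrFun (huniq (fun b => σ (ε ⟨l, hl⟩ b)) (fun b => ε ⟨σ l, hSσ σ l hl⟩ b) ?_ ?_ ?_) b
        · exact fun b => (hεalg _ b).algHom ((σ : Ω →+* Ω).toRatAlgHom)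
        · exact fun b => hεalg _ b
        · have h1 := congrArg σ (hε ⟨l, hl⟩)
          rw [map_sum] at h1
          simp only [map_mul, AlgEquiv.commutes] at h1
          rw [← h1]
          exact hε ⟨σ l, hSσ σ l hl⟩)
    exact ⟨q, fun l hl => by rw [hq l hl, dif_pos hl]⟩
  choose qb hqb using hq
  have hspan := span_left_eigenvectors (Ω := Ω) hμ hμ0
  refine ⟨β, inferInstance, κ, fun b => aeval s (qb b), v - s, ?_, hnil, fun b => ?_, fun b b' => ?_,
    fun b => ?_, huniq, ?_⟩
  · have : ∑ b, κ b • aeval s (qb b) = s := by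
      refine matrix_eq_of_vecMul_eq hspan ?_
      rintro u ⟨l, hl, hu⟩
      have h1 : ∑ b, κ b • aeval s (qb b) = aeval s (∑ b, Polynomial.C (κ b) * qb b) := by
        rw [map_sum]
        refine Finset.sum_congr rfl fun b _ => ?_
        rw [map_mul, aeval_C, Algebra.smul_def]
      rw [h1, vecMul_aeval_of_eigen hu, hu]
      congr 1
      rw [map_sum]
      have hl' := (hSmem l).2 hl
      refine Eq.trans ?_ (hε ⟨l, hl'⟩).symm
      refine Finset.sum_congr rfl fun b _ => ?_
      rw [map_mul, aeval_C, hqb b l hl']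
    rw [this]
    abel
  · have h1 : ∀ f g : K[X], Commute (aeval v f) (aeval v g) := fun f g =>
      (Commute.all f g).map (aeval v)
    have h2 := h1 ((qb b).comp q) (X - q)
    rwa [aeval_comp, map_sub, aeval_X] at h2
  · exact (Commute.all (qb b) (qb b')).map (aeval s)
  · obtain ⟨m, hm, hm0⟩ := exists_separable_of_finite (fun l : S => (ε l b : Ω)) (fun l => hεalg l b)
    refine ⟨m, hm, ?_⟩
    have h1 : aeval (aeval s (qb b)) m = aeval s ((m.map (algebraMap ℚ K)).comp (qb b)) := by
      rw [aeval_comp, aeval_map_algebraMap]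
    rw [h1]
    refine matrix_eq_of_vecMul_eq hspan ?_
    rintro u ⟨l, hl, hu⟩
    have hl' := (hSmem l).2 hl
    rw [vecMul_aeval_of_eigen hu, aeval_comp, aeval_map_algebraMap, hqb b l hl', hm0 ⟨l, hl'⟩]
    ext; simp
  · rw [eq_top_iff, ← hspan]
    refine Submodule.span_mono ?_
    rintro u ⟨l, hl, hu⟩
    have hl' := (hSmem l).2 hl
    refine ⟨fun b => ε ⟨l, hl'⟩ b, fun b => hεalg _ b, fun b => ?_⟩
    rw [vecMul_aeval_of_eigen hu, hqb b l hl']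

end

section
variable {Ω R β : Type} [Field Ω] [IsAlgClosed Ω] [CommRing R] [IsDomain R] [Algebra Ω R] [Fintype β]

/-- If the derivation `∑ κ D + Dn` kills the fraction `P / Q`, then so do the derivations `D b`,
provided these are simultaneously diagonalizable and `Dn` is locally nilpotent. -/
theorem derivation_ratio_eq (D : β → Derivation Ω R R) (Dn : Derivation Ω R R) (κ : β → Ω)
    (hD : ∀ b b', Commute (D b : Module.End Ω R) (D b'))
    (hc : ∀ b, Commute (D b : Module.End Ω R) Dn) (C : Set (β → Ω))
    (hC : ∀ χ ∈ C, ∀ χ' ∈ C, ∑ b, κ b * χ b = ∑ b, κ b * χ' b → χ = χ')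
    (htop : ⨆ χ : C, jointEigen (fun b => (D b : Module.End Ω R)) χ.1 = ⊤)
    (hn : ∀ P, ∃ N, ((Dn : Module.End Ω R) ^ N) P = 0) {P Q : R} (hQ : Q ≠ 0)
    (h : (∑ b, κ b • D b + Dn) P * Q = P * (∑ b, κ b • D b + Dn) Q) (b : β) :
    D b P * Q = P * D b Q := by
  classical
  set T : Module.End Ω R := ∑ b, κ b • (D b : Module.End Ω R) + Dn with hT
  have hTD : ∀ x, T x = (∑ b, κ b • D b + Dn) x := fun x => by
    have : (⇑(∑ b, κ b • D b : Derivation Ω R R)) = ∑ b, ⇑(κ b • D b) :=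
      map_sum (Derivation.coeFnAddMonoidHom : Derivation Ω R R →+ (R → R)) _ _
    rw [hT, Derivation.add_apply, this]
    simp [LinearMap.add_apply, LinearMap.sum_apply, Finset.sum_apply]
  have hTmul : ∀ x y, T (x * y) = x * T y + y * T x := fun x y => by
    simp only [hTD, Derivation.leibniz, smul_eq_mul]
  rw [← hTD, ← hTD] at h
  have hstep : ∀ R₁ R₂ : R, R₁ * P = R₂ * Q → T R₁ * P = T R₂ * Q := by
    intro R₁ R₂ h1
    have h2 := congrArg T h1
    rw [hTmul, hTmul] at h2
    have h3 : R₁ * T P = R₂ * T Q := by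
      apply mul_right_cancel₀ hQ
      linear_combination R₁ * h + T Q * h1
    linear_combination h2 - h3
  have hpoly : ∀ g : Polynomial Ω, Polynomial.aeval T g Q * P = Polynomial.aeval T g P * Q := by
    intro g
    induction g using Polynomial.induction_on' with
    | add p q hp hq => simp only [map_add, LinearMap.add_apply, add_mul, hp, hq]
    | monomial n a =>
      have : ∀ n : ℕ, (T ^ n) Q * P = (T ^ n) P * Q := by
        intro n
        induction n with
        | zero => simp [mul_comm]
        | succ n ih =>
          rw [pow_succ', Module.End.mul_apply, Module.End.mul_apply]
          exact hstep _ _ ih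
      simp only [Polynomial.aeval_monomial, ← Algebra.smul_def, LinearMap.smul_apply, smul_mul_assoc,
        this]
  have htop' : ⨆ χ, jointEigen (fun b => (D b : Module.End Ω R)) χ = ⊤ := by
    rw [eq_top_iff, ← htop]
    exact iSup_le fun χ => le_iSup (jointEigen fun b => (D b : Module.End Ω R)) χ.1
  have hex : ∃ m : ℕ, ∃ f : Polynomial Ω, f ≠ 0 ∧ f.natDegree = m ∧ Polynomial.aeval T f Q = 0 := by
    obtain ⟨f, hf, hfQ⟩ := exists_aeval_apply_eq_zero κ hc htop' hn Q
    exact ⟨_, f, hf, rfl, hfQ⟩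
  obtain ⟨f, hf, hfm, hfQ⟩ := Nat.find_spec hex
  have hdeg : f.degree ≠ 0 := by
    intro h0
    rw [Polynomial.eq_C_of_degree_eq_zero h0, Polynomial.aeval_C, Module.algebraMap_end_apply] at hfQ
    have := (smul_eq_zero.1 hfQ).resolve_right hQ
    rw [Polynomial.eq_C_of_degree_eq_zero h0, this, map_zero] at hf
    exact hf rfl
  obtain ⟨a, ha⟩ := IsAlgClosed.exists_root f hdeg
  obtain ⟨g, rfl⟩ := Polynomial.dvd_iff_isRoot.2 ha
  have hg : g ≠ 0 := right_ne_zero_of_mul hf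
  have hQ0 : Polynomial.aeval T g Q ≠ 0 := by
    intro h0
    refine Nat.find_min hex (m := g.natDegree) ?_ ⟨g, hg, rfl, h0⟩
    rw [← hfm, Polynomial.natDegree_mul (Polynomial.X_sub_C_ne_zero a) hg,
      Polynomial.natDegree_X_sub_C]
    omega
  have hfP : Polynomial.aeval T ((Polynomial.X - Polynomial.C a) * g) P = 0 := by
    have := hpoly ((Polynomial.X - Polynomial.C a) * g)
    rw [hfQ, zero_mul] at this
    exact (mul_eq_zero.1 this.symm).resolve_right hQ
  have heig : ∀ x, Polynomial.aeval T ((Polynomial.X - Polynomial.C a) * g) x = 0 →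
      T (Polynomial.aeval T g x) = a • Polynomial.aeval T g x := by
    intro x hx
    rw [map_mul, Module.End.mul_apply, map_sub, Polynomial.aeval_X, Polynomial.aeval_C,
      LinearMap.sub_apply, Module.algebraMap_end_apply] at hx
    exact sub_eq_zero.1 hx
  obtain ⟨χ, hχ⟩ := exists_jointEigen_of_eigen κ hD hc C hC htop hn a
  have e1 : D b (Polynomial.aeval T g Q) = χ b • Polynomial.aeval T g Q :=
    mem_jointEigen.1 (hχ _ (heig Q hfQ)) b
  have e2 : D b (Polynomial.aeval T g P) = χ b • Polynomial.aeval T g P :=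
    mem_jointEigen.1 (hχ _ (heig P hfP)) b
  have h0 := hpoly g
  have h1 := congrArg (D b) h0
  rw [Derivation.leibniz, Derivation.leibniz, e1, e2, smul_eq_mul, smul_eq_mul, smul_eq_mul,
    smul_eq_mul, Algebra.smul_def, Algebra.smul_def] at h1
  apply mul_left_cancel₀ hQ0
  linear_combination Q * h1 - (algebraMap Ω R (χ b) * Q + D b Q) * h0

end

section
open MvPolynomial
variable {K Ω ι : Type} [Field K] [Field Ω] [Algebra K Ω] [Fintype ι]

theorem linD_X (v : Matrix ι ι K) (q : ι × ι) : linD v (X q) = ∑ l, C (v q.1 l) * X (l, q.2) :=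
  mkDerivation_X _ _ _

theorem linD_map (v : Matrix ι ι K) (P : MvPolynomial (ι × ι) K) :
    linD (v.map (algebraMap K Ω)) (map (algebraMap K Ω) P) = map (algebraMap K Ω) (linD v P) := by
  induction P using MvPolynomial.induction_on with
  | C a => simp [MvPolynomial.map_C, ← MvPolynomial.algebraMap_eq]
  | add p q hp hq => simp [hp, hq]
  | mul_X p q hp =>
    rw [map_mul, map_X, Derivation.leibniz, Derivation.leibniz, hp, linD_X, linD_X]
    simp [smul_eq_mul]

theorem linD_sum_add {β : Type} [Fintype β] (κ : β → K) (e : β → Matrix ι ι K) (n : Matrix ι ι K) :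
    linD (∑ b, κ b • e b + n) = ∑ b, κ b • linD (e b) + linD n := by
  apply MvPolynomial.derivation_ext
  intro q
  have : ∀ x, (∑ b, κ b • linD (e b) : Derivation K _ _) x = ∑ b, κ b • linD (e b) x := fun x => by
    have : (⇑(∑ b, κ b • linD (e b) : Derivation K _ _)) = ∑ b, ⇑(κ b • linD (e b)) :=
      map_sum (Derivation.coeFnAddMonoidHom : Derivation K _ _ →+ _) _ _
    rw [this]
    simp [Finset.sum_apply]
  rw [Derivation.add_apply, this]
  simp only [linD_X, Matrix.add_apply, Matrix.sum_apply, Matrix.smul_apply, map_add, map_sum,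
    smul_eq_mul, map_mul, add_mul, Finset.sum_add_distrib, Finset.sum_mul, Finset.smul_sum,
    MvPolynomial.smul_eq_C_mul]
  rw [Finset.sum_comm]
  simp only [mul_assoc]

theorem linD_commute [DecidableEq ι] {v w : Matrix ι ι K} (h : Commute v w) :
    Commute (linD v : Module.End K (MvPolynomial (ι × ι) K)) (linD w) := by
  have h1 : ⁅linD v, linD w⁆ = 0 := by
    apply MvPolynomial.derivation_ext
    intro q
    have key : ∀ (v w : Matrix ι ι K), linD v (linD w (X q)) =
        ∑ l, C ((w * v) q.1 l) * X (l, q.2) := fun v w => by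
      rw [linD_X, map_sum]
      simp only [Derivation.leibniz, smul_eq_mul, linD_X, ← MvPolynomial.algebraMap_eq,
        Derivation.map_algebraMap, mul_zero, add_zero, Matrix.mul_apply, map_sum, map_mul,
        Finset.mul_sum, Finset.sum_mul]
      rw [Finset.sum_comm]
      simp only [mul_assoc]
    rw [Derivation.commutator_apply, key, key, h.eq, sub_self, Derivation.zero_apply]
  refine LinearMap.ext fun P => ?_
  have h2 := DFunLike.congr_fun h1 P
  rw [Derivation.commutator_apply, Derivation.zero_apply, sub_eq_zero] at h2
  exact h2

theorem linD_linear_form (v : Matrix ι ι K) (u : ι → K) (j : ι) :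
    linD v (∑ i, u i • X (i, j)) = ∑ i, Matrix.vecMul u v i • X (i, j) := by
  rw [map_sum]
  simp only [Derivation.map_smul, linD_X]
  simp only [Matrix.vecMul, dotProduct, Finset.smul_sum,
    MvPolynomial.smul_eq_C_mul, Finset.sum_mul, map_sum, map_mul]
  rw [Finset.sum_comm]
  simp only [mul_assoc]

theorem linD_locally_nilpotent [DecidableEq ι] {n : Matrix ι ι K} (hn : IsNilpotent n)
    (P : MvPolynomial (ι × ι) K) :
    ∃ N, ((linD n : Module.End K (MvPolynomial (ι × ι) K)) ^ N) P = 0 := by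
  set D : Module.End K (MvPolynomial (ι × ι) K) := ↑(linD n) with hD
  have hle : ∀ {a b : ℕ} {R}, (D ^ a) R = 0 → a ≤ b → (D ^ b) R = 0 := by
    intro a b R h hab
    obtain ⟨c, rfl⟩ := Nat.exists_eq_add_of_le' hab
    rw [pow_add, Module.End.mul_apply, h, map_zero]
  have hmul : ∀ m a b : ℕ, a + b ≤ m → ∀ R S, (D ^ a) R = 0 → (D ^ b) S = 0 → (D ^ m) (R * S) = 0 := by
    intro m
    induction m with
    | zero =>
      intro a b hab R S hR hS
      obtain rfl : a = 0 := by omega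
      have : R = 0 := hR
      simp [this]
    | succ m ih =>
      intro a b hab R S hR hS
      have h1 : D (R * S) = R * D S + D R * S := by
        have := (linD n).leibniz R S
        rw [smul_eq_mul, smul_eq_mul, mul_comm S] at this
        exact this
      rw [pow_succ, Module.End.mul_apply, h1, map_add]
      have e1 : (D ^ m) (R * D S) = 0 := by
        cases b with
        | zero =>
          have : S = 0 := hS
          simp [this]
        | succ b =>
          refine ih a b (by omega) _ _ hR ?_
          rw [pow_succ, Module.End.mul_apply] at hS
          exact hS
      have e2 : (D ^ m) (D R * S) = 0 := by
        cases a with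
        | zero =>
          have : R = 0 := hR
          simp [this]
        | succ a =>
          refine ih a b (by omega) _ _ ?_ hS
          rw [pow_succ, Module.End.mul_apply] at hR
          exact hR
      rw [e1, e2, add_zero]
  induction P using MvPolynomial.induction_on with
  | C a =>
    refine ⟨1, ?_⟩
    rw [pow_one, ← MvPolynomial.algebraMap_eq]
    exact (linD n).map_algebraMap a
  | add p q hp hq =>
    obtain ⟨a, ha⟩ := hp
    obtain ⟨b, hb⟩ := hq
    exact ⟨max a b, by rw [map_add, hle ha (le_max_left _ _), hle hb (le_max_right _ _), add_zero]⟩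
  | mul_X p q hp =>
    obtain ⟨a, ha⟩ := hp
    obtain ⟨N, hN⟩ := hn
    refine ⟨a + N, hmul _ a N le_rfl _ _ ha ?_⟩
    have h1 : ∀ (M : ℕ) (u : ι → K), (D ^ M) (∑ i, u i • X (i, q.2)) =
        ∑ i, Matrix.vecMul u (n ^ M) i • X (i, q.2) := by
      intro M
      induction M with
      | zero => simp
      | succ M ih =>
        intro u
        rw [pow_succ, Module.End.mul_apply]
        have := linD_linear_form n u q.2
        rw [hD]
        erw [this]
        rw [← hD, ih, Matrix.vecMul_vecMul, pow_succ']
    have h2 := h1 N (Pi.single q.1 1)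
    rw [hN] at h2
    have h3 : (X q : MvPolynomial (ι × ι) K) = ∑ i, (Pi.single q.1 1 : ι → K) i • X (i, q.2) := by
      rw [Finset.sum_eq_single q.1]
      · simp
      · intro b _ hb
        simp [hb]
      · simp
    rw [h3, h2]
    simp

theorem iSup_jointEigen_linD_eq_top {β : Type} (e : β → Matrix ι ι K) (C : AddSubmonoid (β → K))
    (h : Submodule.span K {u : ι → K | ∃ χ ∈ C, ∀ b, Matrix.vecMul u (e b) = χ b • u} = ⊤) :
    ⨆ χ : (C : Set (β → K)),
      jointEigen (fun b => (linD (e b) : Module.End K (MvPolynomial (ι × ι) K))) χ.1 = ⊤ := by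
  classical
  set E := jointEigen (fun b => (linD (e b) : Module.End K (MvPolynomial (ι × ι) K))) with hE
  set S := ⨆ χ : (C : Set (β → K)), E χ.1 with hS
  have hmemE : ∀ {χ P}, P ∈ E χ ↔ ∀ b, linD (e b) P = χ b • P := fun {χ P} => mem_jointEigen
  have hmem : ∀ χ ∈ C, ∀ P ∈ E χ, P ∈ S := fun χ hχ P hP =>
    (le_iSup (fun χ : (C : Set (β → K)) => E χ.1) ⟨χ, hχ⟩) hP
  have hmul : ∀ P ∈ S, ∀ Q ∈ S, P * Q ∈ S := by
    intro P hP Q hQ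
    induction hP using Submodule.iSup_induction' with
    | mem χ P hP =>
      induction hQ using Submodule.iSup_induction' with
      | mem χ' Q hQ =>
        refine hmem _ (C.add_mem χ.2 χ'.2) _ ?_
        rw [hmemE] at *
        intro b
        rw [Derivation.leibniz, hP, hQ, Pi.add_apply, add_smul, smul_eq_mul, smul_eq_mul,
          mul_smul_comm, mul_smul_comm, mul_comm Q P, add_comm]
      | zero => simp
      | add _ _ _ _ h h' =>
        rw [mul_add]
        exact Submodule.add_mem _ h h'
    | zero => simp
    | add _ _ _ _ h h' =>
      rw [add_mul]
      exact Submodule.add_mem _ h h'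
  have hX : ∀ (u : ι → K) (j : ι), ∑ i, u i • X (i, j) ∈ S := by
    intro u j
    have hu : u ∈ Submodule.span K {u : ι → K | ∃ χ ∈ C, ∀ b, Matrix.vecMul u (e b) = χ b • u} := by
      rw [h]
      trivial
    induction hu using Submodule.span_induction with
    | mem u hu =>
      obtain ⟨χ, hχ, hu⟩ := hu
      refine hmem χ hχ _ (hmemE.2 fun b => ?_)
      rw [linD_linear_form, hu, Finset.smul_sum]
      simp only [Pi.smul_apply, smul_assoc]
    | zero => simp
    | add x y _ _ hx hy =>
      simp only [Pi.add_apply, add_smul, Finset.sum_add_distrib]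
      exact Submodule.add_mem _ hx hy
    | smul a x _ hx =>
      simp only [Pi.smul_apply, smul_assoc]
      rw [← Finset.smul_sum]
      exact Submodule.smul_mem _ _ hx
  rw [eq_top_iff]
  rintro P -
  induction P using MvPolynomial.induction_on with
  | C a =>
    refine hmem 0 C.zero_mem _ (hmemE.2 fun b => ?_)
    rw [← MvPolynomial.algebraMap_eq, Derivation.map_algebraMap]
    simp
  | add p q hp hq => exact Submodule.add_mem _ hp hq
  | mul_X p q hp =>
    refine hmul _ hp _ ?_
    have h3 : (X q : MvPolynomial (ι × ι) K) = ∑ i, (Pi.single q.1 1 : ι → K) i • X (i, q.2) := by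
      rw [Finset.sum_eq_single q.1]
      · simp
      · intro b _ hb
        simp [hb]
      · simp
    rw [h3]
    exact hX _ _

end

section
open Polynomial

variable {K ι : Type} [Field K] [Fintype ι] [DecidableEq ι]

/-- Elements of the Lie algebra are combinations of diagonalizable elements with constant
eigenvalues, up to a nilpotent. -/
theorem InG.exists_rational_parts (Ω : Type) [Field Ω] [Algebra K Ω] [CharZero K] [CharZero Ω]
    [IsAlgClosed Ω] [Algebra.IsAlgebraic K Ω]
    (hCl : ∀ z : Ω, z ∈ Submodule.span K {z : Ω | IsAlgebraic ℚ z}) {d : Derivation ℤ K K}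
    {A v : Matrix ι ι K} (hv : InG d A v) :
    ∃ (β : Type) (_ : Fintype β) (κ : β → K) (e : β → Matrix ι ι K) (n : Matrix ι ι K),
      v = ∑ b, κ b • e b + n ∧ IsNilpotent n ∧ (∀ b, InG d A (e b)) ∧
      (∀ b, ∃ m : ℚ[X], m.Separable ∧ aeval (e b) m = 0) := by
  obtain ⟨β, _, κ, e, n, hve, hn, hen, hee, hm, huniq, hspan⟩ := v.exists_rational_parts hCl
  refine ⟨β, inferInstance, κ, e, n, hve, hn, fun b P Q hQ hPQ => ?_, hm⟩
  have h1 := hv P Q hQ hPQ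
  set φ := MvPolynomial.map (σ := ι × ι) (algebraMap K Ω) with hφ
  have hinj : Function.Injective φ := MvPolynomial.map_injective _ (algebraMap K Ω).injective
  let C : AddSubmonoid (β → Ω) :=
    { carrier := {χ | ∀ b, IsAlgebraic ℚ (χ b)}
      add_mem' := fun h h' b => (h b).add (h' b)
      zero_mem' := fun b => isAlgebraic_zero }
  have hmap : ∀ {x y : Matrix ι ι K}, Commute x y →
      Commute (x.map (algebraMap K Ω)) (y.map (algebraMap K Ω)) := fun {x y} h =>
    h.map (algebraMap K Ω).mapMatrix
  have hnil : IsNilpotent (n.map (algebraMap K Ω)) := hn.map (algebraMap K Ω).mapMatrix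
  have hv' : v.map (algebraMap K Ω) =
      ∑ b, algebraMap K Ω (κ b) • (e b).map (algebraMap K Ω) + n.map (algebraMap K Ω) := by
    rw [hve]
    ext i j
    simp only [Matrix.map_apply, Matrix.add_apply, Matrix.sum_apply, Matrix.smul_apply, smul_eq_mul,
      map_add, map_sum, map_mul]
  have key := derivation_ratio_eq (fun b => linD ((e b).map (algebraMap K Ω)))
    (linD (n.map (algebraMap K Ω))) (fun b => algebraMap K Ω (κ b))
    (fun b b' => linD_commute (hmap (hee b b'))) (fun b => linD_commute (hmap (hen b))) C
    (fun χ hχ χ' hχ' h => huniq χ χ' hχ hχ' h)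
    (iSup_jointEigen_linD_eq_top (fun b => (e b).map (algebraMap K Ω)) C hspan)
    (linD_locally_nilpotent hnil) (P := φ P) (Q := φ Q)
    (fun h => hQ (hinj (h.trans (map_zero φ).symm))) (by
      rw [← linD_sum_add, ← hv', hφ, linD_map, linD_map, ← map_mul, ← map_mul, h1]) b
  rw [hφ, linD_map, linD_map, ← map_mul, ← map_mul] at key
  exact hinj key

end

section
open Polynomial

/-- The action of a derivation on a polynomial in an element which is horizontal up to a
commuting error. -/
theorem addMonoidHom_aeval {R : Type} [Ring R] [Algebra ℚ R] (D : R →+ R)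
    (hD : ∀ x y, D (x * y) = D x * y + x * D y) {a y z : R} (hy : D y = a * y - y * a + z)
    (hz : Commute y z) (q : ℚ[X]) :
    D (aeval y q) = a * aeval y q - aeval y q * a + aeval y (derivative q) * z := by
  have h1 : D 1 = 0 := by
    have := hD 1 1
    rw [mul_one, one_mul, mul_one, left_eq_add] at this
    exact this
  induction q using Polynomial.induction_on with
  | C r =>
    have : D (r • (1 : R)) = r • D 1 := map_rat_smul D r 1
    rw [h1, smul_zero] at this
    simp only [aeval_C, derivative_C, map_zero, zero_mul, add_zero, Algebra.commutes, sub_self]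
    rw [Algebra.algebraMap_eq_smul_one, this]
  | add p q hp hq =>
    rw [map_add, map_add, hp, hq, derivative_add, map_add]
    noncomm_ring
  | monomial n r h =>
    have h2 : C r * X ^ (n + 1) = (C r * X ^ n) * X := by rw [pow_succ, mul_assoc]
    rw [h2]
    generalize C r * X ^ n = q at h
    rw [derivative_mul, derivative_X, mul_one, map_mul, hD, h, map_add, map_mul, aeval_X, hy]
    have h4 : aeval y (derivative q) * y * z = aeval y (derivative q) * z * y := by
      rw [mul_assoc, hz.eq, mul_assoc]
    rw [add_mul, add_mul, h4]
    noncomm_ring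

theorem matrix_isSemisimple_ad {L ι : Type} [Field L] [CharZero L] [Fintype ι] [DecidableEq ι]
    {y : Matrix ι ι L} {m : ℚ[X]} (hm : m.Separable) (hy : aeval y m = 0) :
    Module.End.IsSemisimple (LinearMap.mulLeft L y - LinearMap.mulRight L y) := by
  have hsq : Squarefree (m.map (algebraMap ℚ L)) := (hm.map).squarefree
  have hy' : aeval y (m.map (algebraMap ℚ L)) = 0 := by rw [aeval_map_algebraMap, hy]
  have h1 : Module.End.IsSemisimple (LinearMap.mulLeft L y) := by
    refine Module.End.isSemisimple_of_squarefree_aeval_eq_zero hsq ?_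
    have h := aeval_algHom_apply (Algebra.lmul L (Matrix ι ι L)) y (m.map (algebraMap ℚ L))
    rw [hy', map_zero] at h
    exact h
  have h2 : Module.End.IsSemisimple (LinearMap.mulRight L y) := by
    refine Module.End.isSemisimple_of_squarefree_aeval_eq_zero hsq ?_
    have h : ∀ q : Polynomial L, aeval (LinearMap.mulRight L y) q =
        LinearMap.mulRight L (aeval y q) := by
      intro q
      induction q using Polynomial.induction_on' with
      | add p q hp hq => rw [map_add, map_add, hp, hq]; ext; simp [mul_add]
      | monomial n a =>
        ext1 x
        simp [aeval_monomial, LinearMap.pow_mulRight, Algebra.algebraMap_eq_smul_one]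
    rw [h, hy']
    simp
  exact h1.sub_of_commute (LinearMap.commute_mulLeft_right y y) h2
end

section
open Polynomial

variable {L ι : Type} [Field L] [CharZero L] [Fintype ι] [DecidableEq ι]

/-- A derivation moves a semisimple matrix with rational eigenvalues by a bracket. -/
theorem exists_bracket_of_derivation {y : Matrix ι ι L} {m : ℚ[X]} (hm : m.Separable)
    (hy : aeval y m = 0) (S : Submodule L (Matrix ι ι L)) (hS : ∀ w ∈ S, y * w - w * y ∈ S)
    (D : Derivation ℤ L L) (hD : y.map D ∈ S) : ∃ w ∈ S, y.map D = w * y - y * w := by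
  set T : Module.End L (Matrix ι ι L) := LinearMap.mulLeft L y - LinearMap.mulRight L y with hT
  have hTs : T.IsSemisimple := matrix_isSemisimple_ad hm hy
  have hinv : S ∈ Module.End.invtSubmodule T := by
    rw [Module.End.mem_invtSubmodule]
    exact fun w hw => hS w hw
  have hR := hTs.restrict hinv
  set R := T.restrict hinv with hRdef
  rw [Module.End.isSemisimple_iff] at hR
  obtain ⟨Q, hQ1, hQ2⟩ := hR (LinearMap.range R) (by
    intro x _; exact ⟨x, rfl⟩)
  have hz : (⟨y.map D, hD⟩ : S) ∈ LinearMap.range R ⊔ Q := by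
    rw [hQ2.codisjoint.eq_top]; trivial
  obtain ⟨_, ⟨w, rfl⟩, z0, hz0, hsum⟩ := Submodule.mem_sup.1 hz
  have hRz0 : R z0 = 0 := by
    have h1 : R z0 ∈ Q := hQ1 hz0
    have := hQ2.disjoint.le_bot (x := R z0) ⟨⟨z0, rfl⟩, h1⟩
    simpa using this
  have hcomm : y * z0 - z0 * y = 0 := congrArg Subtype.val hRz0
  have hDy : y.map D = y * w - w * y + z0 := (congrArg Subtype.val hsum).symm
  let δ : Matrix ι ι L →+ Matrix ι ι L := D.toLinearMap.toAddMonoidHom.mapMatrix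
  have hδ : ∀ M, δ M = M.map D := fun _ => rfl
  have h := addMonoidHom_aeval δ (fun x y => by rw [hδ, hδ, hδ, D.map_matrix_mul])
    (a := -w.1) (y := y) (z := z0.1) (by rw [hδ, hDy]; noncomm_ring) (sub_eq_zero.1 hcomm) m
  rw [hy, map_zero, mul_zero, zero_mul, sub_zero, zero_add] at h
  obtain ⟨a, b, hab⟩ := hm
  have h1 := congrArg (aeval y) hab
  rw [map_add, map_mul, hy, mul_zero, zero_add, map_one, map_mul] at h1
  have hz00 : (z0 : Matrix ι ι L) = 0 := by
    rw [← one_mul (z0 : Matrix ι ι L), ← h1, mul_assoc, ← h, mul_zero]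
  refine ⟨-w, S.neg_mem w.2, ?_⟩
  rw [hDy, hz00]
  noncomm_ring
end

/-- In an extension generated by a horizontal matrix of the Lie algebra which is semisimple with
rational eigenvalues, all constants are algebraic. -/
theorem isAlgebraic_of_horizontal {K L ι : Type} [Field K] [CharZero K] [Field L] [Algebra K L]
    [CharZero L] [Fintype ι] [DecidableEq ι] {d : Derivation ℤ K K} {dL : Derivation ℤ L L}
    (hd : Extends d dL) {A : Matrix ι ι K} {y : Matrix ι ι L}
    (hy : y.map dL = A.map (algebraMap K L) * y - y * A.map (algebraMap K L))
    {m : Polynomial ℚ} (hm : m.Separable) (hym : Polynomial.aeval y m = 0)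
    (hyG : y ∈ Submodule.span L ((fun v : Matrix ι ι K => v.map (algebraMap K L)) '' {v | InG d A v}))
    (hgen : IntermediateField.adjoin K (Set.range fun q : ι × ι => y q.1 q.2) = ⊤)
    {c : L} (hc : dL c = 0) : IsAlgebraic K c := by
  by_contra htr
  set S := Submodule.span L
    ((fun v : Matrix ι ι K => v.map (algebraMap K L)) '' {v | InG d A v}) with hSdef
  have hind : AlgebraicIndependent K (fun _ : Unit => c) :=
    algebraicIndependent_unique_type_iff.2 htr
  obtain ⟨D, hDK, hDc⟩ := exists_derivation_algebraicIndependent (0 : Derivation ℤ K L) hind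
    (fun _ => 1)
  replace hDc : D c = 1 := hDc ()
  have hDS : ∀ w ∈ S, w.map D ∈ S := by
    intro w hw
    induction hw using Submodule.span_induction with
    | mem w hw =>
      obtain ⟨v, hv, rfl⟩ := hw
      convert S.zero_mem using 1
      ext i j
      simp [hDK]
    | zero => convert S.zero_mem using 1; ext i j; simp
    | add u w _ _ hu hw =>
      convert S.add_mem hu hw using 1
      ext i j; simp
    | smul a w h hw =>
      convert S.add_mem (S.smul_mem a hw) (S.smul_mem (D a) h) using 1
      ext i j; simp [mul_comm]
  have hbr : ∀ u ∈ S, ∀ w ∈ S, u * w - w * u ∈ S := by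
    intro u hu w hw
    induction hu using Submodule.span_induction with
    | mem u hu =>
      obtain ⟨v, hv, rfl⟩ := hu
      induction hw using Submodule.span_induction with
      | mem w hw =>
        obtain ⟨v', hv', rfl⟩ := hw
        refine Submodule.subset_span ⟨_, InG.lie hv hv', ?_⟩
        simp only [← RingHom.mapMatrix_apply]
        rw [map_sub, map_mul, map_mul]
      | zero => simp
      | add x y _ _ hx hy =>
        convert S.add_mem hx hy using 1; noncomm_ring
      | smul a w h hw =>
        convert S.smul_mem a hw using 1
        rw [Matrix.mul_smul, Matrix.smul_mul, smul_sub]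
    | zero => simp
    | add x y _ _ hx hy =>
      convert S.add_mem hx hy using 1; noncomm_ring
    | smul a x h hx =>
      convert S.smul_mem a hx using 1
      rw [Matrix.mul_smul, Matrix.smul_mul, smul_sub]
  obtain ⟨w, hw, hwy⟩ := exists_bracket_of_derivation hm hym S (fun u hu => hbr _ hyG _ hu) D
    (hDS y hyG)
  obtain ⟨Λ, _, _, dΛ, X, hΛ, hdet, hX, hXi⟩ :=
    exists_generic_fundamental dL (A.map (algebraMap K L))
  let _ : Algebra K Λ := ((algebraMap L Λ).comp (algebraMap K L)).toAlgebra
  have : IsScalarTower K L Λ := IsScalarTower.of_algebraMap_eq fun _ => rfl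
  have hdΛ : Extends d dΛ := fun a => by
    rw [IsScalarTower.algebraMap_apply K L Λ, IsScalarTower.algebraMap_apply K L Λ, hΛ, hd]
  have hAK : (A.map (algebraMap K L)).map (algebraMap L Λ) = A.map (algebraMap K Λ) := by
    ext; simp [IsScalarTower.algebraMap_apply K L Λ]
  rw [hAK] at hX
  have hXK := hXi.restrictScalars (algebraMap K L).injective
  set φ := (algebraMap L Λ).mapMatrix (m := ι) with hφ
  -- the derivation of `Λ` attached to a combination of elements of the Lie algebra
  have hE : ∀ w ∈ S, ∃ E : Derivation ℤ Λ Λ, (∀ a, E (algebraMap K Λ a) = 0) ∧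
      (∀ c, dΛ c = 0 → E c = 0) ∧ X.map E = φ w * X := by
    intro w hw
    induction hw using Submodule.span_induction with
    | mem w hw =>
      obtain ⟨v, hv, rfl⟩ := hw
      obtain ⟨E, h1, h2, h3⟩ := InG.exists_derivation hdΛ X hv hX hXK
      refine ⟨E, h1, h2, ?_⟩
      rw [h3]
      congr 1
    | zero => exact ⟨0, fun _ => rfl, fun _ _ => rfl, by ext; simp⟩
    | add u w _ _ hu hw =>
      obtain ⟨E, h1, h2, h3⟩ := hu
      obtain ⟨E', h1', h2', h3'⟩ := hw
      refine ⟨E + E', fun a => by simp [h1, h1'], fun c hc => by simp [h2 c hc, h2' c hc], ?_⟩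
      rw [map_add, add_mul, ← h3, ← h3']
      rfl
    | smul a w _ hw =>
      obtain ⟨E, h1, h2, h3⟩ := hw
      refine ⟨algebraMap L Λ a • E, fun a => by simp [h1], fun c hc => by simp [h2 c hc], ?_⟩
      have : φ (a • w) = algebraMap L Λ a • φ w := by ext; simp [hφ]
      rw [this, Matrix.smul_mul, ← h3]
      rfl
  obtain ⟨E, hE1, hE2, hE3⟩ := hE w hw
  -- `E` and `D` agree on `y`
  have hφd : ∀ M : Matrix ι ι L, (φ M).map dΛ = φ (M.map dL) := fun M => by
    ext i j; simp [hφ, hΛ (M i j)]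
  have hXX : X * X⁻¹ = 1 := Matrix.mul_nonsing_inv _ hdet
  have hX'X : X⁻¹ * X = 1 := Matrix.nonsing_inv_mul _ hdet
  have hyX : φ y * X = X * (X⁻¹ * φ y * X) := by
    rw [← mul_assoc, ← mul_assoc, hXX, one_mul]
  have hφA : φ (A.map (algebraMap K L)) = A.map (algebraMap K Λ) := hAK
  have hφy : (φ y).map dΛ = A.map (algebraMap K Λ) * φ y - φ y * A.map (algebraMap K Λ) := by
    rw [hφd, hy, map_sub, map_mul, map_mul, hφA]
  set h := X⁻¹ * φ y * X with hh
  have hh0 : h.map dΛ = 0 := by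
    have h1 := congrArg (fun M : Matrix ι ι Λ => M.map dΛ) hyX
    simp only [Derivation.map_matrix_mul] at h1
    rw [hX, hφy] at h1
    have h2 : X * h.map dΛ = 0 := by
      have : A.map (algebraMap K Λ) * X * h = A.map (algebraMap K Λ) * φ y * X := by
        rw [mul_assoc, ← hyX, mul_assoc]
      rw [this] at h1
      have h3 := congrArg (fun M => M - A.map (algebraMap K Λ) * φ y * X) h1
      simp only [add_sub_cancel_left] at h3
      rw [← h3]
      noncomm_ring
    rw [← one_mul (h.map dΛ), ← hX'X, mul_assoc, h2, mul_zero]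
  have hhE : h.map E = 0 := by
    ext i j
    exact hE2 _ (congrFun (congrFun hh0 i) j)
  have hEy : (φ y).map E = φ (y.map D) := by
    have h1 := congrArg (fun M : Matrix ι ι Λ => M.map E) hyX
    simp only [Derivation.map_matrix_mul] at h1
    rw [hE3, hhE, mul_zero, add_zero, mul_assoc _ X, ← hyX] at h1
    have h2 : ((φ y).map E) * X = (φ w * φ y - φ y * φ w) * X := by
      rw [sub_mul, mul_assoc (φ w), ← h1]; noncomm_ring
    have h3 := congrArg (· * X⁻¹) h2
    simp only [mul_assoc, hXX, mul_one] at h3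
    rw [h3, hwy, map_sub, map_mul, map_mul]
  have hagree := Derivation.eq_zero_of_adjoin (A := K)
    (E.compAlgebraMap L - D.baseTo Λ) (s := Set.range fun q : ι × ι => y q.1 q.2)
    (fun a => ?_) ?_ (x := c) (by rw [hgen]; trivial)
  · rw [Derivation.sub_apply, Derivation.baseTo_apply, hDc, map_one, sub_eq_zero] at hagree
    have : E (algebraMap L Λ c) = 0 := hE2 _ (by rw [hΛ, hc, map_zero])
    exact zero_ne_one (this.symm.trans hagree)
  · have : E (algebraMap L Λ (algebraMap K L a)) = 0 := hE1 a
    rw [Derivation.sub_apply, Derivation.baseTo_apply, hDK]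
    change E (algebraMap L Λ (algebraMap K L a)) - algebraMap L Λ 0 = 0
    rw [this, map_zero, sub_zero]
  · rintro _ ⟨q, rfl⟩
    rw [Derivation.sub_apply, sub_eq_zero]
    exact congrFun (congrFun hEy q.1) q.2

/-- The differential extension `L` of `K` has no new constants. -/
def NoNewConst {K L : Type} [Field K] [Field L] [Algebra K L] (d : Derivation ℤ K K)
    (dL : Derivation ℤ L L) : Prop :=
  ∀ x : L, dL x = 0 → ∃ a : K, d a = 0 ∧ algebraMap K L a = x

theorem mem_span_image_of_forall {K L ι : Type} [Field K] [Field L] [Algebra K L] [Fintype ι]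
    [DecidableEq ι] (S : Submodule K (Matrix ι ι K)) (M : Matrix ι ι L)
    (h : ∀ φ : Matrix ι ι K →ₗ[K] K, (∀ v ∈ S, φ v = 0) →
      ∑ i, ∑ j, algebraMap K L (φ (Matrix.single i j 1)) * M i j = 0) :
    M ∈ Submodule.span L ((fun v : Matrix ι ι K => v.map (algebraMap K L)) '' S) := by
  obtain ⟨r, e, v, he, hM⟩ := exists_matrix_expansion (K := K) M
  have hφM : ∀ φ : Matrix ι ι K →ₗ[K] K,
      ∑ i, ∑ j, algebraMap K L (φ (Matrix.single i j 1)) * M i j = ∑ a, φ (v a) • e a := by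
    intro φ
    have hφ : ∀ w, φ w = ∑ i, ∑ j, φ (Matrix.single i j 1) * w i j := by
      intro w
      conv_lhs => rw [Matrix.matrix_eq_sum_single w]
      simp only [map_sum]
      refine Finset.sum_congr rfl fun i _ => Finset.sum_congr rfl fun j _ => ?_
      have : Matrix.single i j (w i j) = w i j • Matrix.single i j (1 : K) := by simp
      rw [this, map_smul, smul_eq_mul, mul_comm]
    have hM' : ∀ i j, M i j = ∑ a, e a * algebraMap K L (v a i j) := fun i j => by
      rw [hM, Matrix.sum_apply]; rfl
    simp_rw [hM', Finset.mul_sum, Algebra.smul_def]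
    simp_rw [fun a => hφ (v a), map_sum, Finset.sum_mul]
    rw [Finset.sum_comm_cycle]
    refine Finset.sum_congr rfl fun a _ => Finset.sum_congr rfl fun i _ =>
      Finset.sum_congr rfl fun j _ => ?_
    rw [map_mul]
    ring
  rw [hM]
  refine Submodule.sum_mem _ fun a _ => Submodule.smul_mem _ _ (Submodule.subset_span ⟨v a, ?_, rfl⟩)
  by_contra hva
  obtain ⟨φ, hφ, hS⟩ := Submodule.exists_le_ker_of_notMem hva
  have h1 := h φ fun v hv => hS hv
  rw [hφM] at h1
  exact hφ (Fintype.linearIndependent_iff.1 he _ h1 a)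

theorem NoNewConst.of_powerSeries {K : Type} [Field K] [CharZero K] {d : Derivation ℤ K K}
    {L : IntermediateField K (PSField K)} {dL : Derivation ℤ L L} (hd : Extends d dL)
    (h : ∀ c : L, dL c = 0 → IsAlgebraic K c) : NoNewConst d dL := by
  intro c hc
  have h1 : IsAlgebraic K (c : PSField K) := (h c hc).algebraMap
  obtain ⟨a, ha⟩ := psField_mem_of_isAlgebraic h1
  have h2 : algebraMap K L a = c := Subtype.ext ha
  refine ⟨a, ?_, h2⟩
  rw [← h2, hd] at hc
  exact (map_eq_zero _).1 hc

/-- The restriction of a derivation to a differential subfield generated by given elements. -/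
theorem exists_derivation_adjoin {K Λ : Type} [Field K] [Field Λ] [Algebra K Λ]
    {d : Derivation ℤ K K} {dΛ : Derivation ℤ Λ Λ} (hd : Extends d dΛ) (s : Set Λ)
    (hs : ∀ x ∈ s, dΛ x ∈ IntermediateField.adjoin K s) :
    ∃ dL : Derivation ℤ (IntermediateField.adjoin K s) (IntermediateField.adjoin K s),
      Extends d dL ∧ ∀ x, (dL x : Λ) = dΛ x := by
  set L := IntermediateField.adjoin K s with hL
  have key : ∀ x ∈ L, dΛ x ∈ L := by
    intro x hx
    induction hx using IntermediateField.adjoin_induction with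
    | mem x hx => exact hs x hx
    | algebraMap a => rw [hd]; exact L.algebraMap_mem _
    | add x y hx hy h1 h2 => rw [map_add]; exact L.add_mem h1 h2
    | inv x hx h1 =>
      rw [Derivation.leibniz_inv, smul_eq_mul]
      exact L.mul_mem (L.neg_mem (pow_mem (L.inv_mem hx) 2)) h1
    | mul x y hx hy h1 h2 =>
      rw [Derivation.leibniz]
      exact L.add_mem (L.mul_mem hx h2) (L.mul_mem hy h1)
  let dL : Derivation ℤ L L := Derivation.mk'
    (AddMonoidHom.toIntLinearMap
      { toFun := fun x => ⟨dΛ x, key x x.2⟩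
        map_zero' := Subtype.ext (map_zero dΛ)
        map_add' := fun a b => Subtype.ext (map_add dΛ a.1 b.1) })
    fun a b => Subtype.ext (dΛ.leibniz a.1 b.1)
  exact ⟨dL, fun a => Subtype.ext (hd a), fun _ => rfl⟩

section
open PowerSeries

/-- The power series solution of `y' = [A, y]` through a given matrix. -/
theorem exists_powerSeries_bracket {K ι : Type} [Field K] [CharZero K] [Fintype ι] [DecidableEq ι]
    {d : Derivation ℤ K K} {A e : Matrix ι ι K} (he : InG d A e) {m : Polynomial ℚ}
    (hm : Polynomial.aeval e m = 0) :
    ∃ y : Matrix ι ι (PowerSeries K), y.map (constantCoeff (R := K)) = e ∧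
      y.map (psDeriv d) = A.map (C (R := K)) * y - y * A.map (C (R := K)) ∧
      Polynomial.aeval y m = 0 ∧ ∀ j, InG d A (y.map (coeff (R := K) j)) := by
  let T : ℕ → (ι × ι → K) → ι × ι → K := fun _ v q =>
    (A * Matrix.of (fun i l => v (i, l)) - Matrix.of (fun i l => v (i, l)) * A -
      (Matrix.of (fun i l => v (i, l))).map d) q.1 q.2
  have hrec : ∀ z : Matrix ι ι (PowerSeries K),
      z.map (psDeriv d) = A.map (C (R := K)) * z - z * A.map (C (R := K)) ↔
      ∀ (j : ℕ) (q : ι × ι), ((j : K) + 1) * coeff (j + 1) (z q.1 q.2) =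
        T j (fun l => coeff j (z l.1 l.2)) q := by
    intro z
    have hAz : ∀ j i l, coeff j ((A.map (C (R := K)) * z - z * A.map (C (R := K))) i l) =
        (A * z.map (coeff (R := K) j) - z.map (coeff (R := K) j) * A) i l := by
      intro j i l
      simp [Matrix.mul_apply, coeff_C_mul, coeff_mul_C]
    constructor
    · intro h j q
      have h1 := congrArg (coeff j) (congrFun (congrFun h q.1) q.2)
      rw [hAz, Matrix.map_apply, coeff_psDeriv] at h1
      rw [eq_sub_of_add_eq' h1]
      rfl
    · intro h
      ext i l j
      rw [hAz, Matrix.map_apply, coeff_psDeriv, h j (i, l)]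
      exact add_sub_cancel _ _
  obtain ⟨y0, hy0, hy1⟩ := exists_powerSeries_recursion T (fun q => e q.1 q.2)
  let y : Matrix ι ι (PowerSeries K) := Matrix.of fun i l => y0 (i, l)
  have hy : y.map (psDeriv d) = A.map (C (R := K)) * y - y * A.map (C (R := K)) :=
    (hrec y).2 hy1
  have hye : y.map (constantCoeff (R := K)) = e := by
    ext i l; exact hy0 (i, l)
  refine ⟨y, hye, hy, ?_, fun j => ?_⟩
  · have hδ := addMonoidHom_aeval (psDeriv d).mapMatrix (a := A.map (C (R := K))) (y := y) (z := 0)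
      (fun M N => ?_) (by rw [add_zero]; exact hy) (Commute.zero_right _) m
    · rw [mul_zero, add_zero] at hδ
      have h0 := powerSeries_recursion_eq_zero T (fun _ => ?_)
        (fun q => (Polynomial.aeval y m) q.1 q.2) ?_ ((hrec _).1 hδ)
      · ext1 i l
        exact congrFun h0 (i, l)
      · funext q
        have : (Matrix.of fun i l => (0 : ι × ι → K) (i, l)) = (0 : Matrix ι ι K) := rfl
        simp only [T, this]
        simp [Matrix.map_zero]
      · intro q
        have h1 := Polynomial.map_aeval_eq_aeval_map (φ := RingHom.id ℚ)
          (ψ := (constantCoeff (R := K)).mapMatrix (m := ι)) (Subsingleton.elim _ _) m y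
        rw [Polynomial.map_id, RingHom.mapMatrix_apply (constantCoeff (R := K)) y, hye, hm] at h1
        exact congrFun (congrFun h1 q.1) q.2
    · ext1 i l
      simp only [AddMonoidHom.mapMatrix_apply, Matrix.map_apply, Matrix.mul_apply, Matrix.add_apply,
        map_sum, psDeriv_mul, Finset.sum_add_distrib]
      rw [add_comm]
      congr 1
      exact Finset.sum_congr rfl fun _ _ => mul_comm _ _
  · induction j with
    | zero =>
      convert he using 1
      rw [← hye]
      ext i l
      simp
    | succ j ih =>
      have h1 := InG.lin (InG.nabla ih) (InG.zero d A) (-((j : K) + 1)⁻¹) 0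
      convert h1 using 1
      ext i l
      have h2 := hy1 j (i, l)
      have h3 : (j : K) + 1 ≠ 0 := by exact_mod_cast Nat.succ_ne_zero j
      have h4 : coeff (j + 1) (y i l) = ((j : K) + 1)⁻¹ * T j (fun l => coeff j (y0 l)) (i, l) := by
        rw [← h2, inv_mul_cancel_left₀ h3]; rfl
      rw [Matrix.map_apply, h4]
      have h5 : (Matrix.of fun i l => coeff j (y0 (i, l))) = y.map (coeff (R := K) j) := rfl
      simp only [T, h5, zero_smul, add_zero, Matrix.smul_apply, Matrix.sub_apply, smul_eq_mul]
      ring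
end

section
open PowerSeries

/-- Extension of a semisimple element of the Lie algebra to a horizontal matrix, in a `p`-adic
differential extension without new constants. -/
theorem exists_horizontal_extension {p : ℕ} (hp : p.Prime) {K ι : Type} [Field K] [CharZero K]
    [Fintype ι] [DecidableEq ι] (hK : IsPAdicField p K) (Ω : Type) [Field Ω] [Algebra K Ω]
    {d : Derivation ℤ K K} {A e : Matrix ι ι K} (he : InG d A e) {m : Polynomial ℚ} (hm : m.Separable)
    (hem : Polynomial.aeval e m = 0) :
    ∃ (L : Type) (_ : Field L) (_ : CharZero L) (_ : Algebra K L) (dL : Derivation ℤ L L)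
      (y : Matrix ι ι L) (Θ : Type) (_ : Field Θ) (i : L →+* Θ) (j : Ω →+* Θ),
      Extends d dL ∧ NoNewConst d dL ∧ IsPAdicField p L ∧
      (∀ a : K, i (algebraMap K L a) = j (algebraMap K Ω a)) ∧
      y.map dL = A.map (algebraMap K L) * y - y * A.map (algebraMap K L) ∧ Polynomial.aeval y m = 0 ∧
      y ∈ Submodule.span L
        ((fun v : Matrix ι ι K => v.map (algebraMap K L)) '' {v | InG d A v}) ∧
      ∀ (u : ι → Ω) (c : Ω), (y.map i).mulVec (j ∘ u) = j c • (j ∘ u) →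
        (e.map (algebraMap K Ω)).mulVec u = c • u := by
  obtain ⟨y, hye, hyd, hym, hyG⟩ := exists_powerSeries_bracket he hem
  set F := PSField K
  set φ := algebraMap (PowerSeries K) F with hφ
  set Y : Matrix ι ι F := y.map φ with hY
  have hφC : ∀ M : Matrix ι ι K, (M.map (C (R := K))).map φ = M.map (algebraMap K F) := fun M => by
    ext i j
    rfl
  have hYd : Y.map (psfDeriv d) = A.map (algebraMap K F) * Y - Y * A.map (algebraMap K F) := by
    have h1 : Y.map (psfDeriv d) = φ.mapMatrix (y.map (psDeriv d)) := by
      ext i j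
      exact psfDeriv_algebraMap d (y i j)
    rw [h1, hyd, map_sub, map_mul, map_mul, RingHom.mapMatrix_apply, hφC]
    rfl
  set s := Set.range fun q : ι × ι => Y q.1 q.2 with hs
  have hsmem : ∀ i j, Y i j ∈ IntermediateField.adjoin K s := fun i j =>
    IntermediateField.subset_adjoin K s ⟨(i, j), rfl⟩
  let L := IntermediateField.adjoin K s
  obtain ⟨dL, hdL, hdL'⟩ : ∃ dL : Derivation ℤ L L, Extends d dL ∧ ∀ x, (dL x : F) = psfDeriv d x :=
    exists_derivation_adjoin (extends_psfDeriv d) s (by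
    rintro _ ⟨q, rfl⟩
    have h1 : psfDeriv d (Y q.1 q.2) = _ := congrFun (congrFun hYd q.1) q.2
    dsimp only
    rw [h1, Matrix.sub_apply, Matrix.mul_apply, Matrix.mul_apply]
    refine sub_mem (sum_mem fun l _ => mul_mem (IntermediateField.algebraMap_mem _ _) (hsmem _ _))
      (sum_mem fun l _ => mul_mem (hsmem _ _) (IntermediateField.algebraMap_mem _ _)))
  let yL : Matrix ι ι L := Matrix.of fun i j => ⟨Y i j, hsmem i j⟩
  have hyL : yL.map (algebraMap L F) = Y := rfl
  have hinj : Function.Injective fun M : Matrix ι ι L => M.map (algebraMap L F) :=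
    Matrix.map_injective (algebraMap L F).injective
  have hyLd : yL.map dL = A.map (algebraMap K L) * yL - yL * A.map (algebraMap K L) := by
    apply hinj
    have h1 : (yL.map dL).map (algebraMap L F) = Y.map (psfDeriv d) := by
      ext i j
      exact hdL' (yL i j)
    have h2 : (A.map (algebraMap K L)).map (algebraMap L F) = A.map (algebraMap K F) := rfl
    dsimp only
    rw [h1, hYd]
    simp only [← RingHom.mapMatrix_apply (algebraMap L F)]
    rw [map_sub, map_mul, map_mul]
    rfl
  have hyLm : Polynomial.aeval yL m = 0 := by
    apply hinj
    have h1 := Polynomial.map_aeval_eq_aeval_map (φ := RingHom.id ℚ)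
      (ψ := (algebraMap L F).mapMatrix (m := ι)) (Subsingleton.elim _ _) m yL
    have h2 := Polynomial.map_aeval_eq_aeval_map (φ := RingHom.id ℚ)
      (ψ := φ.mapMatrix (m := ι)) (Subsingleton.elim _ _) m y
    rw [Polynomial.map_id] at h1 h2
    rw [hym, map_zero] at h2
    simp only [← RingHom.mapMatrix_apply (algebraMap L F)]
    rw [h1, map_zero]
    exact h2.symm
  have hspan : yL ∈ Submodule.span L
      ((fun v : Matrix ι ι K => v.map (algebraMap K L)) '' {v | InG d A v}) := by
    refine mem_span_image_of_forall (inGSubmodule d A) yL fun f hf => ?_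
    apply (algebraMap L F).injective
    have h1 : ∑ i, ∑ j, C (f (Matrix.single i j 1)) * y i j = 0 := by
      ext n
      have h2 := hf _ (hyG n)
      rw [Matrix.matrix_eq_sum_single (y.map (coeff (R := K) n))] at h2
      simp only [map_sum] at h2 ⊢
      rw [map_zero, ← h2]
      refine Finset.sum_congr rfl fun i _ => Finset.sum_congr rfl fun j _ => ?_
      have : Matrix.single i j (y.map (coeff (R := K) n) i j) =
        coeff n (y i j) • Matrix.single i j (1 : K) := by simp
      rw [this, map_smul, smul_eq_mul, coeff_C_mul, mul_comm]
    have h3 := congrArg φ h1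
    simp only [map_sum, map_mul, map_zero] at h3 ⊢
    exact h3
  have hgen : IntermediateField.adjoin K (Set.range fun q : ι × ι => yL q.1 q.2) = ⊤ := by
    apply IntermediateField.map_injective L.val
    rw [IntermediateField.adjoin_map, ← Set.range_comp, ← AlgHom.fieldRange_eq_map,
      IntermediateField.fieldRange_val]
    rfl
  have : CharZero L := charZero_of_injective_algebraMap (algebraMap K L).injective
  let μ : PowerSeries K →+* PowerSeries Ω := PowerSeries.map (algebraMap K Ω)
  have hμ : Function.Injective μ := by
    intro a b h
    ext n
    have := congrArg (coeff n) h
    rw [coeff_map, coeff_map] at this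
    exact (algebraMap K Ω).injective this
  let ψ : F →+* PSField Ω := IsFractionRing.map hμ
  have hψ : ∀ f, ψ (φ f) = algebraMap (PowerSeries Ω) (PSField Ω) (μ f) := fun f =>
    IsLocalization.map_eq _ f
  have hψK : ∀ a : K, ψ (algebraMap K F a) = algebraMap Ω (PSField Ω) (algebraMap K Ω a) := fun a => by
    rw [psField_algebraMap, hψ, psField_algebraMap]
    congr 1
    exact PowerSeries.map_C _ _
  refine ⟨L, inferInstance, this, inferInstance, dL, yL, PSField Ω, inferInstance,
    ψ.comp (algebraMap L F), algebraMap Ω (PSField Ω), hdL,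
    NoNewConst.of_powerSeries hdL fun c hc =>
      isAlgebraic_of_horizontal hdL hyLd hm hyLm hspan hgen hc,
    IsPAdicField.of_ringHom hp (algebraMap L F) (psField_isPAdicField hp hK), hψK, hyLd, hyLm, hspan, ?_⟩
  intro u c h
  funext a
  have h1 := congrFun h a
  simp only [Matrix.mulVec, dotProduct, Matrix.map_apply, Function.comp_apply, Pi.smul_apply,
    smul_eq_mul] at h1 ⊢
  have h2 : ∑ b, μ (y a b) * C (u b) = C c * C (u a) := by
    apply psField_injective
    rw [map_sum]
    simp only [map_mul]
    simp only [← hψ, ← psField_algebraMap]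
    exact h1
  have h3 := congrArg (constantCoeff (R := Ω)) h2
  simp only [map_sum, map_mul, constantCoeff_C] at h3
  rw [← h3]
  refine Finset.sum_congr rfl fun b _ => ?_
  congr 1
  rw [← hye, Matrix.map_apply, ← coeff_zero_eq_constantCoeff_apply,
    ← coeff_zero_eq_constantCoeff_apply, coeff_map]
end

theorem NoNewConst.trans {K L M : Type} [Field K] [Field L] [Field M] [Algebra K L] [Algebra L M]
    [Algebra K M] [IsScalarTower K L M] {d : Derivation ℤ K K} {dL : Derivation ℤ L L}
    {dM : Derivation ℤ M M} (h : NoNewConst d dL) (h' : NoNewConst dL dM) : NoNewConst d dM := by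
  intro x hx
  obtain ⟨b, hb, rfl⟩ := h' x hx
  obtain ⟨a, ha, rfl⟩ := h b hb
  exact ⟨a, ha, IsScalarTower.algebraMap_apply K L M a⟩

theorem Extends.trans {K L M : Type} [Field K] [Field L] [Field M] [Algebra K L] [Algebra L M]
    [Algebra K M] [IsScalarTower K L M] {d : Derivation ℤ K K} {dL : Derivation ℤ L L}
    {dM : Derivation ℤ M M} (h : Extends d dL) (h' : Extends dL dM) : Extends d dM := by
  intro a
  rw [IsScalarTower.algebraMap_apply K L M, h', h, ← IsScalarTower.algebraMap_apply K L M]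

theorem IsPAdicallyClosed.of_ringEquiv {p : ℕ} (hp : p.Prime) {F E : Type} [Field F] [CharZero F]
    [Field E] (e : F ≃+* E) (h : IsPAdicallyClosed p F) : IsPAdicallyClosed p E := by
  have : CharZero E := charZero_of_injective_ringHom (f := e.toRingHom) e.injective
  refine ⟨IsPAdicField.of_ringHom hp e.symm.toRingHom h.1, fun M _ _ hM hMp => ?_⟩
  let _ : Algebra F M := ((algebraMap E M).comp e.toRingHom).toAlgebra
  have hFM : ∀ a, algebraMap F M a = algebraMap E M (e a) := fun _ => rfl
  have halg : Algebra.IsAlgebraic F M := by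
    refine ⟨fun x => ?_⟩
    obtain ⟨P, hP, hx⟩ := hM.isAlgebraic x
    refine ⟨P.map e.symm.toRingHom, (Polynomial.map_ne_zero_iff e.symm.injective).2 hP, ?_⟩
    rw [Polynomial.aeval_def, Polynomial.eval₂_map]
    have h1 : (algebraMap F M).comp e.symm.toRingHom = algebraMap E M := by
      ext a
      simp [hFM]
    rw [h1]
    exact hx
  intro x
  obtain ⟨a, ha⟩ := h.2 M halg hMp x
  exact ⟨e a, ha⟩

theorem NoNewConst.isPAdicallyClosed {p : ℕ} (hp : p.Prime) {K L : Type} [Field K] [CharZero K]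
    [Field L] [Algebra K L] {d : Derivation ℤ K K} {dL : Derivation ℤ L L} (hd : Extends d dL)
    (h : NoNewConst d dL) (hc : IsPAdicallyClosed p d.kerField) : IsPAdicallyClosed p dL.kerField := by
  let f : d.kerField →+* dL.kerField :=
    ((algebraMap K L).comp d.kerField.subtype).codRestrict dL.kerField fun a => by
      rw [Derivation.mem_kerField]
      simp only [RingHom.comp_apply]
      rw [hd]
      have : d (d.kerField.subtype a) = 0 := (Derivation.mem_kerField d).1 a.2
      rw [this, map_zero]
  refine IsPAdicallyClosed.of_ringEquiv hp (RingEquiv.ofBijective f ⟨f.injective, fun x => ?_⟩) hc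
  obtain ⟨a, ha, hx⟩ := h x ((Derivation.mem_kerField dL).1 x.2)
  exact ⟨⟨a, (Derivation.mem_kerField d).2 ha⟩, Subtype.ext hx⟩

/-- Constants of a differential extension that are algebraic over the base are algebraic over the
constants of the base. -/
theorem isAlgebraic_kerField {K L : Type} [Field K] [Field L] [Algebra K L]
    {d : Derivation ℤ K K} {dL : Derivation ℤ L L} (hd : Extends d dL) {c : L} (hc : dL c = 0)
    (h : IsAlgebraic K c) : IsAlgebraic d.kerField c := by
  by_contra hn
  obtain ⟨P, hP, hPc⟩ := h
  have hlin := linearIndependent_of_const hd (P.natDegree + 1) (fun i => c ^ (i : ℕ))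
    (fun i => by rw [Derivation.leibniz_pow, hc, smul_zero, smul_zero]) fun g hg h0 => by
      let G : Fin (P.natDegree + 1) → d.kerField := fun i =>
        ⟨g i, (Derivation.mem_kerField d).2 (hg i)⟩
      have h1 : ∑ i : Fin (P.natDegree + 1), Polynomial.monomial (i : ℕ) (G i) = 0 := by
        apply transcendental_iff.1 hn
        rw [← h0, map_sum]
        exact Finset.sum_congr rfl fun i _ => by rw [Polynomial.aeval_monomial]; rfl
      funext i
      have h2 := congrArg (fun Q => Polynomial.coeff Q (i : ℕ)) h1
      simp only [Polynomial.finsetSum_coeff, Polynomial.coeff_monomial, Polynomial.coeff_zero,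
        Fin.val_inj, Finset.sum_ite_eq', Finset.mem_univ, if_true] at h2
      exact congrArg Subtype.val h2
  have h3 := Fintype.linearIndependent_iff.1 hlin (fun i => P.coeff i) (by
    rw [Fin.sum_univ_eq_sum_range fun i => P.coeff i • c ^ i, ← Polynomial.aeval_eq_sum_range, hPc])
  exact hP (Polynomial.leadingCoeff_eq_zero.1 (h3 (Fin.last _)))

/-- A `p`-adic algebraic extension has no new constants when the constants are `p`-adically
closed. -/
theorem NoNewConst.of_isAlgebraic {p : ℕ} (hp : p.Prime) {K L : Type} [Field K] [CharZero K]
    [Field L] [Algebra K L] {d : Derivation ℤ K K} {dL : Derivation ℤ L L} (hd : Extends d dL)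
    (hc : IsPAdicallyClosed p d.kerField) (hL : IsPAdicField p L)
    (halg : Algebra.IsAlgebraic K L) : NoNewConst d dL := by
  intro c hc'
  have : CharZero L := charZero_of_injective_algebraMap (algebraMap K L).injective
  have h1 := isAlgebraic_kerField hd hc' (halg.isAlgebraic c)
  let E := IntermediateField.adjoin d.kerField {c}
  have h2 : Algebra.IsAlgebraic d.kerField E :=
    IntermediateField.isAlgebraic_adjoin fun x hx => by
      rw [Set.mem_singleton_iff.1 hx]; exact h1.isIntegral
  obtain ⟨a, ha⟩ := hc.2 E h2 (IsPAdicField.of_ringHom hp (algebraMap E L) hL)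
    ⟨c, IntermediateField.subset_adjoin _ _ rfl⟩
  exact ⟨a, (Derivation.mem_kerField d).1 a.2, congrArg Subtype.val ha⟩

/-- In a finitely generated domain over a field `Ω`, a transcendental element cannot have all its
integer translates invertible. -/
theorem exists_not_isUnit_sub_natCast {Ω S : Type} [Field Ω] [CharZero Ω] [CommRing S] [IsDomain S]
    [Algebra Ω S] [Algebra.FiniteType Ω S] {c : S} (hc : Transcendental Ω c) :
    ∃ a : ℕ, ¬ IsUnit (c - a) := by
  let _ : Algebra (Polynomial Ω) S := (Polynomial.aeval c).toAlgebra
  have hmap : ∀ P : Polynomial Ω, algebraMap (Polynomial Ω) S P = Polynomial.aeval c P := fun _ => rfl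
  have hinj : Function.Injective (algebraMap (Polynomial Ω) S) :=
    transcendental_iff_injective.1 hc
  have : IsScalarTower Ω (Polynomial Ω) S := IsScalarTower.of_algebraMap_eq fun a => by
    rw [hmap, Polynomial.algebraMap_apply, Polynomial.aeval_C]; rfl
  have : Algebra.FiniteType (Polynomial Ω) S := Algebra.FiniteType.of_restrictScalars_finiteType Ω _ _
  have : Algebra.FinitePresentation (Polynomial Ω) S :=
    Algebra.FinitePresentation.of_finiteType.1 this
  have : FaithfulSMul (Polynomial Ω) S := (faithfulSMul_iff_algebraMap_injective _ _).2 hinj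
  have : Module.IsTorsionFree (Polynomial Ω) S := inferInstance
  have : Module.Flat (Polynomial Ω) S := inferInstance
  have hopen := PrimeSpectrum.isOpenMap_comap_of_hasGoingDown_of_finitePresentation
    (R := Polynomial Ω) (S := S) Set.univ isOpen_univ
  rw [Set.image_univ] at hopen
  obtain ⟨U, ⟨f, rfl⟩, hf, hU⟩ := PrimeSpectrum.isTopologicalBasis_basic_opens.exists_subset_of_mem_open
    (a := ⟨⊥, Ideal.isPrime_bot⟩) (Set.mem_range.2 ⟨⟨⊥, Ideal.isPrime_bot⟩, by
      ext1
      exact Ideal.comap_bot_of_injective _ hinj⟩) hopen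
  have hf0 : f ≠ 0 := hf
  have hfin : ∃ a : ℕ, ¬ f.IsRoot a := by
    by_contra! h
    refine hf0 (Polynomial.eq_zero_of_infinite_isRoot f ?_)
    exact (Set.infinite_range_of_injective (Nat.cast_injective (R := Ω))).mono
      (Set.range_subset_iff.2 h)
  obtain ⟨a, ha⟩ := hfin
  have hprime : (Ideal.span {(Polynomial.X - Polynomial.C (a : Ω))}).IsPrime :=
    (Ideal.span_singleton_prime (Polynomial.X_sub_C_ne_zero _)).2 (Polynomial.prime_X_sub_C _)
  obtain ⟨q, hq⟩ := hU (a := ⟨_, hprime⟩) (fun h => ha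
    (Polynomial.dvd_iff_isRoot.1 (Ideal.mem_span_singleton.1 h)))
  refine ⟨a, fun hu => q.2.ne_top (Ideal.eq_top_of_isUnit_mem _ ?_ hu)⟩
  have h1 : (Polynomial.X - Polynomial.C (a : Ω)) ∈ (PrimeSpectrum.comap (algebraMap (Polynomial Ω) S) q).asIdeal := by
    rw [hq]
    exact Ideal.mem_span_singleton_self _
  have h2 : algebraMap (Polynomial Ω) S (Polynomial.X - Polynomial.C (a : Ω)) ∈ q.asIdeal := h1
  simpa [hmap] using h2

section
open PowerSeries

theorem eq_zero_of_psDeriv_iterate {K : Type} [Field K] [CharZero K] {d : Derivation ℤ K K}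
    {f : PowerSeries K} (h : ∀ j, constantCoeff ((psDeriv d)^[j] f) = 0) : f = 0 := by
  have key : ∀ (n : ℕ) (f : PowerSeries K), (∀ j, constantCoeff ((psDeriv d)^[j] f) = 0) →
      coeff n f = 0 := by
    intro n
    induction n with
    | zero => intro f hf; simpa using hf 0
    | succ n ih =>
      intro f hf
      have h1 := ih (psDeriv d f) fun j => hf (j + 1)
      rw [coeff_psDeriv, ih f hf, map_zero, zero_add] at h1
      exact (mul_eq_zero.1 h1).resolve_left (by exact_mod_cast Nat.succ_ne_zero n)
  ext n
  exact key n f h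

/-- The power series solution of `X' = A X` through a given matrix. -/
theorem exists_powerSeries_solution {K ι : Type} [Field K] [CharZero K] [Fintype ι]
    (d : Derivation ℤ K K) (A g : Matrix ι ι K) :
    ∃ X : Matrix ι ι (PowerSeries K), X.map (constantCoeff (R := K)) = g ∧
      X.map (psDeriv d) = A.map (C (R := K)) * X := by
  let T : ℕ → (ι × ι → K) → ι × ι → K := fun _ v q =>
    ∑ l, A q.1 l * v (l, q.2) - d (v q)
  obtain ⟨y, hy0, hy1⟩ := exists_powerSeries_recursion T (fun q => g q.1 q.2)
  refine ⟨Matrix.of fun i j => y (i, j), ?_, ?_⟩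
  · ext i j
    exact hy0 (i, j)
  · ext i j n
    rw [Matrix.map_apply, Matrix.of_apply, coeff_psDeriv, hy1 n (i, j), Matrix.mul_apply]
    simp [T, coeff_C_mul]

end

section
open MvPolynomial

/-- An ideal stable under `polyD` vanishing at `g` vanishes on the power series solution through
`g`. -/
theorem aeval_eq_zero_of_stable {K ι : Type} [Field K] [CharZero K] [Fintype ι] [DecidableEq ι]
    {d : Derivation ℤ K K} {A : Matrix ι ι K} {X : Matrix ι ι (PowerSeries K)}
    (hX : X.map (psDeriv d) = A.map (PowerSeries.C (R := K)) * X)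
    {I : Ideal (MvPolynomial (ι × ι) K)} (hI : ∀ P ∈ I, polyD d A P ∈ I)
    (hg : ∀ P ∈ I, aeval (fun q : ι × ι => PowerSeries.constantCoeff (X q.1 q.2)) P = 0)
    {P : MvPolynomial (ι × ι) K} (hP : P ∈ I) : aeval (fun q : ι × ι => X q.1 q.2) P = 0 := by
  set φ := algebraMap (PowerSeries K) (PSField K)
  have hφ : ∀ Q : MvPolynomial (ι × ι) K, φ (aeval (fun q : ι × ι => X q.1 q.2) Q) =
      aeval (fun q : ι × ι => X.map φ q.1 q.2) Q := by
    intro Q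
    induction Q using MvPolynomial.induction_on with
    | C a => rw [MvPolynomial.aeval_C, MvPolynomial.aeval_C, psField_algebraMap]; rfl
    | add p q hp hq => simp only [map_add, hp, hq]
    | mul_X p i hp => simp only [map_mul, hp, MvPolynomial.aeval_X, Matrix.map_apply]
  have hXφ : (X.map φ).map (psfDeriv d) = A.map (algebraMap K (PSField K)) * X.map φ := by
    have h1 : (X.map φ).map (psfDeriv d) = φ.mapMatrix (X.map (psDeriv d)) := by
      ext i j
      exact psfDeriv_algebraMap d (X i j)
    rw [h1, hX, map_mul]
    rfl
  have hδ : ∀ Q : MvPolynomial (ι × ι) K, psDeriv d (aeval (fun q : ι × ι => X q.1 q.2) Q) =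
      aeval (fun q : ι × ι => X q.1 q.2) (polyD d A Q) := by
    intro Q
    apply psField_injective
    rw [hφ, ← derivation_aeval_polyD (extends_psfDeriv d) _ A hXφ, ← hφ, psfDeriv_algebraMap]
  have hc : ∀ Q : MvPolynomial (ι × ι) K,
      PowerSeries.constantCoeff (aeval (fun q : ι × ι => X q.1 q.2) Q) =
      aeval (fun q : ι × ι => PowerSeries.constantCoeff (X q.1 q.2)) Q := by
    intro Q
    induction Q using MvPolynomial.induction_on with
    | C a => rw [MvPolynomial.aeval_C, MvPolynomial.aeval_C]; exact PowerSeries.constantCoeff_C _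
    | add p q hp hq => simp only [map_add, hp, hq]
    | mul_X p i hp => simp only [map_mul, hp, MvPolynomial.aeval_X]
  refine eq_zero_of_psDeriv_iterate (d := d) fun j => ?_
  have : ∃ Q ∈ I, (psDeriv d)^[j] (aeval (fun q : ι × ι => X q.1 q.2) P) =
      aeval (fun q : ι × ι => X q.1 q.2) Q := by
    induction j with
    | zero => exact ⟨P, hP, rfl⟩
    | succ j ih =>
      obtain ⟨Q, hQ, h⟩ := ih
      exact ⟨_, hI Q hQ, by rw [Function.iterate_succ_apply', h, hδ]⟩
  obtain ⟨Q, hQ, h⟩ := this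
  rw [h, hc, hg Q hQ]

/-- A fundamental matrix over an algebraically closed differential field whose differential ideal
of relations is maximal: any larger differential ideal contains a power of the determinant. -/
theorem exists_maximal_solution {Ω ι : Type} [Field Ω] [CharZero Ω] [IsAlgClosed Ω] [Fintype ι]
    [DecidableEq ι] (d : Derivation ℤ Ω Ω) (A : Matrix ι ι Ω) :
    ∃ X : Matrix ι ι (PSField Ω), X.map (psfDeriv d) = A.map (algebraMap Ω (PSField Ω)) * X ∧
      X.det ≠ 0 ∧
      ∀ I : Ideal (MvPolynomial (ι × ι) Ω), (∀ P ∈ I, polyD d A P ∈ I) →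
        (∀ P, aeval (fun q : ι × ι => X q.1 q.2) P = 0 → P ∈ I) →
        (∃ P ∈ I, aeval (fun q : ι × ι => X q.1 q.2) P ≠ 0) →
        ∃ (N : ℕ) (P : MvPolynomial (ι × ι) Ω), P ∈ I ∧
          aeval (fun q : ι × ι => X q.1 q.2) P = X.det ^ N := by
  set φ := algebraMap (PowerSeries Ω) (PSField Ω)
  choose Y hY0 hY using exists_powerSeries_solution d A
  let J : Matrix ι ι Ω → Ideal (MvPolynomial (ι × ι) Ω) := fun g =>
    RingHom.ker (aeval (R := Ω) (fun q : ι × ι => Y g q.1 q.2))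
  have hJ : ∀ g P, P ∈ J g ↔ aeval (R := Ω) (fun q : ι × ι => Y g q.1 q.2) P = 0 := fun g P =>
    Iff.rfl
  obtain ⟨_, ⟨g, hg, rfl⟩, hmax⟩ := set_has_maximal_iff_noetherian.2
    (inferInstance : IsNoetherian (MvPolynomial (ι × ι) Ω) (MvPolynomial (ι × ι) Ω))
    (J '' {g | g.det ≠ 0}) ⟨_, 1, by simp, rfl⟩
  have hφ : ∀ Q : MvPolynomial (ι × ι) Ω, φ (aeval (fun q : ι × ι => Y g q.1 q.2) Q) =
      aeval (fun q : ι × ι => (Y g).map φ q.1 q.2) Q := by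
    intro Q
    induction Q using MvPolynomial.induction_on with
    | C a => rw [MvPolynomial.aeval_C, MvPolynomial.aeval_C, psField_algebraMap]; rfl
    | add p q hp hq => simp only [map_add, hp, hq]
    | mul_X p i hp => simp only [map_mul, hp, MvPolynomial.aeval_X, Matrix.map_apply]
  have hφ0 : ∀ Q : MvPolynomial (ι × ι) Ω, aeval (fun q : ι × ι => (Y g).map φ q.1 q.2) Q = 0 ↔
      aeval (fun q : ι × ι => Y g q.1 q.2) Q = 0 := fun Q => by
    rw [← hφ]
    exact map_eq_zero_iff _ psField_injective
  have hdetX : ∀ {S : Type} [CommRing S] [Algebra Ω S] (M : Matrix ι ι S),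
      aeval (fun q : ι × ι => M q.1 q.2) (Matrix.mvPolynomialX ι ι Ω).det = M.det := by
    intro S _ _ M
    rw [AlgHom.map_det]
    congr 1
    ext i j
    simp [Matrix.mvPolynomialX]
  refine ⟨(Y g).map φ, ?_, ?_, fun I hI hle ⟨P, hPI, hP⟩ => ?_⟩
  · have h1 : ((Y g).map φ).map (psfDeriv d) = φ.mapMatrix ((Y g).map (psDeriv d)) := by
      ext i j
      exact psfDeriv_algebraMap d (Y g i j)
    rw [h1, hY, map_mul]
    rfl
  · have h1 : ((Y g).map φ).det = φ (Y g).det := (RingHom.map_det φ (Y g)).symm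
    rw [h1, Ne, map_eq_zero_iff _ psField_injective]
    intro h0
    apply hg
    rw [← hY0 g]
    have := RingHom.map_det (PowerSeries.constantCoeff (R := Ω)) (Y g)
    rw [h0, map_zero] at this
    exact this.symm
  · have h1 : (Matrix.mvPolynomialX ι ι Ω).det ∈ I.radical := by
      rw [← vanishingIdeal_zeroLocus_eq_radical (K := Ω)]
      intro x hx
      by_contra hne
      let g' : Matrix ι ι Ω := Matrix.of fun i j => x (i, j)
      have hg' : (aeval (R := Ω) x) (Matrix.mvPolynomialX ι ι Ω).det = g'.det := hdetX g'
      rw [hg'] at hne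
      have hle' : I ≤ J g' := fun Q hQ => by
        rw [hJ]
        refine aeval_eq_zero_of_stable (hY g') hI (fun R hR => ?_) hQ
        have h3 : (fun q : ι × ι => PowerSeries.constantCoeff (Y g' q.1 q.2)) = x := by
          funext q
          exact congrFun (congrFun (hY0 g') q.1) q.2
        rw [h3]
        exact hx R hR
      refine hmax _ ⟨g', hne, rfl⟩ (lt_of_lt_of_le (lt_of_le_of_ne ?_ ?_) hle')
      · intro Q hQ
        exact hle Q ((hφ0 Q).2 hQ)
      · rintro rfl
        exact hP ((hφ0 P).2 hPI)
    obtain ⟨N, hN⟩ := h1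
    exact ⟨N, _, hN, by rw [map_pow, hdetX]⟩
end

section
open MvPolynomial

/-- Picard--Vessiot extensions over an algebraically closed differential field exist, without
assumption on the constants of the base. -/
theorem exists_picardVessiot_of_isAlgClosed {Ω ι : Type} [Field Ω] [CharZero Ω] [IsAlgClosed Ω]
    [Fintype ι] [DecidableEq ι] (d : Derivation ℤ Ω Ω) (A : Matrix ι ι Ω) :
    ∃ (L : Type) (_ : Field L) (_ : Algebra Ω L) (dL : Derivation ℤ L L) (X : Matrix ι ι L),
      Extends d dL ∧ NoNewConst d dL ∧ IsUnit X.det ∧ X.map dL = A.map (algebraMap Ω L) * X := by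
  obtain ⟨X, hX, hdet, hmax⟩ := exists_maximal_solution d A
  let F := PSField Ω
  let δ := psfDeriv d
  have hδ : Extends d δ := extends_psfDeriv d
  set ev := aeval (R := Ω) (fun q : ι × ι => X q.1 q.2) with hev
  have hevδ : ∀ P, δ (ev P) = ev (polyD d A P) := derivation_aeval_polyD hδ X A hX
  set D := X.det with hD
  have hDev : ev (Matrix.mvPolynomialX ι ι Ω).det = D := by
    rw [hev, AlgHom.map_det]
    congr 1
    ext i j
    simp [Matrix.mvPolynomialX]
  let S : Subalgebra Ω F := Algebra.adjoin Ω (Set.range (fun q : ι × ι => X q.1 q.2) ∪ {D⁻¹})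
  have hevS : ∀ P, ev P ∈ S := by
    intro P
    have h1 : ev P ∈ ev.range := ⟨P, rfl⟩
    rw [hev, ← Algebra.adjoin_range_eq_range_aeval] at h1
    exact Algebra.adjoin_mono Set.subset_union_left h1
  have hDS : D⁻¹ ∈ S := Algebra.subset_adjoin (Or.inr rfl)
  have hform : ∀ x ∈ S, ∃ (N : ℕ) (P : MvPolynomial (ι × ι) Ω), x * D ^ N = ev P := by
    intro x hx
    induction hx using Algebra.adjoin_induction with
    | mem x hx =>
      rcases hx with ⟨q, rfl⟩ | hx
      · exact ⟨0, MvPolynomial.X q, by simp [hev]⟩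
      · rw [Set.mem_singleton_iff.1 hx]
        exact ⟨1, 1, by rw [pow_one, inv_mul_cancel₀ hdet, map_one]⟩
    | algebraMap a => exact ⟨0, C a, by rw [pow_zero, mul_one, hev, MvPolynomial.aeval_C]⟩
    | add x y _ _ hx hy =>
      obtain ⟨N, P, hP⟩ := hx
      obtain ⟨M, Q, hQ⟩ := hy
      refine ⟨N + M, P * (Matrix.mvPolynomialX ι ι Ω).det ^ M +
        Q * (Matrix.mvPolynomialX ι ι Ω).det ^ N, ?_⟩
      rw [map_add, map_mul, map_mul, map_pow, map_pow, hDev, ← hP, ← hQ]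
      ring
    | mul x y _ _ hx hy =>
      obtain ⟨N, P, hP⟩ := hx
      obtain ⟨M, Q, hQ⟩ := hy
      refine ⟨N + M, P * Q, ?_⟩
      rw [map_mul, ← hP, ← hQ]
      ring
  have hδS : ∀ x ∈ S, δ x ∈ S := by
    intro x hx
    induction hx using Algebra.adjoin_induction with
    | mem x hx =>
      rcases hx with ⟨q, rfl⟩ | hx
      · have h1 : X q.1 q.2 = ev (MvPolynomial.X q) := by simp [hev]
        dsimp only
        rw [h1, hevδ]
        exact hevS _
      · rw [Set.mem_singleton_iff.1 hx, Derivation.leibniz_inv, ← hDev, hevδ, hDev, smul_eq_mul]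
        exact S.mul_mem (S.neg_mem (pow_mem hDS 2)) (hevS _)
    | algebraMap a => rw [hδ]; exact S.algebraMap_mem _
    | add x y _ _ hx hy => rw [map_add]; exact S.add_mem hx hy
    | mul x y hx hy hx' hy' =>
      rw [Derivation.leibniz, smul_eq_mul, smul_eq_mul]
      exact S.add_mem (S.mul_mem hx hy') (S.mul_mem hy hx')
  -- a nonzero constant of `S` is invertible in `S`
  have hunit : ∀ e ∈ S, δ e = 0 → e ≠ 0 → e⁻¹ ∈ S := by
    intro e he hδe he0
    let I : Ideal (MvPolynomial (ι × ι) Ω) :=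
      { carrier := {Q | e⁻¹ * ev Q ∈ S}
        add_mem' := fun {P Q} hP hQ => by
          simp only [Set.mem_ofPred_eq, map_add, mul_add] at *
          exact S.add_mem hP hQ
        zero_mem' := by simp
        smul_mem' := fun P Q hQ => by
          simp only [Set.mem_ofPred_eq, smul_eq_mul, map_mul] at *
          rw [mul_left_comm]
          exact S.mul_mem (hevS P) hQ }
    have hδe' : δ e⁻¹ = 0 := by rw [Derivation.leibniz_inv, hδe, smul_zero]
    obtain ⟨M, P, hP⟩ := hform e he
    obtain ⟨N, Q, hQ, hQN⟩ := hmax I (fun Q hQ => by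
        have h1 := hδS _ hQ
        rw [Derivation.leibniz, hδe', smul_zero, add_zero, hevδ] at h1
        exact h1) (fun Q hQ => by
        change e⁻¹ * ev Q ∈ S
        rw [hQ, mul_zero]
        exact S.zero_mem) ⟨P, by
          change e⁻¹ * ev P ∈ S
          rw [← hP, inv_mul_cancel_left₀ he0, ← hDev, ← map_pow]
          exact hevS _, by
          rw [← hP]
          exact mul_ne_zero he0 (pow_ne_zero _ hdet)⟩
    have h1 : e⁻¹ * ev Q ∈ S := hQ
    rw [hQN] at h1
    have h2 := S.mul_mem h1 (pow_mem hDS N)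
    rwa [inv_pow, mul_assoc, mul_inv_cancel₀ (pow_ne_zero _ hdet), mul_one] at h2
  let s := Set.range fun q : ι × ι => X q.1 q.2
  have hsL : ∀ i j, X i j ∈ IntermediateField.adjoin Ω s := fun i j =>
    IntermediateField.subset_adjoin Ω s ⟨(i, j), rfl⟩
  -- constants of the field generated by `X` lie in `S`
  have hconst : ∀ c ∈ IntermediateField.adjoin Ω s, δ c = 0 → c ∈ S := by
    intro c hc hδc
    rw [IntermediateField.mem_adjoin_range_iff] at hc
    obtain ⟨r, t, hrt⟩ := hc
    change c = ev r / ev t at hrt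
    by_cases ht : ev t = 0
    · rw [hrt, ht, div_zero]
      exact S.zero_mem
    let I : Ideal (MvPolynomial (ι × ι) Ω) :=
      { carrier := {Q | c * ev Q ∈ S}
        add_mem' := fun {P Q} hP hQ => by
          simp only [Set.mem_ofPred_eq, map_add, mul_add] at *
          exact S.add_mem hP hQ
        zero_mem' := by simp
        smul_mem' := fun P Q hQ => by
          simp only [Set.mem_ofPred_eq, smul_eq_mul, map_mul] at *
          rw [mul_left_comm]
          exact S.mul_mem (hevS P) hQ }
    obtain ⟨N, Q, hQ, hQN⟩ := hmax I (fun Q hQ => by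
        have h1 := hδS _ hQ
        rw [Derivation.leibniz, hδc, smul_zero, add_zero, hevδ] at h1
        exact h1) (fun Q hQ => by
        change c * ev Q ∈ S
        rw [hQ, mul_zero]
        exact S.zero_mem) ⟨t, by
          change c * ev t ∈ S
          rw [hrt, div_mul_cancel₀ _ ht]
          exact hevS _, ht⟩
    have h1 : c * ev Q ∈ S := hQ
    rw [hQN] at h1
    have h2 := S.mul_mem h1 (pow_mem hDS N)
    rwa [inv_pow, mul_assoc, mul_inv_cancel₀ (pow_ne_zero _ hdet), mul_one] at h2
  have hfg : Algebra.FiniteType Ω S := by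
    rw [← Subalgebra.fg_iff_finiteType]
    exact Subalgebra.fg_def.2 ⟨_, (Set.finite_range _).union (Set.finite_singleton _), rfl⟩
  have halg : ∀ c ∈ IntermediateField.adjoin Ω s, δ c = 0 → IsAlgebraic Ω c := by
    intro c hc hδc
    by_contra hn
    have hcS := hconst c hc hδc
    have hn' : Transcendental Ω (⟨c, hcS⟩ : S) := fun h => hn (h.algebraMap (A := F))
    obtain ⟨a, ha⟩ := exists_not_isUnit_sub_natCast hn'
    have h1 : δ (c - a) = 0 := by rw [map_sub, hδc, Derivation.map_natCast, sub_zero]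
    have h2 : c - a ≠ 0 := fun h => hn (by
      rw [sub_eq_zero.1 h]
      exact isAlgebraic_natCast _)
    have h3 := hunit (c - a) (S.sub_mem hcS (natCast_mem S a)) h1 h2
    refine ha (IsUnit.of_mul_eq_one ⟨_, h3⟩ (Subtype.ext ?_))
    exact mul_inv_cancel₀ h2
  let L := IntermediateField.adjoin Ω s
  obtain ⟨dL, hdL, hdL'⟩ : ∃ dL : Derivation ℤ L L, Extends d dL ∧ ∀ x, (dL x : F) = δ x :=
    exists_derivation_adjoin hδ s (by
    rintro _ ⟨q, rfl⟩
    have h1 : δ (X q.1 q.2) = _ := congrFun (congrFun hX q.1) q.2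
    dsimp only
    rw [h1, Matrix.mul_apply]
    exact sum_mem fun l _ => mul_mem (IntermediateField.algebraMap_mem _ _) (hsL _ _))
  let XL : Matrix ι ι L := Matrix.of fun i j => ⟨X i j, hsL i j⟩
  refine ⟨L, inferInstance, inferInstance, dL, XL, hdL, fun c hc => ?_, ?_, ?_⟩
  · have h1 : δ c = 0 := by rw [← hdL', hc]; rfl
    obtain ⟨a, ha⟩ := psField_mem_of_isAlgebraic (halg c c.2 h1)
    refine ⟨a, ?_, Subtype.ext ha⟩
    rw [← ha, hδ] at h1
    exact (map_eq_zero _).1 h1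
  · rw [isUnit_iff_ne_zero]
    intro h
    apply hdet
    have h1 := RingHom.map_det (algebraMap L F) XL
    rw [h, map_zero] at h1
    exact h1.symm
  · funext i j
    apply (algebraMap L F).injective
    have h1 : algebraMap L F ((XL.map dL) i j) = δ (X i j) := hdL' _
    have h2 : δ (X i j) = _ := congrFun (congrFun hX i) j
    rw [h1, h2, Matrix.mul_apply, Matrix.mul_apply, map_sum]
    rfl
end

theorem trace_of_connection {Ω V : Type} [Field Ω] [AddCommGroup V] [Module Ω V]
    [FiniteDimensional Ω V] (d : Derivation ℤ Ω Ω) (nab : V →+ V)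
    (hnab : ∀ (a : Ω) (x : V), nab (a • x) = d a • x + a • nab x) (T S : Module.End Ω V)
    (hS : ∀ x, S x = nab (T x) - T (nab x)) :
    LinearMap.trace Ω V S = d (LinearMap.trace Ω V T) := by
  classical
  let b := Module.finBasis Ω V
  rw [LinearMap.trace_eq_matrix_trace Ω b, LinearMap.trace_eq_matrix_trace Ω b, Matrix.trace,
    Matrix.trace, map_sum]
  have key : ∀ j, Matrix.diag (LinearMap.toMatrix b b S) j
      = d (b.repr (T (b j)) j) + ((∑ i, b.repr (T (b j)) i * b.repr (nab (b i)) j)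
        - ∑ i, b.repr (nab (b j)) i * b.repr (T (b i)) j) := by
    intro j
    have h1 : nab (T (b j)) = ∑ i, (d (b.repr (T (b j)) i) • b i
        + b.repr (T (b j)) i • nab (b i)) := by
      conv_lhs => rw [← b.sum_repr (T (b j))]
      rw [map_sum]
      exact Finset.sum_congr rfl fun i _ => hnab _ _
    have h2 : T (nab (b j)) = ∑ i, b.repr (nab (b j)) i • T (b i) := by
      conv_lhs => rw [← b.sum_repr (nab (b j))]
      rw [map_sum]
      exact Finset.sum_congr rfl fun i _ => map_smul _ _ _
    rw [Matrix.diag_apply, LinearMap.toMatrix_apply, hS, h1, h2]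
    simp [map_sum, Finset.sum_add_distrib, Finsupp.single_apply]
    ring
  rw [Finset.sum_congr rfl fun j _ => key j, Finset.sum_add_distrib, Finset.sum_sub_distrib,
    Finset.sum_comm]
  have : (∑ y, ∑ x, b.repr (T (b x)) y * b.repr (nab (b y)) x)
      = ∑ x, ∑ i, b.repr (nab (b x)) i * b.repr (T (b i)) x :=
    Finset.sum_congr rfl fun _ _ => Finset.sum_congr rfl fun _ _ => mul_comm _ _
  rw [this, sub_self, add_zero]
  simp [LinearMap.toMatrix_apply]

section
attribute [local instance] LieRing.ofAssociativeRing LieAlgebra.ofAssociativeAlgebra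

theorem exists_common_kernel {K V : Type} [Field K] [AddCommGroup V] [Module K V] [Nontrivial V]
    (G : Submodule K (Module.End K V)) [FiniteDimensional K G]
    (hG : ∀ x ∈ G, ∀ y ∈ G, x * y - y * x ∈ G) (hnil : ∀ x ∈ G, IsNilpotent x) :
    ∃ w : V, w ≠ 0 ∧ ∀ x ∈ G, x w = 0 := by
  let H : LieSubalgebra K (Module.End K V) :=
    { G with lie_mem' := fun {x y} hx hy => by
              simpa [Ring.lie_def] using hG x hx y hy }
  have : IsNoetherian K H := inferInstanceAs (IsNoetherian K G)
  have : LieModule.IsNilpotent H V := by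
    refine LieAlgebra.isEngelian_of_isNoetherian (R := K) (L := H) V fun x => ?_
    exact hnil x.1 x.2
  have := LieModule.nontrivial_max_triv_of_isNilpotent K H V
  obtain ⟨⟨w, hw⟩, hw0⟩ := exists_ne (0 : LieModule.maxTrivSubmodule K H V)
  refine ⟨w, fun h => hw0 (Subtype.ext h), fun x hx => ?_⟩
  exact (LieModule.mem_maxTrivSubmodule K H V w).1 hw ⟨x, hx⟩
end

theorem InG.map_nabla_mulVec {K Ω ι : Type} [Field K] [Field Ω] [Algebra K Ω]
    [Fintype ι] {d : Derivation ℤ K K} {dΩ : Derivation ℤ Ω Ω} (hd : Extends d dΩ)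
    (A v : Matrix ι ι K) (x : ι → Ω) :
    ((v.map d - (A * v - v * A)).map (algebraMap K Ω)).mulVec x =
      (dΩ ∘ (v.map (algebraMap K Ω)).mulVec x -
        (A.map (algebraMap K Ω)).mulVec ((v.map (algebraMap K Ω)).mulVec x)) -
      (v.map (algebraMap K Ω)).mulVec (dΩ ∘ x - (A.map (algebraMap K Ω)).mulVec x) := by
  classical
  have h1 : (v.map (algebraMap K Ω)).map dΩ = (v.map d).map (algebraMap K Ω) := by
    ext i j
    exact hd _
  rw [dΩ.comp_mulVec, h1, ← RingHom.mapMatrix_apply, map_sub, map_sub, map_mul, map_mul]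
  simp only [RingHom.mapMatrix_apply, Matrix.sub_mulVec, Matrix.mulVec_sub, Matrix.mulVec_mulVec]
  abel

/-- If the diagonalizable elements with rational spectrum act as scalars, then the whole Lie
algebra has a weight vector. -/
theorem exists_weight_submodule {K Ω ι : Type} [Field K] [CharZero K] [Field Ω] [CharZero Ω]
    [Algebra K Ω] [Algebra.IsAlgebraic K Ω] [IsAlgClosed Ω] [Fintype ι] [DecidableEq ι]
    (hCl : ∀ z : Ω, z ∈ Submodule.span K {z : Ω | IsAlgebraic ℚ z})
    {d : Derivation ℤ K K} {dΩ : Derivation ℤ Ω Ω} (hd : Extends d dΩ) {A : Matrix ι ι K}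
    {N : Submodule Ω (ι → Ω)} (hN : ∀ w ∈ N, dΩ ∘ w - (A.map (algebraMap K Ω)).mulVec w ∈ N)
    (hN0 : N ≠ ⊥)
    (hscal : ∀ e, InG d A e → (∃ m : Polynomial ℚ, m.Separable ∧ Polynomial.aeval e m = 0) →
      ∃ c : Ω, ∀ u ∈ N, (e.map (algebraMap K Ω)).mulVec u = c • u) :
    ∃ (lam : Matrix ι ι K → Ω) (N₀ : Submodule Ω (ι → Ω)), N₀ ≠ ⊥ ∧
      (∀ w ∈ N₀, dΩ ∘ w - (A.map (algebraMap K Ω)).mulVec w ∈ N₀) ∧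
      ∀ v, InG d A v → ∀ w ∈ N₀, (v.map (algebraMap K Ω)).mulVec w = lam v • w := by
  have : Nontrivial N := (Submodule.nontrivial_iff_ne_bot).2 hN0
  let rho : inGSubmodule d A →ₗ[K] Module.End Ω N :=
    { toFun := fun v => (v.1.map (algebraMap K Ω)).mulVecLin.restrict
        fun w hw => v.2.mulVec_mem hd hN hw
      map_add' := fun v w => by
        refine LinearMap.ext fun x => Subtype.ext ?_
        change ((v.1 + w.1).map (algebraMap K Ω)).mulVec x.1 =
          (v.1.map (algebraMap K Ω)).mulVec x.1 + (w.1.map (algebraMap K Ω)).mulVec x.1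
        rw [← Matrix.add_mulVec]
        congr 1
        ext i j
        simp
      map_smul' := fun a v => by
        refine LinearMap.ext fun x => Subtype.ext ?_
        change ((a • v.1).map (algebraMap K Ω)).mulVec x.1 =
          a • (v.1.map (algebraMap K Ω)).mulVec x.1
        rw [← Matrix.smul_mulVec]
        congr 1
        ext i j
        simp only [Matrix.map_apply, Matrix.smul_apply, smul_eq_mul, map_mul]
        rw [Algebra.smul_def] }
  have hrho : ∀ v x, ((rho v x : N) : ι → Ω) = (v.1.map (algebraMap K Ω)).mulVec x.1 :=
    fun v x => rfl
  have hr : (Module.finrank Ω N : Ω) ≠ 0 := by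
    exact_mod_cast (Module.finrank_pos (R := Ω) (M := N)).ne'
  let lam : inGSubmodule d A →ₗ[K] Ω :=
    (Module.finrank Ω N : Ω)⁻¹ • ((LinearMap.trace Ω N).restrictScalars K ∘ₗ rho)
  have hlam : ∀ v, lam v = (Module.finrank Ω N : Ω)⁻¹ * LinearMap.trace Ω N (rho v) :=
    fun v => rfl
  have hnil : ∀ v, IsNilpotent (rho v - lam v • 1) := by
    intro v
    obtain ⟨β, _, κ, e, n, hve, ⟨k, hk⟩, heG, hem⟩ := v.2.exists_rational_parts Ω hCl
    choose c hc using fun b => hscal (e b) (heG b) (hem b)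
    let e' : β → inGSubmodule d A := fun b => ⟨e b, heG b⟩
    have hnG : n = v.1 - ∑ b, κ b • (e' b).1 := by rw [hve]; simp [e']
    let n' : inGSubmodule d A := v - ∑ b, κ b • e' b
    have hn' : n'.1 = n := by rw [hnG]; simp [n']
    have hnilp : IsNilpotent (rho n') := by
      refine ⟨k, LinearMap.ext fun x => Subtype.ext ?_⟩
      have : ∀ j, (((rho n') ^ j) x).1 = ((n ^ j).map (algebraMap K Ω)).mulVec x.1 := by
        intro j
        induction j with
        | zero => simp
        | succ j ih =>
          rw [pow_succ', Module.End.mul_apply, hrho, ih, hn', Matrix.mulVec_mulVec,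
            ← Matrix.map_mul, ← pow_succ']
      rw [this, hk]
      simp
    have hdec : rho v = (∑ b, algebraMap K Ω (κ b) * c b) • 1 + rho n' := by
      have h1 : v = ∑ b, κ b • e' b + n' := by simp [n']
      conv_lhs => rw [h1]
      rw [map_add, map_sum, Finset.sum_smul]
      congr 1
      refine Finset.sum_congr rfl fun b _ => LinearMap.ext fun x => Subtype.ext ?_
      rw [map_smul]
      change κ b • ((e b).map (algebraMap K Ω)).mulVec x.1 = (algebraMap K Ω (κ b) * c b) • x.1
      rw [hc b x.1 x.2, mul_smul, algebraMap_smul]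
    have htr : lam v = ∑ b, algebraMap K Ω (κ b) * c b := by
      rw [hlam, hdec, map_add, map_smul, LinearMap.trace_one,
        (LinearMap.isNilpotent_trace_of_isNilpotent hnilp).eq_zero, add_zero, smul_eq_mul,
        mul_comm, mul_assoc, mul_inv_cancel₀ hr, mul_one]
    have h2 : rho v - lam v • 1 = rho n' :=
      LinearMap.ext fun x => by
        rw [htr, hdec]
        exact add_sub_cancel_left (G := N) _ _
    rw [h2]
    exact hnilp
  let Φ : inGSubmodule d A →ₗ[K] Module.End K N :=
    { toFun := fun v => (rho v - lam v • 1).restrictScalars K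
      map_add' := fun v w => LinearMap.ext fun x => by
        simp [add_smul]
        abel
      map_smul' := fun a v => LinearMap.ext fun x => by
        simp [smul_sub] }
  have hΦ : ∀ v x, Φ v x = rho v x - lam v • x := fun v x => rfl
  have hlie : ∀ v w : inGSubmodule d A, rho ⟨v.1 * w.1 - w.1 * v.1, v.2.lie w.2⟩ =
      rho v * rho w - rho w * rho v := by
    intro v w
    refine LinearMap.ext fun x => Subtype.ext ?_
    change ((v.1 * w.1 - w.1 * v.1).map (algebraMap K Ω)).mulVec x.1 =
      (v.1.map (algebraMap K Ω)).mulVec ((w.1.map (algebraMap K Ω)).mulVec x.1) -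
      (w.1.map (algebraMap K Ω)).mulVec ((v.1.map (algebraMap K Ω)).mulVec x.1)
    rw [← RingHom.mapMatrix_apply, map_sub, map_mul, map_mul, Matrix.sub_mulVec,
      Matrix.mulVec_mulVec, Matrix.mulVec_mulVec]
    rfl
  obtain ⟨w, hw0, hw⟩ := exists_common_kernel (LinearMap.range Φ) (by
      rintro _ ⟨v, rfl⟩ _ ⟨w, rfl⟩
      refine ⟨⟨v.1 * w.1 - w.1 * v.1, v.2.lie w.2⟩, LinearMap.ext fun x => ?_⟩
      have h0 : lam ⟨v.1 * w.1 - w.1 * v.1, v.2.lie w.2⟩ = 0 := by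
        have h1 := (LinearMap.trace Ω N).map_sub (rho v * rho w) (rho w * rho v)
        rw [LinearMap.trace_mul_comm, sub_self] at h1
        rw [hlam, hlie]
        exact (congrArg _ h1).trans (mul_zero _)
      rw [hΦ, h0, hlie]
      simp only [LinearMap.sub_apply, Module.End.mul_apply, hΦ, map_sub, map_smul, smul_sub,
        zero_smul, smul_comm (lam v) (lam w)]
      abel) (by
      rintro _ ⟨v, rfl⟩
      obtain ⟨k, hk⟩ := hnil v
      refine ⟨k, LinearMap.ext fun x => ?_⟩
      have : ∀ j, ((Φ v) ^ j) x = ((rho v - lam v • 1) ^ j) x := by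
        intro j
        induction j with
        | zero => simp
        | succ j ih => rw [pow_succ', pow_succ', Module.End.mul_apply, Module.End.mul_apply, ih]; rfl
      rw [this, hk]
      rfl)
  have hlamd : ∀ v : inGSubmodule d A,
      lam ⟨v.1.map d - (A * v.1 - v.1 * A), v.2.nabla⟩ = dΩ (lam v) := by
    intro v
    let nab : N →+ N :=
      { toFun := fun x => ⟨_, hN x.1 x.2⟩
        map_zero' := Subtype.ext (by ext i; simp)
        map_add' := fun x y => Subtype.ext (by
          ext i
          simp [Matrix.mulVec_add]
          ring) }
    have := trace_of_connection dΩ nab (fun a x => Subtype.ext (by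
        ext i
        simp [nab, Matrix.mulVec_smul]
        ring)) (rho v) (rho ⟨v.1.map d - (A * v.1 - v.1 * A), v.2.nabla⟩) fun x => Subtype.ext
          (InG.map_nabla_mulVec hd A v.1 x.1)
    rw [hlam, this, hlam, dΩ.leibniz]
    have : dΩ ((Module.finrank Ω N : Ω)⁻¹) = 0 := by
      rw [dΩ.leibniz_inv]
      simp
    rw [this, smul_zero, add_zero, smul_eq_mul]
  classical
  let lam' : Matrix ι ι K → Ω := fun v => if h : InG d A v then lam ⟨v, h⟩ else 0
  have hlam' : ∀ v (h : InG d A v), lam' v = lam ⟨v, h⟩ := fun v h => dif_pos h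
  let N₀ : Submodule Ω (ι → Ω) :=
    { carrier := {x | x ∈ N ∧ ∀ v, InG d A v →
        (v.map (algebraMap K Ω)).mulVec x = lam' v • x}
      add_mem' := fun {x y} hx hy => ⟨N.add_mem hx.1 hy.1, fun v hv => by
        rw [Matrix.mulVec_add, hx.2 v hv, hy.2 v hv, smul_add]⟩
      zero_mem' := ⟨N.zero_mem, fun v hv => by simp⟩
      smul_mem' := fun a x hx => ⟨N.smul_mem a hx.1, fun v hv => by
        rw [Matrix.mulVec_smul, hx.2 v hv, smul_comm]⟩ }
  refine ⟨lam', N₀, ?_, ?_, fun v hv w hw => hw.2 v hv⟩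
  · intro h
    have : w.1 ∈ N₀ := ⟨w.2, fun v hv => by
      have := congrArg Subtype.val (hw (Φ ⟨v, hv⟩) ⟨_, rfl⟩)
      rw [hlam' v hv]
      exact sub_eq_zero.1 this⟩
    rw [h, Submodule.mem_bot] at this
    exact hw0 (Subtype.ext this)
  · rintro x ⟨hxN, hx⟩
    refine ⟨hN x hxN, fun v hv => ?_⟩
    have h1 := InG.map_nabla_mulVec hd A v x
    rw [hx v hv, hx _ hv.nabla, hlam' _ hv.nabla, hlamd ⟨v, hv⟩, ← hlam' v hv] at h1
    have h2 : dΩ ∘ (lam' v • x) = lam' v • (dΩ ∘ x) + dΩ (lam' v) • x := by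
      ext i
      simp
      ring
    rw [h2, Matrix.mulVec_smul] at h1
    rw [smul_sub]
    have h3 : (v.map (algebraMap K Ω)).mulVec (dΩ ∘ x - (A.map (algebraMap K Ω)).mulVec x) =
      (lam' v • (dΩ ∘ x) + dΩ (lam' v) • x - lam' v • (A.map (algebraMap K Ω)).mulVec x) -
        dΩ (lam' v) • x := by
      rw [eq_sub_iff_add_eq, add_comm]
      exact eq_sub_iff_add_eq.1 h1
    rw [h3]
    abel

theorem mem_range_of_derivation_eq_zero {Ω L : Type} [Field Ω] [CharZero Ω] [IsAlgClosed Ω]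
    [Field L] [Algebra Ω L] {x : L}
    (h : ∀ D : Derivation ℤ L L, (∀ a, D (algebraMap Ω L a) = 0) → D x = 0) :
    ∃ a, algebraMap Ω L a = x := by
  by_cases hx : IsAlgebraic Ω x
  · have := IsAlgClosed.degree_eq_one_of_irreducible Ω (minpoly.irreducible hx.isIntegral)
    exact minpoly.mem_range_of_degree_eq_one Ω x this
  · have hi : AlgebraicIndependent Ω (fun _ : Unit => x) :=
      algebraicIndependent_unique_type_iff.2 hx
    obtain ⟨E, hE, hE1⟩ := exists_derivation_algebraicIndependent (0 : Derivation ℤ Ω L) hi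
      fun _ => 1
    exact absurd ((hE1 ()).symm.trans (h E hE)) one_ne_zero

theorem exists_exponential_solution {K Ω ι : Type} [Field K] [CharZero K] [Field Ω] [CharZero Ω]
    [Algebra K Ω] [IsAlgClosed Ω] [Fintype ι] [DecidableEq ι]
    {d : Derivation ℤ K K} {dΩ : Derivation ℤ Ω Ω} (hd : Extends d dΩ) {A : Matrix ι ι K}
    {N : Submodule Ω (ι → Ω)} (hN : ∀ w ∈ N, dΩ ∘ w - (A.map (algebraMap K Ω)).mulVec w ∈ N)
    (hN0 : N ≠ ⊥) (lam : Matrix ι ι K → Ω)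
    (hlam : ∀ v, InG d A v → ∀ w ∈ N, (v.map (algebraMap K Ω)).mulVec w = lam v • w) :
    ∃ (τ : ι → Ω) (a : Ω), τ ≠ 0 ∧
      dΩ ∘ τ - (A.map (algebraMap K Ω)).mulVec τ = a • τ := by
  obtain ⟨L, _, _, dL, X, hdL, hnc, hdet, hX⟩ :=
    exists_picardVessiot_of_isAlgClosed dΩ (A.map (algebraMap K Ω))
  let _ : Algebra K L := ((algebraMap Ω L).comp (algebraMap K Ω)).toAlgebra
  have hmap : ∀ M : Matrix ι ι K, M.map (algebraMap K L) =
      (M.map (algebraMap K Ω)).map (algebraMap Ω L) := fun M => rfl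
  have hKL : Extends d dL := fun a => by
    change dL (algebraMap Ω L (algebraMap K Ω a)) = algebraMap Ω L (algebraMap K Ω (d a))
    rw [hdL, hd]
  obtain ⟨t, ⟨htN, ht⟩, ht0⟩ : ∃ t, (t ∈ N.extendScalarsPi L ∧
      dL ∘ t = ((A.map (algebraMap K Ω)).map (algebraMap Ω L)).mulVec t) ∧ t ≠ 0 := by
    by_contra! hcon
    refine hN0 ((Submodule.eq_bot_iff _).2 fun x hx => ?_)
    have h1 := dL.le_span_solutions hdet hX (N.extendScalarsPi L)
      (fun w hw => Submodule.nabla_mem_extendScalarsPi hdL hN hw)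
      (Submodule.mem_extendScalarsPi hx)
    have h2 := Submodule.span_mono (R := L) (t := {0}) (fun u hu => hcon u hu) h1
    rw [Submodule.span_singleton_eq_bot.2 rfl, Submodule.mem_bot] at h2
    ext i
    exact (algebraMap Ω L).injective ((congrFun h2 i).trans (map_zero _).symm)
  have hact : ∀ v, InG d A v → ∀ w ∈ N.extendScalarsPi L,
      (v.map (algebraMap K L)).mulVec w = algebraMap Ω L (lam v) • w := by
    intro v hv w hw
    induction hw using Submodule.span_induction with
    | mem y hy =>
      obtain ⟨x, hx, rfl⟩ := hy
      ext i
      have := congrArg (algebraMap Ω L) (congrFun (hlam v hv x hx) i)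
      rw [hmap]
      simpa [Matrix.mulVec, dotProduct] using this
    | zero => simp
    | add a b _ _ ha hb => rw [Matrix.mulVec_add, ha, hb, smul_add]
    | smul c a _ ha => rw [Matrix.mulVec_smul, ha, smul_comm]
  obtain ⟨b, hb⟩ : ∃ b, t b ≠ 0 := by
    by_contra! h
    exact ht0 (funext h)
  have hrat : ∀ i, ∃ a, algebraMap Ω L a = t i * (t b)⁻¹ := by
    intro i
    refine mem_range_of_derivation_eq_zero fun D hD => ?_
    have hDc : ∀ c, dL c = 0 → D c = 0 := by
      intro c hc
      obtain ⟨a, -, rfl⟩ := hnc c hc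
      exact hD a
    obtain ⟨r, e, v, hv, hvX⟩ := exists_inG_of_derivation hKL (A := A) X hdet hX D
      (fun a => hD _) hDc
    have h1 := derivation_comp_solution hDc hdet hX hvX ht
    have h2 : D ∘ t = (∑ a, e a * algebraMap Ω L (lam (v a))) • t := by
      rw [h1, Matrix.sum_mulVec, Finset.sum_smul]
      refine Finset.sum_congr rfl fun a _ => ?_
      rw [Matrix.smul_mulVec, hact _ (hv a) _ htN, mul_smul]
    have h3 : ∀ i, D (t i) = (∑ a, e a * algebraMap Ω L (lam (v a))) * t i := fun i => congrFun h2 i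
    rw [D.leibniz, D.leibniz_inv, h3, h3]
    simp only [smul_eq_mul]
    field_simp
    ring
  choose τ hτ using hrat
  have hτb : τ b = 1 := (algebraMap Ω L).injective (by rw [hτ, mul_inv_cancel₀ hb, map_one])
  have hτd : ∀ i, algebraMap Ω L (dΩ (τ i) - (A.map (algebraMap K Ω)).mulVec τ i) =
      - (dL (t b) * (t b)⁻¹) * algebraMap Ω L (τ i) := by
    intro i
    have h1 : algebraMap Ω L ((A.map (algebraMap K Ω)).mulVec τ i) = dL (t i) * (t b)⁻¹ := by
      have := congrFun ht i
      rw [Function.comp_apply] at this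
      rw [this]
      simp [Matrix.mulVec, dotProduct, hτ, Finset.sum_mul, mul_assoc]
    rw [map_sub, h1, ← hdL, hτ, dL.leibniz, dL.leibniz_inv]
    simp only [smul_eq_mul]
    field_simp
    ring
  refine ⟨τ, - (A.map (algebraMap K Ω)).mulVec τ b, fun h => ?_, ?_⟩
  · rw [h] at hτb
    exact zero_ne_one hτb
  · ext i
    refine (algebraMap Ω L).injective ?_
    have hb' := hτd b
    rw [hτb, Derivation.map_one_eq_zero, zero_sub, map_one, mul_one] at hb'
    simp only [Pi.sub_apply, Function.comp_apply, Pi.smul_apply, smul_eq_mul, map_mul]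
    rw [hτd, hb']

section
variable {Ω F : Type} [Field Ω] [Field F] [Algebra Ω F] {d : Derivation ℤ Ω Ω}
  {δ : Derivation ℤ F F} {H : Submonoid F}

theorem list_map_mul_mem {h : F} (hh : h ∈ H) {l : List F} (hl : ∀ x ∈ l, x ∈ H) :
    ∀ x ∈ l.map (h * ·), x ∈ H := by
  intro x hx
  obtain ⟨y, hy, rfl⟩ := List.mem_map.1 hx
  exact H.mul_mem hh (hl y hy)

theorem list_map_derivation_mem (hΩ : ∀ a, algebraMap Ω F a ∈ H)
    (hη : ∀ h ∈ H, ∃ a, δ h = algebraMap Ω F a * h) {l : List F} (hl : ∀ x ∈ l, x ∈ H) :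
    ∀ x ∈ l.map δ, x ∈ H := by
  intro x hx
  obtain ⟨y, hy, rfl⟩ := List.mem_map.1 hx
  obtain ⟨a, ha⟩ := hη y (hl y hy)
  rw [ha]
  exact H.mul_mem (hΩ a) (hl y hy)

theorem List.sum_map_const_mul (h : F) (l : List F) : (l.map (h * ·)).sum = h * l.sum :=
  (map_list_sum (AddMonoidHom.mulLeft h) l).symm

theorem exists_constant_multiplier (hinv : ∀ h ∈ H, h⁻¹ ∈ H) (hΩ : ∀ a, algebraMap Ω F a ∈ H)
    (hη : ∀ h ∈ H, ∃ a, δ h = algebraMap Ω F a * h) {c : F} (hc : δ c = 0) :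
    ∀ (n : ℕ) (l r : List F), l.length ≤ n → (∀ x ∈ l, x ∈ H) → (∀ x ∈ r, x ∈ H) →
      l.sum ≠ 0 → c * l.sum = r.sum →
      ∃ l' r' : List F, (∀ x ∈ l', x ∈ H) ∧ (∀ x ∈ r', x ∈ H) ∧ l'.sum ≠ 0 ∧
        c * l'.sum = r'.sum ∧ δ l'.sum = 0 := by
  intro n
  induction n with
  | zero =>
    intro l r hl _ _ h0
    rw [Nat.le_zero, List.length_eq_zero_iff] at hl
    simp [hl] at h0
  | succ n ih =>
    intro l r hn hl hr h0 hcl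
    cases l with
    | nil => simp at h0
    | cons h l =>
      have hhH := hl h List.mem_cons_self
      have hlH : ∀ x ∈ l, x ∈ H := fun x hx => hl x (List.mem_cons_of_mem _ hx)
      have hn' : l.length ≤ n := by simpa using hn
      by_cases hh : h = 0
      · refine ih l r hn' hlH hr ?_ ?_
        · simpa [hh] using h0
        · simpa [hh] using hcl
      set q := h⁻¹ * (h :: l).sum with hq
      have hq0 : q ≠ 0 := mul_ne_zero (inv_ne_zero hh) h0
      have hqr : c * q = (r.map (h⁻¹ * ·)).sum := by
        rw [List.sum_map_const_mul, ← hcl, hq]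
        ring
      by_cases hδ : δ q = 0
      · refine ⟨(h :: l).map (h⁻¹ * ·), r.map (h⁻¹ * ·), list_map_mul_mem (hinv _ hhH) hl,
          list_map_mul_mem (hinv _ hhH) hr, ?_⟩
        rw [List.sum_map_const_mul (h⁻¹) (h :: l), ← hq]
        exact ⟨hq0, hqr, hδ⟩
      · have hsum : ((l.map (h⁻¹ * ·)).map δ).sum = δ q := by
          rw [hq, List.sum_cons, mul_add, inv_mul_cancel₀ hh, map_add, δ.map_one_eq_zero, zero_add,
            ← List.sum_map_const_mul, map_list_sum]
        refine ih ((l.map (h⁻¹ * ·)).map δ) ((r.map (h⁻¹ * ·)).map δ) (by simpa using hn')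
          (list_map_derivation_mem hΩ hη (list_map_mul_mem (hinv _ hhH) hlH))
          (list_map_derivation_mem hΩ hη (list_map_mul_mem (hinv _ hhH) hr)) ?_ ?_
        · rw [hsum]
          exact hδ
        · rw [hsum, ← map_list_sum, ← hqr, δ.leibniz c q, hc, smul_zero, add_zero, smul_eq_mul]

theorem constant_sum_mem_range (hΩ : ∀ a, algebraMap Ω F a ∈ H)
    (hη : ∀ h ∈ H, ∃ a, δ h = algebraMap Ω F a * h)
    (hH : ∀ h ∈ H, δ h = 0 → ∃ a, algebraMap Ω F a = h) :
    ∀ (n : ℕ) (l : List F), l.length ≤ n → (∀ x ∈ l, x ∈ H) → δ l.sum = 0 →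
      ∃ a, algebraMap Ω F a = l.sum := by
  intro n
  induction n with
  | zero =>
    intro l hl _ _
    rw [Nat.le_zero, List.length_eq_zero_iff] at hl
    exact ⟨0, by simp [hl]⟩
  | succ n ih =>
    intro l hn hl h0
    cases l with
    | nil => exact ⟨0, by simp⟩
    | cons h l =>
      have hhH := hl h List.mem_cons_self
      have hlH : ∀ x ∈ l, x ∈ H := fun x hx => hl x (List.mem_cons_of_mem _ hx)
      have hn' : l.length ≤ n := by simpa using hn
      obtain ⟨η, hηh⟩ := hη h hhH
      by_cases hη0 : δ h = 0
      · obtain ⟨a, ha⟩ := hH h hhH hη0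
        obtain ⟨b, hb⟩ := ih l hn' hlH (by rwa [List.sum_cons, map_add, hη0, zero_add] at h0)
        exact ⟨a + b, by rw [map_add, ha, hb, List.sum_cons]⟩
      · have hη' : η ≠ 0 := by
          rintro rfl
          exact hη0 (by rw [hηh, map_zero, zero_mul])
        have hη'' : algebraMap Ω F η ≠ 0 := (map_ne_zero _).2 hη'
        have hterm : ∀ x ∈ H, x - algebraMap Ω F η⁻¹ * δ x ∈ H := by
          intro x hx
          obtain ⟨a, ha⟩ := hη x hx
          have : x - algebraMap Ω F η⁻¹ * δ x = algebraMap Ω F (1 - η⁻¹ * a) * x := by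
            rw [ha, map_sub, map_mul, map_one]
            ring
          rw [this]
          exact H.mul_mem (hΩ _) hx
        let φ : F →+ F := AddMonoidHom.id F -
          (AddMonoidHom.mulLeft (algebraMap Ω F η⁻¹)).comp (δ : F →+ F)
        have hφ : ∀ x, φ x = x - algebraMap Ω F η⁻¹ * δ x := fun x => rfl
        have hsum : (h :: l).sum = (l.map φ).sum := by
          have h1 : φ (h :: l).sum = (h :: l).sum := by rw [hφ, h0, mul_zero, sub_zero]
          have h2 : φ h = 0 := by
            rw [hφ, hηh, map_inv₀, inv_mul_cancel_left₀ hη'', sub_self]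
          rw [← h1, List.sum_cons, map_add, h2, zero_add, map_list_sum]
        rw [hsum] at h0 ⊢
        refine ih _ (by simpa using hn') ?_ h0
        intro x hx
        obtain ⟨y, hy, rfl⟩ := List.mem_map.1 hx
        exact hterm y (hlH y hy)

/-- Constants of a field generated by exponentials are constants of the base as soon as this
holds for the exponentials themselves. -/
theorem constant_mem_range_of_exponentials (hinv : ∀ h ∈ H, h⁻¹ ∈ H)
    (hΩ : ∀ a, algebraMap Ω F a ∈ H) (hη : ∀ h ∈ H, ∃ a, δ h = algebraMap Ω F a * h)
    (hH : ∀ h ∈ H, δ h = 0 → ∃ a, algebraMap Ω F a = h) {c : F}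
    (hcH : c ∈ Subfield.closure (H : Set F)) (hc : δ c = 0) : ∃ a, algebraMap Ω F a = c := by
  have hlist : ∀ x ∈ Subring.closure (H : Set F), ∃ l : List F, (∀ y ∈ l, y ∈ H) ∧ l.sum = x := by
    intro x hx
    rw [Subring.mem_closure_iff, Submonoid.closure_eq] at hx
    induction hx using AddSubgroup.closure_induction with
    | mem x hx => exact ⟨[x], by simpa using hx, by simp⟩
    | zero => exact ⟨[], by simp, by simp⟩
    | add x y _ _ hx hy =>
      obtain ⟨l, hl, rfl⟩ := hx
      obtain ⟨r, hr, rfl⟩ := hy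
      exact ⟨l ++ r, fun y hy => (List.mem_append.1 hy).elim (hl y) (hr y), by simp⟩
    | neg x _ hx =>
      obtain ⟨l, hl, rfl⟩ := hx
      refine ⟨l.map ((-1) * ·), list_map_mul_mem ?_ hl, ?_⟩
      · have := hΩ (-1)
        rwa [map_neg, map_one] at this
      · rw [List.sum_map_const_mul, neg_one_mul]
  obtain ⟨y, hy, z, hz, rfl⟩ := Subfield.mem_closure_iff.1 hcH
  obtain ⟨r, hr, rfl⟩ := hlist y hy
  obtain ⟨l, hl, rfl⟩ := hlist z hz
  by_cases hz0 : l.sum = 0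
  · exact ⟨0, by rw [hz0, div_zero, map_zero]⟩
  obtain ⟨l', r', hl', hr', h0, heq, hd⟩ := exists_constant_multiplier hinv hΩ hη hc _ l r le_rfl
    hl hr hz0 (div_mul_cancel₀ _ hz0)
  obtain ⟨a, ha⟩ := constant_sum_mem_range hΩ hη hH _ l' le_rfl hl' hd
  obtain ⟨b, hb⟩ := constant_sum_mem_range hΩ hη hH _ r' le_rfl hr' (by
    rw [← heq, δ.leibniz, hc, hd, smul_zero, smul_zero, add_zero])
  exact ⟨b / a, by rw [map_div₀, ha, hb, ← heq, mul_div_cancel_right₀ _ h0]⟩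

end

section
open PowerSeries
variable {Ω : Type} [Field Ω]

/-- A power series with constant coefficient `1` and logarithmic derivative in `W`. -/
def IsExpOf (d : Derivation ℤ Ω Ω) (W : AddSubgroup Ω) (U : PowerSeries Ω) : Prop :=
  constantCoeff U = 1 ∧ ∃ w ∈ W, psDeriv d U = C w * U

theorem IsExpOf.one (d : Derivation ℤ Ω Ω) (W : AddSubgroup Ω) : IsExpOf d W 1 := by
  refine ⟨map_one _, 0, W.zero_mem, ?_⟩
  rw [← map_one (C (R := Ω)), psDeriv_C, d.map_one_eq_zero, map_zero, zero_mul]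

theorem IsExpOf.mul {d : Derivation ℤ Ω Ω} {W : AddSubgroup Ω} {U V : PowerSeries Ω}
    (hU : IsExpOf d W U) (hV : IsExpOf d W V) : IsExpOf d W (U * V) := by
  obtain ⟨hU, u, hu, hu'⟩ := hU
  obtain ⟨hV, v, hv, hv'⟩ := hV
  refine ⟨by rw [map_mul, hU, hV, mul_one], u + v, W.add_mem hu hv, ?_⟩
  rw [psDeriv_mul, hu', hv', map_add]
  ring

theorem IsExpOf.exists_inv {d : Derivation ℤ Ω Ω} {W : AddSubgroup Ω} {U : PowerSeries Ω}
    (hU : IsExpOf d W U) : ∃ V, IsExpOf d W V ∧ U * V = 1 := by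
  obtain ⟨hU, u, hu, hu'⟩ := hU
  have hUV : U * U⁻¹ = 1 := U.mul_inv_cancel (by rw [hU]; exact one_ne_zero)
  have hU0 : U ≠ 0 := left_ne_zero_of_mul_eq_one hUV
  refine ⟨U⁻¹, ⟨?_, -u, W.neg_mem hu, ?_⟩, hUV⟩
  · have := congrArg (constantCoeff (R := Ω)) hUV
    rwa [map_mul, hU, one_mul, map_one] at this
  · have h1 : psDeriv d (U * U⁻¹) = 0 := by
      rw [hUV, ← map_one (C (R := Ω)), psDeriv_C, d.map_one_eq_zero, map_zero]
    rw [psDeriv_mul, hu'] at h1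
    refine mul_left_cancel₀ hU0 ?_
    rw [map_neg]
    linear_combination h1

theorem IsExpOf.eq_one [CharZero Ω] {d : Derivation ℤ Ω Ω} {U : PowerSeries Ω}
    (h0 : constantCoeff U = 1) (h : psDeriv d U = 0) : U = 1 := by
  rw [← sub_eq_zero]
  have h1 : psDeriv d (U - 1) = 0 := by
    rw [map_sub, h, ← map_one (C (R := Ω)), psDeriv_C, d.map_one_eq_zero, map_zero, sub_zero]
  refine eq_zero_of_psDeriv_iterate (d := d) fun j => ?_
  cases j with
  | zero => simp [h0]
  | succ j => rw [Function.iterate_succ_apply, h1, iterate_map_zero, map_zero]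

/-- Adjoining exponentials whose exponents are independent modulo logarithmic derivatives gives
no new constants among the field generated by the base and the exponentials. -/
theorem mem_range_of_isExpOf [CharZero Ω] {d : Derivation ℤ Ω Ω} {W : AddSubgroup Ω}
    (hW : ∀ w ∈ W, ∀ h, h ≠ 0 → d h = w * h → w = 0) {Z : Set (PowerSeries Ω)}
    (hZ : ∀ z ∈ Z, IsExpOf d W z) {c : PSField Ω}
    (hcZ : c ∈ Subfield.closure (Set.range (algebraMap Ω (PSField Ω)) ∪
      algebraMap (PowerSeries Ω) (PSField Ω) '' Z)) (hc : psfDeriv d c = 0) :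
    ∃ a, algebraMap Ω (PSField Ω) a = c := by
  let H : Submonoid (PSField Ω) :=
    { carrier := {x | ∃ f U, IsExpOf d W U ∧
        algebraMap Ω (PSField Ω) f * algebraMap (PowerSeries Ω) (PSField Ω) U = x}
      one_mem' := ⟨1, 1, IsExpOf.one d W, by simp⟩
      mul_mem' := by
        rintro _ _ ⟨f, U, hU, rfl⟩ ⟨g, V, hV, rfl⟩
        refine ⟨f * g, U * V, hU.mul hV, ?_⟩
        rw [map_mul, map_mul]
        ring }
  have hd : ∀ f U w, psDeriv d U = C w * U → psfDeriv d (algebraMap Ω (PSField Ω) f *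
      algebraMap (PowerSeries Ω) (PSField Ω) U) =
      algebraMap Ω (PSField Ω) (d f + f * w) * algebraMap (PowerSeries Ω) (PSField Ω) U := by
    intro f U w hw
    rw [Derivation.leibniz, extends_psfDeriv, psfDeriv_algebraMap, hw, map_mul,
      ← psField_algebraMap, map_add, map_mul, smul_eq_mul, smul_eq_mul]
    ring
  refine constant_mem_range_of_exponentials (H := H) (δ := psfDeriv d) ?_
    (fun a => ⟨a, 1, IsExpOf.one d W, by simp⟩) ?_ ?_ (Subfield.closure_mono ?_ hcZ) hc
  · rintro _ ⟨f, U, hU, rfl⟩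
    obtain ⟨V, hV, hUV⟩ := hU.exists_inv
    refine ⟨f⁻¹, V, hV, ?_⟩
    have h1 := congrArg (algebraMap (PowerSeries Ω) (PSField Ω)) hUV
    rw [map_mul, map_one] at h1
    rw [mul_inv, map_inv₀, eq_inv_of_mul_eq_one_right h1]
  · rintro _ ⟨f, U, ⟨hU, w, hw, hUw⟩, rfl⟩
    by_cases hf : f = 0
    · exact ⟨0, by simp [hf]⟩
    · refine ⟨(d f + f * w) * f⁻¹, ?_⟩
      rw [hd f U w hUw, map_mul, mul_assoc, map_inv₀, inv_mul_cancel_left₀]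
      exact (map_ne_zero _).2 hf
  · rintro _ ⟨f, U, ⟨hU, w, hw, hUw⟩, rfl⟩ h0
    by_cases hf : f = 0
    · exact ⟨0, by simp [hf]⟩
    · rw [hd f U w hUw, mul_eq_zero, _root_.map_eq_zero] at h0
      have hU0 : algebraMap (PowerSeries Ω) (PSField Ω) U ≠ 0 := by
        rw [Ne, map_eq_zero_iff _ psField_injective]
        rintro rfl
        simp at hU
      have h1 := h0.resolve_right hU0
      have h2 := hW (-w) (W.neg_mem hw) f hf (by linear_combination h1)
      rw [neg_eq_zero] at h2
      rw [h2, map_zero, zero_mul] at hUw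
      exact ⟨f, by rw [IsExpOf.eq_one hU hUw, map_one, mul_one]⟩
  · rintro x (⟨a, rfl⟩ | ⟨z, hz, rfl⟩)
    · exact ⟨a, 1, IsExpOf.one d W, by simp⟩
    · exact ⟨1, z, hZ z hz, by simp⟩

end

/-- When `Ω` is spanned over `K` by algebraic numbers, there are enough finite Galois
subextensions spanned by algebraic numbers. -/
theorem exists_galois_spanned {K Ω : Type} [Field K] [CharZero K] [Field Ω] [CharZero Ω]
    [Algebra K Ω] [IsAlgClosed Ω]
    (hCl : ∀ z : Ω, z ∈ Submodule.span K {z : Ω | IsAlgebraic ℚ z}) (T : Finset Ω) :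
    ∃ E : IntermediateField K Ω, FiniteDimensional K E ∧ IsGalois K E ∧ (∀ x ∈ T, x ∈ E) ∧
      ∀ x ∈ E, x ∈ Submodule.span K {c : Ω | c ∈ E ∧ IsAlgebraic ℚ c} := by
  classical
  choose S hS hxS using fun x : Ω => Submodule.mem_span_finite_of_mem_span (hCl x)
  let P : Polynomial ℚ := ∏ s ∈ T.biUnion S, minpoly ℚ s
  have halg : ∀ s ∈ T.biUnion S, IsAlgebraic ℚ s := by
    intro s hs
    obtain ⟨x, -, hx⟩ := Finset.mem_biUnion.1 hs
    exact hS x hx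
  have hP0 : P ≠ 0 := Finset.prod_ne_zero_iff.2 fun s hs => minpoly.ne_zero (halg s hs).isIntegral
  let Q : Polynomial K := P.map (algebraMap ℚ K)
  have hQ : Q.map (algebraMap K Ω) = P.map (algebraMap ℚ Ω) := by
    rw [Polynomial.map_map]
    congr 1
    exact Subsingleton.elim _ _
  let E := IntermediateField.adjoin K (Q.rootSet Ω)
  have hspl := IntermediateField.adjoin_rootSet_isSplittingField
    (p := Q) (L := Ω) (IsAlgClosed.splits _)
  have hfin : FiniteDimensional K E := hspl.finiteDimensional
  have hnor : Normal K E := Normal.of_isSplittingField Q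
  have hQalg : ∀ s ∈ Q.rootSet Ω, IsAlgebraic ℚ s := by
    intro s hs
    rw [Polynomial.mem_rootSet'] at hs
    refine ⟨P, hP0, ?_⟩
    rw [Polynomial.aeval_def, ← Polynomial.eval_map, ← hQ, Polynomial.eval_map]
    exact hs.2
  refine ⟨E, hfin, ⟨⟩, ?_, ?_⟩
  · intro x hx
    have h1 : Submodule.span K (S x : Set Ω) ≤ Subalgebra.toSubmodule E.toSubalgebra := by
      refine Submodule.span_le.2 fun s hs => IntermediateField.subset_adjoin K _ ?_
      have hsT : s ∈ T.biUnion S := Finset.mem_biUnion.2 ⟨x, hx, hs⟩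
      rw [Polynomial.mem_rootSet']
      refine ⟨?_, ?_⟩
      · rw [hQ]
        exact (Polynomial.map_ne_zero_iff (algebraMap ℚ Ω).injective).2 hP0
      · rw [Polynomial.aeval_def, ← Polynomial.eval_map, hQ, Polynomial.eval_map,
          ← Polynomial.aeval_def, map_prod]
        exact Finset.prod_eq_zero hsT (minpoly.aeval _ _)
    exact h1 (hxS x)
  · intro x hx
    have hx' : x ∈ Algebra.adjoin K (Q.rootSet Ω) := by
      have h1 : ∀ s ∈ Q.rootSet Ω, IsAlgebraic K s := fun s hs =>
        (hQalg s hs).extendScalars (algebraMap ℚ K).injective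
      rw [← IntermediateField.adjoin_toSubalgebra_of_isAlgebraic h1]
      exact hx
    rw [← Subalgebra.mem_toSubmodule, Algebra.adjoin_eq_span] at hx'
    refine Submodule.span_mono ?_ hx'
    intro c hc
    induction hc using Submonoid.closure_induction with
    | mem c hc => exact ⟨IntermediateField.subset_adjoin K _ hc, hQalg c hc⟩
    | one => exact ⟨one_mem _, isAlgebraic_one⟩
    | mul a b _ _ ha hb => exact ⟨mul_mem ha.1 hb.1, ha.2.mul hb.2⟩

/-- The logarithmic derivatives of an algebraically closed differential field which lie in a
subfield. -/
def logDerivSubmodule {Ω : Type} [Field Ω] [CharZero Ω] [IsAlgClosed Ω] (d : Derivation ℤ Ω Ω)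
    (E : Type) [Field E] [CharZero E] (i : E →+* Ω) : Submodule ℚ E where
  carrier := {x | ∃ h, h ≠ 0 ∧ d h = i x * h}
  zero_mem' := ⟨1, one_ne_zero, by simp⟩
  add_mem' := by
    rintro x y ⟨h, hh, hx⟩ ⟨g, hg, hy⟩
    refine ⟨h * g, mul_ne_zero hh hg, ?_⟩
    rw [d.leibniz, hx, hy, map_add, smul_eq_mul, smul_eq_mul]
    ring
  smul_mem' := by
    rintro q x ⟨h, hh, hx⟩
    obtain ⟨g, hg⟩ := IsAlgClosed.exists_pow_nat_eq h q.den_pos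
    have hg0 : g ≠ 0 := by
      rintro rfl
      rw [zero_pow q.den_ne_zero] at hg
      exact hh hg.symm
    have hden : (q.den : Ω) ≠ 0 := by exact_mod_cast q.den_ne_zero
    have hlog : d g = (i x * (q.den : Ω)⁻¹) * g := by
      have h1 := congrArg d hg
      rw [d.leibniz_pow, hx, ← hg, nsmul_eq_mul, smul_eq_mul] at h1
      have h2 : g ^ q.den = g ^ (q.den - 1) * g := by
        rw [← pow_succ, Nat.sub_add_cancel q.den_pos]
      rw [h2] at h1
      have h3 : g ^ (q.den - 1) ≠ 0 := pow_ne_zero _ hg0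
      field_simp
      exact mul_left_cancel₀ h3 (by linear_combination h1)
    have hzpow : ∀ m : ℤ, d (g ^ m) = ((m : Ω) * (i x * (q.den : Ω)⁻¹)) * g ^ m := by
      have hnat : ∀ n : ℕ, d (g ^ n) = ((n : Ω) * (i x * (q.den : Ω)⁻¹)) * g ^ n := by
        intro n
        induction n with
        | zero => simp
        | succ n ih =>
          rw [pow_succ, d.leibniz, ih, hlog, smul_eq_mul, smul_eq_mul]
          push_cast
          ring
      intro m
      obtain ⟨n, rfl | rfl⟩ := m.eq_nat_or_neg
      · simpa using hnat n
      · rw [zpow_neg, zpow_natCast, d.leibniz_inv, hnat]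
        have : g ^ n ≠ 0 := pow_ne_zero _ hg0
        simp
        field_simp
    refine ⟨g ^ q.num, zpow_ne_zero _ hg0, ?_⟩
    rw [hzpow]
    have : i (q • x) = (q.num : Ω) * (q.den : Ω)⁻¹ * i x := by
      rw [Rat.smul_def, map_mul, map_ratCast]
      congr 1
      rw [← div_eq_mul_inv]
      exact Rat.cast_def q
    rw [this]
    ring

theorem Extends.algHom_comm {K E Ω : Type} [Field K] [CharZero K] [Field E] [Algebra K E] [Field Ω]
    [Algebra K Ω] [Algebra.IsAlgebraic K E] {d : Derivation ℤ K K} {dE : Derivation ℤ E E}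
    {dΩ : Derivation ℤ Ω Ω} (hE : Extends d dE) (hΩ : Extends d dΩ) (g : E →ₐ[K] Ω) (x : E) :
    dΩ (g x) = g (dE x) := by
  let _ : Algebra E Ω := g.toRingHom.toAlgebra
  have hg : ∀ y, algebraMap E Ω y = g y := fun y => rfl
  refine Derivation.eq_of_isAlgebraic (A := K) (dΩ.compAlgebraMap E) (dE.baseTo Ω) (fun a => ?_) x
  rw [Derivation.baseTo_apply, hE]
  change dΩ (g (algebraMap K E a)) = g (algebraMap K E (d a))
  rw [g.commutes, g.commutes, hΩ]

theorem exists_logDeriv_complement {K Ω : Type} [Field K] [CharZero K] [Field Ω] [CharZero Ω]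
    [Algebra K Ω] [IsAlgClosed Ω] [Algebra.IsAlgebraic K Ω]
    (hCl : ∀ z : Ω, z ∈ Submodule.span K {z : Ω | IsAlgebraic ℚ z})
    {d : Derivation ℤ K K} {dΩ : Derivation ℤ Ω Ω} (hd : Extends d dΩ) (a : Ω) :
    ∃ (u b : Ω) (W : AddSubgroup Ω), u ≠ 0 ∧ b ∈ W ∧ a * u = dΩ u + b * u ∧
      (∀ (g : Ω ≃ₐ[K] Ω), ∀ w ∈ W, g w ∈ W) ∧
      ∀ w ∈ W, ∀ h, h ≠ 0 → dΩ h = w * h → w = 0 := by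
  classical
  have : Normal K Ω := normal_iff.2 fun x =>
    ⟨(Algebra.IsAlgebraic.isAlgebraic x).isIntegral, IsAlgClosed.splits _⟩
  obtain ⟨E, _, _, haE, -⟩ := exists_galois_spanned hCl {a}
  have : CharZero E := charZero_of_injective_algebraMap (algebraMap K E).injective
  have : Fintype (E ≃ₐ[K] E) := Fintype.ofFinite _
  let D := logDerivSubmodule dΩ E E.val.toRingHom
  have hD : ∀ x, x ∈ D ↔ ∃ h, h ≠ 0 ∧ dΩ h = (x : Ω) * h := fun x => Iff.rfl
  have hDσ : ∀ (σ : E ≃ₐ[K] E) (x : E), x ∈ D → σ x ∈ D := by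
    rintro σ x ⟨h, hh, hx⟩
    let g : Ω ≃ₐ[K] Ω := σ.liftNormal Ω
    have hg : g (x : Ω) = (σ x : E) := σ.liftNormal_commutes Ω x
    refine ⟨g h, (map_ne_zero g).2 hh, ?_⟩
    rw [show dΩ (g h) = g (dΩ h) from hd.algHom_comm hd g.toAlgHom h, hx, map_mul]
    exact congrArg (· * g h) hg
  obtain ⟨f, hf⟩ := LinearMap.exists_leftInverse_of_injective D.subtype D.ker_subtype
  let π : E →ₗ[ℚ] E := D.subtype ∘ₗ f
  have hπD : ∀ x, π x ∈ D := fun x => (f x).2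
  have hπ : ∀ x ∈ D, π x = x := fun x hx => congrArg Subtype.val (LinearMap.congr_fun hf ⟨x, hx⟩)
  let av : E → E := fun x => (Fintype.card (E ≃ₐ[K] E) : ℚ)⁻¹ • ∑ σ : E ≃ₐ[K] E, σ (π (σ⁻¹ x))
  have hcard : (Fintype.card (E ≃ₐ[K] E) : ℚ) ≠ 0 := by exact_mod_cast Fintype.card_ne_zero
  have hav : ∀ x y, av (x - y) = av x - av y := fun x y => by
    simp only [av, map_sub, Finset.sum_sub_distrib, smul_sub]
  have havD : ∀ x, av x ∈ D := fun x =>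
    D.smul_mem _ (D.sum_mem fun σ _ => hDσ σ _ (hπD _))
  have hav1 : ∀ x ∈ D, av x = x := by
    intro x hx
    have h1 : ∀ σ : E ≃ₐ[K] E, σ (π (σ⁻¹ x)) = x := fun σ => by
      rw [hπ _ (hDσ _ _ hx), ← AlgEquiv.mul_apply, mul_inv_cancel, AlgEquiv.one_apply]
    simp only [av, h1, Finset.sum_const, Finset.card_univ]
    rw [← Nat.cast_smul_eq_nsmul ℚ, smul_smul, inv_mul_cancel₀ hcard, one_smul]
  have havσ : ∀ (τ : E ≃ₐ[K] E) x, av (τ x) = τ (av x) := by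
    intro τ x
    have hτq : ∀ (q : ℚ) (y : E), τ (q • y) = q • τ y := fun q y =>
      map_rat_smul (τ : E →+ E) q y
    simp only [av]
    rw [hτq, map_sum, ← Equiv.sum_comp (Equiv.mulLeft τ)]
    congr 1
    refine Finset.sum_congr rfl fun σ _ => ?_
    simp [AlgEquiv.mul_apply, mul_inv_rev]
  let W : AddSubgroup Ω :=
    { carrier := {w | ∃ x : E, av x = 0 ∧ (x : Ω) = w}
      zero_mem' := ⟨0, by simpa using hav 0 0, rfl⟩
      add_mem' := by
        rintro _ _ ⟨x, hx, rfl⟩ ⟨y, hy, rfl⟩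
        refine ⟨x + y, ?_, rfl⟩
        have h1 := hav 0 y
        have h2 := hav x (0 - y)
        have h3 := hav 0 0
        simp_all
      neg_mem' := by
        rintro _ ⟨x, hx, rfl⟩
        refine ⟨-x, ?_, rfl⟩
        have h1 := hav 0 x
        have h3 := hav 0 0
        simp_all }
  let a' : E := ⟨a, haE a (Finset.mem_singleton_self a)⟩
  obtain ⟨u, hu, hau⟩ := (hD _).1 (havD a')
  refine ⟨u, a - av a', W, hu, ⟨a' - av a', ?_, rfl⟩, ?_, ?_, ?_⟩
  · rw [hav, hav1 _ (havD a'), sub_self]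
  · rw [hau]
    ring
  · rintro g _ ⟨x, hx, rfl⟩
    refine ⟨g.restrictNormal E x, ?_, g.restrictNormal_commutes E x⟩
    rw [havσ, hx, map_zero]
  · rintro _ ⟨x, hx, rfl⟩ h hh hxh
    rw [← hav1 x ((hD x).2 ⟨h, hh, hxh⟩), hx]
    rfl

/-- `y' = A y` has a nonzero solution in a `p`-adic extension without new constants. -/
def HasSolution {K ι : Type} [Field K] [Fintype ι] (p : ℕ) (d : Derivation ℤ K K)
    (A : Matrix ι ι K) : Prop :=
  ∃ (L : Type) (_ : Field L) (_ : CharZero L) (_ : Algebra K L) (dL : Derivation ℤ L L) (t : ι → L),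
    Extends d dL ∧ NoNewConst d dL ∧ IsPAdicField p L ∧ t ≠ 0 ∧
      dL ∘ t = (A.map (algebraMap K L)).mulVec t

section
open PowerSeries

theorem psDeriv_map {K Ω : Type} [Field K] [Field Ω] {d : Derivation ℤ K K} {dΩ : Derivation ℤ Ω Ω}
    (f : K →+* Ω) (hf : ∀ x, dΩ (f x) = f (d x)) (z : PowerSeries K) :
    psDeriv dΩ (PowerSeries.map f z) = PowerSeries.map f (psDeriv d z) := by
  ext j
  simp [coeff_psDeriv, hf]

theorem HasSolution.of_isExpOf {p : ℕ} (hp : p.Prime) {K Ω ι : Type} [Field K] [CharZero K]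
    [Field Ω] [CharZero Ω] [Algebra K Ω] [Algebra.IsAlgebraic K Ω] [Fintype ι]
    (hK : IsPAdicField p K) {d : Derivation ℤ K K} {dΩ : Derivation ℤ Ω Ω} (hd : Extends d dΩ)
    {A : Matrix ι ι K} {y : ι → PowerSeries K} (hy0 : y ≠ 0)
    (hy : ∀ i, psDeriv d (y i) = ∑ j, C (A i j) * y j) {W : AddSubgroup Ω}
    (hW : ∀ w ∈ W, ∀ h, h ≠ 0 → dΩ h = w * h → w = 0) {Z : Set (PowerSeries Ω)}
    (hZ : ∀ z ∈ Z, IsExpOf dΩ W z)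
    (hyZ : ∀ i, PowerSeries.map (algebraMap K Ω) (y i) ∈
      Subring.closure (Set.range (C (R := Ω)) ∪ Z)) : HasSolution p d A := by
  let F := PSField K
  let φ : PowerSeries K →+* F := algebraMap (PowerSeries K) (PSField K)
  let δ : Derivation ℤ F F := psfDeriv d
  let s : Set F := Set.range fun i => φ (y i)
  let L := IntermediateField.adjoin K s
  have hys : ∀ i, φ (y i) ∈ L := fun i => IntermediateField.subset_adjoin K s ⟨i, rfl⟩
  have hδy : ∀ i, δ (φ (y i)) = ∑ j, algebraMap K F (A i j) * φ (y j) := by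
    intro i
    change psfDeriv d (algebraMap _ _ (y i)) = _
    rw [psfDeriv_algebraMap, hy, map_sum]
    exact Finset.sum_congr rfl fun j _ => map_mul _ _ _
  obtain ⟨dL, hdL, hdLδ⟩ : ∃ dL : Derivation ℤ L L, Extends d dL ∧ ∀ x, (dL x : F) = δ x := by
    refine exists_derivation_adjoin (extends_psfDeriv d) s ?_
    rintro _ ⟨i, rfl⟩
    change δ (φ (y i)) ∈ L
    rw [hδy]
    exact sum_mem fun j _ => mul_mem (L.algebraMap_mem _) (hys j)
  have : CharZero L := charZero_of_injective_algebraMap (algebraMap K L).injective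
  let μ : PowerSeries K →+* PowerSeries Ω := PowerSeries.map (algebraMap K Ω)
  have hμ : Function.Injective μ := by
    intro a b h
    ext n
    have := congrArg (coeff n) h
    rw [coeff_map, coeff_map] at this
    exact (algebraMap K Ω).injective this
  let ψ : F →+* PSField Ω := IsFractionRing.map hμ
  have hψ : ∀ f, ψ (φ f) = algebraMap (PowerSeries Ω) (PSField Ω) (μ f) := fun f =>
    IsLocalization.map_eq _ f
  have hψK : ∀ a : K, ψ (algebraMap K F a) = algebraMap Ω (PSField Ω) (algebraMap K Ω a) := fun a => by
    rw [psField_algebraMap, hψ, psField_algebraMap]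
    congr 1
    exact PowerSeries.map_C _ _
  have hψδ : ∀ x, psfDeriv dΩ (ψ x) = ψ (δ x) := by
    intro x
    have h1 : ∀ f, psfDeriv dΩ (ψ (φ f)) = ψ (δ (φ f)) := by
      intro f
      change _ = ψ (psfDeriv d (algebraMap _ _ f))
      rw [hψ, psfDeriv_algebraMap, psfDeriv_algebraMap, psDeriv_map _ hd]
      exact (hψ _).symm
    rcases psField_cases x with ⟨f, rfl | ⟨-, rfl⟩⟩
    · exact h1 f
    · have := h1 f
      change psfDeriv dΩ (ψ (φ f)⁻¹) = ψ (δ (φ f)⁻¹)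
      rw [map_inv₀, Derivation.leibniz_inv, Derivation.leibniz_inv, this]
      simp
  let S : Subfield (PSField Ω) := Subfield.closure (Set.range (algebraMap Ω (PSField Ω)) ∪
      algebraMap (PowerSeries Ω) (PSField Ω) '' Z)
  have hSΩ : ∀ a, algebraMap Ω (PSField Ω) a ∈ S := fun a =>
    Subfield.subset_closure (Or.inl ⟨a, rfl⟩)
  have hSy : ∀ f ∈ Subring.closure (Set.range (C (R := Ω)) ∪ Z),
      algebraMap (PowerSeries Ω) (PSField Ω) f ∈ S := by
    intro f hf
    have : Subring.closure (Set.range (C (R := Ω)) ∪ Z) ≤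
        S.toSubring.comap (algebraMap (PowerSeries Ω) (PSField Ω)) := by
      rw [Subring.closure_le]
      rintro _ (⟨a, rfl⟩ | hz)
      · exact hSΩ a
      · exact Subfield.subset_closure (Or.inr ⟨_, hz, rfl⟩)
    exact this hf
  have hLS : ∀ x ∈ L, ψ x ∈ S := by
    intro x hx
    have h1 : L.toSubfield ≤ S.comap ψ := by
      refine Subfield.closure_le.2 ?_
      rintro _ (⟨a, rfl⟩ | ⟨i, rfl⟩)
      · change ψ (algebraMap K F a) ∈ S
        rw [hψK]
        exact hSΩ _
      · change ψ (φ (y i)) ∈ S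
        rw [hψ]
        exact hSy _ (hyZ i)
    exact h1 hx
  have hconst : NoNewConst d dL := by
    refine NoNewConst.of_powerSeries hdL fun c hc => ?_
    have h1 : psfDeriv dΩ (ψ (c : F)) = 0 := by
      rw [hψδ, ← hdLδ, hc]
      exact map_zero ψ
    obtain ⟨a, ha⟩ := mem_range_of_isExpOf hW hZ (hLS c c.2) h1
    obtain ⟨P, hP, hPa⟩ := Algebra.IsAlgebraic.isAlgebraic (R := K) a
    refine ⟨P, hP, ?_⟩
    apply (algebraMap L F).injective
    apply ψ.injective
    have h2 : (algebraMap Ω (PSField Ω)) (Polynomial.aeval a P) =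
        ψ (algebraMap L F (Polynomial.aeval c P)) := by
      rw [Polynomial.aeval_def, Polynomial.aeval_def, Polynomial.hom_eval₂, Polynomial.hom_eval₂,
        Polynomial.hom_eval₂, ha]
      congr 1
      ext b
      exact (hψK b).symm
    rw [← h2, hPa, map_zero, map_zero, map_zero]
  refine ⟨L, inferInstance, this, inferInstance, dL, fun i => ⟨φ (y i), hys i⟩, hdL, hconst,
    IsPAdicField.of_ringHom hp (algebraMap L F) (psField_isPAdicField hp hK), ?_, ?_⟩
  · intro h
    refine hy0 (funext fun i => psField_injective ?_)
    have := congrArg (algebraMap L F) (congrFun h i)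
    rw [Pi.zero_apply, map_zero] at this ⊢
    exact this
  · funext i
    apply (algebraMap L F).injective
    refine ((hdLδ _).trans (hδy i)).trans ?_
    simp only [Matrix.mulVec, dotProduct, Matrix.map_apply]
    rw [map_sum]
    rfl
end

section
open PowerSeries

theorem HasSolution.of_exponential {p : ℕ} (hp : p.Prime) {K Ω ι : Type} [Field K] [CharZero K]
    [Field Ω] [CharZero Ω] [Algebra K Ω] [IsAlgClosed Ω] [Algebra.IsAlgebraic K Ω] [Fintype ι]
    (hK : IsPAdicField p K) (hCl : ∀ z : Ω, z ∈ Submodule.span K {z : Ω | IsAlgebraic ℚ z})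
    {d : Derivation ℤ K K} {dΩ : Derivation ℤ Ω Ω} (hd : Extends d dΩ)
    {A : Matrix ι ι K} {τ : ι → Ω} (hτ : τ ≠ 0) {b : Ω} {W : AddSubgroup Ω} (hb : b ∈ W)
    (hτb : dΩ ∘ τ - (A.map (algebraMap K Ω)).mulVec τ = b • τ)
    (hWg : ∀ (g : Ω ≃ₐ[K] Ω), ∀ w ∈ W, g w ∈ W)
    (hW : ∀ w ∈ W, ∀ h, h ≠ 0 → dΩ h = w * h → w = 0) : HasSolution p d A := by
  classical
  have : Normal K Ω := normal_iff.2 fun x =>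
    ⟨(Algebra.IsAlgebraic.isAlgebraic x).isIntegral, IsAlgClosed.splits _⟩
  obtain ⟨E, _, _, hTE, hE⟩ := exists_galois_spanned hCl (insert b (Finset.univ.image τ))
  have : CharZero E := charZero_of_injective_algebraMap (algebraMap K E).injective
  have hτE : ∀ i, τ i ∈ E := fun i =>
    hTE _ (Finset.mem_insert_of_mem (Finset.mem_image_of_mem τ (Finset.mem_univ i)))
  let bE : E := ⟨b, hTE b (Finset.mem_insert_self _ _)⟩
  let τE : ι → E := fun i => ⟨τ i, hτE i⟩
  obtain ⟨dE, hdE⟩ := exists_extends E d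
  have hcomm : ∀ (σ : E ≃ₐ[K] E) (x : E), dΩ (σ x : E) = (σ (dE x) : E) := fun σ x =>
    hdE.algHom_comm hd (E.val.comp σ.toAlgHom) x
  have hcomm1 : ∀ x : E, dΩ x = dE x := fun x => hcomm AlgEquiv.refl x
  obtain ⟨i₀, hi₀⟩ := Function.ne_iff.1 hτ
  have hτE0 : τE i₀ ≠ 0 := fun h => hi₀ (congrArg Subtype.val h)
  obtain ⟨c, hcQ, hc⟩ : ∃ c : E, IsAlgebraic ℚ (c : Ω) ∧ Algebra.trace K E (c * τE i₀) ≠ 0 := by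
    by_contra! hcon
    obtain ⟨w, hw⟩ := Algebra.trace_surjective K E 1
    let T : E →ₗ[K] K := Algebra.trace K E ∘ₗ LinearMap.mulRight K (τE i₀)
    have hle : Submodule.span K {c : Ω | c ∈ E ∧ IsAlgebraic ℚ c} ≤
        (LinearMap.ker T).map E.val.toLinearMap := by
      rw [Submodule.span_le]
      rintro c ⟨hcE, hc⟩
      exact ⟨⟨c, hcE⟩, hcon ⟨c, hcE⟩ hc, rfl⟩
    obtain ⟨x, hx, hxw⟩ := hle (hE (w * (τE i₀)⁻¹ : E) (w * (τE i₀)⁻¹ : E).2)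
    have hxw' : x = w * (τE i₀)⁻¹ := Subtype.ext hxw
    have hx' : Algebra.trace K E (x * τE i₀) = 0 := hx
    rw [hxw', inv_mul_cancel_right₀ hτE0, hw] at hx'
    exact one_ne_zero hx'
  have hdc : dE c = 0 := by
    apply Subtype.ext
    rw [← hcomm1]
    refine Derivation.eq_zero_of_isAlgebraic (A := ℚ) dΩ (fun q => ?_) hcQ
    have h1 := map_rat_smul dΩ q (1 : Ω)
    rwa [dΩ.map_one_eq_zero, smul_zero, ← Algebra.algebraMap_eq_smul_one] at h1
  obtain ⟨z', hz0', hz'⟩ := exists_powerSeries_recursion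
    (fun _ (v : Unit → E) i => - bE * v i - dE (v i)) (fun _ => (1 : E))
  let z := z' ()
  have hz0 : constantCoeff z = 1 := hz0' ()
  have hz : psDeriv dE z = - (C bE * z) := by
    ext1 j
    rw [coeff_psDeriv, map_neg, coeff_C_mul, hz']
    ring
  let Y : ι → PowerSeries E := fun i => C (c * τE i) * z
  have hτ' : ∀ i, dE (τE i) = ∑ j, algebraMap K E (A i j) * τE j + bE * τE i := by
    intro i
    apply (algebraMap E Ω).injective
    have h1 := congrFun hτb i
    have h2 : dΩ (τ i) = algebraMap E Ω (dE (τE i)) := hcomm1 (τE i)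
    simp only [Pi.sub_apply, Function.comp_apply, Pi.smul_apply, smul_eq_mul, Matrix.mulVec,
      dotProduct, Matrix.map_apply] at h1
    rw [← h2, map_add, map_sum, map_mul]
    rw [sub_eq_iff_eq_add'] at h1
    exact h1
  have hY : ∀ i, psDeriv dE (Y i) = ∑ j, C (algebraMap K E (A i j)) * Y j := by
    intro i
    have h1 : dE (c * τE i) = c * dE (τE i) := by
      rw [dE.leibniz, hdc, smul_zero, add_zero, smul_eq_mul]
    simp only [Y]
    rw [psDeriv_mul, psDeriv_C, hz, h1, hτ']
    simp only [map_mul, map_add, map_sum, mul_add, Finset.mul_sum]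
    have h2 : ∀ j, C (algebraMap K E (A i j)) * (C c * C (τE j) * z) =
      z * (C c * (C (algebraMap K E (A i j)) * C (τE j))) := fun j => by ring
    simp only [h2]
    ring
  let e : (E ≃ₐ[K] E) → E →+* Ω := fun σ => (algebraMap E Ω).comp σ.toRingEquiv.toRingHom
  have he : ∀ σ x, dΩ (e σ x) = e σ (dE x) := hcomm
  have heK : ∀ σ a, e σ (algebraMap K E a) = algebraMap K Ω a := fun σ a =>
    congrArg (algebraMap E Ω) (σ.commutes a)
  let y : ι → PowerSeries K := fun i => PowerSeries.mk fun n => Algebra.trace K E (coeff n (Y i))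
  have hy : ∀ i, PowerSeries.map (algebraMap K Ω) (y i) = ∑ σ, PowerSeries.map (e σ) (Y i) := by
    intro i
    ext1 n
    rw [coeff_map, coeff_mk, map_sum, IsScalarTower.algebraMap_apply K E Ω,
      trace_eq_sum_automorphisms, map_sum]
    exact Finset.sum_congr rfl fun σ _ => (coeff_map (e σ) n (Y i)).symm
  let Z : Set (PowerSeries Ω) := Set.range fun σ => PowerSeries.map (e σ) z
  have hinj : Function.Injective (PowerSeries.map (algebraMap K Ω)) := by
    intro f g h
    ext n
    have := congrArg (coeff n) h
    rw [coeff_map, coeff_map] at this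
    exact (algebraMap K Ω).injective this
  refine HasSolution.of_isExpOf hp hK hd (y := y) ?_ ?_ hW (Z := Z) ?_ ?_
  · intro h
    have h1 := congrArg (coeff 0) (congrFun h i₀)
    rw [coeff_mk, coeff_zero_eq_constantCoeff_apply, map_mul, hz0, constantCoeff_C, mul_one] at h1
    exact hc (by simpa using h1)
  · intro i
    apply hinj
    rw [← psDeriv_map _ hd, hy, map_sum, map_sum]
    simp only [psDeriv_map _ (he _), hY, map_mul, hy, map_sum, map_C, heK, Finset.mul_sum]
    exact Finset.sum_comm
  · rintro _ ⟨σ, rfl⟩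
    refine ⟨?_, - e σ bE, W.neg_mem ?_, ?_⟩
    · rw [← coeff_zero_eq_constantCoeff_apply, coeff_map, coeff_zero_eq_constantCoeff_apply, hz0,
        map_one]
    · have : (σ.liftNormal Ω) b = e σ bE := σ.liftNormal_commutes Ω bE
      rw [← this]
      exact hWg _ b hb
    · change psDeriv dΩ (PowerSeries.map (e σ) z) = C (- e σ bE) * PowerSeries.map (e σ) z
      rw [psDeriv_map _ (he σ), hz, map_neg, map_mul, map_C, map_neg, neg_mul]
  · intro i
    rw [hy]
    refine sum_mem fun σ _ => ?_
    simp only [Y]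
    rw [map_mul, map_C]
    exact mul_mem (Subring.subset_closure (Or.inl ⟨_, rfl⟩))
      (Subring.subset_closure (Or.inr ⟨σ, rfl⟩))
end

theorem HasSolution.of_extension {p : ℕ} {K L ι : Type} [Field K] [Field L] [Algebra K L] [Fintype ι]
    {d : Derivation ℤ K K} {dL : Derivation ℤ L L} (hd : Extends d dL) (hc : NoNewConst d dL)
    {A : Matrix ι ι K} (h : HasSolution p dL (A.map (algebraMap K L))) : HasSolution p d A := by
  obtain ⟨M, _, _, _, dM, t, hM, hMc, hMp, ht, htA⟩ := h
  let _ : Algebra K M := ((algebraMap L M).comp (algebraMap K L)).toAlgebra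
  have : IsScalarTower K L M := IsScalarTower.of_algebraMap_eq fun _ => rfl
  exact ⟨M, inferInstance, inferInstance, inferInstance, dM, t, hd.trans hM, hc.trans hMc, hMp, ht, htA⟩

theorem HasSolution.of_scalar {p : ℕ} (hp : p.Prime) {K Ω ι : Type} [Field K] [CharZero K]
    [Field Ω] [CharZero Ω] [Algebra K Ω] [IsAlgClosed Ω] [Algebra.IsAlgebraic K Ω] [Fintype ι]
    [DecidableEq ι] (hK : IsPAdicField p K)
    (hCl : ∀ z : Ω, z ∈ Submodule.span K {z : Ω | IsAlgebraic ℚ z})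
    {d : Derivation ℤ K K} {dΩ : Derivation ℤ Ω Ω} (hd : Extends d dΩ) {A : Matrix ι ι K}
    {N : Submodule Ω (ι → Ω)} (hN : ∀ w ∈ N, dΩ ∘ w - (A.map (algebraMap K Ω)).mulVec w ∈ N)
    (hN0 : N ≠ ⊥)
    (hscal : ∀ e, InG d A e → (∃ m : Polynomial ℚ, m.Separable ∧ Polynomial.aeval e m = 0) →
      ∃ c : Ω, ∀ u ∈ N, (e.map (algebraMap K Ω)).mulVec u = c • u) : HasSolution p d A := by
  obtain ⟨lam, N₀, hN₀, hN₀d, hlam⟩ := exists_weight_submodule hCl hd hN hN0 hscal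
  obtain ⟨τ, a, hτ, hτa⟩ := exists_exponential_solution hd hN₀d hN₀ lam hlam
  obtain ⟨u, b, W, hu, hb, hab, hWg, hW⟩ := exists_logDeriv_complement hCl hd a
  refine HasSolution.of_exponential hp hK hCl hd (τ := u⁻¹ • τ)
    (smul_ne_zero (inv_ne_zero hu) hτ) hb ?_ hWg hW
  rw [Matrix.mulVec_smul]
  funext i
  have h1 := congrFun hτa i
  simp only [Pi.sub_apply, Function.comp_apply, Pi.smul_apply, smul_eq_mul] at h1 ⊢
  rw [dΩ.leibniz, dΩ.leibniz_inv, sub_eq_iff_eq_add.1 h1]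
  simp only [smul_eq_mul]
  field_simp
  linear_combination τ i * hab

theorem exists_differential_padic_closure {p : ℕ} (hp : p.Prime) (L Ω : Type) [Field L] [Field Ω]
    [CharZero L] [CharZero Ω] [Algebra L Ω] [IsAlgClosed Ω] [Algebra.IsAlgebraic L Ω]
    (hL : IsPAdicField p L) (d : Derivation ℤ L L) :
    ∃ (F : IntermediateField L Ω) (dF : Derivation ℤ F F) (dΩ : Derivation ℤ Ω Ω),
      IsPAdicField p F ∧ (∀ z : Ω, z ∈ Submodule.span F {z : Ω | IsAlgebraic ℚ z}) ∧
      Extends d dF ∧ Extends d dΩ ∧ Extends dF dΩ := by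
  obtain ⟨F, hF, hFΩ⟩ := PadicVal.exists_padic_closure hp L Ω hL
  obtain ⟨dF, hdF⟩ := exists_extends F d
  obtain ⟨dΩ, hdΩ⟩ := exists_extends Ω d
  exact ⟨F, dF, dΩ, hF, hFΩ, hdF, hdΩ, fun x => hdF.algHom_comm hdΩ F.val x⟩

/-- Two fields inside a common field, the second one algebraically closed and algebraic over a
common subfield, embed into an algebraic closure of the first one. -/
theorem exists_algClosed_amalgam {K L Ω Θ : Type} [Field K] [Field L] [CharZero L] [Field Ω] [Field Θ]
    [Algebra K L] [Algebra K Ω] [Algebra.IsAlgebraic K Ω] (i : L →+* Θ) (j : Ω →+* Θ)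
    (hij : ∀ a : K, i (algebraMap K L a) = j (algebraMap K Ω a)) :
    ∃ (Ω' : Type) (_ : Field Ω') (_ : CharZero Ω') (_ : Algebra L Ω') (_ : Algebra Ω Ω')
      (Λ : Type) (_ : Field Λ) (f : Ω' →+* Λ) (g : Θ →+* Λ),
      IsAlgClosed Ω' ∧ Algebra.IsAlgebraic L Ω' ∧
      (∀ x, f (algebraMap L Ω' x) = g (i x)) ∧ (∀ x, f (algebraMap Ω Ω' x) = g (j x)) := by
  let Λ := AlgebraicClosure Θ
  let g : Θ →+* Λ := algebraMap Θ Λ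
  let _ : Algebra L Λ := (g.comp i).toAlgebra
  let Ω' := algebraicClosure L Λ
  have : CharZero Ω' := charZero_of_injective_algebraMap (algebraMap L Ω').injective
  have hj : ∀ x, g (j x) ∈ Ω' := by
    intro x
    rw [mem_algebraicClosure_iff]
    obtain ⟨P, hP, hx⟩ := Algebra.IsAlgebraic.isAlgebraic (R := K) x
    refine ⟨P.map (algebraMap K L), (Polynomial.map_ne_zero_iff (algebraMap K L).injective).2 hP, ?_⟩
    rw [Polynomial.aeval_def, Polynomial.eval₂_map]
    have h1 : (algebraMap L Λ).comp (algebraMap K L) = (g.comp j).comp (algebraMap K Ω) := by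
      ext a
      exact congrArg g (hij a)
    have h2 := congrArg (g.comp j) hx
    rw [Polynomial.aeval_def, Polynomial.hom_eval₂, map_zero, ← h1] at h2
    exact h2
  let j' : Ω →+* Ω' := (g.comp j).codRestrict Ω'.toSubfield hj
  have hcl : IsAlgClosure L Ω' := inferInstance
  exact ⟨Ω', inferInstance, this, inferInstance, j'.toAlgebra, Λ, inferInstance, algebraMap Ω' Λ, g,
    hcl.isAlgClosed, hcl.isAlgebraic, fun x => rfl, fun x => rfl⟩

theorem Matrix.aeval_mulVec_of_eigenvector {F ι : Type} [Field F] [CharZero F] [Fintype ι]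
    [DecidableEq ι] {y : Matrix ι ι F} {c : F} {u : ι → F} (h : y.mulVec u = c • u)
    (m : Polynomial ℚ) : (Polynomial.aeval y m).mulVec u = Polynomial.aeval c m • u := by
  induction m using Polynomial.induction_on with
  | C a =>
    rw [Polynomial.aeval_C, Polynomial.aeval_C, Algebra.algebraMap_eq_smul_one, Matrix.smul_mulVec,
      Matrix.one_mulVec, algebraMap_smul]
  | add p q hp hq => rw [map_add, map_add, Matrix.add_mulVec, hp, hq, add_smul]
  | monomial n a ih =>
    have hX : ∀ q : Polynomial ℚ, Polynomial.aeval y (q * Polynomial.X) = Polynomial.aeval y q * y :=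
      fun q => by rw [map_mul, Polynomial.aeval_X]
    have hX' : ∀ q : Polynomial ℚ, Polynomial.aeval c (q * Polynomial.X) = Polynomial.aeval c q * c :=
      fun q => by rw [map_mul, Polynomial.aeval_X]
    rw [pow_succ, ← mul_assoc, hX, hX', ← Matrix.mulVec_mulVec, h, Matrix.mulVec_smul, ih, smul_smul, mul_comm c]

theorem Submodule.finrank_extendScalarsPi_le {F Λ ι : Type} [Field F] [Field Λ] [Algebra F Λ]
    [Fintype ι] (N : Submodule F (ι → F)) :
    Module.finrank Λ (N.extendScalarsPi Λ) ≤ Module.finrank F N := by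
  classical
  let b := Module.finBasis F N
  let b' : Fin (Module.finrank F N) → ι → Λ := fun k i => algebraMap F Λ ((b k : ι → F) i)
  have hle : N.extendScalarsPi Λ ≤ Submodule.span Λ (Set.range b') := by
    refine Submodule.span_le.2 ?_
    rintro _ ⟨w, hw, rfl⟩
    have h1 := congrArg Subtype.val (b.sum_repr ⟨w, hw⟩)
    have h2 : (fun i => algebraMap F Λ (w i)) =
        ∑ k, algebraMap F Λ (b.repr ⟨w, hw⟩ k) • b' k := by
      funext i
      have h3 := congrFun h1 i
      simp only [Submodule.coe_sum, Submodule.coe_smul, Finset.sum_apply, Pi.smul_apply,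
        smul_eq_mul] at h3 ⊢
      rw [← h3, map_sum]
      exact Finset.sum_congr rfl fun k _ => map_mul _ _ _
    change (fun i => algebraMap F Λ (w i)) ∈ _
    rw [h2]
    exact sum_mem fun k _ => Submodule.smul_mem _ _ (Submodule.subset_span ⟨k, rfl⟩)
  refine (Submodule.finrank_mono hle).trans ((finrank_range_le_card b').trans ?_)
  rw [Fintype.card_fin]

theorem exists_eigen_submodule {K L Ω Ω' ι : Type} [Field K] [CharZero K] [Field L] [CharZero L]
    [Field Ω] [Field Ω'] [CharZero Ω'] [Algebra K L] [Algebra K Ω] [Algebra L Ω'] [Algebra Ω Ω']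
    [IsAlgClosed Ω] [IsAlgClosed Ω'] [Algebra.IsAlgebraic K Ω] [Fintype ι] [DecidableEq ι]
    (hcomp : ∀ a : K, algebraMap L Ω' (algebraMap K L a) = algebraMap Ω Ω' (algebraMap K Ω a))
    {d : Derivation ℤ K K} {dL : Derivation ℤ L L} {dΩ : Derivation ℤ Ω Ω}
    {dΩ' : Derivation ℤ Ω' Ω'} (hdΩ : Extends d dΩ) (hdL : Extends d dL) (hdΩ' : Extends dL dΩ')
    {A : Matrix ι ι K} {N : Submodule Ω (ι → Ω)}
    (hN : ∀ w ∈ N, dΩ ∘ w - (A.map (algebraMap K Ω)).mulVec w ∈ N) (hN0 : N ≠ ⊥)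
    {y : Matrix ι ι L}
    (hy : y.map dL = A.map (algebraMap K L) * y - y * A.map (algebraMap K L))
    {m : Polynomial ℚ} (hm : m ≠ 0) (hym : Polynomial.aeval y m = 0)
    (hspan : y ∈ Submodule.span L
      ((fun v : Matrix ι ι K => v.map (algebraMap K L)) '' {v | InG d A v}))
    (hns : ∀ c : Ω, ∃ u ∈ N, (y.map (algebraMap L Ω')).mulVec (fun i => algebraMap Ω Ω' (u i)) ≠
      algebraMap Ω Ω' c • fun i => algebraMap Ω Ω' (u i)) :
    ∃ N' : Submodule Ω' (ι → Ω'), N' ≠ ⊥ ∧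
      (∀ w ∈ N', dΩ' ∘ w - ((A.map (algebraMap K L)).map (algebraMap L Ω')).mulVec w ∈ N') ∧
      Module.finrank Ω' N' < Module.finrank Ω N := by
  let B := (A.map (algebraMap K L)).map (algebraMap L Ω')
  have hmap : ∀ M : Matrix ι ι K, (M.map (algebraMap K L)).map (algebraMap L Ω') =
      (M.map (algebraMap K Ω)).map (algebraMap Ω Ω') := fun M => by
    ext i j
    exact hcomp _
  have hΩΩ' : Extends dΩ dΩ' := by
    let _ : Algebra K Ω' := ((algebraMap L Ω').comp (algebraMap K L)).toAlgebra
    have : IsScalarTower K L Ω' := IsScalarTower.of_algebraMap_eq fun _ => rfl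
    have : IsScalarTower K Ω Ω' := IsScalarTower.of_algebraMap_eq hcomp
    exact fun x => hdΩ.algHom_comm (hdL.trans hdΩ') (IsScalarTower.toAlgHom K Ω Ω') x
  let M := N.extendScalarsPi Ω'
  have hMd : ∀ w ∈ M, dΩ' ∘ w - B.mulVec w ∈ M := by
    intro w hw
    have := Submodule.nabla_mem_extendScalarsPi hΩΩ' hN hw
    rwa [← hmap] at this
  let Y := y.map (algebraMap L Ω')
  have hYM : ∀ w ∈ M, Y.mulVec w ∈ M := by
    have key : ∀ x ∈ Submodule.span L
        ((fun v : Matrix ι ι K => v.map (algebraMap K L)) '' {v | InG d A v}),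
        ∀ w ∈ M, (x.map (algebraMap L Ω')).mulVec w ∈ M := by
      intro x hx
      induction hx using Submodule.span_induction with
      | mem x hx =>
        obtain ⟨v, hv, rfl⟩ := hx
        intro w hw
        induction hw using Submodule.span_induction with
        | mem w hw =>
          obtain ⟨u, hu, rfl⟩ := hw
          rw [hmap]
          convert Submodule.mem_extendScalarsPi (Λ := Ω') (hv.mulVec_mem hdΩ hN hu) using 1
          funext i
          simp only [Matrix.mulVec, dotProduct, Matrix.map_apply]
          rw [map_sum]
          exact Finset.sum_congr rfl fun k _ => (map_mul _ _ _).symm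
        | zero => rw [Matrix.mulVec_zero]; exact M.zero_mem
        | add w₁ w₂ _ _ h₁ h₂ => rw [Matrix.mulVec_add]; exact M.add_mem h₁ h₂
        | smul c w _ h => rw [Matrix.mulVec_smul]; exact M.smul_mem _ h
      | zero =>
        intro w _
        rw [Matrix.map_zero _ (map_zero _), Matrix.zero_mulVec]
        exact M.zero_mem
      | add x₁ x₂ _ _ h₁ h₂ =>
        intro w hw
        rw [Matrix.map_add _ (map_add _), Matrix.add_mulVec]
        exact M.add_mem (h₁ w hw) (h₂ w hw)
      | smul c x _ h =>
        intro w hw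
        rw [show (c • x).map (algebraMap L Ω') = algebraMap L Ω' c • x.map (algebraMap L Ω') from
          Matrix.ext fun i j => map_mul (algebraMap L Ω') c (x i j), Matrix.smul_mulVec]
        exact M.smul_mem _ (h w hw)
    exact key y hspan
  have hM0 : M ≠ ⊥ := by
    obtain ⟨w, hw, hw0⟩ := (Submodule.ne_bot_iff N).1 hN0
    refine (Submodule.ne_bot_iff M).2 ⟨_, Submodule.mem_extendScalarsPi hw, fun h => hw0 ?_⟩
    funext i
    exact (map_eq_zero (algebraMap Ω Ω')).1 (congrFun h i)
  have : Nontrivial M := (Submodule.nontrivial_iff_ne_bot).2 hM0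
  obtain ⟨c, hc⟩ := Module.End.exists_eigenvalue (Y.mulVecLin.restrict hYM)
  obtain ⟨⟨u, hu⟩, huc⟩ := hc.exists_hasEigenvector
  have huY : Y.mulVec u = c • u := congrArg Subtype.val huc.apply_eq_smul
  have hu0 : u ≠ 0 := fun h => huc.2 (Subtype.ext h)
  have hYm : Polynomial.aeval Y m = 0 := by
    have h1 : Polynomial.aeval ((algebraMap L Ω').mapMatrix y) m =
        (algebraMap L Ω').mapMatrix (Polynomial.aeval y m) := by
      rw [Polynomial.aeval_def, Polynomial.aeval_def, Polynomial.hom_eval₂]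
      congr 1
      exact Subsingleton.elim _ _
    rw [hym, map_zero] at h1
    exact h1
  have hcm : Polynomial.aeval c m = 0 := by
    have h1 := Matrix.aeval_mulVec_of_eigenvector huY m
    rw [hYm, Matrix.zero_mulVec] at h1
    exact (smul_eq_zero.1 h1.symm).resolve_right hu0
  have hcalg : IsAlgebraic ℚ c := ⟨m, hm, hcm⟩
  have hdc : dΩ' c = 0 := by
    refine Derivation.eq_zero_of_isAlgebraic (A := ℚ) dΩ' (fun q => ?_) hcalg
    have h1 := map_rat_smul dΩ' q (1 : Ω')
    rwa [dΩ'.map_one_eq_zero, smul_zero, ← Algebra.algebraMap_eq_smul_one] at h1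
  have : CharZero Ω := charZero_of_injective_algebraMap (algebraMap K Ω).injective
  obtain ⟨c₀, rfl⟩ : ∃ c₀, algebraMap Ω Ω' c₀ = c := by
    have hxint : IsIntegral Ω c := by
      have : IsAlgebraic Ω c := hcalg.extendScalars (algebraMap ℚ Ω).injective
      exact this.isIntegral
    exact minpoly.mem_range_of_degree_eq_one Ω c
      (IsAlgClosed.degree_eq_one_of_irreducible Ω (minpoly.irreducible hxint))
  let N' : Submodule Ω' (ι → Ω') :=
    M ⊓ LinearMap.ker (Y.mulVecLin - algebraMap Ω Ω' c₀ • LinearMap.id)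
  have hN' : ∀ w, w ∈ N' ↔ w ∈ M ∧ Y.mulVec w = algebraMap Ω Ω' c₀ • w := by
    intro w
    rw [Submodule.mem_inf, LinearMap.mem_ker, LinearMap.sub_apply, sub_eq_zero]
    rfl
  have hYd : Y.map dΩ' = B * Y - Y * B := by
    have h1 : Y.map dΩ' = (y.map dL).map (algebraMap L Ω') := Matrix.ext fun i j => hdΩ' _
    rw [h1, hy, ← RingHom.mapMatrix_apply, map_sub, map_mul, map_mul]
    rfl
  refine ⟨N', ?_, ?_, ?_⟩
  · exact (Submodule.ne_bot_iff N').2 ⟨u, (hN' u).2 ⟨hu, huY⟩, hu0⟩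
  · intro w hw
    obtain ⟨hwM, hwc⟩ := (hN' w).1 hw
    refine (hN' _).2 ⟨hMd w hwM, ?_⟩
    have h1 := dΩ'.comp_mulVec Y w
    have h2 : dΩ' ∘ (algebraMap Ω Ω' c₀ • w) = algebraMap Ω Ω' c₀ • (dΩ' ∘ w) := by
      funext i
      change dΩ' (algebraMap Ω Ω' c₀ * w i) = algebraMap Ω Ω' c₀ * dΩ' (w i)
      rw [dΩ'.leibniz, hdc, smul_zero, add_zero, smul_eq_mul]
    rw [hwc, h2, hYd, Matrix.sub_mulVec, ← Matrix.mulVec_mulVec, ← Matrix.mulVec_mulVec, hwc,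
      Matrix.mulVec_smul] at h1
    rw [Matrix.mulVec_sub, smul_sub]
    change Y.mulVec (dΩ' ∘ w) - Y.mulVec (B.mulVec w) = _
    rw [h1]
    abel
  · refine lt_of_lt_of_le (Submodule.finrank_lt_finrank_of_lt (lt_of_le_of_ne inf_le_left ?_))
      (Submodule.finrank_extendScalarsPi_le (Λ := Ω') N)
    intro h
    obtain ⟨v, hv, hvc⟩ := hns c₀
    refine hvc ((hN' _).1 ?_).2
    rw [show N' = M from h]
    exact Submodule.mem_extendScalarsPi hv

theorem HasSolution.of_stable {p : ℕ} (hp : p.Prime) {ι : Type} [Fintype ι] [DecidableEq ι] (r : ℕ) :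
    ∀ {K Ω : Type} [Field K] [CharZero K] [Field Ω] [CharZero Ω] [Algebra K Ω] [IsAlgClosed Ω]
      [Algebra.IsAlgebraic K Ω] (_ : IsPAdicField p K)
      (_ : ∀ z : Ω, z ∈ Submodule.span K {z : Ω | IsAlgebraic ℚ z})
      {d : Derivation ℤ K K} {dΩ : Derivation ℤ Ω Ω} (_ : IsPAdicallyClosed p d.kerField)
      (_ : Extends d dΩ) {A : Matrix ι ι K} {N : Submodule Ω (ι → Ω)}
      (_ : ∀ w ∈ N, dΩ ∘ w - (A.map (algebraMap K Ω)).mulVec w ∈ N) (_ : N ≠ ⊥)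
      (_ : Module.finrank Ω N ≤ r), HasSolution p d A := by
  induction r with
  | zero =>
    intro K Ω _ _ _ _ _ _ _ _ _ d dΩ _ _ A N _ hN0 hr
    exact absurd (Submodule.finrank_eq_zero.1 (Nat.le_zero.1 hr)) hN0
  | succ r ih =>
    intro K Ω _ _ _ _ _ _ _ hK hCl d dΩ hk hd A N hN hN0 hr
    by_cases hscal : ∀ e, InG d A e → (∃ m : Polynomial ℚ, m.Separable ∧ Polynomial.aeval e m = 0) →
      ∃ c : Ω, ∀ u ∈ N, (e.map (algebraMap K Ω)).mulVec u = c • u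
    · exact HasSolution.of_scalar hp hK hCl hd hN hN0 hscal
    push Not at hscal
    obtain ⟨e, he, ⟨m, hm, hem⟩, hne⟩ := hscal
    obtain ⟨L, _, _, _, dL, y, Θ, _, i, j, hdL, hcL, hL, hij, hyd, hym, hspan, hye⟩ :=
      exists_horizontal_extension hp hK Ω he hm hem
    obtain ⟨Ω', _, _, _, _, Λ, _, f, g, _, _, hfi, hfj⟩ := exists_algClosed_amalgam i j hij
    obtain ⟨K', d', dΩ', hK', hCl', hdK', hdΩ', hdd⟩ :=
      exists_differential_padic_closure hp L Ω' hL dL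
    have : CharZero K' := charZero_of_injective_algebraMap (algebraMap L K').injective
    have hcomp : ∀ a : K, algebraMap L Ω' (algebraMap K L a) =
        algebraMap Ω Ω' (algebraMap K Ω a) := fun a => f.injective (by rw [hfi, hfj, hij])
    have hns : ∀ c : Ω, ∃ u ∈ N, (y.map (algebraMap L Ω')).mulVec (fun i => algebraMap Ω Ω' (u i)) ≠
        algebraMap Ω Ω' c • fun i => algebraMap Ω Ω' (u i) := by
      intro c
      obtain ⟨u, hu, huc⟩ := hne c
      refine ⟨u, hu, fun h => huc (hye u c ?_)⟩
      funext a
      apply g.injective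
      have h1 := congrArg f (congrFun h a)
      simp only [Matrix.mulVec, dotProduct, Matrix.map_apply, Pi.smul_apply, smul_eq_mul, map_sum,
        map_mul, hfi, hfj, Function.comp_apply] at h1 ⊢
      exact h1
    obtain ⟨N', hN'0, hN', hlt⟩ := exists_eigen_submodule hcomp hd hdL hdΩ' hN hN0 hyd hm.ne_zero hym
      hspan hns
    have hkL := hcL.isPAdicallyClosed hp hdL hk
    have hcK' : NoNewConst dL d' := NoNewConst.of_isAlgebraic hp hdK' hkL hK' inferInstance
    refine HasSolution.of_extension hdL hcL (HasSolution.of_extension hdK' hcK' ?_)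
    exact ih hK' hCl' (hcK'.isPAdicallyClosed hp hdK' hkL) hdd hN' hN'0 (by omega)

/-- Every nonempty linear system has a nonzero `p`-adic solution. -/
theorem hasSolution_of_isPAdicallyClosed {p : ℕ} (hp : p.Prime) {K ι : Type} [Field K] [CharZero K]
    [Fintype ι] [Nonempty ι] (hK : IsPAdicField p K) {d : Derivation ℤ K K}
    (hk : IsPAdicallyClosed p d.kerField) (A : Matrix ι ι K) : HasSolution p d A := by
  classical
  let Ω := AlgebraicClosure K
  obtain ⟨K', d', dΩ, hK', hCl, hdK, hdΩ, hdd⟩ := exists_differential_padic_closure hp K Ω hK d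
  have : CharZero K' := charZero_of_injective_algebraMap (algebraMap K K').injective
  have hcK : NoNewConst d d' := NoNewConst.of_isAlgebraic hp hdK hk hK' inferInstance
  refine HasSolution.of_extension hdK hcK ?_
  exact HasSolution.of_stable hp (Module.finrank Ω (⊤ : Submodule Ω (ι → Ω))) hK' hCl
    (hcK.isPAdicallyClosed hp hdK hk) hdd (N := ⊤) (fun _ _ => trivial) top_ne_bot le_rfl

section
open Polynomial

theorem exists_polynomial_derivative {K : Type} [Field K] (d : Derivation ℤ K K) (w : K)
    (P : K[X]) : ∃ Q : K[X], (∀ j, Q.coeff j = d (P.coeff j) + w * (P.coeff (j + 1) * (j + 1))) ∧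
      ∀ (M : Type) [Field M] [Algebra K M] (dM : Derivation ℤ M M) (x : M), Extends d dM →
        dM x = algebraMap K M w → dM (aeval x P) = aeval x Q := by
  refine ⟨(∑ i ∈ Finset.range (P.natDegree + 1), monomial i (d (P.coeff i))) + C w * derivative P,
    fun j => ?_, fun M _ _ dM x hd hx => ?_⟩
  · rw [coeff_add, finsetSum_coeff, coeff_C_mul, coeff_derivative]
    congr 1
    simp only [coeff_monomial, Finset.sum_ite_eq', Finset.mem_range]
    split_ifs with h
    · rfl
    · rw [coeff_eq_zero_of_natDegree_lt (by omega), map_zero]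
  · have h1 : ∀ i (a : K), dM (aeval x (monomial i a)) =
        aeval x (monomial i (d a)) + algebraMap K M w * aeval x (derivative (monomial i a)) := by
      intro i a
      rw [aeval_monomial, dM.leibniz, dM.leibniz_pow, hx, hd, derivative_monomial, aeval_monomial,
        aeval_monomial]
      simp only [smul_eq_mul, nsmul_eq_mul, map_mul, map_natCast]
      ring
    conv_lhs => rw [P.as_sum_range]
    rw [map_sum, map_sum, Finset.sum_congr rfl fun i _ => h1 i _, Finset.sum_add_distrib,
      ← Finset.mul_sum, map_add, map_mul, aeval_C, map_sum]
    congr 2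
    conv_rhs => rw [P.as_sum_range, map_sum, map_sum]

/-- Adjoining a transcendental antiderivative of an element without antiderivative does not
create new constants. -/
theorem mem_range_of_adjoin_antiderivative {K M : Type} [Field K] [CharZero K] [Field M] [Algebra K M]
    {d : Derivation ℤ K K} {dM : Derivation ℤ M M} (hd : Extends d dM) {w : K} (hw : ∀ z, d z ≠ w)
    {x : M} (hx : dM x = algebraMap K M w) (hxt : Transcendental K x) {c : M}
    (hc : c ∈ IntermediateField.adjoin K {x}) (hc0 : dM c = 0) : ∃ a, algebraMap K M a = c := by
  have hinj := transcendental_iff_injective.1 hxt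
  have hconst : ∀ P : K[X], dM (aeval x P) = 0 → ∃ a, P = C a := by
    intro P hP
    refine ⟨P.coeff 0, eq_C_of_natDegree_eq_zero ?_⟩
    by_contra hdeg
    obtain ⟨Q, hQ, hQM⟩ := exists_polynomial_derivative d w P
    have hQ0 : Q = 0 := hinj (by rw [← hQM M dM x hd hx, hP, map_zero])
    obtain ⟨m, hm⟩ := Nat.exists_eq_succ_of_ne_zero hdeg
    have hlc : P.coeff (m + 1) ≠ 0 := by
      rw [← Nat.succ_eq_add_one, ← hm]
      exact leadingCoeff_ne_zero.2 fun h => hdeg (by rw [h, natDegree_zero])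
    have h1 := hQ m
    have h2 := hQ (m + 1)
    rw [coeff_eq_zero_of_natDegree_lt (n := m + 1 + 1) (by omega), zero_mul, mul_zero, add_zero, hQ0,
      coeff_zero] at h2
    rw [hQ0, coeff_zero] at h1
    have hm1 : ((m : K) + 1) ≠ 0 := by exact_mod_cast Nat.succ_ne_zero m
    have hden : d (P.coeff (m + 1) * ((m : K) + 1)) = 0 := by
      have : d ((m : K) + 1) = 0 := by rw [map_add, d.map_natCast, d.map_one_eq_zero, add_zero]
      rw [d.leibniz, this, ← h2, smul_zero, smul_zero, add_zero]
    refine hw (-(P.coeff m) * (P.coeff (m + 1) * ((m : K) + 1))⁻¹) ?_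
    rw [d.leibniz, d.leibniz_inv, hden, smul_zero, smul_zero, zero_add, map_neg, smul_eq_mul]
    have h3 : -d (P.coeff m) = w * (P.coeff (m + 1) * ((m : K) + 1)) := by
      linear_combination h1
    rw [h3]
    field_simp
  classical
  obtain ⟨R, S, hRS⟩ := (IntermediateField.mem_adjoin_simple_iff K c).1 hc
  by_cases hS : S = 0
  · refine ⟨0, ?_⟩
    rw [hRS, hS, map_zero, map_zero, div_zero]
  obtain ⟨P, Q, hQm, hcop, hPQ⟩ : ∃ P Q : K[X], Q.Monic ∧ IsCoprime P Q ∧ c * aeval x Q = aeval x P := by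
    obtain ⟨R', hR'⟩ := EuclideanDomain.gcd_dvd_left R S
    obtain ⟨S', hS'⟩ := EuclideanDomain.gcd_dvd_right R S
    have hab := EuclideanDomain.gcd_eq_gcd_ab R S
    have hg : EuclideanDomain.gcd R S ≠ 0 := fun h => hS (by rw [hS', h, zero_mul])
    generalize EuclideanDomain.gcd R S = g at *
    generalize EuclideanDomain.gcdA R S = a at *
    generalize EuclideanDomain.gcdB R S = b at *
    have hS'0 : S' ≠ 0 := fun h => hS (by rw [hS', h, mul_zero])
    have hl : S'.leadingCoeff ≠ 0 := leadingCoeff_ne_zero.2 hS'0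
    have hCC : (C S'.leadingCoeff * C S'.leadingCoeff⁻¹ : K[X]) = 1 := by
      rw [← C_mul, mul_inv_cancel₀ hl, C_1]
    have hbez : R' * a + S' * b = 1 :=
      mul_left_cancel₀ hg (by linear_combination -hab - a * hR' - b * hS')
    refine ⟨R' * C S'.leadingCoeff⁻¹, S' * C S'.leadingCoeff⁻¹, monic_mul_leadingCoeff_inv hS'0,
      ⟨a * C S'.leadingCoeff, b * C S'.leadingCoeff, ?_⟩, ?_⟩
    · linear_combination (R' * a + S' * b) * hCC + hbez
    · have hS0 : aeval x S ≠ 0 := fun h => hS (hinj (by rw [h, map_zero]))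
      have h1 : c * aeval x S = aeval x R := by rw [hRS, div_mul_cancel₀ _ hS0]
      rw [hS', hR', map_mul, map_mul] at h1
      rw [hS', map_mul] at hS0
      have h2 : c * aeval x S' = aeval x R' :=
        mul_left_cancel₀ (left_ne_zero_of_mul hS0) (by linear_combination h1)
      rw [map_mul, map_mul, ← mul_assoc, h2]
  obtain ⟨P', hP', hPM⟩ := exists_polynomial_derivative d w P
  obtain ⟨Q', hQ', hQM⟩ := exists_polynomial_derivative d w Q
  have hder : c * aeval x Q' = aeval x P' := by
    rw [← hPM M dM x hd hx, ← hQM M dM x hd hx, ← hPQ, dM.leibniz, hc0, smul_zero, add_zero,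
      smul_eq_mul]
  have hpoly : P' * Q = P * Q' := hinj (by
    rw [map_mul, map_mul, ← hder, ← hPQ]
    ring)
  have hQ'0 : Q' = 0 := by
    by_contra h0
    have hdvd : Q ∣ Q' := hcop.symm.dvd_of_dvd_mul_left ⟨P', by rw [← hpoly, mul_comm]⟩
    have hle := natDegree_le_of_dvd hdvd h0
    refine h0 (leadingCoeff_eq_zero.1 ?_)
    rw [leadingCoeff, hQ', coeff_eq_zero_of_natDegree_lt (n := Q'.natDegree + 1) (by omega), zero_mul,
      mul_zero, add_zero]
    rcases hle.lt_or_eq with h | h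
    · rw [coeff_eq_zero_of_natDegree_lt h, map_zero]
    · rw [← h, hQm.coeff_natDegree, d.map_one_eq_zero]
  obtain ⟨b, hb⟩ := hconst Q (by rw [hQM M dM x hd hx, hQ'0, map_zero])
  obtain ⟨a, ha⟩ := hconst P (by rw [hPM M dM x hd hx, ← hder, hQ'0, map_zero, mul_zero])
  rw [hb, Monic, leadingCoeff_C] at hQm
  refine ⟨a, ?_⟩
  rw [ha, hb, hQm, aeval_C, aeval_C, map_one, mul_one] at hPQ
  exact hPQ.symm
end

section
open PowerSeries

/-- An antiderivative exists in a `p`-adic differential extension without new constants. -/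
theorem exists_antiderivative {p : ℕ} (hp : p.Prime) {K : Type} [Field K] [CharZero K]
    (hK : IsPAdicField p K) (d : Derivation ℤ K K) (w : K) :
    ∃ (L : Type) (_ : Field L) (_ : CharZero L) (_ : Algebra K L) (dL : Derivation ℤ L L) (x : L),
      Extends d dL ∧ NoNewConst d dL ∧ IsPAdicField p L ∧ dL x = algebraMap K L w := by
  by_cases hw : ∃ z, d z = w
  · obtain ⟨z, hz⟩ := hw
    exact ⟨K, inferInstance, inferInstance, inferInstance, d, z, fun _ => rfl,
      fun x hx => ⟨x, hx, rfl⟩, hK, hz⟩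
  push Not at hw
  obtain ⟨y, -, hy⟩ := exists_powerSeries_recursion (K := K) (ι := Unit)
    (fun j v _ => (if j = 0 then w else 0) - d (v ())) 0
  have hyd : psDeriv d (y ()) = C w := by
    ext j
    rw [coeff_psDeriv, hy, coeff_C]
    ring
  let F := PSField K
  let x : F := algebraMap (PowerSeries K) (PSField K) (y ())
  have hx : psfDeriv d x = algebraMap K F w := by
    rw [psField_algebraMap, ← hyd]
    exact psfDeriv_algebraMap d (y ())
  have hxt : Transcendental K x := by
    intro h
    obtain ⟨z, hz⟩ := psField_mem_of_isAlgebraic h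
    rw [← hz, extends_psfDeriv d] at hx
    exact hw z ((algebraMap K F).injective hx)
  obtain ⟨dL, hdL, hdLδ⟩ := exists_derivation_adjoin (extends_psfDeriv d) {x} (by
    rintro _ rfl
    rw [hx]
    exact IntermediateField.algebraMap_mem _ _)
  have : CharZero (IntermediateField.adjoin K {x}) :=
    charZero_of_injective_algebraMap (algebraMap K (IntermediateField.adjoin K {x})).injective
  refine ⟨IntermediateField.adjoin K {x}, inferInstance, inferInstance, inferInstance, dL,
    ⟨x, IntermediateField.mem_adjoin_simple_self K x⟩, hdL, NoNewConst.of_powerSeries hdL fun c hc => ?_,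
    IsPAdicField.of_ringHom hp (algebraMap _ F) (psField_isPAdicField hp hK), ?_⟩
  · have hc' : psfDeriv d (c : F) = 0 := by
      rw [← hdLδ, hc]
      rfl
    obtain ⟨a, ha⟩ := mem_range_of_adjoin_antiderivative (extends_psfDeriv d) hw hx hxt c.2 hc'
    have h2 : algebraMap K (IntermediateField.adjoin K {x}) a = c := Subtype.ext ha
    rw [← h2]
    exact isAlgebraic_algebraMap a
  · apply Subtype.ext
    rw [hdLδ]
    exact hx

theorem exists_antiderivatives {p : ℕ} (hp : p.Prime) (m : ℕ) {K : Type} [Field K] [CharZero K]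
    (hK : IsPAdicField p K) (d : Derivation ℤ K K) (w : Fin m → K) :
    ∃ (L : Type) (_ : Field L) (_ : CharZero L) (_ : Algebra K L) (dL : Derivation ℤ L L)
      (x : Fin m → L), Extends d dL ∧ NoNewConst d dL ∧ IsPAdicField p L ∧
        ∀ j, dL (x j) = algebraMap K L (w j) := by
  induction m generalizing K with
  | zero =>
    exact ⟨K, inferInstance, inferInstance, inferInstance, d, Fin.elim0, fun _ => rfl,
      fun x hx => ⟨x, hx, rfl⟩, hK, fun j => j.elim0⟩
  | succ m ih =>
    obtain ⟨L, _, _, _, dL, x₀, hd, hc, hL, hx₀⟩ := exists_antiderivative hp hK d (w 0)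
    obtain ⟨M, _, _, _, dM, x, hd', hc', hM, hx⟩ := ih hL dL fun j => algebraMap K L (w j.succ)
    let _ : Algebra K M := ((algebraMap L M).comp (algebraMap K L)).toAlgebra
    have : IsScalarTower K L M := IsScalarTower.of_algebraMap_eq fun _ => rfl
    refine ⟨M, inferInstance, inferInstance, inferInstance, dM, Fin.cons (algebraMap L M x₀) x,
      hd.trans hd', hc.trans hc', hM, Fin.cases ?_ fun j => ?_⟩
    · rw [Fin.cons_zero, hd', hx₀, ← IsScalarTower.algebraMap_apply]
    · rw [Fin.cons_succ, hx, ← IsScalarTower.algebraMap_apply]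
end

theorem exists_coupled_solution {p : ℕ} (hp : p.Prime) {m q : ℕ} (hq : 0 < q) {K : Type} [Field K]
    [CharZero K] (hK : IsPAdicField p K) {d : Derivation ℤ K K} (hk : IsPAdicallyClosed p d.kerField)
    (R : Fin q → Fin q → K) (r : Fin q → Fin m → K) :
    ∃ (L : Type) (_ : Field L) (_ : CharZero L) (_ : Algebra K L) (dL : Derivation ℤ L L)
      (g : Fin q → L) (x : Fin m → L), Extends d dL ∧ NoNewConst d dL ∧ IsPAdicField p L ∧ g ≠ 0 ∧
        (∀ k, dL (g k) = -∑ l, algebraMap K L (R l k) * g l) ∧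
        ∀ j, dL (x j) = ∑ l, g l * algebraMap K L (r l j) := by
  have : Nonempty (Fin q) := ⟨⟨0, hq⟩⟩
  obtain ⟨L, _, _, _, dL, g, hd, hc, hL, hg0, hg⟩ :=
    hasSolution_of_isPAdicallyClosed hp hK hk (Matrix.of fun k l => -R l k)
  obtain ⟨M, _, _, _, dM, x, hd', hc', hM, hx⟩ :=
    exists_antiderivatives hp m hL dL fun j => ∑ l, g l * algebraMap K L (r l j)
  let _ : Algebra K M := ((algebraMap L M).comp (algebraMap K L)).toAlgebra
  have : IsScalarTower K L M := IsScalarTower.of_algebraMap_eq fun _ => rfl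
  refine ⟨M, inferInstance, inferInstance, inferInstance, dM, fun l => algebraMap L M (g l), x,
    hd.trans hd', hc.trans hc', hM, fun h => hg0 ?_, fun k => ?_, fun j => ?_⟩
  · funext l
    exact (map_eq_zero (algebraMap L M)).1 (congrFun h l)
  · have h1 : dL (g k) = _ := congrFun hg k
    rw [hd', h1]
    simp only [Matrix.mulVec, dotProduct, Matrix.map_apply, Matrix.of_apply, map_neg, neg_mul,
      Finset.sum_neg_distrib, map_sum, map_mul]
    rfl
  · rw [hx, map_sum]
    exact Finset.sum_congr rfl fun l _ => map_mul _ _ _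

theorem LinearIndependent.exists_complement_dual {K ι : Type} [Field K] [Fintype ι] {m : ℕ}
    {s : Fin m → ι → K} (hs : LinearIndependent K s) :
    ∃ (q : ℕ) (c : Fin q → ι → K) (N₁ : Fin m → ι → K) (N₂ : Fin q → ι → K),
      m + q = Fintype.card ι ∧ (∀ i j, N₁ i ⬝ᵥ s j = if j = i then 1 else 0) ∧
      (∀ k j, N₂ k ⬝ᵥ s j = 0) ∧ (∀ k l, N₂ k ⬝ᵥ c l = if l = k then 1 else 0) ∧
      ∀ v, v = ∑ j, (N₁ j ⬝ᵥ v) • s j + ∑ k, (N₂ k ⬝ᵥ v) • c k := by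
  classical
  obtain ⟨C, hC⟩ := (Submodule.span K (Set.range s)).exists_isCompl
  let bC := Module.finBasis K C
  let c : Fin (Module.finrank K C) → ι → K := fun k => bC k
  have hcs : Submodule.span K (Set.range c) = C := by
    have : Set.range c = C.subtype '' Set.range bC := by
      rw [← Set.range_comp]
      rfl
    rw [this, Submodule.span_image, bC.span_eq, Submodule.map_top, Submodule.range_subtype]
  have hc : LinearIndependent K c :=
    bC.linearIndependent.map' C.subtype (Submodule.ker_subtype C)
  let b : Module.Basis (Fin m ⊕ Fin (Module.finrank K C)) K (ι → K) := Module.Basis.mk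
    (hs.sum_type hc (by rw [hcs]; exact hC.disjoint))
    (by rw [Set.Sum.elim_range, Submodule.span_union, hcs, hC.sup_eq_top])
  have hb1 : ∀ j, b (Sum.inl j) = s j := fun j => by rw [Module.Basis.mk_apply]; rfl
  have hb2 : ∀ k, b (Sum.inr k) = c k := fun k => by rw [Module.Basis.mk_apply]; rfl
  have hN : ∀ e v, (fun i => b.repr (Pi.single i 1) e) ⬝ᵥ v = b.repr v e := by
    intro e v
    conv_rhs => rw [pi_eq_sum_univ' v]
    simp only [map_sum, map_smul, Finsupp.coe_finsetSum, Finset.sum_apply, Finsupp.smul_apply,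
      dotProduct, smul_eq_mul]
    exact Finset.sum_congr rfl fun i _ => mul_comm _ _
  refine ⟨_, c, fun j i => b.repr (Pi.single i 1) (Sum.inl j),
    fun k i => b.repr (Pi.single i 1) (Sum.inr k), ?_, fun i j => ?_, fun k j => ?_, fun k l => ?_,
    fun v => ?_⟩
  · have := Module.finrank_eq_card_basis b
    rw [Module.finrank_fintype_fun_eq_card, Fintype.card_sum, Fintype.card_fin, Fintype.card_fin] at this
    exact this.symm
  · rw [hN, ← hb1, b.repr_self, Finsupp.single_apply]
    simp
  · rw [hN, ← hb1, b.repr_self, Finsupp.single_apply]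
    simp
  · rw [hN, ← hb2, b.repr_self, Finsupp.single_apply]
    simp
  · conv_lhs => rw [← b.sum_repr v]
    simp only [Fintype.sum_sum_type, hb1, hb2, hN]

/-- Enlarging an independent family of solutions by one. -/
theorem exists_extend_solutions {p : ℕ} (hp : p.Prime) {K ι : Type} [Field K] [CharZero K]
    [Fintype ι] (hK : IsPAdicField p K) {d : Derivation ℤ K K}
    (hk : IsPAdicallyClosed p d.kerField) {A : Matrix ι ι K} {m : ℕ} (hm : m < Fintype.card ι)
    {s : Fin m → ι → K} (hs : LinearIndependent K s) (hsd : ∀ j i, d (s j i) = ∑ a, A i a * s j a) :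
    ∃ (L : Type) (_ : Field L) (_ : CharZero L) (_ : Algebra K L) (dL : Derivation ℤ L L)
      (t : Fin (m + 1) → ι → L), Extends d dL ∧ NoNewConst d dL ∧ IsPAdicField p L ∧
        LinearIndependent L t ∧ ∀ j i, dL (t j i) = ∑ a, algebraMap K L (A i a) * t j a := by
  obtain ⟨q, c, N₁, N₂, hq, h11, h21, h22, hN⟩ := hs.exists_complement_dual
  let D : Fin q → ι → K := fun l i => d (c l i) - ∑ a, A i a * c l a
  obtain ⟨L, _, _, _, dL, g, x, hd, hc, hL, hg0, hg, hx⟩ := exists_coupled_solution hp (by omega) hK hk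
    (fun l k => N₂ k ⬝ᵥ D l) (fun l j => N₁ j ⬝ᵥ D l)
  have hD : ∀ l i, d (c l i) = ∑ a, A i a * c l a + (∑ j, (N₁ j ⬝ᵥ D l) * s j i +
      ∑ k, (N₂ k ⬝ᵥ D l) * c k i) := by
    intro l i
    have h1 := congrFun (hN (D l)) i
    simp only [Pi.add_apply, Finset.sum_apply, Pi.smul_apply, smul_eq_mul] at h1
    rw [← h1]
    simp only [D]
    ring
  let σ := algebraMap K L
  let τ : ι → L := fun i => ∑ l, g l * σ (c l i) - ∑ j, x j * σ (s j i)
  let Λ : (ι → K) → (ι → L) →ₗ[L] L := fun N => dotProductBilin L L (σ ∘ N)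
  have hΛ : ∀ N v, Λ N (σ ∘ v) = σ (N ⬝ᵥ v) := fun N v => (RingHom.map_dotProduct σ N v).symm
  refine ⟨L, inferInstance, inferInstance, inferInstance, dL, Fin.cons τ fun j => σ ∘ s j, hd, hc, hL,
    linearIndependent_finCons.2 ⟨?_, fun hmem => hg0 ?_⟩, Fin.cases (fun i => ?_) fun j i => ?_⟩
  · rw [Fintype.linearIndependent_iff]
    intro a ha j
    have h1 := congrArg (Λ (N₁ j)) ha
    simpa only [map_sum, map_smul, hΛ, h11, apply_ite σ, map_one, map_zero, smul_eq_mul, mul_ite, mul_one, mul_zero,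
      Finset.sum_ite_eq', Finset.mem_univ, if_true] using h1
  · funext k
    have h1 : τ ∈ LinearMap.ker (Λ (N₂ k)) := by
      refine (Submodule.span_le.2 ?_) hmem
      rintro _ ⟨j, rfl⟩
      rw [SetLike.mem_coe, LinearMap.mem_ker, hΛ, h21, map_zero]
    have h2 : τ = ∑ l, g l • (σ ∘ c l) - ∑ j, x j • (σ ∘ s j) := by
      funext i
      simp [τ]
    rw [LinearMap.mem_ker, h2] at h1
    simpa only [map_sub, map_sum, map_smul, hΛ, h21, h22, apply_ite σ, map_one, map_zero, smul_eq_mul, mul_ite, mul_one, mul_zero,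
      Finset.sum_ite_eq', Finset.mem_univ, if_true, Finset.sum_const_zero, sub_zero,
      Pi.zero_apply] using h1
  · rw [Fin.cons_zero]
    change dL (∑ l, g l * σ (c l i) - ∑ j, x j * σ (s j i)) =
      ∑ a, σ (A i a) * (∑ l, g l * σ (c l a) - ∑ j, x j * σ (s j a))
    have hdc : ∀ l, dL (g l * σ (c l i)) = g l * ∑ a, σ (A i a) * σ (c l a) +
        g l * ∑ j, σ (N₁ j ⬝ᵥ D l) * σ (s j i) + g l * ∑ k, σ (N₂ k ⬝ᵥ D l) * σ (c k i) -
          σ (c l i) * ∑ k, σ (N₂ l ⬝ᵥ D k) * g k := by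
      intro l
      rw [dL.leibniz, hg, hd, hD]
      simp only [smul_eq_mul, map_add, map_sum, map_mul, σ]
      ring
    have hds : ∀ j, dL (x j * σ (s j i)) = x j * ∑ a, σ (A i a) * σ (s j a) +
        σ (s j i) * ∑ l, g l * σ (N₁ j ⬝ᵥ D l) := by
      intro j
      rw [dL.leibniz, hx, hd, hsd]
      simp only [smul_eq_mul, map_sum, map_mul, σ]
    have e1 : ∑ l, g l * ∑ k, σ (N₂ k ⬝ᵥ D l) * σ (c k i) =
        ∑ l, σ (c l i) * ∑ k, σ (N₂ l ⬝ᵥ D k) * g k := by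
      simp only [Finset.mul_sum]
      rw [Finset.sum_comm]
      exact Finset.sum_congr rfl fun _ _ => Finset.sum_congr rfl fun _ _ => by ring
    have e2 : ∑ l, g l * ∑ j, σ (N₁ j ⬝ᵥ D l) * σ (s j i) =
        ∑ j, σ (s j i) * ∑ l, g l * σ (N₁ j ⬝ᵥ D l) := by
      simp only [Finset.mul_sum]
      rw [Finset.sum_comm]
      exact Finset.sum_congr rfl fun _ _ => Finset.sum_congr rfl fun _ _ => by ring
    have e3 : ∀ (r : ℕ) (h : Fin r → L) (v : Fin r → ι → K),
        ∑ l, h l * ∑ a, σ (A i a) * σ (v l a) = ∑ a, σ (A i a) * ∑ l, h l * σ (v l a) := by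
      intro r h v
      simp only [Finset.mul_sum]
      rw [Finset.sum_comm]
      exact Finset.sum_congr rfl fun _ _ => Finset.sum_congr rfl fun _ _ => by ring
    simp only [map_sub, map_sum, hdc, hds, Finset.sum_add_distrib, Finset.sum_sub_distrib, mul_sub]
    rw [e1, e2, e3, e3]
    ring
  · rw [Fin.cons_succ]
    change dL (σ (s j i)) = ∑ a, σ (A i a) * σ (s j a)
    rw [hd, hsd, map_sum]
    exact Finset.sum_congr rfl fun a _ => map_mul _ _ _

/-- A full system of solutions in a `p`-adic differential extension without new constants. -/
theorem exists_independent_solutions {p : ℕ} (hp : p.Prime) {K ι : Type} [Field K] [CharZero K]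
    [Fintype ι] (hK : IsPAdicField p K) {d : Derivation ℤ K K}
    (hk : IsPAdicallyClosed p d.kerField) (A : Matrix ι ι K) (m : ℕ) (hm : m ≤ Fintype.card ι) :
    ∃ (L : Type) (_ : Field L) (_ : CharZero L) (_ : Algebra K L) (dL : Derivation ℤ L L)
      (t : Fin m → ι → L), Extends d dL ∧ NoNewConst d dL ∧ IsPAdicField p L ∧
        LinearIndependent L t ∧ ∀ j i, dL (t j i) = ∑ a, algebraMap K L (A i a) * t j a := by
  induction m with
  | zero =>
    exact ⟨K, inferInstance, inferInstance, inferInstance, d, Fin.elim0, fun _ => rfl,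
      fun x hx => ⟨x, hx, rfl⟩, hK, linearIndependent_empty_type, fun j => j.elim0⟩
  | succ m ih =>
    obtain ⟨L, _, _, _, dL, s, hd, hc, hL, hs, hsd⟩ := ih (by omega)
    obtain ⟨M, _, _, _, dM, t, hd', hc', hM, ht, htd⟩ := exists_extend_solutions hp hL
      (hc.isPAdicallyClosed hp hd hk) (A := A.map (algebraMap K L)) hm hs hsd
    let _ : Algebra K M := ((algebraMap L M).comp (algebraMap K L)).toAlgebra
    have : IsScalarTower K L M := IsScalarTower.of_algebraMap_eq fun _ => rfl
    exact ⟨M, inferInstance, inferInstance, inferInstance, dM, t, hd.trans hd', hc.trans hc', hM, ht,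
      htd⟩

/-- If `K` is a p-adic differential field (characteristic zero) whose field
of constants `k` is p-adically closed and `k ≠ K`, then for every `n ≥ 1` and every
`A ∈ Mat_n(K)` there exists a p-adic Picard--Vessiot field for `y' = A y` over `K`. -/
theorem padic_picard_vessiot_exists
    (p : ℕ) (hp : p.Prime)
    (K : Type) [Field K] [CharZero K] (dK : FieldDeriv K)
    (hKpadic : IsPAdicField p K)
    (k : Type) [Field k] [Algebra k K]
    (hconst : ∀ a : K, dK.d a = 0 ↔ a ∈ Set.range (algebraMap k K))
    (hkpc : IsPAdicallyClosed p k)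
    (hkK : ∃ a : K, dK.d a ≠ 0)
    (n : ℕ) (hn : 1 ≤ n) (A : Matrix (Fin n) (Fin n) K) :
    ∃ (L : Type) (_ : Field L) (_ : Algebra K L) (dL : FieldDeriv L),
      IsPicardVessiot dK dL A ∧ IsPAdicField p L := by
  let d : Derivation ℤ K K := Derivation.mk' (AddMonoidHom.mk' dK.d dK.map_add).toIntLinearMap
    fun a b => by
      change dK.d (a * b) = a * dK.d b + b * dK.d a
      rw [dK.leibniz, mul_comm b]
  have hd0 : ∀ a, d a = dK.d a := fun _ => rfl
  have hk : IsPAdicallyClosed p d.kerField := by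
    have : CharZero k := (algebraMap k K).charZero
    let f : k →+* d.kerField := (algebraMap k K).codRestrict d.kerField fun a => by
      rw [Derivation.mem_kerField, hd0, hconst]
      exact ⟨a, rfl⟩
    refine IsPAdicallyClosed.of_ringEquiv hp (RingEquiv.ofBijective f ⟨f.injective, fun x => ?_⟩) hkpc
    obtain ⟨a, ha⟩ := (hconst x).1 ((Derivation.mem_kerField d).1 x.2)
    exact ⟨a, Subtype.ext ha⟩
  obtain ⟨M, _, _, _, dM, t, hd, hc, hM, ht, htd⟩ :=
    exists_independent_solutions hp hKpadic hk A n (Fintype.card_fin n).ge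
  let s : Set M := Set.range fun q : Fin n × Fin n => t q.2 q.1
  let L := IntermediateField.adjoin K s
  have hts : ∀ i j, t j i ∈ L := fun i j => IntermediateField.subset_adjoin K s ⟨(i, j), rfl⟩
  obtain ⟨dL, hdL, hdLM⟩ : ∃ dL : Derivation ℤ L L, Extends d dL ∧ ∀ x, (dL x : M) = dM x := by
    refine exists_derivation_adjoin hd s ?_
    rintro _ ⟨q, rfl⟩
    rw [htd]
    exact sum_mem fun a _ => mul_mem (L.algebraMap_mem _) (hts _ _)
  let F : Matrix (Fin n) (Fin n) L := Matrix.of fun i j => ⟨t j i, hts i j⟩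
  have : CharZero L := charZero_of_injective_algebraMap (algebraMap K L).injective
  refine ⟨L, inferInstance, inferInstance,
    ⟨dL, fun a b => dL.map_add a b, fun a b => by
      rw [dL.leibniz, smul_eq_mul, smul_eq_mul, mul_comm b]⟩,
    ⟨hdL, F, ?_, fun i j => ?_, ?_, fun x hx => ?_⟩, IsPAdicField.of_ringHom hp (algebraMap L M) hM⟩
  · rw [isUnit_iff_ne_zero]
    intro h
    have h1 : (F.map (algebraMap L M)).det = 0 := by
      rw [← RingHom.mapMatrix_apply, ← RingHom.map_det, h, map_zero]
    have h2 : IsUnit (F.map (algebraMap L M)) := Matrix.linearIndependent_cols_iff_isUnit.1 ht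
    exact ((Matrix.isUnit_iff_isUnit_det _).1 h2).ne_zero h1
  · apply Subtype.ext
    change (dL (F i j) : M) = _
    rw [hdLM, Matrix.mul_apply]
    refine (htd j i).trans ?_
    rw [AddSubmonoidClass.coe_finsetSum]
    rfl
  · apply IntermediateField.map_injective L.val
    rw [IntermediateField.adjoin_map, ← Set.range_comp, ← AlgHom.fieldRange_eq_map,
      IntermediateField.fieldRange_val]
    rfl
  · have h1 : dM (x : M) = 0 := by
      rw [← hdLM]
      exact congrArg Subtype.val hx
    obtain ⟨a, ha, hax⟩ := hc _ h1
    exact ⟨a, ha, Subtype.ext hax⟩
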